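/- For every integer n > 2 there exist a constant c = c(n) and an absolute constant κ such that the following holds. Let f ∈ ℤ[y_1,…,y_n] be a polynomial whose homogeneous part h(f) of highest degree is absolutely irreducible (i.e., irreducible in ℂ[y_1,…,y_n]) of degree 4, and let X ⊆ 𝔸^n be the affine hypersurface f = 0. Then for every real H ≥ 2, the number of points of X(ℤ,H) is at most c·H^{n−2}·(log H)^κ. -/

import Mathlib

section
namespace DG
open MvPolynomial

/-- polynomials in two variables of total degree at most M -/
noncomputable abbrev VV (k : Type*) [Field k] (M : ℕ) : Submodule k (MvPolynomial (Fin 2) k) :=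
  restrictTotalDegree (Fin 2) k M

lemma card_deg_le (M : ℕ) :
    Nat.card {n : Fin 2 →₀ ℕ | (n.sum fun _ e => e) ≤ M} = ∑ t ∈ Finset.range (M+1), (t+1) := by
  have e : {n : Fin 2 →₀ ℕ | (n.sum fun _ e => e) ≤ M} ≃
      ((Finset.range (M+1)).sigma (fun t => Finset.HasAntidiagonal.antidiagonal t) : Finset (Σ _ : ℕ, ℕ × ℕ)) :=
    { toFun := fun n => ⟨⟨n.1 0 + n.1 1, (n.1 0, n.1 1)⟩, by
        have := n.2
        rw [Set.mem_ofPred_eq, Finsupp.sum_fintype _ _ (by simp), Fin.sum_univ_two] at this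
        simp; omega⟩
      invFun := fun q => ⟨Finsupp.equivFunOnFinite.symm ![q.1.2.1, q.1.2.2], by
        obtain ⟨⟨t, a, b⟩, h⟩ := q
        simp [Finset.mem_sigma] at h
        rw [Set.mem_ofPred_eq, Finsupp.sum_fintype _ _ (by simp), Fin.sum_univ_two]
        simp; omega⟩
      left_inv := fun n => by
        ext i; fin_cases i <;> simp
      right_inv := fun q => by
        obtain ⟨⟨t, a, b⟩, h⟩ := q
        simp [Finset.mem_sigma] at h
        simp [h.2] }
  rw [Nat.card_congr e, Nat.card_eq_fintype_card, Fintype.card_coe]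
  simp [Finset.card_sigma]

lemma finrank_VV (k : Type*) [Field k] (M : ℕ) :
    Module.finrank k (VV k M) = ∑ t ∈ Finset.range (M+1), (t+1) := by
  rw [← card_deg_le, VV, restrictTotalDegree]
  exact Module.finrank_eq_nat_card_basis (basisRestrictSupport k _)

lemma two_finrank_VV (k : Type*) [Field k] (M : ℕ) :
    2 * Module.finrank k (VV k M) = (M+1)*(M+2) := by
  rw [finrank_VV]
  induction M with
  | zero => simp
  | succ n ih => rw [Finset.sum_range_succ, mul_add, ih]; ring

instance finVV (k : Type*) [Field k] (M : ℕ) : Module.Finite k (VV k M) := by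
  apply Module.finite_of_finrank_pos
  have := two_finrank_VV k M
  have : 0 < (M+1)*(M+2) := by positivity
  omega

lemma mem_VV {k : Type*} [Field k] {M : ℕ} {p : MvPolynomial (Fin 2) k} :
    p ∈ VV k M ↔ p.totalDegree ≤ M := by
  exact mem_restrictTotalDegree _ _ _

theorem bezout_indep {k : Type*} [Field k] (P Q : MvPolynomial (Fin 2) k) (hPQ : IsRelPrime P Q)
    (hP : P ≠ 0) (hQ : Q ≠ 0) {ι : Type*} [Fintype ι] (v : ι → MvPolynomial (Fin 2) k)
    (hv : ∀ c : ι → k, (∑ i, c i • v i) ∈ Ideal.span {P, Q} → c = 0) :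
    Fintype.card ι ≤ P.totalDegree * Q.totalDegree := by
  classical
  set a := P.totalDegree
  set b := Q.totalDegree
  obtain ⟨m, hm⟩ : ∃ m, ∀ i, (v i).totalDegree ≤ m :=
    ⟨∑ i, (v i).totalDegree, fun i => Finset.single_le_sum (f := fun i => (v i).totalDegree) (by simp) (Finset.mem_univ i)⟩
  set M := m + a + b with hM
  -- the map
  let L : ((ι → k) × VV k (m+b) × VV k (m+a)) →ₗ[k] MvPolynomial (Fin 2) k :=
    LinearMap.coprod (Fintype.linearCombination k v)
      (LinearMap.coprod ((LinearMap.mulLeft k P).comp (VV k (m+b)).subtype)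
        ((LinearMap.mulLeft k Q).comp (VV k (m+a)).subtype))
  have hL : ∀ x, L x = (∑ i, x.1 i • v i) + (P * x.2.1 + Q * x.2.2) := by
    intro x; simp [L, Fintype.linearCombination_apply]
  have hmem : ∀ x, L x ∈ VV k M := by
    intro x
    rw [hL]
    refine add_mem (sum_mem fun i _ => Submodule.smul_mem _ _ (mem_VV.2 ((hm i).trans (by omega)))) (add_mem ?_ ?_)
    · rw [mem_VV]
      refine (totalDegree_mul _ _).trans ?_
      have := mem_VV.1 x.2.1.2
      omega
    · rw [mem_VV]
      refine (totalDegree_mul _ _).trans ?_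
      have := mem_VV.1 x.2.2.2
      omega
  let L' : ((ι → k) × VV k (m+b) × VV k (m+a)) →ₗ[k] VV k M := L.codRestrict _ hmem
  have hker : Module.finrank k (LinearMap.ker L') ≤ Module.finrank k (VV k m) := by
    let S : VV k m →ₗ[k] ((ι → k) × VV k (m+b) × VV k (m+a)) :=
      LinearMap.prod 0 (LinearMap.prod
        (((LinearMap.mulLeft k Q).comp (VV k m).subtype).codRestrict _ (by
          intro c
          have := mem_VV.1 c.2
          rw [mem_VV]; simp
          refine (totalDegree_mul _ _).trans ?_
          omega))
        (((LinearMap.mulLeft k (-P)).comp (VV k m).subtype).codRestrict _ (by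
          intro c
          have := mem_VV.1 c.2
          rw [mem_VV]; simp
          refine (totalDegree_mul _ _).trans ?_
          omega)))
    have hle : LinearMap.ker L' ≤ LinearMap.range S := by
      rintro ⟨c, A, B⟩ hx
      rw [LinearMap.mem_ker] at hx
      have hx' : L (c, A, B) = 0 := congrArg Subtype.val hx
      rw [hL] at hx'
      simp only at hx'
      have hc : c = 0 := by
        apply hv
        have : (∑ i, c i • v i) = (-A.1) * P + (-B.1) * Q := by linear_combination hx'
        rw [this]
        exact Ideal.mem_span_pair.2 ⟨_, _, rfl⟩
      subst hc
      simp only [Pi.zero_apply, zero_smul, Finset.sum_const_zero, zero_add] at hx'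
      have hdvd : Q ∣ P * A.1 := ⟨-B.1, by linear_combination hx'⟩
      obtain ⟨C, hC⟩ := hPQ.symm.dvd_of_dvd_mul_left hdvd
      have hB : B.1 = -P * C := by
        have : Q * (B.1 + P * C) = 0 := by rw [hC] at hx'; linear_combination hx'
        rcases mul_eq_zero.1 this with h | h
        · exact absurd h hQ
        · linear_combination h
      have hCm : C ∈ VV k m := by
        rw [mem_VV]
        by_cases hC0 : C = 0
        · simp [hC0]
        have h1 := mem_VV.1 A.2
        rw [hC, totalDegree_mul_of_isDomain hQ hC0] at h1
        omega
      refine ⟨⟨C, hCm⟩, ?_⟩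
      ext1
      · rfl
      ext1
      · apply Subtype.ext; simp [S, hC]
      · apply Subtype.ext; simp [S, hB]
    exact (Submodule.finrank_mono hle).trans (LinearMap.finrank_range_le S)
  have hrn := LinearMap.finrank_range_add_finrank_ker L'
  have hrange := Submodule.finrank_le (LinearMap.range L')
  simp only [Module.finrank_prod, Module.finrank_fintype_fun_eq_card] at hrn
  have e1 := two_finrank_VV k m
  have e2 := two_finrank_VV k (m+a)
  have e3 := two_finrank_VV k (m+b)
  have e4 := two_finrank_VV k M
  rw [hM] at e4
  zify at *
  nlinarith

/-- number of common zeros -/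
theorem bezout_points {k : Type*} [Field k] (P Q : MvPolynomial (Fin 2) k) (hPQ : IsRelPrime P Q)
    (hP : P ≠ 0) (hQ : Q ≠ 0) (S : Finset (Fin 2 → k)) (hS : ∀ s ∈ S, eval s P = 0 ∧ eval s Q = 0) :
    S.card ≤ P.totalDegree * Q.totalDegree := by
  classical
  -- separating polynomials
  have hsep : ∀ s : S, ∃ e : MvPolynomial (Fin 2) k, eval s.1 e ≠ 0 ∧ ∀ t ∈ S, t ≠ s.1 → eval t e = 0 := by
    intro s
    have h1 : ∀ t : Fin 2 → k, ∃ e : MvPolynomial (Fin 2) k, t ≠ s.1 → (eval s.1 e ≠ 0 ∧ eval t e = 0) := by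
      intro t
      by_cases h : t = s.1
      · exact ⟨0, fun h' => absurd h h'⟩
      · obtain ⟨i, hi⟩ := Function.ne_iff.1 h
        refine ⟨X i - C (t i), fun _ => ⟨?_, by simp⟩⟩
        simp [sub_ne_zero]; exact fun h => hi h.symm
    choose e he using h1
    refine ⟨∏ t ∈ S.erase s.1, e t, ?_, ?_⟩
    · rw [map_prod, Finset.prod_ne_zero_iff]
      intro t ht; exact (he t (Finset.ne_of_mem_erase ht)).1
    · intro t ht hne
      rw [map_prod]
      exact Finset.prod_eq_zero (Finset.mem_erase.2 ⟨hne, ht⟩) (he t hne).2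
  choose e he1 he2 using hsep
  have := bezout_indep P Q hPQ hP hQ e (by
    intro c hc
    obtain ⟨A, B, hAB⟩ := Ideal.mem_span_pair.1 hc
    ext s
    have := congrArg (eval s.1) hAB
    simp only [map_add, map_mul, (hS s.1 s.2).1, (hS s.1 s.2).2, map_sum, smul_eval] at this
    rw [Finset.sum_eq_single s] at this
    · simp at this
      rcases this with h | h
      · exact h
      · exact absurd h (he1 s)
    · intro t _ hts
      rw [he2 t s.1 s.2 (fun h => hts (Subtype.ext h.symm))]; simp
    · simp)
  simpa using this
end DG

end

section
namespace DG
open MvPolynomial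

lemma fse_coeff_top {R : Type*} [CommRing R] {n : ℕ} (f : MvPolynomial (Fin (n+1)) R) (d : ℕ)
    (hd : f.totalDegree ≤ d) :
    (finSuccEquiv R n f).coeff d = C (coeff (Finsupp.single 0 d) f) := by
  classical
  ext m
  rw [finSuccEquiv_coeff_coeff, coeff_C]
  split_ifs with h
  · subst h
    congr 1
    ext i
    refine Fin.cases ?_ (fun j => ?_) i <;> simp
  · apply coeff_eq_zero_of_totalDegree_lt
    refine lt_of_le_of_lt hd ?_
    change d < (Finsupp.cons d m).sum fun _ e => e
    rw [Finsupp.sum_cons]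
    have : 0 < m.sum fun _ e => e := by
      rw [Nat.pos_iff_ne_zero]
      intro h0
      apply h
      have : m.degree = 0 := h0
      exact ((Finsupp.degree_eq_zero_iff m).1 this).symm
    omega

lemma fse_natDegree_le {R : Type*} [CommRing R] {n : ℕ} (f : MvPolynomial (Fin (n+1)) R) (d : ℕ)
    (hd : f.totalDegree ≤ d) : (finSuccEquiv R n f).natDegree ≤ d := by
  rw [natDegree_finSuccEquiv]
  exact (degreeOf_le_totalDegree f 0).trans hd

/-- evaluation through finSuccEquiv -/
lemma aeval_cons_fse {R A : Type*} [CommRing R] [CommRing A] [Algebra R A] {n : ℕ}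
    (f : MvPolynomial (Fin (n+1)) R) (a : A) (x : Fin n → A) :
    aeval (Fin.cons a x : Fin (n+1) → A) f
      = (Polynomial.map (aeval x : MvPolynomial (Fin n) R →ₐ[R] A).toRingHom (finSuccEquiv R n f)).eval a := by
  induction f using MvPolynomial.induction_on with
  | C r => simp [finSuccEquiv_apply]
  | add p q hp hq => simp [hp, hq]
  | mul_X p i hp =>
    rw [map_mul, hp, map_mul, Polynomial.map_mul, Polynomial.eval_mul]
    congr 1
    refine Fin.cases ?_ (fun j => ?_) i
    · simp [finSuccEquiv_X_zero]
    · simp [finSuccEquiv_X_succ]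

lemma fse_pderiv_zero {R : Type*} [CommRing R] {n : ℕ} (f : MvPolynomial (Fin (n+1)) R) :
    finSuccEquiv R n (pderiv 0 f) = Polynomial.derivative (finSuccEquiv R n f) := by
  induction f using MvPolynomial.induction_on with
  | C r => simp [finSuccEquiv_apply]
  | add p q hp hq => simp [hp, hq]
  | mul_X p i hp =>
    rw [Derivation.leibniz, map_add, map_mul, Polynomial.derivative_mul, smul_eq_mul, smul_eq_mul, map_mul, map_mul, hp]
    refine Fin.cases ?_ (fun j => ?_) i
    · simp [finSuccEquiv_X_zero]; ring
    · rw [pderiv_X_of_ne (Fin.succ_ne_zero j)]; simp [finSuccEquiv_X_succ]; ring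

lemma totalDegree_pderiv_le {R σ : Type*} [CommRing R] (i : σ) (f : MvPolynomial σ R) :
    (pderiv i f).totalDegree ≤ f.totalDegree := by
  classical
  conv_lhs => rw [f.as_sum]
  rw [map_sum]
  refine totalDegree_finsetSum_le fun s hs => ?_
  rw [pderiv_monomial]
  refine (totalDegree_monomial_le _ _).trans ?_
  refine le_trans ?_ (le_totalDegree hs)
  change (s - Finsupp.single i 1).degree ≤ s.degree
  exact Finsupp.degree_mono tsub_le_self

lemma taylor_two {R A : Type*} [CommRing R] [CommRing A] [Algebra R A] {n : ℕ}
    (f : MvPolynomial (Fin (n+1)) R) (a h : A) (x : Fin n → A) :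
    ∃ g : A, aeval (Fin.cons (a + h) x : Fin (n+1) → A) f = aeval (Fin.cons a x : Fin (n+1) → A) f
      + aeval (Fin.cons a x : Fin (n+1) → A) (pderiv 0 f) * h + g * h^2 := by
  rw [aeval_cons_fse, aeval_cons_fse, aeval_cons_fse, fse_pderiv_zero, ← Polynomial.derivative_map]
  obtain ⟨g, hg⟩ := Polynomial.binomExpansion (Polynomial.map (aeval x : MvPolynomial (Fin n) R →ₐ[R] A).toRingHom (finSuccEquiv R n f)) a h
  exact ⟨g, hg⟩
end DG

end

section
namespace DG
open MvPolynomial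

section
variable {k : Type*} [Field k]

/-- the Hamiltonian derivation attached to F -/
noncomputable def ham (F : MvPolynomial (Fin 2) k) :
    Derivation k (MvPolynomial (Fin 2) k) (MvPolynomial (Fin 2) k) :=
  (pderiv 0 F) • pderiv 1 - (pderiv 1 F) • pderiv 0

lemma ham_apply (F g : MvPolynomial (Fin 2) k) :
    ham F g = pderiv 0 F * pderiv 1 g - pderiv 1 F * pderiv 0 g := by
  simp [ham]

lemma ham_deg (F g : MvPolynomial (Fin 2) k) (hF : F.totalDegree ≤ 4) :
    (ham F g).totalDegree ≤ g.totalDegree + 4 := by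
  rw [ham_apply]
  refine (totalDegree_sub _ _).trans (max_le ?_ ?_)
  · refine (totalDegree_mul _ _).trans ?_
    have := totalDegree_pderiv_le 0 F
    have := totalDegree_pderiv_le 1 g
    omega
  · refine (totalDegree_mul _ _).trans ?_
    have := totalDegree_pderiv_le 1 F
    have := totalDegree_pderiv_le 0 g
    omega

/-- parametrised branch of F at P -/
structure Branch (F : MvPolynomial (Fin 2) k) (P : Fin 2 → k) where
  φ : PowerSeries k
  h0 : PowerSeries.constantCoeff φ = P 0
  hF : aeval (Fin.cons φ (fun _ => PowerSeries.C (P 1) + PowerSeries.X) : Fin 2 → PowerSeries k) F = 0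

lemma exists_branch (F : MvPolynomial (Fin 2) k) (hF : F.totalDegree ≤ 4)
    (hlead : coeff (Finsupp.single 0 4) F ≠ 0) (P : Fin 2 → k) (h0 : eval P F = 0)
    (h1 : eval P (pderiv 0 F) ≠ 0) : Nonempty (Branch F P) := by
  set x : Fin 1 → PowerSeries k := fun _ => PowerSeries.C (P 1) + PowerSeries.X with hx
  set u := coeff (Finsupp.single 0 4) F with hu
  set ρ := (aeval x : MvPolynomial (Fin 1) k →ₐ[k] PowerSeries k).toRingHom with hρ
  set q := Polynomial.map ρ (finSuccEquiv k 1 F) with hq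
  set q' := Polynomial.C (PowerSeries.C u⁻¹) * q with hq'
  have hmonic : q'.Monic := by
    apply Polynomial.monic_of_natDegree_le_of_coeff_eq_one 4
    · refine (Polynomial.natDegree_C_mul_le _ _).trans ((Polynomial.natDegree_map_le).trans (fse_natDegree_le _ _ hF))
    · rw [hq', Polynomial.coeff_C_mul, hq, Polynomial.coeff_map, fse_coeff_top _ _ hF, ← hu, hρ]
      simp only [AlgHom.toRingHom_eq_coe, RingHom.coe_coe, algHom_C]
      change PowerSeries.C u⁻¹ * PowerSeries.C u = 1
      rw [← map_mul, inv_mul_cancel₀ hlead, map_one]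
  have key : ∀ G : MvPolynomial (Fin 2) k, PowerSeries.constantCoeff (aeval (Fin.cons (PowerSeries.C (P 0)) x : Fin 2 → PowerSeries k) G) = eval P G := by
    intro G
    induction G using MvPolynomial.induction_on with
    | C r => simp [algHom_C]
    | add p q hp hq => simp [hp, hq]
    | mul_X p i hp =>
      rw [map_mul, map_mul, hp, map_mul]
      congr 1
      fin_cases i <;> simp [hx]
  have hmem : ∀ s : PowerSeries k, s ∈ Ideal.span {(PowerSeries.X : PowerSeries k)} ↔ PowerSeries.constantCoeff s = 0 := by
    intro s; rw [Ideal.mem_span_singleton, PowerSeries.X_dvd_iff]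
  obtain ⟨φ, hroot, hφ⟩ := HenselianRing.is_henselian (I := Ideal.span {(PowerSeries.X : PowerSeries k)}) q' hmonic (PowerSeries.C (P 0))
    (by
      rw [hmem, hq', Polynomial.eval_mul, map_mul, hq, hρ, ← aeval_cons_fse, key, h0, mul_zero])
    (by
      apply IsUnit.map
      rw [hq', Polynomial.derivative_C_mul, Polynomial.eval_mul, hq, Polynomial.derivative_map, ← fse_pderiv_zero, hρ, ← aeval_cons_fse,
        PowerSeries.isUnit_iff_constantCoeff, map_mul, key]
      simp [h1, hlead])
  refine ⟨⟨φ, ?_, ?_⟩⟩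
  · rw [hmem] at hφ
    simp at hφ
    exact sub_eq_zero.1 hφ
  · rw [aeval_cons_fse, ← hx, ← hρ, ← hq]
    have : Polynomial.eval φ q' = 0 := hroot
    rw [hq', Polynomial.eval_mul, Polynomial.eval_C] at this
    rcases mul_eq_zero.1 this with h | h
    · exfalso
      have := congrArg PowerSeries.constantCoeff h
      simp [hlead] at this
    · exact h

namespace Branch
variable {F : MvPolynomial (Fin 2) k} {P : Fin 2 → k} (β : Branch F P)

noncomputable def ev : MvPolynomial (Fin 2) k →ₐ[k] PowerSeries k :=
  aeval (Fin.cons β.φ (fun _ => PowerSeries.C (P 1) + PowerSeries.X) : Fin 2 → PowerSeries k)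

lemma ev_F : β.ev F = 0 := β.hF

lemma ev_of_dvd {g : MvPolynomial (Fin 2) k} (h : F ∣ g) : β.ev g = 0 := by
  obtain ⟨c, rfl⟩ := h
  rw [map_mul, ev_F, zero_mul]

lemma ev_X0 : β.ev (X 0) = β.φ := by simp [ev]
lemma ev_X1 : β.ev (X 1) = PowerSeries.C (P 1) + PowerSeries.X := by
  simp only [ev, aeval_X]; rfl

lemma const_ev (g : MvPolynomial (Fin 2) k) : PowerSeries.constantCoeff (β.ev g) = eval P g := by
  induction g using MvPolynomial.induction_on with
  | C r => simp [algHom_C]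
  | add p q hp hq => simp [hp, hq]
  | mul_X p i hp =>
    rw [map_mul, map_mul, hp, map_mul]
    congr 1
    fin_cases i
    · simp [ev_X0, β.h0]
    · simp [ev_X1]

lemma deriv_ev (g : MvPolynomial (Fin 2) k) :
    PowerSeries.derivative k (β.ev g) = β.ev (pderiv 0 g) * PowerSeries.derivative k β.φ + β.ev (pderiv 1 g) := by
  induction g using MvPolynomial.induction_on with
  | C r =>
    have : β.ev (C r) = PowerSeries.C r := by rw [algHom_C]; rfl
    rw [this, PowerSeries.derivative_C]; simp
  | add p q hp hq => simp only [map_add, hp, hq]; ring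
  | mul_X p i hp =>
    rw [map_mul, Derivation.leibniz, hp, Derivation.leibniz, Derivation.leibniz]
    fin_cases i
    · simp [ev_X0, pderiv_X_of_ne]; ring
    · simp [ev_X1, pderiv_X_of_ne]; ring

lemma deriv_ham (g : MvPolynomial (Fin 2) k) :
    β.ev (pderiv 0 F) * PowerSeries.derivative k (β.ev g) = β.ev (ham F g) := by
  have h := β.deriv_ev F
  rw [ev_F, map_zero] at h
  rw [deriv_ev, ham_apply, map_sub, map_mul, map_mul]
  linear_combination (-β.ev (pderiv 0 g)) * h

lemma order_of_ham (p : ℕ) [Fact p.Prime] [CharP k p] (hz : eval P (pderiv 0 F) ≠ 0) (n : ℕ) (hn : n ≤ p) :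
    ∀ g : MvPolynomial (Fin 2) k, (∀ j < n, eval P ((ham F)^[j] g) = 0) → PowerSeries.X ^ n ∣ β.ev g := by
  induction n with
  | zero => intro g _; simp
  | succ n ih =>
    intro g hg
    have h1 := ih (by omega) (ham F g) (fun j hj => by
      have := hg (j+1) (by omega)
      rwa [Function.iterate_succ_apply] at this)
    rw [← deriv_ham] at h1
    have hu : IsUnit (β.ev (pderiv 0 F)) := by
      rw [PowerSeries.isUnit_iff_constantCoeff, const_ev]
      exact hz.isUnit
    rw [hu.dvd_mul_left] at h1
    rw [PowerSeries.X_pow_dvd_iff] at h1 ⊢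
    intro m hm
    rcases m with _ | m
    · have := hg 0 (by omega)
      rw [PowerSeries.coeff_zero_eq_constantCoeff_apply, const_ev]
      simpa using this
    · have := h1 m (by omega)
      rw [PowerSeries.coeff_derivative] at this
      rcases mul_eq_zero.1 this with h | h
      · exact h
      · exfalso
        have h' : ((m+1 : ℕ) : k) = 0 := by push_cast; exact h
        rw [CharP.cast_eq_zero_iff k p] at h'
        have := Nat.le_of_dvd (by omega) h'
        omega
end Branch

/-- fat Bezout -/
theorem fat_bezout (F : MvPolynomial (Fin 2) k) (hirr : Irreducible F) (hF : F.totalDegree ≤ 4)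
    (S : Finset (Fin 2 → k)) (β : ∀ P ∈ S, Branch F P) (ψ : MvPolynomial (Fin 2) k) (hψ : ¬ F ∣ ψ) (n : ℕ)
    (hord : ∀ P (hP : P ∈ S), PowerSeries.X ^ n ∣ (β P hP).ev ψ) :
    S.card * n ≤ 4 * ψ.totalDegree := by
  classical
  have hsep : ∀ s : S, ∃ e : MvPolynomial (Fin 2) k, eval s.1 e ≠ 0 ∧ ∀ t ∈ S, t ≠ s.1 → eval t e = 0 := by
    intro s
    have h1 : ∀ t : Fin 2 → k, ∃ e : MvPolynomial (Fin 2) k, t ≠ s.1 → (eval s.1 e ≠ 0 ∧ eval t e = 0) := by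
      intro t
      by_cases h : t = s.1
      · exact ⟨0, fun h' => absurd h h'⟩
      · obtain ⟨i, hi⟩ := Function.ne_iff.1 h
        refine ⟨X i - C (t i), fun _ => ⟨?_, by simp⟩⟩
        simp [sub_ne_zero]; exact fun h => hi h.symm
    choose e he using h1
    refine ⟨∏ t ∈ S.erase s.1, e t, ?_, ?_⟩
    · rw [map_prod, Finset.prod_ne_zero_iff]
      intro t ht; exact (he t (Finset.ne_of_mem_erase ht)).1
    · intro t ht hne
      rw [map_prod]
      exact Finset.prod_eq_zero (Finset.mem_erase.2 ⟨hne, ht⟩) (he t hne).2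
  choose e he1 he2 using hsep
  have := bezout_indep F ψ ((hirr.isRelPrime_iff_not_dvd).2 hψ) hirr.ne_zero
    (by rintro rfl; exact hψ (dvd_zero _))
    (fun q : S × Fin n => e q.1 ^ n * (X 1 - C (q.1.1 1)) ^ (q.2 : ℕ)) (by
    intro c hc
    obtain ⟨A, B, hAB⟩ := Ideal.mem_span_pair.1 hc
    ext ⟨s, j⟩
    have h1 := congrArg ((β s.1 s.2).ev) hAB
    rw [map_add, map_mul, map_mul, Branch.ev_F, mul_zero, zero_add] at h1
    have h2 : PowerSeries.X ^ n ∣ (β s.1 s.2).ev (∑ q : S × Fin n, c q • (e q.1 ^ n * (X 1 - C (q.1.1 1)) ^ (q.2 : ℕ))) := by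
      rw [← h1]
      exact Dvd.dvd.mul_left (hord s.1 s.2) _
    rw [Fintype.sum_prod_type, map_sum, ← Finset.add_sum_erase _ _ (Finset.mem_univ s)] at h2
    have h3 : PowerSeries.X ^ n ∣ ∑ t ∈ Finset.univ.erase s, (β s.1 s.2).ev (∑ j : Fin n, c (t, j) • (e t ^ n * (X 1 - C (t.1 1)) ^ (j : ℕ))) := by
      refine Finset.dvd_sum fun t ht => ?_
      rw [map_sum]
      refine Finset.dvd_sum fun j _ => ?_
      rw [map_smul, map_mul, map_pow, PowerSeries.smul_eq_C_mul]
      apply Dvd.dvd.mul_left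
      apply Dvd.dvd.mul_right
      apply pow_dvd_pow_of_dvd
      rw [PowerSeries.X_dvd_iff, Branch.const_ev]
      exact he2 t s.1 s.2 (fun h => (Finset.ne_of_mem_erase ht) (Subtype.ext h.symm))
    have h4 := (dvd_add_left h3).1 h2
    have h5 : (β s.1 s.2).ev (∑ j : Fin n, c (s, j) • (e s ^ n * (X 1 - C (s.1 1)) ^ (j : ℕ)))
       = (β s.1 s.2).ev (e s ^ n) * ∑ j : Fin n, PowerSeries.C (c (s,j)) * PowerSeries.X ^ (j : ℕ) := by
      rw [map_sum, Finset.mul_sum]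
      refine Finset.sum_congr rfl fun j _ => ?_
      have : (β s.1 s.2).ev (C (s.1 1)) = PowerSeries.C (s.1 1) := by rw [algHom_C]; rfl
      rw [map_smul, map_mul, map_pow _ (X 1 - C (s.1 1)), map_sub, Branch.ev_X1, this, PowerSeries.smul_eq_C_mul]
      ring
    have hu : IsUnit ((β s.1 s.2).ev (e s ^ n)) := by
      rw [PowerSeries.isUnit_iff_constantCoeff, Branch.const_ev, map_pow]
      exact (he1 s).isUnit.pow n
    rw [h5, hu.dvd_mul_left, PowerSeries.X_pow_dvd_iff] at h4
    have h6 := h4 j j.2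
    rw [map_sum, Finset.sum_eq_single j] at h6
    · simpa [PowerSeries.coeff_C_mul, PowerSeries.coeff_X_pow] using h6
    · intro i _ hij
      rw [PowerSeries.coeff_C_mul, PowerSeries.coeff_X_pow, if_neg (fun h => hij (Fin.ext h.symm)), mul_zero]
    · simp)
  rw [Fintype.card_prod, Fintype.card_coe, Fintype.card_fin] at this
  exact this.trans (Nat.mul_le_mul_right _ hF)
end
end DG

end

section
namespace DG
open MvPolynomial

section
variable {k : Type*} [Field k]

/-- multiples of F in VV (N+4) -/
noncomputable def UU (F : MvPolynomial (Fin 2) k) (N : ℕ) : Submodule k (VV k (N+4)) :=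
  ((VV k N).map (LinearMap.mulLeft k F)).comap (VV k (N+4)).subtype

lemma mem_UU {F : MvPolynomial (Fin 2) k} (hF : F.totalDegree = 4) {N : ℕ} (x : VV k (N+4)) :
    x ∈ UU F N ↔ F ∣ x.1 := by
  constructor
  · rintro ⟨c, hc, hcx⟩
    exact ⟨c, hcx.symm⟩
  · rintro ⟨c, hc⟩
    refine ⟨c, ?_, hc.symm⟩
    have hF0 : F ≠ 0 := by rintro rfl; simp at hF
    have := mem_VV.1 x.2
    by_cases hc0 : c = 0
    · subst hc0; exact zero_mem _
    rw [hc, totalDegree_mul_of_isDomain hF0 hc0, hF] at this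
    exact mem_VV.2 (by omega)

lemma finrank_UU {F : MvPolynomial (Fin 2) k} (hF : F.totalDegree = 4) (N : ℕ) :
    Module.finrank k (UU F N) = Module.finrank k (VV k N) := by
  have hF0 : F ≠ 0 := by rintro rfl; simp at hF
  have hle : (VV k N).map (LinearMap.mulLeft k F) ≤ VV k (N+4) := by
    rintro _ ⟨c, hc, rfl⟩
    have := mem_VV.1 hc
    rw [mem_VV]
    simp only [LinearMap.mulLeft_apply]
    exact (totalDegree_mul _ _).trans (by omega)
  rw [UU, (Submodule.comapSubtypeEquivOfLe hle).finrank_eq]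
  exact (LinearEquiv.finrank_eq (Submodule.equivMapOfInjective (LinearMap.mulLeft k F) (mul_right_injective₀ hF0) (VV k N))).symm

lemma finrank_quot {F : MvPolynomial (Fin 2) k} (hF : F.totalDegree = 4) (N : ℕ) :
    Module.finrank k (VV k (N+4) ⧸ UU F N) = 4 * N + 14 := by
  have h1 := Submodule.finrank_quotient_add_finrank (UU F N)
  rw [finrank_UU hF] at h1
  have e1 := two_finrank_VV k N
  have e2 := two_finrank_VV k (N+4)
  nlinarith

lemma exists_compl {F : MvPolynomial (Fin 2) k} (hF : F.totalDegree = 4) (N : ℕ) :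
    ∃ W : Submodule k (MvPolynomial (Fin 2) k), (∀ w ∈ W, w.totalDegree ≤ N+4) ∧
      (∀ w ∈ W, F ∣ w → w = 0) ∧ Module.finrank k W = 4*N+14 ∧ Module.Finite k W := by
  obtain ⟨W, hW⟩ := Submodule.exists_isCompl (UU F N)
  refine ⟨W.map (VV k (N+4)).subtype, ?_, ?_, ?_, inferInstance⟩
  · rintro _ ⟨w, hw, rfl⟩
    exact mem_VV.1 w.2
  · rintro _ ⟨w, hw, rfl⟩ h
    have : w ∈ UU F N := (mem_UU hF w).2 h
    have := (Submodule.disjoint_def.1 hW.disjoint) w this hw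
    simp [this]
  · rw [Submodule.finrank_map_subtype_eq]
    have := Submodule.finrank_add_eq_of_isCompl hW
    have h1 := Submodule.finrank_quotient_add_finrank (UU F N)
    rw [finrank_quot hF] at h1
    omega
lemma ham_iter_add (F a b : MvPolynomial (Fin 2) k) (j : ℕ) :
    (ham F)^[j] (a + b) = (ham F)^[j] a + (ham F)^[j] b := by
  induction j generalizing a b with
  | zero => rfl
  | succ j ih => simp [ih]

lemma ham_iter_smul (F a : MvPolynomial (Fin 2) k) (c : k) (j : ℕ) :
    (ham F)^[j] (c • a) = c • (ham F)^[j] a := by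
  induction j generalizing a with
  | zero => rfl
  | succ j ih => rw [Function.iterate_succ_apply, Function.iterate_succ_apply, Derivation.map_smul, ih]

lemma ham_iter_sum {ι : Type*} (s : Finset ι) (F : MvPolynomial (Fin 2) k) (a : ι → MvPolynomial (Fin 2) k) (j : ℕ) :
    (ham F)^[j] (∑ i ∈ s, a i) = ∑ i ∈ s, (ham F)^[j] (a i) := by
  induction j generalizing a with
  | zero => rfl
  | succ j ih => simp only [Function.iterate_succ_apply, map_sum, ih]

lemma ham_iter_mul_pow {p : ℕ} [CharP k p] (F a f : MvPolynomial (Fin 2) k) (j : ℕ) :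
    (ham F)^[j] (a * f ^ p) = (ham F)^[j] a * f ^ p := by
  induction j generalizing a with
  | zero => rfl
  | succ j ih =>
    rw [Function.iterate_succ_apply, Function.iterate_succ_apply, ← ih]
    congr 1
    rw [Derivation.leibniz, Derivation.leibniz_pow]
    simp [mul_comm, CharP.cast_eq_zero]

lemma ham_iter_deg (F a : MvPolynomial (Fin 2) k) (hF : F.totalDegree ≤ 4) (j : ℕ) :
    ((ham F)^[j] a).totalDegree ≤ a.totalDegree + 4 * j := by
  induction j with
  | zero => simp
  | succ j ih =>
    rw [Function.iterate_succ_apply']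
    have := ham_deg F ((ham F)^[j] a) hF
    omega

noncomputable def hamIter (F : MvPolynomial (Fin 2) k) (j : ℕ) :
    MvPolynomial (Fin 2) k →ₗ[k] MvPolynomial (Fin 2) k where
  toFun := (ham F)^[j]
  map_add' a b := ham_iter_add F a b j
  map_smul' c a := ham_iter_smul F a c j

/-- existence of the auxiliary coefficients -/
lemma exists_aux (F : MvPolynomial (Fin 2) k) (hF : F.totalDegree = 4) (m E n : ℕ)
    (W : Submodule k (MvPolynomial (Fin 2) k)) (hWdeg : ∀ w ∈ W, w.totalDegree ≤ E+4)
    (hWf : Module.finrank k W = 4*E+14) (hfin : Module.Finite k W)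
    (f : Fin (n+1) → MvPolynomial (Fin 2) k) (hf : ∀ i, (f i).totalDegree ≤ m)
    (hE : n * m + 2 * n^2 ≤ E) :
    ∃ a : Fin (n+1) → W, a ≠ 0 ∧ ∀ j < n, F ∣ ∑ i, (ham F)^[j] (a i).1 * f i := by
  let L : ∀ j : Fin n, (Fin (n+1) → W) →ₗ[k] (VV k ((E + m + 4 * (j:ℕ)) + 4)) := fun j =>
    LinearMap.codRestrict _ (∑ i : Fin (n+1), ((LinearMap.mulRight k (f i)).comp ((hamIter F j).comp W.subtype)).comp (LinearMap.proj i))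
      (by
        intro a
        rw [LinearMap.sum_apply]
        refine sum_mem fun i _ => ?_
        rw [mem_VV]
        simp only [LinearMap.comp_apply, LinearMap.mulRight_apply, LinearMap.proj_apply]
        refine (totalDegree_mul _ _).trans ?_
        have h1 := ham_iter_deg F (a i).1 hF.le j
        have h2 := hWdeg _ (a i).2
        have h3 := hf i
        have : ((hamIter F ↑j) (W.subtype (a i))).totalDegree ≤ _ := h1
        omega)
  have hL : ∀ j a, (L j a).1 = ∑ i, (ham F)^[j] (a i).1 * f i := by
    intro j a
    simp [L, LinearMap.sum_apply]; rfl
  let Λ : (Fin (n+1) → W) →ₗ[k] (∀ j : Fin n, VV k ((E + m + 4 * (j:ℕ)) + 4) ⧸ UU F (E + m + 4 * (j:ℕ))) :=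
    LinearMap.pi fun j => (UU F _).mkQ.comp (L j)
  have hker : ∃ a, a ≠ 0 ∧ Λ a = 0 := by
    by_contra hne
    push Not at hne
    have hinj : Function.Injective Λ := (injective_iff_map_eq_zero Λ).2 fun a ha => by
      by_contra h; exact hne a h ha
    have hfr := LinearMap.finrank_le_finrank_of_injective hinj
    revert hfr
    apply Nat.not_le_of_lt
    haveI hfree : ∀ i : Fin n, Module.Free k (VV k (E + m + 4 * (i:ℕ) + 4) ⧸ UU F (E + m + 4 * (i:ℕ))) :=
      fun i => Module.Free.of_divisionRing k _
    rw [Module.finrank_pi_fintype, Module.finrank_pi_fintype]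
    simp only [finrank_quot hF, hWf, Finset.sum_const, Finset.card_univ, Fintype.card_fin, smul_eq_mul]
    have h1 : ∑ x : Fin n, (4 * (E + m + 4 * (x:ℕ)) + 14) ≤ ∑ x : Fin n, (4 * (E + m) + 14) + 8 * n^2 := by
      have h2 : ∑ x : Fin n, 2 * (x : ℕ) ≤ n^2 := by
        rw [Fin.sum_univ_eq_sum_range (fun x => 2 * x), ← Finset.mul_sum, mul_comm, Finset.sum_range_id_mul_two]
        rw [sq]; exact Nat.mul_le_mul_left _ (by omega)
      calc _ = ∑ x : Fin n, (4 * (E + m) + 14) + 8 * ∑ x : Fin n, 2 * (x : ℕ) := by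
            rw [Finset.mul_sum, ← Finset.sum_add_distrib]; refine Finset.sum_congr rfl fun x _ => by ring
        _ ≤ _ := by omega
    refine lt_of_le_of_lt h1 ?_
    simp only [Finset.sum_const, Finset.card_univ, Fintype.card_fin, smul_eq_mul]
    nlinarith
  obtain ⟨a, ha0, ha⟩ := hker
  refine ⟨a, ha0, fun j hj => ?_⟩
  have := congrFun ha ⟨j, hj⟩
  simp only [Λ, LinearMap.pi_apply, LinearMap.comp_apply, Submodule.mkQ_apply, Pi.zero_apply, Submodule.Quotient.mk_eq_zero] at this
  rw [mem_UU hF, hL] at this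
  exact this

end

section
variable {p : ℕ} [hp : Fact p.Prime]

lemma order_le (F : MvPolynomial (Fin 2) (ZMod p)) (hirr : Irreducible F) (hF : F.totalDegree = 4)
    (P : Fin 2 → ZMod p) (β : Branch F P) (g : MvPolynomial (Fin 2) (ZMod p)) (hg : ¬ F ∣ g) (n : ℕ)
    (h : PowerSeries.X ^ n ∣ β.ev g) : n ≤ 4 * g.totalDegree := by
  have := fat_bezout F hirr hF.le {P} (fun Q hQ => (Finset.mem_singleton.1 hQ) ▸ β) g hg n (by
    intro Q hQ
    obtain rfl := Finset.mem_singleton.1 hQ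
    exact h)
  simpa using this

/-- expansion of a p-th power modulo a power of X -/
lemma pow_p_expand (s : PowerSeries (ZMod p)) (r : ℕ) :
    ∃ h : PowerSeries (ZMod p), s ^ p = ∑ i ∈ Finset.range (r+1), PowerSeries.C (PowerSeries.coeff i s) * PowerSeries.X ^ (p * i)
      + PowerSeries.X ^ (p * (r+1)) * h := by
  have h1 : PowerSeries.X ^ (r+1) ∣ s - ∑ i ∈ Finset.range (r+1), PowerSeries.C (PowerSeries.coeff i s) * PowerSeries.X ^ i := by
    rw [PowerSeries.X_pow_dvd_iff]
    intro m hm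
    rw [map_sub, map_sum, Finset.sum_eq_single m]
    · simp [PowerSeries.coeff_C_mul, PowerSeries.coeff_X_pow]
    · intro i _ hi
      simp [PowerSeries.coeff_C_mul, PowerSeries.coeff_X_pow, hi.symm]
    · intro h; exact absurd (Finset.mem_range.2 hm) h
  obtain ⟨h, hh⟩ := h1
  haveI : CharP (PowerSeries (ZMod p)) p := by
    refine charP_of_injective_ringHom (f := (PowerSeries.C : ZMod p →+* PowerSeries (ZMod p))) PowerSeries.C_injective p
  refine ⟨h ^ p, ?_⟩
  have h2 : s = ∑ i ∈ Finset.range (r+1), PowerSeries.C (PowerSeries.coeff i s) * PowerSeries.X ^ i + PowerSeries.X ^ (r+1) * h := by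
    rw [← hh]; ring
  conv_lhs => rw [h2]
  rw [add_pow_char, sum_pow_char, mul_pow, ← pow_mul, mul_comm (r+1) p]
  congr 1
  refine Finset.sum_congr rfl fun i _ => ?_
  rw [mul_pow, ← map_pow, ZMod.pow_card, ← pow_mul, mul_comm i p]

lemma psi_not_dvd (F : MvPolynomial (Fin 2) (ZMod p)) (hirr : Irreducible F) (hF : F.totalDegree = 4)
    (P : Fin 2 → ZMod p) (β : Branch F P) {ι : Type*} [Fintype ι] (a f : ι → MvPolynomial (Fin 2) (ZMod p))
    (W : Submodule (ZMod p) (MvPolynomial (Fin 2) (ZMod p))) (E : ℕ) (hWdeg : ∀ w ∈ W, w.totalDegree ≤ E)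
    (hW : ∀ w ∈ W, F ∣ w → w = 0) (haW : ∀ i, a i ∈ W) (ha : a ≠ 0)
    (hf : ∀ c : ι → ZMod p, F ∣ ∑ i, c i • f i → c = 0) (hE : 4 * E < p) :
    ¬ F ∣ ∑ i, a i * f i ^ p := by
  intro hdvd
  have hp0 := hp.out.pos
  set c : ℕ → MvPolynomial (Fin 2) (ZMod p) := fun r => ∑ i, PowerSeries.coeff r (β.ev (f i)) • a i with hc
  have hcW : ∀ r, c r ∈ W := fun r => sum_mem fun i _ => Submodule.smul_mem _ _ (haW i)
  have hcd : ∀ r, F ∣ c r := by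
    intro r
    induction r using Nat.strong_induction_on with
    | _ r ih =>
      by_contra hnd
      have h0 := β.ev_of_dvd hdvd
      choose h hh using fun i => pow_p_expand (β.ev (f i)) r
      have h1 : β.ev (∑ i, a i * f i ^ p) = ∑ s ∈ Finset.range (r+1), β.ev (c s) * PowerSeries.X ^ (p * s)
          + PowerSeries.X ^ (p * (r+1)) * ∑ i, β.ev (a i) * h i := by
        rw [map_sum]
        simp only [map_mul, map_pow, hh, mul_add, Finset.sum_add_distrib, Finset.mul_sum]
        congr 1
        · rw [Finset.sum_comm]
          refine Finset.sum_congr rfl fun s _ => ?_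
          rw [hc]; simp only [map_sum, map_smul, Finset.sum_mul, PowerSeries.smul_eq_C_mul]
          refine Finset.sum_congr rfl fun i _ => by ring
        · refine Finset.sum_congr rfl fun i _ => by ring
      rw [h0, Finset.sum_range_succ, Finset.sum_eq_zero (fun s hs => by
        rw [β.ev_of_dvd (ih s (Finset.mem_range.1 hs)), zero_mul]), zero_add] at h1
      have h2 : PowerSeries.X ^ p ∣ β.ev (c r) := by
        have h3 : PowerSeries.X ^ (p * r) * (β.ev (c r) + PowerSeries.X ^ p * ∑ i, β.ev (a i) * h i) = 0 := by
          rw [h1]; ring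
        rcases mul_eq_zero.1 h3 with h4 | h4
        · exact absurd h4 (pow_ne_zero _ PowerSeries.X_ne_zero)
        · exact ⟨-∑ i, β.ev (a i) * h i, by linear_combination h4⟩
      have := order_le F hirr hF P β (c r) hnd p h2
      have := hWdeg _ (hcW r)
      omega
  have hc0 : ∀ r, c r = 0 := fun r => hW _ (hcW r) (hcd r)
  obtain ⟨i0, hi0⟩ := Function.ne_iff.1 ha
  obtain ⟨mm, hm⟩ := MvPolynomial.ne_zero_iff.1 hi0
  have h1 : β.ev (∑ i, (coeff mm (a i)) • f i) = 0 := by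
    ext r
    have := congrArg (coeff mm) (hc0 r)
    simp only [hc, coeff_sum, coeff_smul, smul_eq_mul, coeff_zero] at this
    rw [map_sum, map_sum, map_zero, ← this]
    refine Finset.sum_congr rfl fun i _ => ?_
    rw [map_smul, PowerSeries.coeff_smul, mul_comm]; rfl
  have h2 : F ∣ ∑ i, (coeff mm (a i)) • f i := by
    by_contra hnd
    have := order_le F hirr hF P β _ hnd (4 * (∑ i, (coeff mm (a i)) • f i).totalDegree + 1) (by rw [h1]; exact dvd_zero _)
    omega
  exact hm (congrFun (hf _ h2) i0)

/-- Stepanov bound with parameters: n = 4 * m + 13 -/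
theorem stepanov (F : MvPolynomial (Fin 2) (ZMod p)) (hirr : Irreducible F) (hF : F.totalDegree = 4)
    (hlead : coeff (Finsupp.single 0 4) F ≠ 0) (m n E : ℕ) (hn : n = 4 * m + 13)
    (hE : E = n * (m+4) + 2*n^2) (hEp : 4 * (E + 4) < p) (S : Finset (Fin 2 → ZMod p))
    (hS : ∀ P ∈ S, eval P F = 0 ∧ eval P (pderiv 0 F) ≠ 0) :
    S.card * n ≤ 4 * (E + 4 + p * (m+4)) := by
  classical
  rcases S.eq_empty_or_nonempty with rfl | ⟨P0, hP0⟩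
  · simp
  obtain ⟨W, hWdeg, hW, hWf, hfin⟩ := exists_compl hF E
  obtain ⟨W', hWdeg', hW', hWf', hfin'⟩ := exists_compl hF m
  let b := Module.finBasisOfFinrankEq (ZMod p) W' (n := n+1) (by rw [hWf', hn])
  obtain ⟨a, ha0, ha⟩ := exists_aux F hF (m+4) E n W hWdeg hWf hfin (fun i => (b i).1) (fun i => hWdeg' _ (b i).2) hE.ge
  set ψ := ∑ i, (a i).1 * (b i).1 ^ p with hψ
  have hbr : ∀ P ∈ S, Nonempty (Branch F P) := fun P hP => exists_branch F hF.le hlead P (hS P hP).1 (hS P hP).2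
  have hnd : ¬ F ∣ ψ := by
    refine psi_not_dvd F hirr hF P0 (hbr P0 hP0).some (fun i => (a i).1) (fun i => (b i).1) W (E+4) hWdeg hW (fun i => (a i).2) ?_ ?_ hEp
    · intro h
      exact ha0 (funext fun i => Subtype.ext (congrFun h i))
    · intro c hc
      have h1 : (∑ i, c i • b i).1 = ∑ i, c i • (b i).1 := by simp
      have h2 : ∑ i, c i • b i = 0 := Subtype.ext (hW' _ (∑ i, c i • b i).2 (h1 ▸ hc))
      exact funext (Fintype.linearIndependent_iff.1 b.linearIndependent c h2)
  have := fat_bezout F hirr hF.le S (fun P hP => (hbr P hP).some) ψ hnd n (by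
    intro P hP
    refine Branch.order_of_ham _ p (hS P hP).2 n (by nlinarith) ψ ?_
    intro j hj
    rw [hψ, ham_iter_sum]
    simp only [ham_iter_mul_pow, map_sum, map_mul, map_pow, ZMod.pow_card]
    obtain ⟨q, hq⟩ := ha j hj
    have := congrArg (eval P) hq
    simpa [(hS P hP).1] using this)
  refine this.trans (Nat.mul_le_mul_left _ ?_)
  refine totalDegree_finsetSum_le fun i _ => ?_
  refine (totalDegree_mul _ _).trans (add_le_add (hWdeg _ (a i).2) ?_)
  exact (totalDegree_pow _ _).trans (Nat.mul_le_mul_left _ (hWdeg' _ (b i).2))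

theorem weil_bound (F : MvPolynomial (Fin 2) (ZMod p)) (hirr : Irreducible F) (hF : F.totalDegree = 4)
    (hlead : coeff (Finsupp.single 0 4) F ≠ 0) (S : Finset (Fin 2 → ZMod p))
    (hS : ∀ P ∈ S, eval P F = 0 ∧ eval P (pderiv 0 F) ≠ 0) :
    (S.card : ℝ) ≤ p + 1000000 * Real.sqrt p := by
  have hp0 : (0:ℝ) < p := by exact_mod_cast hp.out.pos
  set R := Real.sqrt p with hR
  have hR2 : R * R = p := Real.mul_self_sqrt hp0.le
  have hR0 : 0 < R := Real.sqrt_pos.2 hp0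
  by_cases hsmall : R < 100
  · have h1 : S.card ≤ p ^ 2 := by
      refine (Finset.card_le_univ S).trans ?_
      simp [ZMod.card]
    have h2 : (S.card : ℝ) ≤ (p:ℝ)^2 := by exact_mod_cast h1
    have h3 : (p:ℝ)^2 = R * R * R * R := by rw [← hR2]; ring
    have h4 : R * R * R ≤ 1000000 := by
      have : R * R ≤ 100 * 100 := by nlinarith
      nlinarith
    nlinarith
  push Not at hsmall
  set m := ⌊R / 20⌋₊ - 4 with hm
  have hfl : 5 ≤ ⌊R/20⌋₊ := by apply Nat.le_floor; push_cast; linarith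
  have hmR : ((m:ℝ) + 4) ≤ R / 20 := by
    have : (m + 4 : ℕ) = ⌊R/20⌋₊ := by omega
    have h2 := Nat.floor_le (show 0 ≤ R/20 by positivity)
    rw [← this] at h2
    exact_mod_cast h2
  have hmR' : R/20 < (m:ℝ) + 4 + 1 := by
    have : (m + 4 : ℕ) = ⌊R/20⌋₊ := by omega
    have h2 := Nat.lt_floor_add_one (R/20)
    rw [← this] at h2
    exact_mod_cast h2
  have hm0 : (0:ℝ) ≤ m := by positivity
  have key := stepanov F hirr hF hlead m (4*m+13) ((4*m+13) * (m+4) + 2*(4*m+13)^2) rfl rfl (by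
    have : ((4 * ((4*m+13) * (m+4) + 2*(4*m+13)^2 + 4) : ℕ) : ℝ) < (p : ℝ) := by
      push_cast
      rw [← hR2]
      have h1 : (4*(m:ℝ)+13) ≤ R / 5 := by linarith
      have h2 : (4*(m:ℝ)+13) * (m+4) ≤ R/5 * (R/20) := by gcongr
      have h3 : (4*(m:ℝ)+13)^2 ≤ (R/5)^2 := by gcongr
      nlinarith
    exact_mod_cast this) S hS
  have key' : (S.card : ℝ) * (4*m+13) ≤ 4 * (((4*m+13) * (m+4) + 2*(4*m+13)^2) + 4 + p * (m+4)) := by exact_mod_cast key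
  set N : ℝ := 4*m+13 with hN
  have hNR : R/10 ≤ N := by linarith
  have hN0 : 0 < N := by linarith
  have h5 : (m:ℝ) + 4 = (N + 3)/4 := by rw [hN]; ring
  rw [h5] at key'
  have hNle : N ≤ R := by linarith
  -- S*N ≤ N*(N+3) + 8 N^2 + 16 + p*N + 3 p
  have h6 : 3 * (p:ℝ) ≤ 30 * R * N := by rw [← hR2]; nlinarith
  have h7 : (S.card : ℝ) * N ≤ (p + 1000000 * R) * N := by nlinarith
  exact le_of_mul_le_mul_right h7 hN0
end
end DG

end

section
namespace DG
open MvPolynomial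

lemma fse_monic {R : Type*} [CommRing R] {n : ℕ} (f : MvPolynomial (Fin (n+1)) R) (d : ℕ)
    (hd : f.totalDegree ≤ d) (h1 : coeff (Finsupp.single 0 d) f = 1) :
    (finSuccEquiv R n f).Monic := by
  apply Polynomial.monic_of_natDegree_le_of_coeff_eq_one d (fse_natDegree_le f d hd)
  rw [fse_coeff_top f d hd, h1, C_1]

lemma noeth_int {S R : Type*} [CommRing S] [CommRing R] [Algebra S R]
    (F : MvPolynomial (Fin 2) S) (P : MvPolynomial (Fin 2) R) (d a : ℕ)
    (hF : F.totalDegree ≤ d) (hF1 : coeff (Finsupp.single 0 d) F = 1)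
    (hP : P.totalDegree ≤ a) (hP1 : coeff (Finsupp.single 0 a) P = 1)
    (hdvd : P ∣ map (algebraMap S R) F) (m : Fin 2 →₀ ℕ) : IsIntegral S (coeff m P) := by
  letI := MvPolynomial.algebraMvPolynomial (R := S) (S := R) (σ := Fin 1)
  have h1 := Polynomial.isIntegral_coeff_of_dvd (R := MvPolynomial (Fin 1) S) (S := MvPolynomial (Fin 1) R)
    (finSuccEquiv S 1 F) (finSuccEquiv R 1 P) (fse_monic F d hF hF1) (fse_monic P a hP hP1)
    (by
      have : (finSuccEquiv S 1 F).map (algebraMap (MvPolynomial (Fin 1) S) (MvPolynomial (Fin 1) R))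
          = finSuccEquiv R 1 (map (algebraMap S R) F) := by
        ext i m
        rw [Polynomial.coeff_map, MvPolynomial.algebraMap_def, coeff_map, finSuccEquiv_coeff_coeff, finSuccEquiv_coeff_coeff, coeff_map]
      rw [this]
      exact map_dvd _ hdvd) (m 0)
  rw [MvPolynomial.isIntegral_iff_isIntegral_coeff] at h1
  have := h1 m.tail
  rwa [finSuccEquiv_coeff_coeff, Finsupp.cons_tail] at this

lemma coeff_top_mul {R : Type*} [CommRing R] {n : ℕ} (P Q : MvPolynomial (Fin (n+1)) R) (a b : ℕ)
    (hP : P.totalDegree ≤ a) (hQ : Q.totalDegree ≤ b) :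
    coeff (Finsupp.single 0 (a+b)) (P * Q) =
      coeff (Finsupp.single 0 a) P * coeff (Finsupp.single 0 b) Q := by
  have h := fse_coeff_top (P*Q) (a+b) ((totalDegree_mul P Q).trans (by omega))
  rw [map_mul, Polynomial.coeff_mul_add_eq_of_natDegree_le (fse_natDegree_le P a hP) (fse_natDegree_le Q b hQ),
    fse_coeff_top P a hP, fse_coeff_top Q b hQ, ← C_mul] at h
  exact (C_injective _ _ h).symm

/-- indices of the non-leading coefficients of a polynomial of degree `d`, monic in variable 0 -/
noncomputable def ix (d : ℕ) : Finset (Fin 2 →₀ ℕ) :=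
  ((Finsupp.finite_of_degree_le (σ := Fin 2) d).subset
    (Set.sdiff_subset (s := {m : Fin 2 →₀ ℕ | m.degree ≤ d}) (t := {Finsupp.single 0 d}))).toFinset

lemma mem_ix {d : ℕ} {m : Fin 2 →₀ ℕ} : m ∈ ix d ↔ m.degree ≤ d ∧ m ≠ Finsupp.single 0 d := by
  simp [ix]

noncomputable def Gen {R : Type*} [CommRing R] (d : ℕ) (c : ix d → R) : MvPolynomial (Fin 2) R :=
  monomial (Finsupp.single 0 d) 1 + ∑ m : ix d, monomial m.1 (c m)

section
variable {R : Type*} [CommRing R]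

lemma Gen_coeff (d : ℕ) (c : ix d → R) (m : ix d) : coeff m.1 (Gen d c) = c m := by
  classical
  have h := (mem_ix.1 m.2).2
  rw [Gen, coeff_add, coeff_monomial, if_neg (Ne.symm h), coeff_sum, Finset.sum_eq_single m]
  · simp
  · intro b _ hb
    rw [coeff_monomial, if_neg]
    exact fun hh => hb (Subtype.ext hh)
  · simp

lemma Gen_coeff_top (d : ℕ) (c : ix d → R) : coeff (Finsupp.single 0 d) (Gen d c) = 1 := by
  classical
  rw [Gen, coeff_add, coeff_monomial, if_pos rfl, coeff_sum, Finset.sum_eq_zero, add_zero]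
  intro b _
  rw [coeff_monomial, if_neg (mem_ix.1 b.2).2]

lemma Gen_deg (d : ℕ) (c : ix d → R) : (Gen d c).totalDegree ≤ d := by
  rw [Gen]
  refine (totalDegree_add _ _).trans (max_le ?_ ?_)
  · refine (totalDegree_monomial_le _ _).trans ?_
    simp [Finsupp.sum_single_index]
  · refine totalDegree_finsetSum_le fun m _ => (totalDegree_monomial_le _ _).trans ?_
    exact (mem_ix.1 m.2).1

lemma eq_Gen (d : ℕ) (F : MvPolynomial (Fin 2) R) (hF : F.totalDegree ≤ d)
    (h1 : coeff (Finsupp.single 0 d) F = 1) : F = Gen d (fun m => coeff m.1 F) := by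
  classical
  ext m
  by_cases hm : m = Finsupp.single 0 d
  · rw [hm, h1, Gen_coeff_top]
  by_cases hd : m.degree ≤ d
  · exact (Gen_coeff d (fun m => coeff m.1 F) ⟨m, mem_ix.2 ⟨hd, hm⟩⟩).symm
  · rw [coeff_eq_zero_of_totalDegree_lt, coeff_eq_zero_of_totalDegree_lt]
    · exact (Gen_deg d _).trans_lt (not_le.1 hd)
    · exact hF.trans_lt (not_le.1 hd)

lemma Gen_map {R' : Type*} [CommRing R'] (g : R →+* R') (d : ℕ) (c : ix d → R) :
    map g (Gen d c) = Gen d (fun m => g (c m)) := by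
  simp [Gen, map_sum, map_monomial]

lemma Gen_not_unit [IsDomain R] (d : ℕ) (hd : d ≠ 0) (c : ix d → R) : ¬ IsUnit (Gen d c) := by
  intro h
  rw [MvPolynomial.isUnit_iff_eq_C_of_isReduced] at h
  obtain ⟨r, _, hr⟩ := h
  have := Gen_coeff_top d c
  rw [hr, coeff_C, if_neg] at this
  · simp at this
  · intro h
    have := congrArg (fun f => f 0) h
    simp at this; omega
end

abbrev NS := MvPolynomial (ix 4) ℤ
abbrev NR (a b : ℕ) := MvPolynomial (ix a ⊕ ix b) ℤ
noncomputable def nprod (a b : ℕ) : MvPolynomial (Fin 2) (NR a b) :=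
  Gen a (fun m => X (Sum.inl m)) * Gen b (fun m => X (Sum.inr m))
noncomputable def ntau (a b : ℕ) : NS →+* NR a b :=
  (aeval (fun m : ix 4 => coeff m.1 (nprod a b))).toRingHom

lemma nprod_eq (a b : ℕ) (hab : a + b = 4) :
    nprod a b = Gen 4 (fun m => coeff m.1 (nprod a b)) := by
  apply eq_Gen
  · refine (totalDegree_mul _ _).trans ?_
    have := Gen_deg a (fun m => (X (Sum.inl m) : NR a b))
    have := Gen_deg b (fun m => (X (Sum.inr m) : NR a b))
    omega
  · have := coeff_top_mul _ _ a b (Gen_deg a (fun m => (X (Sum.inl m) : NR a b)))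
      (Gen_deg b (fun m => (X (Sum.inr m) : NR a b)))
    rw [hab, Gen_coeff_top, Gen_coeff_top, mul_one] at this
    exact this

lemma nprod_spec {R : Type*} [CommRing R] (a b : ℕ) (A : ix a → R) (B : ix b → R) :
    map (aeval (Sum.elim A B) : NR a b →ₐ[ℤ] R).toRingHom (nprod a b) = Gen a A * Gen b B := by
  rw [nprod, map_mul, Gen_map, Gen_map]
  congr 1 <;> congr 1 <;> ext m <;> simp

lemma ntau_spec {R : Type*} [CommRing R] (a b : ℕ) (g : NR a b →+* R) (φ : NS) :
    g (ntau a b φ) = aeval (fun m : ix 4 => coeff m.1 (map g (nprod a b))) φ := by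
  induction φ using MvPolynomial.induction_on with
  | C r => simp [ntau]
  | add p q hp hq => simp [hp, hq]
  | mul_X p i hp => rw [map_mul, map_mul, hp, map_mul]; simp [ntau, coeff_map]

/-- factorizations kill the kernel -/
lemma noeth_dir2 {k : Type*} [Field k] (c : ix 4 → k) (φ : NS)
    (hφ : ∀ a b, a + b = 4 → a ≠ 0 → b ≠ 0 → ntau a b φ = 0) (hc : aeval c φ ≠ 0) :
    Irreducible (Gen 4 c) := by
  have hne : Gen 4 c ≠ 0 := by
    intro h; have := Gen_coeff_top 4 c; rw [h] at this; simp at this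
  refine ⟨Gen_not_unit 4 (by norm_num) c, ?_⟩
  intro P Q hPQ
  by_contra hcon
  push Not at hcon
  have hP0 : P ≠ 0 := by rintro rfl; rw [zero_mul] at hPQ; exact hne hPQ
  have hQ0 : Q ≠ 0 := by rintro rfl; rw [mul_zero] at hPQ; exact hne hPQ
  have hu : ∀ P : MvPolynomial (Fin 2) k, P ≠ 0 → ¬ IsUnit P → P.totalDegree ≠ 0 := by
    intro P h0 h h1
    rw [totalDegree_eq_zero_iff_eq_C] at h1
    apply h
    rw [h1]
    apply IsUnit.map
    rw [isUnit_iff_ne_zero]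
    intro h2; rw [h2, C_0] at h1; exact h0 h1
  have hdeg : P.totalDegree + Q.totalDegree = 4 := by
    rw [← totalDegree_mul_of_isDomain hP0 hQ0, ← hPQ]
    apply le_antisymm (Gen_deg 4 c)
    have : Finsupp.single 0 4 ∈ (Gen 4 c).support := by
      rw [mem_support_iff, Gen_coeff_top]; exact one_ne_zero
    have := le_totalDegree this
    simpa [Finsupp.sum_single_index] using this
  set a := P.totalDegree with ha
  set b := Q.totalDegree with hb
  have htop := coeff_top_mul P Q a b le_rfl le_rfl
  rw [hdeg, ← hPQ, Gen_coeff_top] at htop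
  set p := coeff (Finsupp.single 0 a) P
  set q := coeff (Finsupp.single 0 b) Q
  have hP' : C q * P = Gen a (fun m => coeff m.1 (C q * P)) := by
    apply eq_Gen
    · refine (totalDegree_mul _ _).trans ?_
      simp [totalDegree_C, ← ha]
    · rw [coeff_C_mul, mul_comm]; exact htop.symm
  have hQ' : C p * Q = Gen b (fun m => coeff m.1 (C p * Q)) := by
    apply eq_Gen
    · refine (totalDegree_mul _ _).trans ?_
      simp [totalDegree_C, ← hb]
    · rw [coeff_C_mul]; exact htop.symm
  have hprod : Gen 4 c = Gen a (fun m => coeff m.1 (C q * P)) * Gen b (fun m => coeff m.1 (C p * Q)) := by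
    rw [← hP', ← hQ', hPQ]
    have : (C q * C p : MvPolynomial (Fin 2) k) = 1 := by
      rw [← C_mul, mul_comm q p, ← htop, C_1]
    linear_combination (-(P*Q)) * this
  have h0 := hφ a b hdeg (hu P hP0 hcon.1) (hu Q hQ0 hcon.2)
  have := ntau_spec a b (aeval (Sum.elim (fun m : ix a => coeff m.1 (C q * P)) (fun m : ix b => coeff m.1 (C p * Q))) : NR a b →ₐ[ℤ] k).toRingHom φ
  rw [h0, map_zero, nprod_spec, ← hprod] at this
  apply hc
  rw [this]
  congr 2
  ext m
  rw [Gen_coeff]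

lemma noeth_dir1 {K : Type*} [Field K] [IsAlgClosed K] (c : ix 4 → K) (a b : ℕ) (hab : a + b = 4)
    (ha : a ≠ 0) (hb : b ≠ 0)
    (hker : RingHom.ker (ntau a b) ≤ RingHom.ker (aeval c : NS →ₐ[ℤ] K).toRingHom) :
    ¬ Irreducible (Gen 4 c) := by
  letI alg : Algebra NS (NR a b) := (ntau a b).toAlgebra
  have halg : algebraMap NS (NR a b) = ntau a b := rfl
  have hmapF : map (algebraMap NS (NR a b)) (Gen 4 (fun m => (X m : NS))) = nprod a b := by
    rw [Gen_map, nprod_eq a b hab]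
    congr 1; ext1 m
    rw [halg, ntau]; simp
  have hintg : Algebra.IsIntegral NS (NR a b) := by
    constructor
    intro x
    have hX : ∀ i, IsIntegral NS (X i : NR a b) := by
      rintro (i | i)
      · have := noeth_int (Gen 4 (fun m => (X m : NS))) (Gen a (fun m => (X (Sum.inl m) : NR a b))) 4 a
          (Gen_deg _ _) (Gen_coeff_top _ _) (Gen_deg _ _) (Gen_coeff_top _ _) (by rw [hmapF]; exact Dvd.intro _ rfl) i.1
        rwa [Gen_coeff] at this
      · have := noeth_int (Gen 4 (fun m => (X m : NS))) (Gen b (fun m => (X (Sum.inr m) : NR a b))) 4 b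
          (Gen_deg _ _) (Gen_coeff_top _ _) (Gen_deg _ _) (Gen_coeff_top _ _) (by rw [hmapF]; exact Dvd.intro_left _ rfl) i.1
        rwa [Gen_coeff] at this
    induction x using MvPolynomial.induction_on with
    | C r =>
      have : (C r : NR a b) = algebraMap NS (NR a b) (C r) := by rw [halg, ntau]; simp
      rw [this]; exact isIntegral_algebraMap
    | add p q hp hq => exact hp.add hq
    | mul_X p i hp => exact hp.mul (hX i)
  set ev : NS →+* K := (aeval c : NS →ₐ[ℤ] K).toRingHom with hev
  haveI hkp : (RingHom.ker ev).IsPrime := RingHom.ker_isPrime ev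
  obtain ⟨Q, _, hQ, hQP⟩ := Ideal.exists_ideal_over_prime_of_isIntegral (RingHom.ker ev) (⊥ : Ideal (NR a b))
    (by rw [← RingHom.ker_eq_comap_bot]; exact hker)
  let P := RingHom.ker ev
  haveI : P.IsPrime := RingHom.ker_isPrime ev
  haveI : Q.LiesOver P := ⟨hQP.symm⟩
  letI algK : Algebra (NS ⧸ P) K := (RingHom.kerLift ev).toAlgebra
  haveI : IsDomain (NS ⧸ P) := inferInstance
  haveI : FaithfulSMul (NS ⧸ P) K := (faithfulSMul_iff_algebraMap_injective _ _).2 (RingHom.kerLift_injective ev)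
  haveI : FaithfulSMul (NS ⧸ P) (NR a b ⧸ Q) := inferInstance
  haveI : Algebra.IsIntegral (NS ⧸ P) (NR a b ⧸ Q) := inferInstance
  haveI : Algebra.IsAlgebraic (NS ⧸ P) (NR a b ⧸ Q) := inferInstance
  let l : (NR a b ⧸ Q) →ₐ[NS ⧸ P] K := IsAlgClosed.lift
  let g : NR a b →+* K := l.toRingHom.comp (Ideal.Quotient.mk Q)
  have hg : ∀ s : NS, g (ntau a b s) = ev s := by
    intro s
    have h1 : Ideal.Quotient.mk Q (algebraMap NS (NR a b) s) = algebraMap (NS ⧸ P) (NR a b ⧸ Q) (Ideal.Quotient.mk P s) := rfl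
    change l (Ideal.Quotient.mk Q (algebraMap NS (NR a b) s)) = _
    rw [h1, l.commutes]
    rfl
  have hfac : Gen 4 c = map g (nprod a b) := by
    rw [← hmapF, Gen_map, Gen_map]
    congr 1; ext1 m
    rw [halg, hg, hev]; simp
  rw [nprod, map_mul, Gen_map, Gen_map] at hfac
  intro hirr
  rcases hirr.isUnit_or_isUnit hfac with h | h
  · exact Gen_not_unit a ha _ h
  · exact Gen_not_unit b hb _ h

/-- homogenised version of an element of NS as a polynomial in all coefficients -/
noncomputable def hz (φ : NS) : MvPolynomial (Fin 2 →₀ ℕ) ℤ :=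
  ∑ m ∈ φ.support, C (coeff m φ) * X (Finsupp.single 0 4) ^ (φ.totalDegree - m.degree) *
    ∏ i ∈ m.support, X i.1 ^ (m i)

lemma hz_eval {k : Type*} [Field k] (φ : NS) (F : MvPolynomial (Fin 2) k)
    (h : coeff (Finsupp.single 0 4) F ≠ 0) :
    aeval (fun m => coeff m F) (hz φ) = (coeff (Finsupp.single 0 4) F) ^ φ.totalDegree *
      aeval (fun m : ix 4 => (coeff (Finsupp.single 0 4) F)⁻¹ * coeff m.1 F) φ := by
  rw [hz, map_sum, aeval_def (fun m : ix 4 => (coeff (Finsupp.single 0 4) F)⁻¹ * coeff m.1 F), eval₂_eq, Finset.mul_sum]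
  refine Finset.sum_congr rfl fun m hm => ?_
  simp only [map_mul, map_pow, aeval_X, map_prod, aeval_C]
  simp only [mul_pow, Finset.prod_mul_distrib]
  have hdeg : m.degree ≤ φ.totalDegree := le_totalDegree hm
  rw [Finset.prod_pow_eq_pow_sum]
  have : ∑ i ∈ m.support, m i = m.degree := rfl
  rw [this, inv_pow]
  have h2 : coeff (Finsupp.single 0 4) F ^ φ.totalDegree = coeff (Finsupp.single 0 4) F ^ (φ.totalDegree - m.degree) * coeff (Finsupp.single 0 4) F ^ m.degree := by
    rw [← pow_add]; congr 1; omega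
  rw [h2]
  field_simp

theorem noether_forms : ∃ Ψ : Finset (MvPolynomial (Fin 2 →₀ ℕ) ℤ),
    (∀ (K : Type) [Field K] [IsAlgClosed K] (F : MvPolynomial (Fin 2) K), F.totalDegree ≤ 4 →
      coeff (Finsupp.single 0 4) F ≠ 0 → Irreducible F → ∃ ψ ∈ Ψ, aeval (fun m => coeff m F) ψ ≠ 0) ∧
    (∀ (k : Type) [Field k] (F : MvPolynomial (Fin 2) k), F.totalDegree ≤ 4 →
      coeff (Finsupp.single 0 4) F ≠ 0 → ∀ ψ ∈ Ψ, aeval (fun m => coeff m F) ψ ≠ 0 → Irreducible F) := by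
  classical
  let I : Ideal NS := RingHom.ker (ntau 1 3) ⊓ (RingHom.ker (ntau 2 2) ⊓ RingHom.ker (ntau 3 1))
  obtain ⟨Φ, hΦ⟩ := (isNoetherianRing_iff_ideal_fg NS).1 inferInstance I
  have key : ∀ (k : Type) [Field k] (F : MvPolynomial (Fin 2) k), F.totalDegree ≤ 4 →
      coeff (Finsupp.single 0 4) F ≠ 0 →
      F = C (coeff (Finsupp.single 0 4) F) * Gen 4 (fun m => (coeff (Finsupp.single 0 4) F)⁻¹ * coeff m.1 F) := by
    intro k _ F hF h0
    have := eq_Gen 4 (C (coeff (Finsupp.single 0 4) F)⁻¹ * F) ((totalDegree_mul _ _).trans (by simpa using hF))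
      (by rw [coeff_C_mul, inv_mul_cancel₀ h0])
    simp only [coeff_C_mul] at this
    rw [← this, ← mul_assoc, ← C_mul, mul_inv_cancel₀ h0, C_1, one_mul]
  have keyirr : ∀ (k : Type) [Field k] (F : MvPolynomial (Fin 2) k), F.totalDegree ≤ 4 →
      coeff (Finsupp.single 0 4) F ≠ 0 →
      (Irreducible F ↔ Irreducible (Gen 4 (fun m => (coeff (Finsupp.single 0 4) F)⁻¹ * coeff m.1 F))) := by
    intro k _ F hF h0
    conv_lhs => rw [key k F hF h0]
    apply irreducible_isUnit_mul
    exact (isUnit_iff_ne_zero.2 h0).map C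
  refine ⟨Φ.image hz, ?_, ?_⟩
  · intro K _ _ F hF h0 hirr
    by_contra hcon
    push Not at hcon
    rw [keyirr K F hF h0] at hirr
    set c := (fun m : ix 4 => (coeff (Finsupp.single 0 4) F)⁻¹ * coeff m.1 F)
    have hle : I ≤ RingHom.ker (aeval c : NS →ₐ[ℤ] K).toRingHom := by
      rw [← hΦ]
      apply Ideal.span_le.2
      intro φ hφ
      have := hcon (hz φ) (Finset.mem_image_of_mem _ hφ)
      rw [hz_eval φ F h0] at this
      rcases mul_eq_zero.1 this with h | h
      · exact absurd h (pow_ne_zero _ h0)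
      · exact h
    haveI : (RingHom.ker (aeval c : NS →ₐ[ℤ] K).toRingHom).IsPrime := RingHom.ker_isPrime _
    rcases (Ideal.IsPrime.inf_le inferInstance).1 hle with h | h
    · exact noeth_dir1 c 1 3 (by norm_num) (by norm_num) (by norm_num) h hirr
    rcases (Ideal.IsPrime.inf_le inferInstance).1 h with h | h
    · exact noeth_dir1 c 2 2 (by norm_num) (by norm_num) (by norm_num) h hirr
    · exact noeth_dir1 c 3 1 (by norm_num) (by norm_num) (by norm_num) h hirr
  · intro k _ F hF h0 ψ hψ hne
    obtain ⟨φ, hφ, rfl⟩ := Finset.mem_image.1 hψ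
    rw [hz_eval φ F h0] at hne
    rw [keyirr k F hF h0]
    have hI : φ ∈ I := by rw [← hΦ]; exact Ideal.subset_span hφ
    refine noeth_dir2 _ φ ?_ (right_ne_zero_of_mul hne)
    intro a b hab ha hb
    have h3 : a = 1 ∨ a = 2 ∨ a = 3 := by omega
    rcases h3 with rfl | rfl | rfl
    · obtain rfl : b = 3 := by omega
      exact hI.1
    · obtain rfl : b = 2 := by omega
      exact hI.2.1
    · obtain rfl : b = 1 := by omega
      exact hI.2.2

end DG

end

section
namespace DG
open MvPolynomial

noncomputable def noe : Finset (MvPolynomial (Fin 2 →₀ ℕ) ℤ) := Classical.choose noether_forms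
lemma noe_spec1 (K : Type) [Field K] [IsAlgClosed K] (F : MvPolynomial (Fin 2) K) (h : F.totalDegree ≤ 4)
    (h0 : coeff (Finsupp.single 0 4) F ≠ 0) (hi : Irreducible F) :
    ∃ ψ ∈ noe, aeval (fun m => coeff m F) ψ ≠ 0 := (Classical.choose_spec noether_forms).1 K F h h0 hi
lemma noe_spec2 (k : Type) [Field k] (F : MvPolynomial (Fin 2) k) (h : F.totalDegree ≤ 4)
    (h0 : coeff (Finsupp.single 0 4) F ≠ 0) (ψ) (hψ : ψ ∈ noe) (hne : aeval (fun m => coeff m F) ψ ≠ 0) :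
    Irreducible F := (Classical.choose_spec noether_forms).2 k F h h0 ψ hψ hne

noncomputable def prj (m : Fin 3 →₀ ℕ) : Fin 2 →₀ ℕ := Finsupp.single 0 (m 0) + Finsupp.single 1 (m 1)
lemma prj_zero (m : Fin 3 →₀ ℕ) : prj m 0 = m 0 := by simp [prj]
lemma prj_one (m : Fin 3 →₀ ℕ) : prj m 1 = m 1 := by simp [prj]
lemma deg3 (m : Fin 3 →₀ ℕ) : m.degree = m 0 + m 1 + m 2 := by
  rw [Finsupp.degree_eq_sum, Fin.sum_univ_three]
lemma deg2 (m : Fin 2 →₀ ℕ) : m.degree = m 0 + m 1 := by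
  rw [Finsupp.degree_eq_sum, Fin.sum_univ_two]

/-- family of slices of `f`, `E_u(z,x) = u^4 f(z/u,x/u,1/u)` -/
noncomputable def sl (f : MvPolynomial (Fin 3) ℤ) : MvPolynomial (Fin 2) (Polynomial ℤ) :=
  ∑ m ∈ f.support, monomial (prj m) (Polynomial.monomial (4 - m.degree) (coeff m f))

noncomputable def slE {R : Type*} [CommRing R] (f : MvPolynomial (Fin 3) ℤ) (u : R) : MvPolynomial (Fin 2) R :=
  map (Polynomial.eval₂RingHom (Int.castRingHom R) u) (sl f)

lemma slE_eq {R : Type*} [CommRing R] (f : MvPolynomial (Fin 3) ℤ) (u : R) :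
    slE f u = ∑ m ∈ f.support, monomial (prj m) (((coeff m f : ℤ) : R) * u ^ (4 - m.degree)) := by
  simp [slE, sl, map_sum, map_monomial]

lemma slE_deg {R : Type*} [CommRing R] (f : MvPolynomial (Fin 3) ℤ) (hf : f.totalDegree ≤ 4) (u : R) :
    (slE f u).totalDegree ≤ 4 := by
  rw [slE_eq]
  refine totalDegree_finsetSum_le fun m hm => (totalDegree_monomial_le _ _).trans ?_
  have h1 : m.degree ≤ 4 := (le_totalDegree hm).trans hf
  have : (prj m).degree ≤ 4 := by
    rw [deg2, prj_zero, prj_one]; rw [deg3] at h1; omega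
  exact this

lemma slE_top {R : Type*} [CommRing R] (f : MvPolynomial (Fin 3) ℤ) (hf : f.totalDegree ≤ 4) (u : R) :
    coeff (Finsupp.single 0 4) (slE f u) = ((coeff (Finsupp.single 0 4) f : ℤ) : R) := by
  classical
  rw [slE_eq, coeff_sum]
  have key : ∀ m ∈ f.support, (coeff (Finsupp.single 0 4) (monomial (prj m) (((coeff m f : ℤ) : R) * u ^ (4 - m.degree)))) = if m = Finsupp.single 0 4 then ((coeff m f : ℤ) : R) else 0 := by
    intro m hm
    have h1 : m.degree ≤ 4 := (le_totalDegree hm).trans hf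
    rw [coeff_monomial]
    rw [deg3] at h1
    by_cases h : m = Finsupp.single 0 4
    · rw [if_pos h, if_pos, deg3, h]
      · simp
      · rw [h]; ext i; fin_cases i <;> simp [prj]
    · rw [if_neg h, if_neg]
      intro h2
      apply h
      have h3 := congrArg (fun g => g 0) h2
      simp only [prj_zero] at h3
      simp at h3
      ext i
      fin_cases i
      · simp [h3]
      · simp; omega
      · simp; omega
  rw [Finset.sum_congr rfl key, Finset.sum_ite_eq']
  split_ifs with h
  · rfl
  · rw [notMem_support_iff.1 h]; simp

lemma slE_eval {R : Type*} [CommRing R] (f : MvPolynomial (Fin 3) ℤ) (u : R) (P : Fin 2 → R) :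
    eval P (slE f u) = ∑ m ∈ f.support, ((coeff m f : ℤ) : R) * u ^ (4 - m.degree) * (P 0 ^ m 0 * P 1 ^ m 1) := by
  rw [slE_eq, map_sum]
  refine Finset.sum_congr rfl fun m hm => ?_
  rw [eval_monomial, Finsupp.prod_fintype _ _ (by simp), Fin.prod_univ_two, prj_zero, prj_one]

lemma slE_eval' {R : Type*} [CommRing R] (f : MvPolynomial (Fin 3) ℤ) (u : R) (P : Fin 2 → R) :
    eval P (pderiv 0 (slE f u)) = ∑ m ∈ f.support, ((coeff m f : ℤ) : R) * u ^ (4 - m.degree) * (m 0 : R) * (P 0 ^ (m 0 - 1) * P 1 ^ m 1) := by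
  rw [slE_eq, map_sum, map_sum]
  refine Finset.sum_congr rfl fun m hm => ?_
  rw [pderiv_monomial, eval_monomial, Finsupp.prod_fintype _ _ (by simp), Fin.prod_univ_two]
  simp [prj]

lemma f_eval {R : Type*} [CommRing R] (f : MvPolynomial (Fin 3) ℤ) (P : Fin 3 → R) :
    aeval P f = ∑ m ∈ f.support, ((coeff m f : ℤ) : R) * (P 0 ^ m 0 * P 1 ^ m 1 * P 2 ^ m 2) := by
  rw [aeval_def, eval₂_eq']
  simp [Fin.prod_univ_three]

lemma f_eval' {R : Type*} [CommRing R] (f : MvPolynomial (Fin 3) ℤ) (P : Fin 3 → R) :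
    aeval P (pderiv 0 f) = ∑ m ∈ f.support, ((coeff m f : ℤ) : R) * (m 0 : R) * (P 0 ^ (m 0 - 1) * P 1 ^ m 1 * P 2 ^ m 2) := by
  conv_lhs => rw [f.as_sum]
  rw [map_sum, map_sum]
  refine Finset.sum_congr rfl fun m hm => ?_
  rw [pderiv_monomial, aeval_monomial, Finsupp.prod_fintype _ _ (by simp), Fin.prod_univ_three]
  simp [Finsupp.single_apply]

lemma slE_scale {k : Type*} [Field k] (f : MvPolynomial (Fin 3) ℤ) (hf : f.totalDegree ≤ 4) (P : Fin 3 → k) (hy : P 2 ≠ 0) :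
    aeval P f = P 2 ^ 4 * eval ![(P 2)⁻¹ * P 0, (P 2)⁻¹ * P 1] (slE f (P 2)⁻¹) := by
  rw [f_eval, slE_eval, Finset.mul_sum]
  refine Finset.sum_congr rfl fun m hm => ?_
  have h1 : m.degree ≤ 4 := (le_totalDegree hm).trans hf
  have h4 : P 2 ^ 4 = P 2 ^ (4 - m.degree) * (P 2 ^ (m 0) * P 2 ^ (m 1) * P 2 ^ (m 2)) := by
    rw [← pow_add, ← pow_add, ← pow_add, ← deg3]; congr 1; omega
  rw [h4]
  simp only [Matrix.cons_val_zero, Matrix.cons_val_one, mul_pow, inv_pow]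
  field_simp

lemma slE_scale' {k : Type*} [Field k] (f : MvPolynomial (Fin 3) ℤ) (hf : f.totalDegree ≤ 4) (P : Fin 3 → k) (hy : P 2 ≠ 0) :
    aeval P (pderiv 0 f) = P 2 ^ 3 * eval ![(P 2)⁻¹ * P 0, (P 2)⁻¹ * P 1] (pderiv 0 (slE f (P 2)⁻¹)) := by
  rw [f_eval', slE_eval', Finset.mul_sum]
  refine Finset.sum_congr rfl fun m hm => ?_
  rcases Nat.eq_zero_or_pos (m 0) with h0 | h0
  · simp [h0]
  have h1 : m.degree ≤ 4 := (le_totalDegree hm).trans hf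
  have h4 : P 2 ^ 3 = P 2 ^ (4 - m.degree) * (P 2 ^ (m 0 - 1) * P 2 ^ (m 1) * P 2 ^ (m 2)) := by
    rw [← pow_add, ← pow_add, ← pow_add]; congr 1; rw [deg3] at *; omega
  rw [h4]
  simp only [Matrix.cons_val_zero, Matrix.cons_val_one, mul_pow, inv_pow]
  field_simp

lemma roots_le {k : Type*} [Field k] {n : ℕ} (f : MvPolynomial (Fin (n+1)) ℤ) (d : ℕ) (hf : f.totalDegree ≤ d)
    (ha : ((coeff (Finsupp.single 0 d) f : ℤ) : k) ≠ 0) (x : Fin n → k) (S : Finset k)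
    (hS : ∀ z ∈ S, aeval (Fin.cons z x : Fin (n+1) → k) f = 0) : S.card ≤ d := by
  classical
  set q := Polynomial.map (aeval x : MvPolynomial (Fin n) ℤ →ₐ[ℤ] k).toRingHom (finSuccEquiv ℤ n f)
  have hq : q.coeff d ≠ 0 := by
    rw [Polynomial.coeff_map, fse_coeff_top f d hf]
    simpa using ha
  have hq0 : q ≠ 0 := by intro h; rw [h] at hq; simp at hq
  have h1 : S ⊆ q.roots.toFinset := by
    intro z hz
    rw [Multiset.mem_toFinset, Polynomial.mem_roots hq0, Polynomial.IsRoot, ← aeval_cons_fse]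
    exact hS z hz
  calc S.card ≤ q.roots.toFinset.card := Finset.card_le_card h1
    _ ≤ Multiset.card q.roots := Multiset.toFinset_card_le _
    _ ≤ q.natDegree := q.card_roots'
    _ ≤ (finSuccEquiv ℤ n f).natDegree := Polynomial.natDegree_map_le
    _ ≤ d := fse_natDegree_le f d hf

lemma natDegree_aeval_le {σ : Type*} (ψ : MvPolynomial σ ℤ) (g : σ → Polynomial ℤ) (d : ℕ) (hg : ∀ i, (g i).natDegree ≤ d) :
    (aeval g ψ).natDegree ≤ d * ψ.totalDegree := by
  rw [aeval_def, eval₂_eq]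
  refine Polynomial.natDegree_sum_le_of_forall_le _ _ fun m hm => ?_
  refine (Polynomial.natDegree_C_mul_le _ _).trans ?_
  refine (Polynomial.natDegree_prod_le _ _).trans ?_
  calc _ ≤ ∑ i ∈ m.support, d * m i := Finset.sum_le_sum fun i _ =>
        Polynomial.natDegree_pow_le.trans (by rw [mul_comm]; exact Nat.mul_le_mul_right _ (hg i))
    _ = d * m.degree := by rw [← Finset.mul_sum]; rfl
    _ ≤ _ := Nat.mul_le_mul_left _ (le_totalDegree hm)

noncomputable def noeDeg : ℕ := noe.sup totalDegree

theorem Np_bound (p : ℕ) [Fact p.Prime] (f : MvPolynomial (Fin 3) ℤ) (hf : f.totalDegree ≤ 4)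
    (ha : ((coeff (Finsupp.single 0 4) f : ℤ) : ZMod p) ≠ 0) (ψ) (hψ : ψ ∈ noe)
    (hne : ((aeval (fun m => coeff m (slE f (0:ℤ))) ψ : ℤ) : ZMod p) ≠ 0)
    (S : Finset (Fin 3 → ZMod p)) (hS : ∀ P ∈ S, aeval P f = 0 ∧ aeval P (pderiv 0 f) ≠ 0) :
    (S.card : ℝ) ≤ p^2 + (1000004 + 16 * noeDeg) * (p * Real.sqrt p) := by
  classical
  have hp : p.Prime := Fact.out
  let θ : Polynomial ℤ := aeval (fun m => coeff m (sl f)) ψ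
  have hθ : ∀ (R : Type) [CommRing R] (u : R), Polynomial.eval₂ (Int.castRingHom R) u θ
      = aeval (fun m => coeff m (slE f u)) ψ := by
    intro R _ u
    change Polynomial.eval₂RingHom (Int.castRingHom R) u θ = _
    rw [show θ = aeval (fun m => coeff m (sl f)) ψ from rfl]
    simp only [slE, coeff_map]
    rw [aeval_def, aeval_def, hom_eval₂]
    congr 1
    exact RingHom.ext_int _ _
  let θp : Polynomial (ZMod p) := θ.map (Int.castRingHom _)
  have hθ0 : θp ≠ 0 := by
    intro h
    apply hne
    have h1 := hθ ℤ 0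
    have h2 : Polynomial.eval 0 θp = ((Polynomial.eval₂ (Int.castRingHom ℤ) 0 θ : ℤ) : ZMod p) := by
      rw [← Polynomial.coeff_zero_eq_eval_zero, Polynomial.coeff_map, Polynomial.eval₂_at_zero]; simp
    rw [← h1, ← h2, h]; simp
  have hθd : θp.natDegree ≤ 4 * noeDeg := by
    refine Polynomial.natDegree_map_le.trans ?_
    refine (natDegree_aeval_le ψ _ 4 ?_).trans (Nat.mul_le_mul_left _ (Finset.le_sup (f := totalDegree) hψ))
    intro m
    rw [sl, coeff_sum]
    refine Polynomial.natDegree_sum_le_of_forall_le _ _ fun i _ => ?_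
    rw [coeff_monomial]
    split_ifs
    · exact (Polynomial.natDegree_monomial_le _).trans (by omega)
    · simp
  have hsq : (1:ℝ) ≤ Real.sqrt p := by
    rw [Real.one_le_sqrt]; exact_mod_cast hp.one_le
  let bad : Finset (ZMod p) := insert 0 ((θp.roots.toFinset).image (fun u => u⁻¹))
  have hbad : bad.card ≤ 4 * noeDeg + 1 := by
    refine (Finset.card_insert_le _ _).trans ?_
    have := (Finset.card_image_le (s := θp.roots.toFinset) (f := fun u => u⁻¹)).trans
      ((Multiset.toFinset_card_le _).trans (θp.card_roots'.trans hθd))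
    omega
  let Sy : ZMod p → Finset (Fin 3 → ZMod p) := fun y => S.filter (fun P => P 2 = y)
  have hsum : S.card = ∑ y, (Sy y).card := Finset.card_eq_sum_card_fiberwise (fun _ _ => Finset.mem_coe.2 (Finset.mem_univ _))
  have hbadslice : ∀ y, (Sy y).card ≤ 4 * p := by
    intro y
    have h1 : (Sy y).card = ∑ x : ZMod p, ((Sy y).filter (fun P => P 1 = x)).card :=
      Finset.card_eq_sum_card_fiberwise (fun _ _ => Finset.mem_coe.2 (Finset.mem_univ _))
    have h2 : ∀ x : ZMod p, ((Sy y).filter (fun P => P 1 = x)).card ≤ 4 := by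
      intro x
      have hcons : ∀ P ∈ (Sy y).filter (fun P => P 1 = x), P = Fin.cons (P 0) ![x, y] := by
        intro P hP
        simp only [Finset.mem_filter, Sy] at hP
        ext i
        fin_cases i
        · rfl
        · exact hP.2
        · exact hP.1.2
      rw [← Finset.card_image_of_injOn (f := fun P : Fin 3 → ZMod p => P 0)]
      · apply roots_le f 4 hf ha ![x, y]
        intro z hz
        obtain ⟨P, hP, rfl⟩ := Finset.mem_image.1 hz
        rw [← hcons P hP]
        simp only [Finset.mem_filter, Sy] at hP
        exact (hS P hP.1.1).1
      · intro P hP Q hQ h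
        rw [hcons P hP, hcons Q hQ]
        simp only at h
        rw [h]
    calc (Sy y).card ≤ ∑ x : ZMod p, 4 := h1.trans_le (Finset.sum_le_sum fun x _ => h2 x)
      _ = 4 * p := by simp [ZMod.card, mul_comm]
  have hgood : ∀ y, y ∉ bad → ((Sy y).card : ℝ) ≤ p + 1000000 * Real.sqrt p := by
    intro y hy
    have hy0 : y ≠ 0 := by rintro rfl; exact hy (Finset.mem_insert_self _ _)
    have hroot : Polynomial.eval y⁻¹ θp ≠ 0 := by
      intro h
      apply hy
      refine Finset.mem_insert_of_mem (Finset.mem_image.2 ⟨y⁻¹, ?_, inv_inv y⟩)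
      rw [Multiset.mem_toFinset, Polynomial.mem_roots hθ0]; exact h
    have hψ2 : aeval (fun m => coeff m (slE f y⁻¹)) ψ ≠ 0 := by
      rw [← hθ (ZMod p) y⁻¹]
      rwa [Polynomial.eval_map] at hroot
    have htop : coeff (Finsupp.single 0 4) (slE f y⁻¹) ≠ 0 := by rw [slE_top f hf]; exact ha
    have hirr := noe_spec2 (ZMod p) (slE f y⁻¹) (slE_deg f hf _) htop ψ hψ hψ2
    have hd4 : (slE f y⁻¹).totalDegree = 4 := by
      apply le_antisymm (slE_deg f hf _)
      have := le_totalDegree (mem_support_iff.2 htop)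
      simpa [Finsupp.sum_single_index] using this
    rw [← Finset.card_image_of_injOn (f := fun P : Fin 3 → ZMod p => ![y⁻¹ * P 0, y⁻¹ * P 1])]
    · apply weil_bound (slE f y⁻¹) hirr hd4 htop
      intro Q hQ
      obtain ⟨P, hP, rfl⟩ := Finset.mem_image.1 hQ
      simp only [Finset.mem_filter, Sy] at hP
      obtain ⟨hPS, rfl⟩ := hP
      have h1 := (hS P hPS).1
      have h2 := (hS P hPS).2
      rw [slE_scale f hf P hy0] at h1
      rw [slE_scale' f hf P hy0] at h2
      exact ⟨(mul_eq_zero.1 h1).resolve_left (pow_ne_zero _ hy0), right_ne_zero_of_mul h2⟩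
    · intro P hP Q hQ h
      simp only [Finset.coe_filter, Sy, Set.mem_ofPred_eq] at hP hQ
      have e0 := congrFun h 0
      have e1 := congrFun h 1
      simp [hy0] at e0 e1
      ext i; fin_cases i
      · exact e0
      · exact e1
      · exact hP.2.trans hQ.2.symm
  have hfin : (S.card : ℝ) ≤ ∑ y : ZMod p, ((p + 1000000 * Real.sqrt p) + if y ∈ bad then (4 * p : ℝ) else 0) := by
    rw [hsum]; push_cast
    refine Finset.sum_le_sum fun y _ => ?_
    split_ifs with h
    · have : ((Sy y).card : ℝ) ≤ 4 * p := by exact_mod_cast hbadslice y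
      have : (0:ℝ) ≤ p := Nat.cast_nonneg _
      linarith
    · simpa using hgood y h
  rw [Finset.sum_add_distrib, Finset.sum_ite_mem, Finset.sum_const, Finset.sum_const, Finset.univ_inter,
    Finset.card_univ, ZMod.card, nsmul_eq_mul, nsmul_eq_mul] at hfin
  have hb' : (bad.card : ℝ) ≤ 4 * noeDeg + 1 := by exact_mod_cast hbad
  have hp0 : (0:ℝ) ≤ p := Nat.cast_nonneg _
  have hm : (bad.card : ℝ) * (4 * p) ≤ (4 * noeDeg + 1) * (4 * (p * Real.sqrt p)) := by
    apply mul_le_mul hb' _ (by positivity) (by positivity)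
    nlinarith
  nlinarith
end DG

end

section
namespace DG
open Matrix

attribute [local instance] Matrix.seminormedAddCommGroup in
lemma siegel_nat {α β : Type} [Fintype α] [Fintype β] (M : Matrix α β ℤ) (A : ℕ) (hA : 1 ≤ A)
    (hM : ∀ i j, |M i j| ≤ A) (hn : Fintype.card α < Fintype.card β) :
    ∃ t : β → ℤ, t ≠ 0 ∧ M *ᵥ t = 0 ∧ ∀ j, |t j| ≤ ((Fintype.card β * A) ^ (Fintype.card β) : ℕ) := by
  classical
  rcases Nat.eq_zero_or_pos (Fintype.card α) with h0 | h0
  · have : IsEmpty α := Fintype.card_eq_zero_iff.1 h0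
    obtain ⟨j0⟩ : Nonempty β := Fintype.card_pos_iff.1 (by omega)
    refine ⟨fun _ => 1, ?_, ?_, ?_⟩
    · intro h; have := congrFun h j0; simp at this
    · ext i; exact this.elim i
    · intro j
      have : 1 ≤ (Fintype.card β * A) ^ (Fintype.card β) := Nat.one_le_pow _ _ (Nat.mul_pos (by omega) hA)
      simpa using (by exact_mod_cast this : (1:ℤ) ≤ _)
  · obtain ⟨t, ht, hMt, hnorm⟩ := Int.Matrix.exists_ne_zero_int_vec_norm_le M hn h0
    refine ⟨t, ht, hMt, fun j => ?_⟩
    have hN : ‖M‖ ≤ A := by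
      rw [Matrix.norm_le_iff (Nat.cast_nonneg _)]
      intro i j
      rw [Int.norm_eq_abs]
      exact_mod_cast hM i j
    have hb1 : (1:ℝ) ≤ Fintype.card β := by exact_mod_cast (by omega : 1 ≤ Fintype.card β)
    have hA' : (1:ℝ) ≤ A := by exact_mod_cast hA
    have h1 : ‖t‖ ≤ ((Fintype.card β : ℝ) * A) ^ ((Fintype.card β : ℕ) : ℝ) := by
      refine hnorm.trans ?_
      have e1 : (Fintype.card β : ℝ) * max 1 ‖M‖ ≤ Fintype.card β * A := by
        gcongr; exact max_le hA' hN
      have hd : (1:ℝ) ≤ (Fintype.card β : ℝ) - Fintype.card α := by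
        have : ((Fintype.card α : ℝ)) + 1 ≤ Fintype.card β := by exact_mod_cast hn
        linarith
      have e2 : (Fintype.card α : ℝ) / ((Fintype.card β : ℝ) - Fintype.card α) ≤ Fintype.card β := by
        rw [div_le_iff₀ (by linarith)]
        nlinarith [(by positivity : (0:ℝ) ≤ (Fintype.card α : ℝ))]
      calc _ ≤ ((Fintype.card β : ℝ) * A) ^ ((Fintype.card α : ℝ) / ((Fintype.card β : ℝ) - Fintype.card α)) := by
            apply Real.rpow_le_rpow (by positivity) e1 (by positivity)
        _ ≤ _ := by
            apply Real.rpow_le_rpow_of_exponent_le _ e2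
            nlinarith
    have h2 : ‖t j‖ ≤ ‖t‖ := norm_le_pi_norm t j
    rw [Int.norm_eq_abs] at h2
    rw [Real.rpow_natCast] at h1
    have := h2.trans h1
    exact_mod_cast this

/-- either a nonvanishing determinant, or a small integral relation -/
lemma rank_siegel {V J : Type} [Fintype J] [DecidableEq J] (S : Set V) (g : J → V → ℤ) (A : ℕ) (hA : 1 ≤ A)
    (hg : ∀ v ∈ S, ∀ j, |g j v| ≤ A) :
    (∃ e : J → V, (∀ j, e j ∈ S) ∧ (Matrix.of fun i j => g j (e i)).det ≠ 0) ∨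
    (∃ c : J → ℤ, c ≠ 0 ∧ (∀ v ∈ S, ∑ j, c j * g j v = 0) ∧
      ∀ j, |c j| ≤ ((Fintype.card J * A) ^ (Fintype.card J) : ℕ)) := by
  classical
  let v : S → (J → ℚ) := fun x j => (g j x.1 : ℚ)
  obtain ⟨κ, a, ha, hspan, hli⟩ := exists_linearIndependent' ℚ v
  have hfin : Finite κ := hli.finite
  haveI : Fintype κ := Fintype.ofFinite κ
  have hcard : Fintype.card κ ≤ Fintype.card J := by
    have := hli.fintype_card_le_finrank
    simpa using this
  rcases hcard.lt_or_eq with hlt | heq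
  · right
    obtain ⟨c, hc0, hMc, hcb⟩ := siegel_nat (Matrix.of fun (i : κ) j => g j (a i).1) A hA
      (fun i j => hg _ (a i).2 j) hlt
    refine ⟨c, hc0, ?_, hcb⟩
    intro x hx
    let L : (J → ℚ) →ₗ[ℚ] ℚ := ∑ j, (c j : ℚ) • LinearMap.proj j
    have hL : ∀ w, L w = ∑ j, (c j : ℚ) * w j := by
      intro w; simp [L, LinearMap.sum_apply]
    have h1 : Submodule.span ℚ (Set.range (v ∘ a)) ≤ LinearMap.ker L := by
      rw [Submodule.span_le]
      rintro _ ⟨i, rfl⟩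
      change L _ = 0
      rw [hL]
      have := congrFun hMc i
      simp only [Matrix.mulVec, dotProduct, Matrix.of_apply, Pi.zero_apply] at this
      have h2 : ((∑ j, g j (a i).1 * c j : ℤ) : ℚ) = 0 := by rw [this]; simp
      push_cast at h2
      rw [← h2]
      exact Finset.sum_congr rfl fun j _ => mul_comm _ _
    have h3 : v ⟨x, hx⟩ ∈ Submodule.span ℚ (Set.range (v ∘ a)) := by
      rw [hspan]; exact Submodule.subset_span ⟨_, rfl⟩
    have h4 : L (v ⟨x, hx⟩) = 0 := h1 h3
    rw [hL] at h4
    have : ((∑ j, c j * g j x : ℤ) : ℚ) = 0 := by push_cast; exact h4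
    exact_mod_cast this
  · left
    have e : J ≃ κ := (Fintype.equivOfCardEq heq).symm
    refine ⟨fun j => (a (e j)).1, fun j => (a (e j)).2, ?_⟩
    intro hdet
    have hli2 : LinearIndependent ℚ (fun i : J => v (a (e i))) := hli.comp e e.injective
    have h5 : IsUnit (Matrix.of fun i j => v (a (e i)) j) := by
      rw [← Matrix.linearIndependent_rows_iff_isUnit]; exact hli2
    rw [Matrix.isUnit_iff_isUnit_det, isUnit_iff_ne_zero] at h5
    apply h5
    have : (Matrix.of fun i j => v (a (e i)) j) = (Int.castRingHom ℚ).mapMatrix (Matrix.of fun i j => g j (a (e i)).1) := by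
      ext i j; simp [v]
    rw [this, ← RingHom.map_det, hdet, map_zero]

lemma det_zero_of_rel {V J R : Type} [Fintype J] [DecidableEq J] [CommRing R] [IsDomain R] (S : Set V) (g : J → V → R)
    (c : J → R) (hc : c ≠ 0) (h : ∀ v ∈ S, ∑ j, c j * g j v = 0) (e : J → V) (he : ∀ j, e j ∈ S) :
    (Matrix.of fun i j => g j (e i)).det = 0 := by
  rw [← Matrix.exists_mulVec_eq_zero_iff]
  refine ⟨c, hc, ?_⟩
  ext i
  simp only [Matrix.mulVec, dotProduct, Matrix.of_apply, Pi.zero_apply]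
  rw [← h _ (he i)]
  exact Finset.sum_congr rfl fun j _ => mul_comm _ _
end DG

end

section
namespace DG
open MvPolynomial

lemma det_div {J A Cl : Type*} [Fintype J] [DecidableEq J] [Fintype A] [DecidableEq A] (q : ℤ) (T : ℕ) (w : A → ℕ)
    (M : Matrix J J ℤ) (good : Finset J) (cl : J → Cl) (Cset : Finset Cl) (hcl : ∀ i ∈ good, cl i ∈ Cset)
    (β : J → A → ℤ) (Cv : Cl → A → J → ℤ) (R : J → J → ℤ)
    (hM : ∀ i ∈ good, ∀ j, M i j = ∑ a, q ^ (w a) * β i a * Cv (cl i) a j + q ^ T * R i j) :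
    q ^ (T * good.card - Cset.card * ∑ a, (T - w a)) ∣ M.det := by
  classical
  let wt : J → Option A → ℕ := fun i o => if i ∈ good then o.elim T w else 0
  let vec : J → Option A → J → ℤ := fun i o => if i ∈ good then (o.elim (R i) (fun a => Cv (cl i) a)) else
    (if o = none then M i else 0)
  let bb : J → Option A → ℤ := fun i o => o.elim 1 (fun a => β i a)
  have hrow : ∀ i, M i = ∑ o, (q ^ (wt i o) * bb i o) • vec i o := by
    intro i
    rw [Fintype.sum_option]
    by_cases hi : i ∈ good
    · ext j
      simp only [wt, vec, bb, if_pos hi, Option.elim_none, Option.elim_some]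
      rw [hM i hi j, Pi.add_apply, Finset.sum_apply]
      simp only [Pi.smul_apply, smul_eq_mul]
      rw [add_comm]
      rw [mul_one]
    · simp [wt, vec, bb, hi]
  have hdet : M.det = ∑ r : J → Option A, (∏ i, (q ^ wt i (r i) * bb i (r i))) • Matrix.det (fun i => vec i (r i)) := by
    have h1 : M.det = Matrix.detRowAlternating.toMultilinearMap (fun i => ∑ o, (q ^ (wt i o) * bb i o) • vec i o) := by
      change M.det = Matrix.det (fun i => ∑ o, (q ^ (wt i o) * bb i o) • vec i o)
      congr 1
      ext i j
      exact congrFun (hrow i) j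
    rw [h1, MultilinearMap.map_sum]
    refine Finset.sum_congr rfl fun r _ => ?_
    rw [MultilinearMap.map_smul_univ]
    rfl
  rw [hdet]
  refine Finset.dvd_sum fun r _ => ?_
  by_cases hinj : ∀ i ∈ good, ∀ i' ∈ good, i ≠ i' → cl i = cl i' → r i = r i' → r i = none
  · apply Dvd.dvd.mul_right
    rw [Finset.prod_mul_distrib, Finset.prod_pow_eq_pow_sum]
    apply Dvd.dvd.mul_right
    apply pow_dvd_pow
    have h1 : ∑ i, wt i (r i) = ∑ i ∈ good, (r i).elim T w := by
      rw [← Finset.sum_filter_add_sum_filter_not Finset.univ (· ∈ good)]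
      have : ∑ i ∈ Finset.univ.filter (fun i => i ∉ good), wt i (r i) = 0 := by
        apply Finset.sum_eq_zero; intro i hi; simp only [Finset.mem_filter] at hi; simp [wt, hi.2]
      rw [this, add_zero, Finset.filter_mem_eq_inter, Finset.univ_inter]
      exact Finset.sum_congr rfl fun i hi => by simp [wt, hi]
    rw [h1]
    have h2 : T * good.card ≤ ∑ i ∈ good, (r i).elim T w + ∑ i ∈ good, (r i).elim 0 (fun a => T - w a) := by
      rw [← Finset.sum_add_distrib, mul_comm, ← smul_eq_mul, ← Finset.sum_const]
      refine Finset.sum_le_sum fun i _ => ?_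
      cases r i <;> simp <;> omega
    have h3 : ∑ i ∈ good, (r i).elim 0 (fun a => T - w a) ≤ Cset.card * ∑ a, (T - w a) := by
      have e1 : ∑ i ∈ good, (r i).elim 0 (fun a => T - w a) = ∑ i ∈ good.filter (fun i => r i ≠ none), (r i).elim 0 (fun a => T - w a) := by
        rw [Finset.sum_filter]
        refine Finset.sum_congr rfl fun i _ => ?_
        split_ifs with h
        · rfl
        · push Not at h; rw [h]; rfl
      let F : Cl × Option A → ℕ := fun x => x.2.elim 0 (fun a => T - w a)
      have hinj2 : Set.InjOn (fun i => (cl i, r i)) (good.filter (fun i => r i ≠ none)) := by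
        intro i hi i' hi' h
        simp only [Finset.coe_filter, Set.mem_ofPred_eq] at hi hi'
        by_contra hne
        simp only [Prod.mk.injEq] at h
        exact hi.2 (hinj i hi.1 i' hi'.1 hne h.1 h.2)
      calc _ = ∑ x ∈ (good.filter (fun i => r i ≠ none)).image (fun i => (cl i, r i)), F x := by
            rw [Finset.sum_image hinj2, e1]
        _ ≤ ∑ x ∈ Cset ×ˢ Finset.univ, F x := by
            apply Finset.sum_le_sum_of_subset
            intro x hx
            obtain ⟨i, hi, rfl⟩ := Finset.mem_image.1 hx
            simp only [Finset.mem_product, Finset.mem_univ, and_true]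
            exact hcl i (Finset.mem_filter.1 hi).1
        _ = _ := by
            rw [Finset.sum_product]
            simp only [F]
            rw [Finset.sum_const, Fintype.sum_option, smul_eq_mul]
            simp
    omega
  · push Not at hinj
    obtain ⟨i, hi, i', hi', hne, hc, hr, hn⟩ := hinj
    obtain ⟨a, ha⟩ := Option.ne_none_iff_exists'.1 hn
    have : Matrix.det (fun i => vec i (r i)) = 0 := by
      apply Matrix.det_zero_of_row_eq hne
      change vec i (r i) = vec i' (r i')
      rw [← hr, ha]
      simp only [vec, if_pos hi, if_pos hi', Option.elim_some, hc]
    rw [this]; simp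
lemma aeval_sub_dvd {σ : Type*} (n : ℤ) (v w : σ → ℤ) (h : ∀ i, n ∣ v i - w i) (g : MvPolynomial σ ℤ) :
    n ∣ aeval v g - aeval w g := by
  induction g using MvPolynomial.induction_on with
  | C r => simp
  | add p q hp hq =>
    rw [map_add, map_add, add_sub_add_comm]; exact dvd_add hp hq
  | mul_X p i hp =>
    rw [map_mul, map_mul, aeval_X, aeval_X]
    obtain ⟨a, ha⟩ := hp
    obtain ⟨b, hb⟩ := h i
    exact ⟨a * v i + aeval w p * b, by linear_combination v i * ha + aeval w p * hb⟩

/-- Hensel: local polynomial parametrisation -/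
lemma hensel_param {r : ℕ} (f : MvPolynomial (Fin (r+1)) ℤ) (p : ℕ) (hp : p.Prime) (k N : ℕ) (hk : 1 ≤ k)
    (z0 : ℤ) (x0 : Fin r → ℤ) (h0 : ¬ (p : ℤ) ∣ aeval (Fin.cons z0 x0 : Fin (r+1) → ℤ) (pderiv 0 f)) :
    ∃ φ : MvPolynomial (Fin r) ℤ, ∀ (z : ℤ) (u : Fin r → ℤ), (p : ℤ) ∣ z - z0 →
      aeval (Fin.cons z (fun i => x0 i + p ^ k * u i) : Fin (r+1) → ℤ) f = 0 →
      (p : ℤ) ^ (N+1) ∣ aeval (fun i => (p:ℤ) ^ k * u i) φ - z := by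
  obtain ⟨c, hc⟩ : ∃ c : ℤ, (p : ℤ) ∣ 1 - c * aeval (Fin.cons z0 x0 : Fin (r+1) → ℤ) (pderiv 0 f) := by
    have hcop : IsCoprime (p : ℤ) (aeval (Fin.cons z0 x0 : Fin (r+1) → ℤ) (pderiv 0 f)) :=
      (Nat.prime_iff_prime_int.1 hp).coprime_iff_not_dvd.2 h0
    obtain ⟨a, b, hab⟩ := hcop
    exact ⟨b, a, by linear_combination -hab⟩
  induction N with
  | zero =>
    refine ⟨C z0, fun z u hz _ => ?_⟩
    rw [zero_add, pow_one]
    simp only [aeval_C]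
    rw [← dvd_neg]; simpa using hz
  | succ N ih =>
    obtain ⟨φ, hφ⟩ := ih
    refine ⟨φ - C c * aeval (Fin.cons φ (fun i => C (x0 i) + X i) : Fin (r+1) → MvPolynomial (Fin r) ℤ) f, ?_⟩
    intro z u hz hf
    have h1 := hφ z u hz hf
    set e := aeval (fun i => (p:ℤ) ^ k * u i) φ - z with he
    set x : Fin r → ℤ := fun i => x0 i + p ^ k * u i with hx
    have hcomp : aeval (fun i => (p:ℤ) ^ k * u i) (aeval (Fin.cons φ (fun i => C (x0 i) + X i) : Fin (r+1) → MvPolynomial (Fin r) ℤ) f)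
        = aeval (Fin.cons (z + e) x : Fin (r+1) → ℤ) f := by
      rw [← AlgHom.comp_apply, comp_aeval]
      congr 2
      ext i
      refine Fin.cases ?_ (fun i => ?_) i
      · simp [he]
      · simp [hx]
    obtain ⟨g, hg⟩ := taylor_two f z e x
    rw [hf, zero_add] at hg
    have hder : (p : ℤ) ∣ aeval (Fin.cons z x : Fin (r+1) → ℤ) (pderiv 0 f) - aeval (Fin.cons z0 x0 : Fin (r+1) → ℤ) (pderiv 0 f) := by
      apply aeval_sub_dvd
      intro i
      refine Fin.cases ?_ (fun i => ?_) i
      · simpa using hz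
      · simp only [hx, Fin.cons_succ, add_sub_cancel_left]
        exact Dvd.dvd.mul_right (dvd_pow_self _ (by omega)) _
    rw [map_sub, map_mul, hcomp, hg, aeval_C]
    simp only [eq_intCast, Int.cast_id]
    obtain ⟨d1, hd1⟩ := h1
    obtain ⟨d2, hd2⟩ := hc
    obtain ⟨d3, hd3⟩ := hder
    have hee : aeval (fun i => (p:ℤ) ^ k * u i) φ = e + z := by rw [he]; ring
    refine ⟨d1 * (d2 - c * d3 - c * g * (p:ℤ)^N * d1), ?_⟩
    rw [hee]
    set D := aeval (Fin.cons z x : Fin (r+1) → ℤ) (pderiv 0 f)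
    set D0 := aeval (Fin.cons z0 x0 : Fin (r+1) → ℤ) (pderiv 0 f)
    have : e + z - c * (D * e + g * e ^ 2) - z = e * (1 - c * D - c * g * e) := by ring
    rw [this]
    have h5 : 1 - c * D - c * g * e = p * (d2 - c * d3 - c * g * (p:ℤ)^N * d1) := by
      rw [hd1]
      linear_combination hd2 - c * hd3
    rw [h5, hd1]
    ring

/-- indices of the Taylor expansion -/
noncomputable def tix (r T : ℕ) : Finset (Fin r →₀ ℕ) := (Finsupp.finite_of_degree_lt (σ := Fin r) T).toFinset
lemma mem_tix {r T : ℕ} {a : Fin r →₀ ℕ} : a ∈ tix r T ↔ a.degree < T := by simp [tix]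
noncomputable def BB (r T : ℕ) : ℕ := ∑ a ∈ tix r T, (T - a.degree)

lemma taylor_split {r : ℕ} (G : MvPolynomial (Fin r) ℤ) (q : ℤ) (u : Fin r → ℤ) (T : ℕ) :
    ∃ R : ℤ, aeval (fun i => q * u i) G = ∑ a : tix r T, q ^ (a.1.degree) * (∏ i, u i ^ a.1 i) * coeff a.1 G + q ^ T * R := by
  classical
  have h0 : aeval (fun i => q * u i) G = ∑ a ∈ G.support, q ^ a.degree * (∏ i, u i ^ a i) * coeff a G := by
    rw [aeval_def, eval₂_eq']
    refine Finset.sum_congr rfl fun a _ => ?_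
    simp only [mul_pow, Finset.prod_mul_distrib, Finset.prod_pow_eq_pow_sum]
    rw [← Finsupp.degree_eq_sum]
    simp; ring
  have h1 : ∑ a ∈ G.support, q ^ a.degree * (∏ i, u i ^ a i) * coeff a G
      = ∑ a ∈ G.support ∪ tix r T, q ^ a.degree * (∏ i, u i ^ a i) * coeff a G := by
    apply Finset.sum_subset Finset.subset_union_left
    intro a _ ha
    rw [notMem_support_iff.1 ha, mul_zero]
  rw [h0, h1, ← Finset.sum_sdiff (Finset.subset_union_right : tix r T ⊆ G.support ∪ tix r T)]
  have h2 : q ^ T ∣ ∑ a ∈ (G.support ∪ tix r T) \ tix r T, q ^ a.degree * (∏ i, u i ^ a i) * coeff a G := by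
    refine Finset.dvd_sum fun a ha => ?_
    have : T ≤ a.degree := by
      have := (Finset.mem_sdiff.1 ha).2
      rw [mem_tix] at this; omega
    exact Dvd.dvd.mul_right (Dvd.dvd.mul_right (pow_dvd_pow _ this) _) _
  obtain ⟨R, hR⟩ := h2
  refine ⟨R, ?_⟩
  rw [hR, add_comm, Finset.sum_coe_sort (tix r T) (fun a => q ^ a.degree * (∏ i, u i ^ a i) * coeff a G)]

/-- residue class at level `k` -/
def cls {r : ℕ} (p k : ℕ) (v : Fin (r+1) → ℤ) : (Fin r → ZMod (p^k)) × ZMod p :=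
  (fun i => (v i.succ : ZMod (p^k)), (v 0 : ZMod p))

theorem det_local {r : ℕ} {J : Type} [Fintype J] [DecidableEq J] (f : MvPolynomial (Fin (r+1)) ℤ) (p k T : ℕ) (hp : p.Prime)
    (hk : 1 ≤ k) (v : J → Fin (r+1) → ℤ) (hv : ∀ i, aeval (v i) f = 0) (gs : J → MvPolynomial (Fin (r+1)) ℤ)
    (good : Finset J) (hgood : ∀ i ∈ good, ¬ (p:ℤ) ∣ aeval (v i) (pderiv 0 f))
    (Cset : Finset ((Fin r → ZMod (p^k)) × ZMod p)) (hC : ∀ i ∈ good, cls p k (v i) ∈ Cset) :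
    ((p:ℤ)^k) ^ (T * good.card - Cset.card * BB r T) ∣ (Matrix.of fun i j => aeval (v i) (gs j)).det := by
  classical
  -- representatives
  have hrep : ∀ c : (Fin r → ZMod (p^k)) × ZMod p, ∃ (w : Fin (r+1) → ℤ) (φ : MvPolynomial (Fin r) ℤ), ∀ i ∈ good, cls p k (v i) = c →
      (∀ j : Fin r, ((p:ℤ)^k) ∣ v i j.succ - w j.succ) ∧ ∀ u : Fin r → ℤ, (∀ j, v i j.succ = w j.succ + (p:ℤ)^k * u j) →
        ((p:ℤ)^k)^T ∣ aeval (fun j => (p:ℤ)^k * u j) φ - v i 0 := by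
    intro c
    by_cases hex : ∃ i ∈ good, cls p k (v i) = c
    · obtain ⟨i0, hi0, hc0⟩ := hex
      have hcons : ∀ w : Fin (r+1) → ℤ, Fin.cons (w 0) (fun j => w j.succ) = w := fun w => Fin.cons_self_tail w
      obtain ⟨φ, hφ⟩ := hensel_param f p hp k (k*T) hk (v i0 0) (fun j => v i0 j.succ) (by rw [hcons]; exact hgood i0 hi0)
      refine ⟨v i0, φ, fun i hi hc => ?_⟩
      rw [← hc0, cls, cls, Prod.mk.injEq] at hc
      refine ⟨fun j => ?_, fun u hu => ?_⟩
      · have := congrFun hc.1 j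
        have := (ZMod.intCast_eq_intCast_iff_dvd_sub _ _ _).1 this.symm
        exact_mod_cast this
      · have hz : (p:ℤ) ∣ v i 0 - v i0 0 := (ZMod.intCast_eq_intCast_iff_dvd_sub _ _ _).1 hc.2.symm
        have := hφ (v i 0) u hz (by
          have e : (fun j => v i0 j.succ + (p:ℤ)^k * u j) = fun j => v i j.succ := by ext j; rw [hu j]
          rw [e, hcons]; exact hv i)
        rw [← pow_mul]
        exact (pow_dvd_pow _ (by omega)).trans this
    · refine ⟨0, 0, fun i hi hc => absurd ⟨i, hi, hc⟩ hex⟩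
  choose w φ hw using hrep
  have hrow : ∀ i, ∃ (u : Fin r → ℤ) (R : J → ℤ), i ∈ good → ∀ j, aeval (v i) (gs j) =
      ∑ a : tix r T, ((p:ℤ)^k) ^ (a.1.degree) * (∏ l, u l ^ a.1 l) *
        coeff a.1 (aeval (Fin.cons (φ (cls p k (v i))) (fun l => C (w (cls p k (v i)) l.succ) + X l) : Fin (r+1) → MvPolynomial (Fin r) ℤ) (gs j))
        + ((p:ℤ)^k) ^ T * R j := by
    intro i
    by_cases hi : i ∈ good
    swap
    · exact ⟨0, 0, fun h => absurd h hi⟩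
    obtain ⟨h1, h2⟩ := hw (cls p k (v i)) i hi rfl
    choose u hu using h1
    have hu' : ∀ j : Fin r, v i j.succ = w (cls p k (v i)) j.succ + (p:ℤ)^k * u j := fun j => by rw [← hu j]; ring
    have h3 := h2 u hu'
    have h4 : ∀ j, ∃ R : ℤ, aeval (v i) (gs j) =
      ∑ a : tix r T, ((p:ℤ)^k) ^ (a.1.degree) * (∏ l, u l ^ a.1 l) *
        coeff a.1 (aeval (Fin.cons (φ (cls p k (v i))) (fun l => C (w (cls p k (v i)) l.succ) + X l) : Fin (r+1) → MvPolynomial (Fin r) ℤ) (gs j))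
        + ((p:ℤ)^k) ^ T * R := by
      intro j
      obtain ⟨R, hR⟩ := taylor_split (aeval (Fin.cons (φ (cls p k (v i))) (fun l => C (w (cls p k (v i)) l.succ) + X l) : Fin (r+1) → MvPolynomial (Fin r) ℤ) (gs j)) ((p:ℤ)^k) u T
      have h5 : ((p:ℤ)^k)^T ∣ aeval (v i) (gs j) - aeval (fun l => (p:ℤ)^k * u l) (aeval (Fin.cons (φ (cls p k (v i))) (fun l => C (w (cls p k (v i)) l.succ) + X l) : Fin (r+1) → MvPolynomial (Fin r) ℤ) (gs j)) := by
        rw [← AlgHom.comp_apply, comp_aeval]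
        apply aeval_sub_dvd
        intro l
        refine Fin.cases ?_ (fun l => ?_) l
        · rw [Fin.cons_zero, ← dvd_neg, neg_sub]; exact h3
        · rw [Fin.cons_succ, hu' l]; simp
      obtain ⟨R', hR'⟩ := h5
      refine ⟨R + R', ?_⟩
      linear_combination hR' + hR
    choose R hR using h4
    exact ⟨u, R, fun _ => hR⟩
  choose u R hR using hrow
  have := det_div (A := tix r T) ((p:ℤ)^k) T (fun a => a.1.degree) (Matrix.of fun i j => aeval (v i) (gs j)) good (fun i => cls p k (v i)) Cset hC
    (fun i a => ∏ l, u i l ^ a.1 l) (fun c a j => coeff a.1 (aeval (Fin.cons (φ c) (fun l => C (w c l.succ) + X l) : Fin (r+1) → MvPolynomial (Fin r) ℤ) (gs j)))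
    R (fun i hi j => hR i hi j)
  rw [Finset.sum_coe_sort (tix r T) (fun a => T - a.degree)] at this
  exact this

lemma BB_succ (r T : ℕ) : BB r (T+1) = BB r T + (tix r (T+1)).card := by
  classical
  have hsub : tix r T ⊆ tix r (T+1) := fun a ha => by rw [mem_tix] at *; omega
  have h1 : BB r T = ∑ a ∈ tix r (T+1), (T - a.degree) := by
    rw [BB]
    apply Finset.sum_subset hsub
    intro a _ ha
    rw [mem_tix] at ha; omega
  rw [h1, BB, Finset.card_eq_sum_ones, ← Finset.sum_add_distrib]
  refine Finset.sum_congr rfl fun a ha => ?_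
  rw [mem_tix] at ha; omega

lemma tix_one (T : ℕ) : (tix 1 T).card = T := by
  classical
  have : tix 1 T = (Finset.range T).image (fun i => Finsupp.single 0 i) := by
    ext a
    rw [mem_tix, Finset.mem_image, Finsupp.degree_eq_sum, Fin.sum_univ_one]
    constructor
    · intro h; refine ⟨a 0, Finset.mem_range.2 h, ?_⟩; ext; simp
    · rintro ⟨i, hi, rfl⟩; simpa using hi
  rw [this, Finset.card_image_of_injective _ (Finsupp.single_injective 0), Finset.card_range]

lemma tix_two (T : ℕ) : 2 * (tix 2 T).card = T * (T + 1) := by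
  classical
  induction T with
  | zero =>
    have : tix 2 0 = ∅ := by ext a; simp [mem_tix]
    rw [this]; simp
  | succ T ih =>
    have h : tix 2 (T+1) = tix 2 T ∪ (Finset.range (T+1)).image (fun i => Finsupp.single 0 i + Finsupp.single 1 (T - i)) := by
      ext a
      rw [Finset.mem_union, mem_tix, mem_tix, Finset.mem_image, Finsupp.degree_eq_sum, Fin.sum_univ_two]
      constructor
      · intro h
        by_cases h2 : a 0 + a 1 < T
        · exact Or.inl h2
        · right
          refine ⟨a 0, Finset.mem_range.2 (by omega), ?_⟩
          ext i; fin_cases i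
          · simp
          · simp; omega
      · rintro (h | ⟨i, hi, rfl⟩)
        · omega
        · simp at *; omega
    rw [h, Finset.card_union_of_disjoint, Finset.card_image_of_injective, Finset.card_range]
    · linarith
    · intro i j hij
      have := congrArg (fun f => f 0) hij
      simpa using this
    · rw [Finset.disjoint_left]
      intro a ha hb
      obtain ⟨i, hi, rfl⟩ := Finset.mem_image.1 hb
      rw [mem_tix, Finsupp.degree_eq_sum, Fin.sum_univ_two] at ha
      simp at *; omega

lemma BB_one (T : ℕ) : 2 * BB 1 T = T * (T+1) := by
  induction T with
  | zero => simp [BB]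
  | succ T ih => rw [BB_succ, mul_add, ih, tix_one]; ring

lemma BB_two (T : ℕ) : 6 * BB 2 T = T * (T+1) * (T+2) := by
  induction T with
  | zero => simp [BB]
  | succ T ih =>
    rw [BB_succ, mul_add, ih]
    have := tix_two (T+1)
    linear_combination 3 * this

end DG

end

section
namespace DG
open MvPolynomial

lemma det_totalDegree_le {k : Type*} [CommRing k] {σ ι : Type*} [Fintype ι] [DecidableEq ι]
    (M : Matrix ι ι (MvPolynomial σ k)) (w : ι → ℕ) (hM : ∀ i j, (M i j).totalDegree ≤ w j) :
    M.det.totalDegree ≤ ∑ j, w j := by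
  rw [Matrix.det_apply]
  refine totalDegree_finsetSum_le fun s _ => ?_
  have h : (∏ i, M (s i) i).totalDegree ≤ ∑ j, w j :=
    (totalDegree_finsetProd _ _).trans (Finset.sum_le_sum fun i _ => hM _ _)
  rcases Int.units_eq_one_or (Equiv.Perm.sign s) with h1 | h1 <;> rw [h1]
  · simpa using h
  · rw [Units.neg_smul, one_smul, totalDegree_neg]; exact h

lemma fse_coeff_deg {k : Type*} [CommRing k] {n : ℕ} (f : MvPolynomial (Fin (n+1)) k) (d : ℕ)
    (hd : f.totalDegree ≤ d) (i : ℕ) : ((finSuccEquiv k n f).coeff i).totalDegree ≤ d := by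
  by_cases h : (finSuccEquiv k n f).coeff i = 0
  · rw [h]; simp
  · have := totalDegree_coeff_finSuccEquiv_add_le f i h
    omega

lemma res_exists {k : Type*} [Field k] {n : ℕ} (f : MvPolynomial (Fin (n+1)) k) (d : ℕ) (hd : f.totalDegree ≤ d)
    (hd0 : 0 < d) (h1 : coeff (Finsupp.single 0 d) f = 1) (hi : Irreducible f)
    (g : MvPolynomial (Fin (n+1)) k) (e : ℕ) (hg : g.totalDegree ≤ e) (hfg : ¬ f ∣ g) :
    ∃ G : MvPolynomial (Fin n) k, G ≠ 0 ∧ G.totalDegree ≤ 2 * d * e ∧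
      ∀ v : Fin (n+1) → k, aeval v f = 0 → aeval v g = 0 → aeval (Fin.tail v) G = 0 := by
  classical
  set F := finSuccEquiv k n f with hF
  set Gg := finSuccEquiv k n g with hGg
  have hFm : F.Monic := fse_monic f d hd h1
  have hFd : F.natDegree ≤ d := fse_natDegree_le f d hd
  have hFc : F.coeff d = 1 := by rw [hF, fse_coeff_top f d hd, h1, C_1]
  have hFd' : F.natDegree = d := le_antisymm hFd (Polynomial.le_natDegree_of_ne_zero (by rw [hFc]; exact one_ne_zero))
  have hGd : Gg.natDegree ≤ e := fse_natDegree_le g e hg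
  have hFi : Irreducible F := (MulEquiv.irreducible_iff (finSuccEquiv k n).toMulEquiv).2 hi
  have hndvd : ¬ F ∣ Gg := fun h => hfg ((map_dvd_iff (finSuccEquiv k n)).1 h)
  refine ⟨Polynomial.resultant F Gg d e, ?_, ?_, ?_⟩
  · set K := FractionRing (MvPolynomial (Fin n) k)
    set φ := algebraMap (MvPolynomial (Fin n) k) K
    have hφ : Function.Injective φ := IsFractionRing.injective _ _
    have hFKi : Irreducible (F.map φ) := (Polynomial.Monic.irreducible_iff_irreducible_map_fraction_map hFm).1 hFi
    have hnd : ¬ F.map φ ∣ Gg.map φ := fun h => hndvd ((Polynomial.map_dvd_map φ hφ hFm).1 h)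
    have hco : IsCoprime (F.map φ) (Gg.map φ) := (Irreducible.coprime_iff_not_dvd hFKi).2 hnd
    have hne := Polynomial.resultant_ne_zero _ _ hco
    rw [Polynomial.natDegree_map_eq_of_injective hφ, Polynomial.natDegree_map_eq_of_injective hφ, hFd', Polynomial.resultant_map_map] at hne
    intro h0
    apply hne
    have := Polynomial.resultant_add_right_deg F Gg d Gg.natDegree (e - Gg.natDegree) le_rfl
    rw [Nat.add_sub_cancel' hGd, hFc, one_pow, one_mul, h0] at this
    rw [← this, map_zero]
  · rw [Polynomial.resultant]
    refine (det_totalDegree_le _ (fun j => j.addCases (fun _ => e) (fun _ => d)) ?_).trans ?_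
    · intro i j
      induction j using Fin.addCases with
      | left j => 
        simp only [Polynomial.sylvester, Matrix.of_apply, Fin.addCases_left]
        split_ifs
        · exact fse_coeff_deg g e hg _
        · simp
      | right j =>
        simp only [Polynomial.sylvester, Matrix.of_apply, Fin.addCases_right]
        split_ifs
        · exact fse_coeff_deg f d hd _
        · simp
    · rw [Fin.sum_univ_add]
      simp
      nlinarith
  · intro v hv hgv
    obtain ⟨p, q, _, _, hpq⟩ := Polynomial.exists_mul_add_mul_eq_C_resultant F Gg hFd hGd (Or.inl hd0.ne')
    have h2 := congrArg (fun P => (Polynomial.map (aeval (Fin.tail v) : MvPolynomial (Fin n) k →ₐ[k] k).toRingHom P).eval (v 0)) hpq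
    simp only [Polynomial.map_add, Polynomial.map_mul, Polynomial.eval_add, Polynomial.eval_mul, Polynomial.map_C, Polynomial.eval_C] at h2
    rw [hF, hGg, ← aeval_cons_fse, ← aeval_cons_fse, Fin.cons_self_tail, hv, hgv, zero_mul, zero_mul, zero_add] at h2
    exact h2.symm

end DG

end

section
namespace DG
open Finset

lemma log_fact_eq (n : ℕ) : Real.log (n.factorial) = ∑ p ∈ Nat.primesLE n, ((n.factorial).factorization p : ℝ) * Real.log p := by
  rw [Real.log_nat_eq_sum_factorization, Finsupp.sum]
  refine Finset.sum_subset ?_ ?_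
  · intro p hp
    rw [Nat.support_factorization] at hp
    have hpp := Nat.prime_of_mem_primeFactors hp
    rw [Nat.mem_primesLE]
    exact ⟨(Nat.Prime.dvd_factorial hpp).1 (Nat.dvd_of_mem_primeFactors hp), hpp⟩
  · intro p _ hp
    rw [Finsupp.notMem_support_iff] at hp
    simp [hp]

lemma fact_low (n p : ℕ) (hp : p.Prime) : n / p ≤ (n.factorial).factorization p := by
  rw [Nat.factorization_factorial hp (b := Nat.log p n + 2) (by omega)]
  refine le_trans (by simp) (Finset.single_le_sum (f := fun i => n / p ^ i) (fun _ _ => Nat.zero_le _) (a := 1) (by simp))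

lemma fact_high (n p : ℕ) (hp : p.Prime) : (p - 1) * (n.factorial).factorization p ≤ n := by
  rw [Nat.sub_one_mul_factorization_factorial hp]; omega

lemma log_le_pow (x : ℝ) (hx : 0 < x) : Real.log x ≤ 4 * x ^ (1/4 : ℝ) := by
  have := Real.log_le_rpow_div hx.le (show (0:ℝ) < 1/4 by norm_num)
  linarith

lemma mertens_upper (n : ℕ) (hn : 1 ≤ n) : ∑ p ∈ Nat.primesLE n, Real.log p / p ≤ Real.log n + 2 := by
  have h1 := log_fact_eq n
  have h2 : Real.log (n.factorial) ≤ n * Real.log n := by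
    rw [← Real.log_pow]
    apply Real.log_le_log (by exact_mod_cast Nat.factorial_pos n)
    exact_mod_cast Nat.factorial_le_pow n
  have h3 : ∑ p ∈ Nat.primesLE n, ((n:ℝ)/p - 1) * Real.log p ≤ n * Real.log n := by
    refine le_trans (Finset.sum_le_sum fun p hp => ?_) (h1.symm.le.trans h2)
    have hpp := (Nat.mem_primesLE.1 hp).2
    apply mul_le_mul_of_nonneg_right _ (Real.log_natCast_nonneg p)
    have : ((n / p : ℕ):ℝ) ≤ (n.factorial).factorization p := by exact_mod_cast fact_low n p hpp
    have h4 := (Nat.lt_floor_add_one ((n:ℝ)/p))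
    rw [Nat.floor_div_natCast, Nat.floor_natCast] at h4
    linarith
  have h5 : Chebyshev.theta n ≤ Real.log 4 * n := Chebyshev.theta_le_log4_mul_x (Nat.cast_nonneg n)
  rw [Chebyshev.theta_eq_sum_primesLE_log] at h5
  have h6 : ∑ p ∈ Nat.primesLE n, ((n:ℝ)/p - 1) * Real.log p = n * (∑ p ∈ Nat.primesLE n, Real.log p / p) - ∑ p ∈ Nat.primesLE n, Real.log p := by
    rw [Finset.mul_sum, ← Finset.sum_sub_distrib]
    refine Finset.sum_congr rfl fun p _ => by ring
  have hn' : (0:ℝ) < n := by exact_mod_cast hn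
  have h7 : Real.log 4 ≤ 2 := by
    have : Real.log 4 = 2 * Real.log 2 := by
      rw [show (4:ℝ) = 2^2 by norm_num, Real.log_pow]; norm_num
    rw [this]; linarith [Real.log_two_lt_d9]
  rw [h6] at h3
  have : n * (∑ p ∈ Nat.primesLE n, Real.log p / p) ≤ n * (Real.log n + 2) := by nlinarith
  exact le_of_mul_le_mul_left this hn'

/-- sums of log p / p^{3/2} bounded -/
lemma sum_log_bdd : ∃ C : ℝ, 0 ≤ C ∧ ∀ S : Finset ℕ, (∀ p ∈ S, 1 ≤ p) → ∑ p ∈ S, Real.log p / (p * Real.sqrt p) ≤ C := by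
  have hs : Summable (fun n : ℕ => 4 * (1 / (n:ℝ) ^ (5/4 : ℝ))) :=
    (Real.summable_one_div_nat_rpow.2 (by norm_num)).mul_left 4
  refine ⟨∑' n : ℕ, 4 * (1 / (n:ℝ) ^ (5/4 : ℝ)), tsum_nonneg fun _ => by positivity, fun S hS => ?_⟩
  refine le_trans (Finset.sum_le_sum fun p hp => ?_) (hs.sum_le_tsum S fun _ _ => by positivity)
  have hp0 : (0:ℝ) < p := by exact_mod_cast hS p hp
  have h1 := log_le_pow p hp0
  have h2 : (p:ℝ) * Real.sqrt p = (p:ℝ) ^ (5/4:ℝ) * (p:ℝ)^(1/4:ℝ) := by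
    rw [Real.sqrt_eq_rpow, ← Real.rpow_add hp0]
    nth_rewrite 1 [← Real.rpow_one (p:ℝ)]
    rw [← Real.rpow_add hp0]; norm_num
  rw [h2, div_le_iff₀ (by positivity)]
  field_simp
  linarith

lemma mertens_lower : ∃ C : ℝ, 0 ≤ C ∧ ∀ n : ℕ, 1 ≤ n → Real.log n - C ≤ ∑ p ∈ Nat.primesLE n, Real.log p / p := by
  obtain ⟨C, hC0, hC⟩ := sum_log_bdd
  refine ⟨1 + 2 * C, by positivity, fun n hn => ?_⟩
  have hn' : (0:ℝ) < n := by exact_mod_cast hn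
  have h1 := log_fact_eq n
  have h2 : n * Real.log n - n ≤ Real.log (n.factorial) := by
    have := Real.log_le_log (by positivity) (Stirling.le_factorial_stirling n)
    rw [Real.log_mul (by positivity) (by positivity), Real.log_pow, Real.log_div (by positivity) (by positivity), Real.log_exp] at this
    have h3 : 0 ≤ Real.log √(2 * Real.pi * n) := by
      apply Real.log_nonneg
      rw [Real.one_le_sqrt]
      have : (1:ℝ) ≤ n := by exact_mod_cast hn
      nlinarith [Real.pi_gt_three]
    linarith
  have h3 : Real.log (n.factorial) ≤ ∑ p ∈ Nat.primesLE n, (n * (Real.log p / p) + n * 2 * (Real.log p / (p * Real.sqrt p))) := by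
    rw [h1]
    refine Finset.sum_le_sum fun p hp => ?_
    have hpp := (Nat.mem_primesLE.1 hp).2
    have h4 : ((p:ℝ) - 1) * (n.factorial).factorization p ≤ n := by
      have := fact_high n p hpp
      have h5 : (((p - 1 : ℕ) : ℝ)) * (n.factorial).factorization p ≤ n := by exact_mod_cast this
      rwa [Nat.cast_sub hpp.one_le, Nat.cast_one] at h5
    have hp2 : (2:ℝ) ≤ p := by exact_mod_cast hpp.two_le
    have hs : Real.sqrt p ≤ p := by
      rw [Real.sqrt_le_left (by linarith)]; nlinarith
    have hs0 : 0 < Real.sqrt p := Real.sqrt_pos.2 (by linarith)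
    have hss : Real.sqrt p * Real.sqrt p = p := Real.mul_self_sqrt (by linarith)
    have h6 : ((n.factorial).factorization p : ℝ) ≤ n / (p - 1) := by
      rw [le_div_iff₀ (by linarith)]; linarith
    have h7 : (n:ℝ) / (p - 1) ≤ n / p + n * 2 / (p * Real.sqrt p) := by
      rw [div_add_div _ _ (by positivity) (by positivity), div_le_div_iff₀ (by linarith) (by positivity)]
      have : (n:ℝ) * (p * (p * Real.sqrt p)) + n * p * (p - Real.sqrt p) + n * (p * (p - 2) )= (n * (p * Real.sqrt p) + p * (n * 2)) * (p - 1) := by ring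
      nlinarith [mul_nonneg (mul_nonneg hn'.le (by linarith : (0:ℝ) ≤ p)) (sub_nonneg.2 hs), mul_nonneg hn'.le (mul_nonneg (by linarith : (0:ℝ) ≤ p) (sub_nonneg.2 hp2))]
    calc _ ≤ (n / p + n * 2 / (p * Real.sqrt p)) * Real.log p :=
          mul_le_mul_of_nonneg_right (h6.trans h7) (Real.log_natCast_nonneg p)
      _ = _ := by ring
  rw [Finset.sum_add_distrib, ← Finset.mul_sum, ← Finset.mul_sum] at h3
  have h4 := hC (Nat.primesLE n) (fun p hp => (Nat.mem_primesLE.1 hp).2.one_le)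
  have : n * (Real.log n - (1 + 2*C)) ≤ n * ∑ p ∈ Nat.primesLE n, Real.log p / p := by nlinarith
  exact le_of_mul_le_mul_left this hn'

lemma sum_log_primeFactors_le (n : ℕ) (hn : n ≠ 0) (S : Finset ℕ) (hS : ∀ p ∈ S, p.Prime ∧ p ∣ n) :
    ∑ p ∈ S, Real.log p ≤ Real.log n := by
  have h : ∏ p ∈ S, p ∣ n := Finset.prod_primes_dvd n (fun p hp => (hS p hp).1.prime) (fun p hp => (hS p hp).2)
  have h2 : (∏ p ∈ S, p) ≤ n := Nat.le_of_dvd (Nat.pos_of_ne_zero hn) h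
  rw [← Real.log_prod (fun p hp => by exact_mod_cast (hS p hp).1.ne_zero)]
  apply Real.log_le_log
  · exact Finset.prod_pos fun p hp => by exact_mod_cast (hS p hp).1.pos
  · rw [← Nat.cast_prod]; exact_mod_cast h2

/-- primes dividing n -/
lemma sum_dvd_le (n : ℕ) (hn : n ≠ 0) (M : ℕ) (hM : 1 ≤ M) (hnM : Real.log n ≤ M) (S : Finset ℕ)
    (hS : ∀ p ∈ S, p.Prime ∧ p ∣ n) : ∑ p ∈ S, Real.log p / p ≤ Real.log M + 3 := by
  rw [← Finset.sum_filter_add_sum_filter_not S (fun p => p ≤ M)]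
  have h1 : ∑ p ∈ S with p ≤ M, Real.log p / p ≤ Real.log M + 2 := by
    refine le_trans (Finset.sum_le_sum_of_subset_of_nonneg ?_ ?_) (mertens_upper M hM)
    · intro p hp
      rw [Finset.mem_filter] at hp
      exact Nat.mem_primesLE.2 ⟨hp.2, (hS p hp.1).1⟩
    · intro p _ _
      exact div_nonneg (Real.log_natCast_nonneg p) (Nat.cast_nonneg p)
  have hM' : (0:ℝ) < M := by exact_mod_cast hM
  have h2 : ∑ p ∈ S with ¬ p ≤ M, Real.log p / p ≤ 1 := by
    have h3 : ∑ p ∈ S with ¬ p ≤ M, Real.log p / p ≤ ∑ p ∈ S with ¬ p ≤ M, Real.log p / M := by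
      refine Finset.sum_le_sum fun p hp => ?_
      rw [Finset.mem_filter] at hp
      apply div_le_div_of_nonneg_left (Real.log_natCast_nonneg p) hM'
      exact_mod_cast (not_le.1 hp.2).le
    refine h3.trans ?_
    rw [← Finset.sum_div, div_le_one hM']
    refine (sum_log_primeFactors_le n hn _ ?_).trans hnM
    intro p hp
    rw [Finset.mem_filter] at hp
    exact hS p hp.1
  linarith

/-- product of coprime prime powers -/
lemma sum_exp_log_le (Δ : ℤ) (hΔ : Δ ≠ 0) (S : Finset ℕ) (hS : ∀ p ∈ S, p.Prime) (e : ℕ → ℕ) (h : ∀ p ∈ S, (p:ℤ)^(e p) ∣ Δ) :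
    ∑ p ∈ S, (e p : ℝ) * Real.log p ≤ Real.log |(Δ:ℝ)| := by
  have h1 : ∏ p ∈ S, p ^ e p ∣ Δ.natAbs := by
    apply Finset.prod_dvd_of_isRelPrime
    · intro p hp q hq hpq
      have : Nat.Coprime (p ^ e p) (q ^ e q) := Nat.Coprime.pow _ _ ((Nat.coprime_primes (hS p hp) (hS q hq)).2 hpq)
      exact Nat.coprime_iff_isRelPrime.1 this
    · intro p hp
      have := Int.natAbs_dvd_natAbs.2 (h p hp)
      rwa [Int.natAbs_pow, Int.natAbs_natCast] at this
  have h2 : (∏ p ∈ S, p ^ e p) ≤ Δ.natAbs := Nat.le_of_dvd (Int.natAbs_pos.2 hΔ) h1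
  have h3 : ∑ p ∈ S, (e p : ℝ) * Real.log p = Real.log (∏ p ∈ S, (p:ℝ) ^ e p) := by
    rw [Real.log_prod (fun p hp => pow_ne_zero _ (by exact_mod_cast (hS p hp).ne_zero))]
    exact Finset.sum_congr rfl fun p _ => by rw [Real.log_pow]
  rw [h3]
  apply Real.log_le_log
  · exact Finset.prod_pos fun p hp => pow_pos (by exact_mod_cast (hS p hp).pos) _
  · have : ((∏ p ∈ S, p ^ e p : ℕ):ℝ) ≤ Δ.natAbs := by exact_mod_cast h2
    rw [Nat.cast_natAbs, Int.cast_abs] at this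
    simpa using this

end DG

end

section
namespace DG
open MvPolynomial

lemma aeval_intCast {σ : Type*} (R : Type*) [CommRing R] (v : σ → ℤ) (f : MvPolynomial σ ℤ) :
    aeval (fun j => ((v j : ℤ) : R)) f = ((aeval v f : ℤ) : R) := by
  have := MvPolynomial.map_aeval (v : σ → ℤ) (Int.castRingHom R) f
  rw [← eq_intCast (Int.castRingHom R), this, aeval_def, coe_eval₂Hom]
  congr 1

lemma card_image_le_image {α β γ : Type*} [DecidableEq β] [DecidableEq γ] (s : Finset α) (f : α → β) (g : α → γ)
    (h : ∀ a ∈ s, ∀ b ∈ s, g a = g b → f a = f b) : (s.image f).card ≤ (s.image g).card := by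
  classical
  rcases s.eq_empty_or_nonempty with rfl | ⟨a0, ha0⟩
  · simp
  have : ∀ c : γ, ∃ b : β, ∀ a ∈ s, g a = c → f a = b := by
    intro c
    by_cases hc : ∃ a ∈ s, g a = c
    · obtain ⟨a, ha, hac⟩ := hc
      exact ⟨f a, fun b hb hbc => h b hb a ha (hbc.trans hac.symm)⟩
    · exact ⟨f a0, fun a ha hac => absurd ⟨a, ha, hac⟩ hc⟩
  choose F hF using this
  have : s.image f ⊆ (s.image g).image F := by
    intro b hb
    obtain ⟨a, ha, rfl⟩ := Finset.mem_image.1 hb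
    exact Finset.mem_image.2 ⟨g a, Finset.mem_image_of_mem _ ha, (hF (g a) a ha rfl).symm⟩
  exact (Finset.card_le_card this).trans Finset.card_image_le

/-- number of mod p classes of good points -/
lemma cls_count (p : ℕ) (hp : p.Prime) (f : MvPolynomial (Fin 3) ℤ) (hf : f.totalDegree ≤ 4) (ψ) (hψ : ψ ∈ noe)
    (hne : ¬ (p:ℤ) ∣ coeff (Finsupp.single 0 4) f * aeval (fun m => coeff m (slE f (0:ℤ))) ψ)
    {J : Type} (good : Finset J) (v : J → Fin 3 → ℤ) (hv : ∀ i ∈ good, aeval (v i) f = 0)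
    (hg : ∀ i ∈ good, ¬ (p:ℤ) ∣ aeval (v i) (pderiv 0 f)) [DecidableEq ((Fin 2 → ZMod (p^1)) × ZMod p)] :
    ((good.image (fun i => cls p 1 (v i))).card : ℝ) ≤ p^2 + (1000004 + 16 * noeDeg) * (p * Real.sqrt p) := by
  classical
  haveI : Fact p.Prime := ⟨hp⟩
  have hpr : Prime (p:ℤ) := Nat.prime_iff_prime_int.1 hp
  have h1 := Np_bound p f hf (fun h => hne (Dvd.dvd.mul_right ((ZMod.intCast_zmod_eq_zero_iff_dvd _ _).1 h) _)) ψ hψ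
    (fun h => hne (Dvd.dvd.mul_left ((ZMod.intCast_zmod_eq_zero_iff_dvd _ _).1 h) _))
    (good.image (fun i j => ((v i j : ℤ) : ZMod p))) (by
      intro P hP
      obtain ⟨i, hi, rfl⟩ := Finset.mem_image.1 hP
      rw [aeval_intCast, aeval_intCast, hv i hi]
      refine ⟨by simp, fun h => hg i hi ((ZMod.intCast_zmod_eq_zero_iff_dvd _ _).1 h)⟩)
  refine le_trans ?_ h1
  have := card_image_le_image good (fun i => cls p 1 (v i)) (fun i j => ((v i j : ℤ) : ZMod p)) (by
    intro a _ b _ hab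
    simp only [cls, Prod.mk.injEq]
    refine ⟨?_, congrFun hab 0⟩
    funext j
    have h3 := congrFun hab j.succ
    rw [ZMod.intCast_eq_intCast_iff_dvd_sub] at h3 ⊢
    simpa using h3)
  exact_mod_cast this

/-- index set of monomials -/
abbrev GJ (D : ℕ) : Type := Fin 4 × (Σ m : Fin (D+1), Fin (m.1+1))
noncomputable def gexp {D : ℕ} (j : GJ D) : Fin 3 →₀ ℕ :=
  Finsupp.single 0 j.1.1 + Finsupp.single 1 j.2.2.1 + Finsupp.single 2 (j.2.1.1 - j.2.2.1)
lemma gexp_zero {D : ℕ} (j : GJ D) : gexp j 0 = j.1.1 := by simp [gexp]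
lemma gexp_one {D : ℕ} (j : GJ D) : gexp j 1 = j.2.2.1 := by simp [gexp]
lemma gexp_two {D : ℕ} (j : GJ D) : gexp j 2 = j.2.1.1 - j.2.2.1 := by simp [gexp]
lemma gexp_inj (D : ℕ) : Function.Injective (gexp : GJ D → _) := by
  rintro ⟨i, m, l⟩ ⟨i', m', l'⟩ h
  have h0 := DFunLike.congr_fun h 0
  have h1 := DFunLike.congr_fun h 1
  have h2 := DFunLike.congr_fun h 2
  rw [gexp_zero, gexp_zero] at h0
  rw [gexp_one, gexp_one] at h1
  rw [gexp_two, gexp_two] at h2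
  simp only at h0 h1 h2
  have hm : m = m' := by
    have := l.2; have := l'.2
    apply Fin.ext; omega
  subst hm
  have hl : l = l' := Fin.ext h1
  have hi : i = i' := Fin.ext h0
  rw [hl, hi]
lemma gexp_deg {D : ℕ} (j : GJ D) : (gexp j).degree = j.1.1 + j.2.1.1 := by
  have := j.2.2.2
  rw [deg3, gexp_zero, gexp_one, gexp_two]; omega

lemma GJ_card (D : ℕ) : Fintype.card (GJ D) = 2 * (D+1) * (D+2) := by
  simp only [Fintype.card_prod, Fintype.card_fin, Fintype.card_sigma]
  rw [Fin.sum_univ_eq_sum_range (fun i => i + 1)]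
  have : 2 * ∑ i ∈ Finset.range (D+1), (i+1) = (D+1)*(D+2) := by
    induction D with
    | zero => simp
    | succ D ih => rw [Finset.sum_range_succ, mul_add, ih]; ring
  linarith

lemma GJ_sum (D : ℕ) : 3 * ∑ j : GJ D, (gexp j).degree = (D+1)*(D+2)*(4*D+9) := by
  simp only [gexp_deg, Fintype.sum_prod_type, Fintype.sum_sigma]
  simp only [Finset.sum_const, Finset.card_univ, Fintype.card_fin, Fin.sum_univ_four, ← Finset.sum_add_distrib]
  simp only [Fin.val_zero, Fin.val_one, Fin.val_two, show ((3:Fin 4):ℕ) = 3 from rfl, smul_eq_mul]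
  rw [Fin.sum_univ_eq_sum_range (fun i => (i+1)*(0+i) + (i+1)*(1+i)+(i+1)*(2+i)+(i+1)*(3+i))]
  induction D with
  | zero => simp
  | succ D ih => rw [Finset.sum_range_succ, mul_add, ih]; ring

lemma monom_eval_le (m : Fin 3 →₀ ℕ) (v : Fin 3 → ℤ) (B : ℕ) (hv : ∀ i, |v i| ≤ B) :
    |aeval v (monomial m (1:ℤ))| ≤ (B:ℤ)^m.degree := by
  rw [aeval_monomial, Finsupp.prod_fintype _ _ (by simp), Fin.prod_univ_three, deg3, map_one, one_mul, abs_mul, abs_mul, abs_pow, abs_pow, abs_pow, pow_add, pow_add]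
  have := hv 0; have := hv 1; have := hv 2
  gcongr <;> apply hv

lemma det_abs_le {J : Type} [Fintype J] [DecidableEq J] (M : Matrix J J ℤ) (w : J → ℤ) (hM : ∀ i j, |M i j| ≤ w j) :
    |M.det| ≤ (Fintype.card J).factorial * ∏ j, w j := by
  rw [Matrix.det_apply]
  refine (Finset.abs_sum_le_sum_abs _ _).trans ?_
  have : ∀ s ∈ (Finset.univ : Finset (Equiv.Perm J)), |Equiv.Perm.sign s • ∏ i, M (s i) i| ≤ ∏ j, w j := by
    intro s _
    have h : |∏ i, M (s i) i| ≤ ∏ j, w j := by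
      rw [Finset.abs_prod]
      exact Finset.prod_le_prod (fun _ _ => abs_nonneg _) fun i _ => hM _ _
    rcases Int.units_eq_one_or (Equiv.Perm.sign s) with h1 | h1 <;> rw [h1]
    · simpa using h
    · simpa using h
  refine (Finset.sum_le_card_nsmul _ _ _ this).trans ?_
  rw [Finset.card_univ, Fintype.card_perm, nsmul_eq_mul]

/-- real arithmetic for one prime -/
lemma prime_arith (p D T s bad good N BBv : ℝ) (C0 : ℝ) (hC0 : 0 ≤ C0) (hp : 2 ≤ p) (hD : p ≤ D) (hT1 : 2 * D / p - 1 ≤ T) (hT : T ≤ 2 * D / p) (hT0 : 0 ≤ T)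
    (hs : s = 2 * (D+1) * (D+2)) (hbad : 0 ≤ bad) (hgood : good = s - bad) (hN : N ≤ p^2 + C0 * (p * Real.sqrt p))
    (hBB : 6 * BBv = T * (T+1) * (T+2)) :
    8/3 * D^3 * (1/p) - 5 * D^2 - 4 * C0 * D^3 * (1/(p * Real.sqrt p)) - bad * (2 * D) * (1/p) ≤ T * good - N * BBv := by
  have hp0 : 0 < p := by linarith
  have hs0 : 0 < Real.sqrt p := Real.sqrt_pos.2 hp0
  have hss : Real.sqrt p * Real.sqrt p = p := Real.mul_self_sqrt hp0.le
  obtain ⟨t, ht⟩ : ∃ t, t = 2 * D / p := ⟨_, rfl⟩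
  have htp : t * p = 2 * D := by rw [ht]; field_simp
  have ht2 : 2 ≤ t := by rw [ht, le_div_iff₀ hp0]; linarith
  rw [← ht] at hT1 hT
  have hD0 : 0 < D := by linarith
  have e1 : D^3 * (1/p) = D^2 * t / 2 := by rw [ht]; field_simp
  have e2 : bad * (2*D) * (1/p) = bad * t := by rw [ht]; field_simp
  have e3 : 4 * D^3 * (1/(p * Real.sqrt p)) = p * Real.sqrt p * t^3 / 2 := by
    rw [ht]; field_simp
    have : Real.sqrt p ^ 2 = p := Real.sq_sqrt hp0.le
    rw [this]; ring
  have hB1 : BBv ≤ t * (t+1)*(t+2)/6 := by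
    have : T * (T+1) * (T+2) ≤ t * (t+1) * (t+2) := by gcongr
    linarith
  have hB0 : 0 ≤ BBv := by
    have : 0 ≤ T * (T+1) * (T+2) := by positivity
    linarith
  have h1 : N * BBv ≤ (p^2 + C0 * (p * Real.sqrt p)) * (t * (t+1)*(t+2)/6) :=
    (mul_le_mul_of_nonneg_right hN hB0).trans (mul_le_mul_of_nonneg_left hB1 (by positivity))
  have h2 : p^2 * (t * (t+1)*(t+2)/6) ≤ D^2 * t * (2/3) + 3 * D^2 := by
    have a1 : p^2 * (t * (t+1)*(t+2)/6) = ((t*p)^2 * t + 3 * (t*p)^2 + 2 * (t*p)*p)/6 := by ring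
    rw [a1, htp]
    nlinarith
  have h3 : C0 * (p * Real.sqrt p) * (t * (t+1)*(t+2)/6) ≤ C0 * (p * Real.sqrt p * t^3 / 2) := by
    have : t * (t+1)*(t+2)/6 ≤ t^3/2 := by nlinarith [mul_nonneg (by linarith : 0 ≤ t) (sub_nonneg.2 ht2), mul_nonneg (mul_nonneg (by linarith : 0 ≤ t) (by linarith : 0 ≤ t)) (sub_nonneg.2 ht2)]
    calc _ ≤ C0 * (p * Real.sqrt p) * (t^3/2) := by gcongr
      _ = _ := by ring
  have h4 : t * s - s ≤ T * s := by
    have : 0 ≤ s := by rw [hs]; positivity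
    nlinarith
  have h5 : T * bad ≤ t * bad := by gcongr
  have h6 : 2 * D^2 * t - 2 * D^2 ≤ t * s - s := by
    rw [hs]; nlinarith [mul_nonneg hD0.le (by linarith : 0 ≤ t - 1)]
  have e3' : 4 * C0 * D^3 * (1/(p * Real.sqrt p)) = C0 * (p * Real.sqrt p * t^3 / 2) := by rw [← e3]; ring
  have e1' : 8/3 * D^3 * (1/p) = 8/3 * (D^2 * t / 2) := by rw [← e1]; ring
  rw [e1', e2, e3', hgood]
  nlinarith

end DG

end

section
namespace DG
open MvPolynomial

noncomputable def C0 : ℝ := 1000004 + 16 * noeDeg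
lemma C0_nonneg : 0 ≤ C0 := by unfold C0; positivity

/-- divisibility by p^e for an auxiliary prime -/
lemma aux_prime (f : MvPolynomial (Fin 3) ℤ) (hf : f.totalDegree ≤ 4) (ψ) (hψ : ψ ∈ noe) (D : ℕ)
    (v : GJ D → Fin 3 → ℤ) (hv : ∀ i, aeval (v i) f = 0) (p : ℕ) (hp : p.Prime) (hpD : p ≤ D)
    (hne : ¬ (p:ℤ) ∣ coeff (Finsupp.single 0 4) f * aeval (fun m => coeff m (slE f (0:ℤ))) ψ) :
    ∃ e : ℕ, (p:ℤ)^e ∣ (Matrix.of fun i j : GJ D => aeval (v i) (monomial (gexp j) (1:ℤ))).det ∧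
      8/3 * (D:ℝ)^3 * (1/p) - 5 * (D:ℝ)^2 - 4 * C0 * (D:ℝ)^3 * (1/(p * Real.sqrt p))
        - (∑ i : GJ D, if (p:ℤ) ∣ aeval (v i) (pderiv 0 f) then (1:ℝ) else 0) * (2 * D) * (1/p) ≤ e := by
  classical
  let good : Finset (GJ D) := Finset.univ.filter fun i => ¬ (p:ℤ) ∣ aeval (v i) (pderiv 0 f)
  let bad : Finset (GJ D) := Finset.univ.filter fun i => (p:ℤ) ∣ aeval (v i) (pderiv 0 f)
  have hg : ∀ i ∈ good, ¬ (p:ℤ) ∣ aeval (v i) (pderiv 0 f) := fun i hi => (Finset.mem_filter.1 hi).2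
  let T := 2 * D / p
  have h1 := det_local f p 1 T hp le_rfl v hv (fun j => monomial (gexp j) (1:ℤ)) good hg
    (good.image fun i => cls p 1 (v i)) (fun i hi => Finset.mem_image_of_mem _ hi)
  have h2 := cls_count p hp f hf ψ hψ hne good v (fun i _ => hv i) hg
  refine ⟨_, by rw [pow_one] at h1; exact h1, ?_⟩
  have hb : (∑ i : GJ D, if (p:ℤ) ∣ aeval (v i) (pderiv 0 f) then (1:ℝ) else 0) = bad.card := by
    rw [Finset.sum_boole]
  rw [hb]
  have hgb : good.card + bad.card = 2 * (D+1) * (D+2) := by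
    rw [← GJ_card, ← Finset.card_univ, add_comm]
    exact Finset.card_filter_add_card_filter_not (s := Finset.univ) _
  have hgb' : (good.card : ℝ) + bad.card = 2 * (D+1) * (D+2) := by exact_mod_cast hgb
  have hp0 : (0:ℝ) < p := by exact_mod_cast hp.pos
  have hfl : ((T:ℕ):ℝ) ≤ 2 * D / p := by
    have := @Nat.cast_div_le ℝ _ _ _ (2*D) p
    push_cast at this; exact this
  have hfl2 : 2 * (D:ℝ) / p - 1 ≤ T := by
    have := Nat.lt_floor_add_one (((2*D:ℕ):ℝ)/p)
    rw [Nat.floor_div_natCast, Nat.floor_natCast] at this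
    push_cast at this
    linarith
  have key := prime_arith p D T (2 * (D+1) * (D+2)) bad.card good.card _ (BB 2 T) C0 C0_nonneg (by exact_mod_cast hp.two_le) (by exact_mod_cast hpD)
    hfl2 hfl (Nat.cast_nonneg _) rfl (Nat.cast_nonneg _) (by linarith) h2 (by exact_mod_cast BB_two T)
  refine key.trans ?_
  have : ((T * good.card : ℕ):ℝ) ≤ ((T * good.card - (good.image fun i => cls p 1 (v i)).card * BB 2 T : ℕ):ℝ) + (((good.image fun i => cls p 1 (v i)).card * BB 2 T : ℕ) : ℝ) := by
    exact_mod_cast (by omega)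
  push_cast at this ⊢
  linarith

/-- divisibility at p0 -/
lemma main_prime (f : MvPolynomial (Fin 3) ℤ) (D : ℕ)
    (v : GJ D → Fin 3 → ℤ) (hv : ∀ i, aeval (v i) f = 0) (p k : ℕ) (hp : p.Prime)
    (hg : ∀ i, ¬ (p:ℤ) ∣ aeval (v i) (pderiv 0 f)) (hc : 1 ≤ k → ∀ i j, cls p k (v i) = cls p k (v j)) :
    ∃ e : ℕ, (p:ℤ)^(k * e) ∣ (Matrix.of fun i j : GJ D => aeval (v i) (monomial (gexp j) (1:ℤ))).det ∧
      8/3 * (D:ℝ)^3 ≤ e := by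
  classical
  rcases Nat.eq_zero_or_pos k with rfl | hk
  · refine ⟨3*D^3, by simp, ?_⟩
    push_cast
    have : (0:ℝ) ≤ (D:ℝ)^3 := by positivity
    linarith
  have i0 : GJ D := (0, ⟨0, 0⟩)
  have h1 := det_local f p k (2*D) hp hk v hv (fun j => monomial (gexp j) (1:ℤ)) Finset.univ (fun i _ => hg i)
    {cls p k (v i0)} (fun i _ => by rw [Finset.mem_singleton]; exact hc hk i i0)
  rw [← pow_mul] at h1
  refine ⟨_, h1, ?_⟩
  rw [Finset.card_univ, GJ_card, Finset.card_singleton, one_mul]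
  have h2 := BB_two (2*D)
  have : ((2 * D * (2 * (D+1) * (D+2)) : ℕ):ℝ) ≤ ((2 * D * (2 * (D+1) * (D+2)) - BB 2 (2*D) : ℕ):ℝ) + ((BB 2 (2*D) : ℕ) : ℝ) := by
    exact_mod_cast (by omega)
  have h3 : 6 * ((BB 2 (2*D) : ℕ) : ℝ) = 2 * D * (2 * D+1) * (2*D+2) := by exact_mod_cast h2
  push_cast at this ⊢
  nlinarith [(Nat.cast_nonneg D : (0:ℝ) ≤ D), sq_nonneg (D:ℝ)]

lemma log_sfact_le (D : ℕ) (hD : 1 ≤ D) : Real.log ((2*(D+1)*(D+2)).factorial : ℝ) ≤ 60 * (D:ℝ)^3 := by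
  have hDr : (1:ℝ) ≤ D := by exact_mod_cast hD
  set s := 2*(D+1)*(D+2)
  have hs : (s:ℝ) ≤ 12 * (D:ℝ)^2 := by
    have : (s:ℝ) = 2*(D+1)*(D+2) := by simp only [s]; push_cast; ring
    rw [this]; nlinarith
  have hs1 : (1:ℝ) ≤ s := by
    have : 1 ≤ s := Nat.succ_le_of_lt (by positivity)
    exact_mod_cast this
  have a1 : Real.log (s.factorial) ≤ s * Real.log s := by
    rw [← Real.log_pow]
    apply Real.log_le_log (by exact_mod_cast Nat.factorial_pos s)
    exact_mod_cast Nat.factorial_le_pow s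
  have a2 : Real.log s ≤ 5 * D := by
    have b1 : Real.log s ≤ Real.log (12 * (D:ℝ)^2) := Real.log_le_log (by linarith) hs
    rw [Real.log_mul (by norm_num) (by positivity), Real.log_pow] at b1
    have b2 : Real.log D ≤ D := Real.log_le_self (by linarith)
    have b3 : Real.log 12 ≤ 3 := by
      have : Real.log 12 ≤ Real.log 16 := Real.log_le_log (by norm_num) (by norm_num)
      have h16 : Real.log 16 = 4 * Real.log 2 := by
        rw [show (16:ℝ) = 2^4 by norm_num, Real.log_pow]; norm_num
      linarith [Real.log_two_lt_d9]
    push_cast at b1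
    linarith
  have a3 : (s:ℝ) * Real.log s ≤ (12 * (D:ℝ)^2) * (5 * D) :=
    mul_le_mul hs a2 (Real.log_nonneg hs1) (by positivity)
  nlinarith

set_option maxHeartbeats 1000000 in
theorem glob : ∃ A : ℝ, 0 ≤ A ∧ ∀ (f : MvPolynomial (Fin 3) ℤ) (_ : f.totalDegree ≤ 4) (ψ) (_ : ψ ∈ noe) (M : ℕ) (_ : 1 ≤ M)
    (_ : coeff (Finsupp.single 0 4) f * aeval (fun m => coeff m (slE f (0:ℤ))) ψ ≠ 0)
    (_ : Real.log |((coeff (Finsupp.single 0 4) f * aeval (fun m => coeff m (slE f (0:ℤ))) ψ : ℤ) : ℝ)| ≤ M)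
    (B : ℕ) (_ : 1 ≤ B) (p k D : ℕ) (_ : p.Prime) (_ : 1 ≤ D) (_ : Real.log B ≤ D)
    (_ : Real.log B / 2 + A * (1 + Real.log M) ≤ k * Real.log p + Real.log D)
    (S : Set (Fin 3 → ℤ)) (_ : ∀ v ∈ S, aeval v f = 0 ∧ (∀ i, |v i| ≤ (B:ℤ)) ∧ Real.log |((aeval v (pderiv 0 f) : ℤ) : ℝ)| ≤ M ∧
      ¬ (p:ℤ) ∣ aeval v (pderiv 0 f)) (_ : 1 ≤ k → ∀ v ∈ S, ∀ w ∈ S, cls p k v = cls p k w),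
    ∃ g : MvPolynomial (Fin 3) ℤ, g ≠ 0 ∧ g.degreeOf 0 ≤ 3 ∧ g.totalDegree ≤ D + 3 ∧ ∀ v ∈ S, aeval v g = 0 := by
  classical
  obtain ⟨C1, hC1, hmer⟩ := mertens_lower
  obtain ⟨C2, hC2, hlog⟩ := sum_log_bdd
  refine ⟨C1 + 4 * C0 * C2 + 200, by have := C0_nonneg; positivity, ?_⟩
  intro f hf ψ hψ M hM hN0 hNM B hB p0 k D hp0 hD hBD hbig S hS hcls
  set N0 : ℤ := coeff (Finsupp.single 0 4) f * aeval (fun m => coeff m (slE f (0:ℤ))) ψ with hN0d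
  rcases rank_siegel S (fun (j : GJ D) v => aeval v (monomial (gexp j) (1:ℤ))) (B^(D+3)) (Nat.one_le_pow _ _ hB) (by
    intro v hv j
    refine (monom_eval_le _ _ B (hS v hv).2.1).trans ?_
    push_cast
    apply pow_le_pow_right₀ (by exact_mod_cast hB)
    rw [gexp_deg]; omega) with ⟨e, heS, hdet⟩ | ⟨c, hc0, hcS, _⟩
  · exfalso
    set Δ := (Matrix.of fun i j : GJ D => aeval (e i) (monomial (gexp j) (1:ℤ))).det with hΔd
    have hΔ : Δ ≠ 0 := hdet
    have hv : ∀ i, aeval (e i) f = 0 := fun i => (hS _ (heS i)).1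
    obtain ⟨e0, he0, he0'⟩ := main_prime f D e hv p0 k hp0 (fun i => (hS _ (heS i)).2.2.2) (fun hk i j => hcls hk _ (heS i) _ (heS j))
    set P := (Nat.primesLE D).filter fun p => p ≠ p0 ∧ ¬ (p:ℤ) ∣ N0 with hP
    have hPp : ∀ p ∈ P, p.Prime ∧ p ≤ D ∧ p ≠ p0 ∧ ¬ (p:ℤ) ∣ N0 := by
      intro p hp
      rw [hP, Finset.mem_filter, Nat.mem_primesLE] at hp
      exact ⟨hp.1.2, hp.1.1, hp.2.1, hp.2.2⟩
    have hex : ∀ p : ℕ, ∃ ep : ℕ, p ∈ P → ((p:ℤ)^ep ∣ Δ ∧ 8/3 * (D:ℝ)^3 * (1/p) - 5 * (D:ℝ)^2 - 4 * C0 * (D:ℝ)^3 * (1/(p * Real.sqrt p))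
        - (∑ i : GJ D, if (p:ℤ) ∣ aeval (e i) (pderiv 0 f) then (1:ℝ) else 0) * (2 * D) * (1/p) ≤ ep) := by
      intro p
      by_cases hp : p ∈ P
      · obtain ⟨ep, h1, h2⟩ := aux_prime f hf ψ hψ D e hv p (hPp p hp).1 (hPp p hp).2.1 (hPp p hp).2.2.2
        exact ⟨ep, fun _ => ⟨h1, h2⟩⟩
      · exact ⟨0, fun h => absurd h hp⟩
    choose ep hep using hex
    have hp0P : p0 ∉ P := fun h => (hPp p0 h).2.2.1 rfl
    have hsum := sum_exp_log_le Δ hΔ (insert p0 P) (by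
        intro p hp
        rcases Finset.mem_insert.1 hp with rfl | hp
        · exact hp0
        · exact (hPp p hp).1) (fun p => if p = p0 then k * e0 else ep p) (by
        intro p hp
        rcases Finset.mem_insert.1 hp with rfl | hp
        · simp only [if_true]; exact he0
        · simp only [(hPp p hp).2.2.1, if_false]; exact (hep p hp).1)
    rw [Finset.sum_insert hp0P] at hsum
    simp only [if_true] at hsum
    have hDr : (1:ℝ) ≤ D := by exact_mod_cast hD
    have hlM : 0 ≤ Real.log M := Real.log_natCast_nonneg M
    -- lower bound of prime sum
    have hPsum : ∑ p ∈ P, (8/3 * (D:ℝ)^3 * (Real.log p/p) - 5 * (D:ℝ)^2 * Real.log p - 4 * C0 * (D:ℝ)^3 * (Real.log p/(p * Real.sqrt p))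
        - (2 * D) * ∑ i : GJ D, (if (p:ℤ) ∣ aeval (e i) (pderiv 0 f) then (Real.log p/p) else 0)) ≤ ∑ p ∈ P, ((if p = p0 then k * e0 else ep p : ℕ):ℝ) * Real.log p := by
      refine Finset.sum_le_sum fun p hp => ?_
      simp only [(hPp p hp).2.2.1, if_false]
      refine le_trans (le_of_eq ?_) (mul_le_mul_of_nonneg_right (hep p hp).2 (Real.log_natCast_nonneg p))
      have : ∑ i : GJ D, (if (p:ℤ) ∣ aeval (e i) (pderiv 0 f) then (Real.log p/p) else 0) = (∑ i : GJ D, if (p:ℤ) ∣ aeval (e i) (pderiv 0 f) then (1:ℝ) else 0) * (Real.log p/p) := by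
        rw [Finset.sum_mul]
        refine Finset.sum_congr rfl fun i _ => by split_ifs <;> simp
      rw [this]; ring
    rw [Finset.sum_sub_distrib, Finset.sum_sub_distrib, Finset.sum_sub_distrib, ← Finset.mul_sum, ← Finset.mul_sum, ← Finset.mul_sum, ← Finset.mul_sum, Finset.sum_comm] at hPsum
    have hlp : ∀ p : ℕ, 0 ≤ Real.log p / p := fun p => div_nonneg (Real.log_natCast_nonneg p) (Nat.cast_nonneg p)
    have hbad : ∑ i : GJ D, ∑ p ∈ P, (if (p:ℤ) ∣ aeval (e i) (pderiv 0 f) then (Real.log p/p) else 0) ≤ 2 * (D+1)*(D+2) * (Real.log M + 3) := by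
      refine (Finset.sum_le_card_nsmul _ _ (Real.log M + 3) fun i _ => ?_).trans ?_
      · rw [← Finset.sum_filter]
        have hz : aeval (e i) (pderiv 0 f) ≠ 0 := fun h => (hS _ (heS i)).2.2.2 (by rw [h]; exact dvd_zero _)
        apply sum_dvd_le (aeval (e i) (pderiv 0 f)).natAbs (Int.natAbs_ne_zero.2 hz) M hM
        · rw [Nat.cast_natAbs, Int.cast_abs]; exact (hS _ (heS i)).2.2.1
        · intro p hp
          rw [Finset.mem_filter] at hp
          exact ⟨(hPp p hp.1).1, Int.natCast_dvd.1 hp.2⟩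
      · rw [Finset.card_univ, GJ_card, nsmul_eq_mul]; push_cast; exact le_rfl
    have h5 : ∑ p ∈ P, Real.log p ≤ 2 * D := by
      have h5 : Chebyshev.theta D ≤ Real.log 4 * D := Chebyshev.theta_le_log4_mul_x (Nat.cast_nonneg D)
      rw [Chebyshev.theta_eq_sum_primesLE_log] at h5
      have h7 : Real.log 4 ≤ 2 := by
        have : Real.log 4 = 2 * Real.log 2 := by
          rw [show (4:ℝ) = 2^2 by norm_num, Real.log_pow]; norm_num
        rw [this]; linarith [Real.log_two_lt_d9]
      refine (Finset.sum_le_sum_of_subset_of_nonneg (Finset.filter_subset _ _) fun p _ _ => Real.log_natCast_nonneg p).trans (h5.trans ?_)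
      nlinarith
    have h6 : ∑ p ∈ P, Real.log p/(p * Real.sqrt p) ≤ C2 := hlog P fun p hp => (hPp p hp).1.one_le
    have h7 : Real.log D - C1 - (Real.log M + 3) - 1 ≤ ∑ p ∈ P, Real.log p / p := by
      have h8 := hmer D hD
      have h9 : ∑ p ∈ Nat.primesLE D, Real.log p / p ≤ ∑ p ∈ P, Real.log p / p + (∑ p ∈ {p0}, Real.log p / p + ∑ p ∈ (Nat.primesLE D).filter (fun p : ℕ => (p:ℤ) ∣ N0), Real.log p / p) := by
        refine (Finset.sum_le_sum_of_subset_of_nonneg (t := P ∪ ({p0} ∪ (Nat.primesLE D).filter (fun p : ℕ => (p:ℤ) ∣ N0))) ?_ fun p _ _ => hlp p).trans ?_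
        · intro p hp
          simp only [Finset.mem_union, Finset.mem_singleton, Finset.mem_filter, hP]
          tauto
        · have hu : ∀ s t : Finset ℕ, ∑ p ∈ s ∪ t, Real.log p / p ≤ ∑ p ∈ s, Real.log p / p + ∑ p ∈ t, Real.log p / p := by
            intro s t
            rw [← Finset.sum_union_inter]
            linarith [Finset.sum_nonneg (s := s ∩ t) fun p _ => hlp p]
          exact (hu _ _).trans (by gcongr; exact hu _ _)
      have h10 : ∑ p ∈ (Nat.primesLE D).filter (fun p : ℕ => (p:ℤ) ∣ N0), Real.log p / p ≤ Real.log M + 3 := by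
        apply sum_dvd_le N0.natAbs (Int.natAbs_ne_zero.2 hN0) M hM
        · rw [Nat.cast_natAbs, Int.cast_abs]; exact hNM
        · intro p hp
          rw [Finset.mem_filter, Nat.mem_primesLE] at hp
          exact ⟨hp.1.2, Int.natCast_dvd.1 hp.2⟩
      have h11 : Real.log p0 / p0 ≤ 1 := by
        rw [div_le_one (by exact_mod_cast hp0.pos)]
        exact Real.log_le_self (Nat.cast_nonneg _)
      rw [Finset.sum_singleton] at h9
      linarith
    -- upper bound of det
    have hup : Real.log |(Δ:ℝ)| ≤ 60 * (D:ℝ)^3 + (4/3 * (D:ℝ)^3 + 25 * (D:ℝ)^2) * Real.log B := by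
      have h1 := det_abs_le (Matrix.of fun i j : GJ D => aeval (e i) (monomial (gexp j) (1:ℤ))) (fun j => (B:ℤ)^(gexp j).degree)
        (fun i j => monom_eval_le _ _ B (hS _ (heS i)).2.1)
      rw [Finset.prod_pow_eq_pow_sum, ← hΔd, GJ_card] at h1
      have h2 : |(Δ:ℝ)| ≤ ((2*(D+1)*(D+2)).factorial : ℝ) * (B:ℝ)^(∑ j : GJ D, (gexp j).degree) := by exact_mod_cast h1
      have hB0 : (0:ℝ) < B := by exact_mod_cast hB
      have h3 := Real.log_le_log (abs_pos.2 (by exact_mod_cast hΔ)) h2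
      rw [Real.log_mul (by exact_mod_cast Nat.factorial_ne_zero _) (by positivity), Real.log_pow] at h3
      have h4 : 3 * ((∑ j : GJ D, (gexp j).degree : ℕ):ℝ) = (D+1)*(D+2)*(4*D+9) := by exact_mod_cast GJ_sum D
      have h5 : ((∑ j : GJ D, (gexp j).degree : ℕ):ℝ) ≤ 4/3 * (D:ℝ)^3 + 25 * (D:ℝ)^2 := by nlinarith
      have h6 : Real.log ((2*(D+1)*(D+2)).factorial : ℝ) ≤ 60 * (D:ℝ)^3 := by
        exact log_sfact_le D hD
      have hB1 : 0 ≤ Real.log B := Real.log_natCast_nonneg B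
      have := mul_le_mul_of_nonneg_right h5 hB1
      linarith
    have hB1 : 0 ≤ Real.log B := Real.log_natCast_nonneg B
    have hlp0 : 0 ≤ Real.log p0 := Real.log_natCast_nonneg p0
    have m1 : 8/3 * (D:ℝ)^3 * (k * Real.log p0) ≤ ((k * e0 : ℕ):ℝ) * Real.log p0 := by
      push_cast
      nlinarith [mul_le_mul_of_nonneg_left he0' (mul_nonneg (Nat.cast_nonneg k : (0:ℝ) ≤ k) hlp0)]
    have hD3 : (0:ℝ) < (D:ℝ)^3 := by positivity
    have m2 : (D:ℝ)^2 * Real.log B ≤ (D:ℝ)^3 := by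
      calc (D:ℝ)^2 * Real.log B ≤ (D:ℝ)^2 * D := by gcongr
        _ = _ := by ring
    have m3 : (2 * (D:ℝ)) * (2 * (D+1)*(D+2) * (Real.log M + 3)) ≤ 24 * (D:ℝ)^3 * (Real.log M + 3) := by
      have : 2 * (D:ℝ) * (2 * (D+1)*(D+2)) ≤ 24 * (D:ℝ)^3 := by nlinarith [mul_nonneg (by linarith : (0:ℝ) ≤ D) (by linarith : (0:ℝ) ≤ D - 1), mul_nonneg (mul_nonneg (by linarith : (0:ℝ) ≤ D) (by linarith : (0:ℝ) ≤ D)) (by linarith : (0:ℝ) ≤ D - 1)]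
      nlinarith
    have m4 : 5 * (D:ℝ)^2 * ∑ p ∈ P, Real.log p ≤ 10 * (D:ℝ)^3 := by
      calc _ ≤ 5 * (D:ℝ)^2 * (2 * D) := by gcongr
        _ = _ := by ring
    have m5 : 4 * C0 * (D:ℝ)^3 * ∑ p ∈ P, Real.log p/(p * Real.sqrt p) ≤ 4 * C0 * (D:ℝ)^3 * C2 := by
      have := C0_nonneg
      gcongr
    have m6 : (2 * (D:ℝ)) * ∑ i : GJ D, ∑ p ∈ P, (if (p:ℤ) ∣ aeval (e i) (pderiv 0 f) then (Real.log p/p) else 0) ≤ (2 * (D:ℝ)) * (2 * (D+1)*(D+2) * (Real.log M + 3)) := by gcongr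
    have m7 : 8/3 * (D:ℝ)^3 * (Real.log D - C1 - (Real.log M + 3) - 1) ≤ 8/3 * (D:ℝ)^3 * ∑ p ∈ P, Real.log p / p := by gcongr
    have tot : 8/3 * (D:ℝ)^3 * (k * Real.log p0) + 8/3 * (D:ℝ)^3 * (Real.log D - C1 - (Real.log M + 3) - 1) - 10 * (D:ℝ)^3 - 4 * C0 * (D:ℝ)^3 * C2 - 24 * (D:ℝ)^3 * (Real.log M + 3)
        ≤ 60 * (D:ℝ)^3 + 4/3 * (D:ℝ)^3 * Real.log B + 25 * (D:ℝ)^3 := by linarith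
    have tot2 : (D:ℝ)^3 * (8/3 * (k * Real.log p0 + Real.log D - Real.log B / 2)) ≤ (D:ℝ)^3 * (8/3 * (C1 + Real.log M + 4) + 10 + 4 * C0 * C2 + 24 * (Real.log M + 3) + 85) := by nlinarith
    have tot3 := le_of_mul_le_mul_left tot2 hD3
    have hCC : 0 ≤ C0 * C2 := mul_nonneg C0_nonneg hC2
    nlinarith [mul_nonneg hC1 hlM, mul_nonneg hCC hlM]
  · refine ⟨∑ j, monomial (gexp j) (c j), ?_, ?_, ?_, ?_⟩
    · intro h
      apply hc0
      funext j
      have h2 := congrArg (coeff (gexp j)) h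
      rw [coeff_sum, coeff_zero] at h2
      simp only [coeff_monomial, (gexp_inj D).eq_iff] at h2
      simpa using h2
    · rw [degreeOf_le_iff]
      intro m hm
      obtain ⟨j, _, hj⟩ := Finset.mem_biUnion.1 (support_sum hm)
      have := Finset.mem_singleton.1 (support_monomial_subset hj)
      rw [this, gexp_zero]
      have := j.1.2
      omega
    · refine totalDegree_finsetSum_le fun j _ => (totalDegree_monomial_le _ _).trans ?_
      change (gexp j).degree ≤ _
      rw [gexp_deg]
      have := j.1.2; have := j.2.1.2
      omega
    · intro v hv
      rw [map_sum, ← hcS v hv]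
      refine Finset.sum_congr rfl fun j _ => ?_
      rw [aeval_monomial, aeval_monomial]; simp

end DG

end

section
namespace DG
open MvPolynomial

lemma pool (N : ℕ) (hN : 1 ≤ N) : ∃ P : Finset ℕ, P.card = N ∧ ∀ p ∈ P, p.Prime ∧ p ≤ 16 * N^2 := by
  have h := Chebyshev.pi_ge (16 * N^2)
  have hNr : (1:ℝ) ≤ N := by exact_mod_cast hN
  have hlog : 0 < Real.log ((16 * N^2 : ℕ):ℝ) := Real.log_pos (by push_cast; nlinarith)
  rw [div_le_iff₀ hlog] at h
  push_cast at h hlog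
  have l1 : Real.log (16 * (N:ℝ)^2) ≤ 8 * N := by
    have : (16 * (N:ℝ)^2) = (4 * N)^2 := by ring
    rw [this, Real.log_pow]
    have := Real.log_le_self (show 0 ≤ 4 * (N:ℝ) by positivity)
    push_cast; linarith
  have l2 : Real.log (16 * (N:ℝ)^2 + 1) ≤ 3 * (N:ℝ)^2 := by
    have h1 : Real.log (16 * (N:ℝ)^2 + 1) ≤ Real.log (17 * (N:ℝ)^2) := Real.log_le_log (by positivity) (by nlinarith)
    have h3 : Real.log 17 ≤ 2.9 := by
      rw [Real.log_le_iff_le_exp (by norm_num)]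
      have e1 := Real.exp_one_gt_d9
      have e2 : Real.exp 2.9 = Real.exp 1 ^ 3 * Real.exp (-0.1) := by
        rw [← Real.exp_nat_mul, ← Real.exp_add]; norm_num
      have e3 := Real.add_one_le_exp (-0.1 : ℝ)
      have e4 : (20:ℝ) ≤ Real.exp 1 ^ 3 := by
        calc (20:ℝ) ≤ 2.7182818283^3 := by norm_num
          _ ≤ _ := by gcongr
      rw [e2]
      nlinarith [Real.exp_pos (-0.1 : ℝ)]
    rw [Real.log_mul (by norm_num) (by positivity), Real.log_pow] at h1
    have := Real.log_le_sub_one_of_pos (show (0:ℝ) < N by linarith)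
    push_cast at h1
    nlinarith
  have hl2 := Real.log_two_gt_d9
  have hpi : (N:ℝ) ≤ (Nat.primeCounting (16*N^2) : ℝ) := by
    by_contra hc
    push Not at hc
    have : (Nat.primeCounting (16*N^2) : ℝ) * Real.log (16 * (N:ℝ)^2) ≤ N * (8 * N) := by
      apply mul_le_mul hc.le l1 hlog.le (by positivity)
    nlinarith
  have hpi' : N ≤ Nat.primeCounting (16*N^2) := by exact_mod_cast hpi
  have hcard : (Nat.primesLE (16*N^2)).card = Nat.primeCounting (16*N^2) := by
    simp [Nat.primesLE_card_eq_primeCounting]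
  rw [← hcard] at hpi'
  obtain ⟨P, hP, hPc⟩ := Finset.exists_subset_card_eq hpi'
  exact ⟨P, hPc, fun p hp => ⟨(Nat.mem_primesLE.1 (hP hp)).2, (Nat.mem_primesLE.1 (hP hp)).1⟩⟩

lemma pick_prime {α : Type*} (S : Finset α) (F : α → ℤ) (M : ℕ) (hM : 1 ≤ M) (hF : ∀ v ∈ S, F v ≠ 0)
    (hFM : ∀ v ∈ S, Real.log |(F v : ℝ)| ≤ M) :
    ∃ p : ℕ, p.Prime ∧ p ≤ 256 * M^2 ∧ S.card ≤ 2 * (S.filter fun v => ¬ (p:ℤ) ∣ F v).card := by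
  classical
  obtain ⟨P, hPc, hP⟩ := pool (4*M) (by omega)
  by_contra hcon
  push Not at hcon
  have h1 : ∀ p ∈ P, S.card + 1 ≤ 2 * (S.filter fun v => (p:ℤ) ∣ F v).card := by
    intro p hp
    have h := hcon p (hP p hp).1 (by have := (hP p hp).2; nlinarith)
    have := Finset.card_filter_add_card_filter_not (s := S) (fun v => (p:ℤ) ∣ F v)
    omega
  have h2 : ∀ v ∈ S, (P.filter fun p : ℕ => (p:ℤ) ∣ F v).card ≤ 2 * M := by
    intro v hv
    have h3 := sum_log_primeFactors_le (F v).natAbs (Int.natAbs_ne_zero.2 (hF v hv)) (P.filter fun p : ℕ => (p:ℤ) ∣ F v) (by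
      intro p hp
      rw [Finset.mem_filter] at hp
      exact ⟨(hP p hp.1).1, Int.natCast_dvd.1 hp.2⟩)
    rw [Nat.cast_natAbs, Int.cast_abs] at h3
    have h4 : ((P.filter fun p : ℕ => (p:ℤ) ∣ F v).card : ℝ) * (1/2) ≤ ∑ p ∈ P.filter (fun p : ℕ => (p:ℤ) ∣ F v), Real.log p := by
      rw [← nsmul_eq_mul]
      refine Finset.card_nsmul_le_sum _ _ _ fun p hp => ?_
      rw [Finset.mem_filter] at hp
      have : Real.log 2 ≤ Real.log p := Real.log_le_log (by norm_num) (by exact_mod_cast (hP p hp.1).1.two_le)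
      linarith [Real.log_two_gt_d9]
    have h5 := hFM v hv
    have : ((P.filter fun p : ℕ => (p:ℤ) ∣ F v).card : ℝ) ≤ 2 * M := by linarith
    exact_mod_cast this
  have h3 : ∑ p ∈ P, (S.filter fun v => (p:ℤ) ∣ F v).card = ∑ v ∈ S, (P.filter fun p : ℕ => (p:ℤ) ∣ F v).card := by
    simp only [Finset.card_filter]
    exact Finset.sum_comm
  have h4 : P.card * (S.card + 1) ≤ 2 * ∑ p ∈ P, (S.filter fun v => (p:ℤ) ∣ F v).card := by
    rw [Finset.mul_sum, ← smul_eq_mul]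
    exact Finset.card_nsmul_le_sum _ _ _ h1
  have h5 : ∑ v ∈ S, (P.filter fun p : ℕ => (p:ℤ) ∣ F v).card ≤ S.card * (2*M) := by
    rw [← smul_eq_mul]
    exact Finset.sum_le_card_nsmul _ _ _ h2
  rw [hPc] at h4
  nlinarith

/-- integer point as rational point -/
def zq {n : ℕ} (v : Fin n → ℤ) : Fin n → ℚ := fun j => (v j : ℚ)
lemma zq_inj {n : ℕ} : Function.Injective (zq : (Fin n → ℤ) → _) := by
  intro v w h
  funext j
  have := congrFun h j
  simpa [zq] using this

noncomputable def toQ {n : ℕ} (f : MvPolynomial (Fin n) ℤ) : MvPolynomial (Fin n) ℚ := map (Int.castRingHom ℚ) f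
lemma aeval_toQ {n : ℕ} (f : MvPolynomial (Fin n) ℤ) (v : Fin n → ℤ) : aeval (zq v) (toQ f) = ((aeval v f : ℤ) : ℚ) := by
  rw [← aeval_intCast ℚ v f, toQ]
  simp only [aeval_def, eval₂_map]
  congr 1
lemma aeval_toQ_iff {n : ℕ} (f : MvPolynomial (Fin n) ℤ) (v : Fin n → ℤ) : aeval (zq v) (toQ f) = 0 ↔ aeval v f = 0 := by
  rw [aeval_toQ]; exact Int.cast_eq_zero
lemma toQ_deg {n : ℕ} (f : MvPolynomial (Fin n) ℤ) : (toQ f).totalDegree = f.totalDegree := by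
  rw [toQ, totalDegree, totalDegree, support_map_of_injective _ (RingHom.injective_int (Int.castRingHom ℚ))]
lemma toQ_ne {n : ℕ} (f : MvPolynomial (Fin n) ℤ) : toQ f = 0 ↔ f = 0 := by
  rw [toQ]
  constructor
  · intro h
    exact map_injective _ (RingHom.injective_int (Int.castRingHom ℚ)) (by rw [h, map_zero])
  · rintro rfl; simp
lemma toQ_pderiv {n : ℕ} (f : MvPolynomial (Fin n) ℤ) (i) : toQ (pderiv i f) = pderiv i (toQ f) := by
  rw [toQ, toQ, pderiv_map]
lemma toQ_coeff {n : ℕ} (f : MvPolynomial (Fin n) ℤ) (m) : coeff m (toQ f) = ((coeff m f : ℤ) : ℚ) := by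
  rw [toQ, coeff_map]; rfl

lemma bez_int (P Q : MvPolynomial (Fin 2) ℚ) (hP : Irreducible P) (hPQ : ¬ P ∣ Q) (Z : Finset (Fin 2 → ℤ))
    (hZ : ∀ v ∈ Z, aeval (zq v) P = 0 ∧ aeval (zq v) Q = 0) : Z.card ≤ P.totalDegree * Q.totalDegree := by
  classical
  have hrel : IsRelPrime P Q := (Irreducible.isRelPrime_iff_not_dvd hP).2 hPQ
  have hQ0 : Q ≠ 0 := fun h => hPQ (h ▸ dvd_zero _)
  have := bezout_points P Q hrel hP.ne_zero hQ0 (Z.image zq) (by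
    intro x hx
    obtain ⟨v, hv, rfl⟩ := Finset.mem_image.1 hx
    exact hZ v hv)
  rwa [Finset.card_image_of_injective _ zq_inj] at this

/-- top coefficient under affine substitutions -/
lemma coeff_top_subst {R : Type*} [CommRing R] {m n : ℕ} (P : MvPolynomial (Fin m) R) (d : ℕ) (hd : P.totalDegree ≤ d)
    (l : Fin m → MvPolynomial (Fin (n+1)) R) (hl : ∀ i, (l i).totalDegree ≤ 1) :
    (aeval l P).totalDegree ≤ d ∧
    coeff (Finsupp.single 0 d) (aeval l P) = aeval (fun i => coeff (Finsupp.single 0 1) (l i)) (homogeneousComponent d P) := by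
  classical
  have hpow : ∀ i e, ((l i)^e).totalDegree ≤ e ∧ coeff (Finsupp.single 0 e) ((l i)^e) = (coeff (Finsupp.single 0 1) (l i))^e := by
    intro i e
    induction e with
    | zero => simp
    | succ e ih =>
      rw [pow_succ, pow_succ]
      refine ⟨(totalDegree_mul _ _).trans (Nat.add_le_add ih.1 (hl i)), ?_⟩
      rw [coeff_top_mul _ _ _ _ ih.1 (hl i), ih.2]
  have hprod : ∀ (s : Finset (Fin m)) (e : Fin m → ℕ), (∏ i ∈ s, (l i)^(e i)).totalDegree ≤ ∑ i ∈ s, e i ∧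
      coeff (Finsupp.single 0 (∑ i ∈ s, e i)) (∏ i ∈ s, (l i)^(e i)) = ∏ i ∈ s, (coeff (Finsupp.single 0 1) (l i))^(e i) := by
    intro s e
    induction s using Finset.induction_on with
    | empty => simp
    | insert a s ha ih =>
      rw [Finset.prod_insert ha, Finset.sum_insert ha, Finset.prod_insert ha]
      refine ⟨(totalDegree_mul _ _).trans (Nat.add_le_add (hpow a _).1 ih.1), ?_⟩
      rw [coeff_top_mul _ _ _ _ (hpow a _).1 ih.1, ih.2, (hpow a _).2]
  have hmon : ∀ e : Fin m →₀ ℕ, ∀ c : R, e.degree ≤ d → (aeval l (monomial e c)).totalDegree ≤ d ∧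
      coeff (Finsupp.single 0 d) (aeval l (monomial e c)) = aeval (fun i => coeff (Finsupp.single 0 1) (l i)) (homogeneousComponent d (monomial e c)) := by
    intro e c he
    have hh := hprod Finset.univ e
    rw [← Finsupp.degree_eq_sum] at hh
    rw [aeval_monomial, Finsupp.prod_fintype _ _ (by simp), algebraMap_eq]
    refine ⟨(totalDegree_mul _ _).trans (by rw [totalDegree_C]; omega), ?_⟩
    rw [coeff_C_mul]
    rcases he.lt_or_eq with hlt | heq
    · rw [coeff_eq_zero_of_totalDegree_lt (lt_of_le_of_lt hh.1 ?_), mul_zero, homogeneousComponent_of_mem (isHomogeneous_monomial c rfl), if_neg hlt.ne', map_zero]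
      change e.degree < (Finsupp.single 0 d : Fin (n+1) →₀ ℕ).degree
      rw [Finsupp.degree_single]; exact hlt
    · rw [← heq, hh.2, homogeneousComponent_of_mem (isHomogeneous_monomial c rfl), if_pos rfl, aeval_monomial, Finsupp.prod_fintype _ _ (by simp)]
      rfl
  constructor
  · conv_lhs => rw [P.as_sum, map_sum]
    exact totalDegree_finsetSum_le fun e he => (hmon e _ ((le_totalDegree he).trans hd)).1
  · conv_lhs => rw [P.as_sum, map_sum, coeff_sum]
    conv_rhs => rw [P.as_sum, map_sum, map_sum]
    exact Finset.sum_congr rfl fun e he => (hmon e _ ((le_totalDegree he).trans hd)).2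

end DG

end

section
namespace DG
open MvPolynomial

lemma monom_eval_le' {n : ℕ} (m : Fin n →₀ ℕ) (v : Fin n → ℤ) (B : ℕ) (hv : ∀ i, |v i| ≤ B) :
    |aeval v (monomial m (1:ℤ))| ≤ (B:ℤ)^m.degree := by
  rw [aeval_monomial, Finsupp.prod_fintype _ _ (by simp), map_one, one_mul, Finset.abs_prod, Finsupp.degree_eq_sum, ← Finset.prod_pow_eq_pow_sum]
  refine Finset.prod_le_prod (fun _ _ => abs_nonneg _) fun i _ => ?_
  rw [abs_pow]
  exact pow_le_pow_left₀ (abs_nonneg _) (hv i) _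

lemma not_dvd_of_degreeOf_lt {k : Type*} [Field k] {n : ℕ} (i : Fin n) (f g : MvPolynomial (Fin n) k) (hg : g ≠ 0)
    (h : g.degreeOf i < f.degreeOf i) : ¬ f ∣ g := by
  rintro ⟨q, rfl⟩
  rw [degreeOf_mul_eq (left_ne_zero_of_mul hg) (right_ne_zero_of_mul hg)] at h
  omega

lemma degreeOf_pderiv_lt {R : Type*} [CommRing R] {n : ℕ} (i : Fin n) (f : MvPolynomial (Fin n) R) (h : 0 < f.degreeOf i) :
    (pderiv i f).degreeOf i < f.degreeOf i := by
  classical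
  have : (pderiv i f).degreeOf i ≤ f.degreeOf i - 1 := by
    rw [degreeOf_le_iff]
    intro m hm
    rw [mem_support_iff, coeff_pderiv] at hm
    have : m + Finsupp.single i 1 ∈ f.support := by
      rw [mem_support_iff]; exact left_ne_zero_of_mul hm
    have := (degreeOf_le_iff (d := f.degreeOf i)).1 le_rfl _ this
    simp at this
    omega
  omega

lemma degreeOf_of_coeff_top {R : Type*} [CommRing R] {n : ℕ} (i : Fin n) (f : MvPolynomial (Fin n) R) (d : ℕ)
    (h : coeff (Finsupp.single i d) f ≠ 0) : d ≤ f.degreeOf i := by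
  have := (degreeOf_le_iff (n := i) (d := f.degreeOf i) (f := f)).1 le_rfl _ (mem_support_iff.2 h)
  simpa using this

lemma pderiv_ne_zero_of_top {R : Type*} [CommRing R] [IsDomain R] [CharZero R] {n : ℕ} (i : Fin n) (f : MvPolynomial (Fin n) R) (d : ℕ)
    (h : coeff (Finsupp.single i (d+1)) f ≠ 0) : pderiv i f ≠ 0 := by
  intro h0
  have := coeff_pderiv (i := i) f (Finsupp.single i d)
  rw [h0, coeff_zero, ← Finsupp.single_add, Finsupp.single_eq_same] at this
  have := (mul_eq_zero.1 this.symm).resolve_left h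
  exact Nat.cast_add_one_ne_zero d this

/-- auxiliary polynomial for one residue class on a plane curve -/
lemma cb_class (f : MvPolynomial (Fin 2) ℤ) (p k D B : ℕ) (hp : p.Prime) (hk : 1 ≤ k) (hD : 1 ≤ D) (hB : 1 ≤ B)
    (hBD : Real.log B ≤ D) (hkp : Real.log B / 2 + 3 ≤ k * Real.log p) (S : Set (Fin 2 → ℤ))
    (hS : ∀ v ∈ S, aeval v f = 0 ∧ (∀ i, |v i| ≤ (B:ℤ)) ∧ ¬ (p:ℤ) ∣ aeval v (pderiv 0 f))
    (hcls : ∀ v ∈ S, ∀ w ∈ S, cls p k v = cls p k w) :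
    ∃ g : MvPolynomial (Fin 2) ℤ, g ≠ 0 ∧ g.degreeOf 0 ≤ 1 ∧ g.totalDegree ≤ D + 1 ∧ ∀ v ∈ S, aeval v g = 0 := by
  classical
  let ex : Fin 2 × Fin (D+1) → (Fin 2 →₀ ℕ) := fun j => Finsupp.single 0 j.1.1 + Finsupp.single 1 j.2.1
  have ex0 : ∀ j, ex j 0 = j.1.1 := fun j => by simp [ex]
  have ex1 : ∀ j, ex j 1 = j.2.1 := fun j => by simp [ex]
  have exd : ∀ j, (ex j).degree = j.1.1 + j.2.1 := fun j => by simp [ex]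
  have exi : Function.Injective ex := by
    intro a b h
    have h0 := congrArg (fun m => m 0) h
    have h1 := congrArg (fun m => m 1) h
    simp only [ex0, ex1] at h0 h1
    exact Prod.ext (Fin.ext h0) (Fin.ext h1)
  rcases rank_siegel S (fun (j : Fin 2 × Fin (D+1)) v => aeval v (monomial (ex j) (1:ℤ))) (B^(D+1)) (Nat.one_le_pow _ _ hB) (by
    intro v hv j
    refine (monom_eval_le' _ _ B (hS v hv).2.1).trans ?_
    push_cast
    apply pow_le_pow_right₀ (by exact_mod_cast hB)
    rw [exd]; omega) with ⟨e, heS, hdet⟩ | ⟨c, hc0, hcS, _⟩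
  · exfalso
    have h1 := det_local f p k (2*D+1) hp hk e (fun i => (hS _ (heS i)).1) (fun j => monomial (ex j) (1:ℤ)) Finset.univ
      (fun i _ => (hS _ (heS i)).2.2) {cls p k (e (0,0))} (fun i _ => by
        rw [Finset.mem_singleton]; exact hcls _ (heS i) _ (heS _))
    have h2 := BB_one (2*D+1)
    rw [Finset.card_univ, Fintype.card_prod, Fintype.card_fin, Fintype.card_fin, Finset.card_singleton, one_mul] at h1
    have h3 : (2*D+1) * (2 * (D+1)) - BB 1 (2*D+1) = (2*D+1)*(D+1) := by
      have : BB 1 (2*D+1) = (2*D+1)*(D+1) := by nlinarith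
      rw [this]
      have : (2*D+1) * (2 * (D+1)) = 2 * ((2*D+1)*(D+1)) := by ring
      omega
    rw [h3] at h1
    have h4 := det_abs_le (Matrix.of fun i j => aeval (e i) (monomial (ex j) (1:ℤ))) (fun j => (B:ℤ)^(ex j).degree) (fun i j => by
      exact monom_eval_le' _ _ B (hS _ (heS i)).2.1)
    rw [Finset.prod_pow_eq_pow_sum, Fintype.card_prod, Fintype.card_fin, Fintype.card_fin] at h4
    have h5 : ∑ j, (ex j).degree = (D+1)^2 := by
      simp only [exd]
      rw [Fintype.sum_prod_type, Fin.sum_univ_two]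
      have : ∑ x : Fin (D+1), (x:ℕ) = ∑ x ∈ Finset.range (D+1), x := Fin.sum_univ_eq_sum_range (fun i => i) _
      simp only [Fin.val_zero, Fin.val_one, zero_add, Finset.sum_add_distrib, this]
      have := Finset.sum_range_id_mul_two (D+1)
      simp at this ⊢
      nlinarith
    rw [h5] at h4
    have h6 := Int.le_of_dvd (abs_pos.2 hdet) ((dvd_abs _ _).2 h1)
    have h7 := h6.trans h4
    have h8 : ((p:ℝ)^k)^((2*D+1)*(D+1)) ≤ ((2*(D+1)).factorial : ℝ) * (B:ℝ)^((D+1)^2) := by exact_mod_cast h7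
    have hp0 : (0:ℝ) < p := by exact_mod_cast hp.pos
    have hB0 : (0:ℝ) < B := by exact_mod_cast hB
    have h9 := Real.log_le_log (by positivity) h8
    rw [Real.log_mul (by positivity) (by positivity), Real.log_pow, Real.log_pow, Real.log_pow] at h9
    have h10 : Real.log ((2*(D+1)).factorial : ℝ) ≤ (2*(D+1)) * (2*D+1) := by
      have : ((2*(D+1)).factorial : ℝ) ≤ (2*(D+1):ℝ)^(2*(D+1)) := by exact_mod_cast Nat.factorial_le_pow _
      refine (Real.log_le_log (by positivity) this).trans ?_
      rw [Real.log_pow]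
      push_cast
      have := Real.log_le_sub_one_of_pos (show (0:ℝ) < 2*(D+1) by positivity)
      have h : (0:ℝ) ≤ 2*(D+1) := by positivity
      nlinarith
    push_cast at h9
    have hDr : (1:ℝ) ≤ D := by exact_mod_cast hD
    have h11 : (2*(D:ℝ)+1) * (Real.log B/2+3) * (D+1) ≤ (2*D+1)*(D+1) * (k * Real.log p) := by
      have : (0:ℝ) ≤ (2*D+1)*(D+1) := by positivity
      nlinarith
    have h12 : (2*(D:ℝ)+1) * (Real.log B/2+3) * (D+1) ≤ (2 * (2*D+1) + (D+1) * Real.log B) * (D+1) := by nlinarith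
    have h13 := le_of_mul_le_mul_right h12 (by positivity)
    nlinarith
  · refine ⟨∑ j, monomial (ex j) (c j), ?_, ?_, ?_, ?_⟩
    · obtain ⟨j, hj⟩ := Function.ne_iff.1 hc0
      intro h
      apply hj
      have := congrArg (coeff (ex j)) h
      rw [coeff_sum, Finset.sum_eq_single j] at this
      · simpa using this
      · intro b _ hb
        rw [coeff_monomial, if_neg fun h => hb (exi h)]
      · simp
    · refine (degreeOf_sum_le _ _ _).trans (Finset.sup_le fun j _ => ?_)
      rw [degreeOf_le_iff]
      intro m hm
      have := support_monomial_subset hm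
      rw [Finset.mem_singleton] at this
      rw [this, ex0]; omega
    · refine totalDegree_finsetSum_le fun j _ => (totalDegree_monomial_le _ _).trans ?_
      change (ex j).degree ≤ _
      rw [exd]; omega
    · intro v hv
      rw [map_sum, ← hcS v hv]
      refine Finset.sum_congr rfl fun j _ => ?_
      simp [aeval_monomial]

lemma exists_pow_mid (p : ℕ) (hp : 2 ≤ p) (x : ℝ) (hx : 1 ≤ x) : ∃ k : ℕ, 1 ≤ k ∧ x ≤ (p:ℝ)^k ∧ (p:ℝ)^k ≤ p * x := by
  have hp1 : (1:ℝ) < p := by exact_mod_cast hp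
  obtain ⟨n, h1, h2⟩ := exists_nat_pow_near hx hp1
  refine ⟨n+1, by omega, h2.le, ?_⟩
  rw [pow_succ, mul_comm]
  gcongr

/-- curve bound, core -/
lemma cb_core (f : MvPolynomial (Fin 2) ℤ) (δ L : ℕ) (hirr : Irreducible (toQ f)) (hdeg : f.totalDegree = δ) (h2 : 2 ≤ δ) (hL : δ ≤ L)
    (htop : coeff (Finsupp.single 0 δ) f ≠ 0) (B D M : ℕ) (hB : 1 ≤ B) (hD : 1 ≤ D) (hM : 1 ≤ M) (hBD : Real.log B ≤ D)
    (Z : Finset (Fin 2 → ℤ)) (hZ : ∀ v ∈ Z, aeval v f = 0 ∧ (∀ i, |v i| ≤ (B:ℤ)) ∧ Real.log |((aeval v (pderiv 0 f) : ℤ):ℝ)| ≤ M) :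
    (Z.card : ℝ) ≤ L^2 + 2 * ((256 * M^2)^2 * (30 * Real.sqrt B)) * (L * (D+1)) := by
  classical
  set Z1 := Z.filter fun v => aeval v (pderiv 0 f) = 0
  set Z2 := Z.filter fun v => ¬ aeval v (pderiv 0 f) = 0
  have hdegO : δ ≤ (toQ f).degreeOf 0 := degreeOf_of_coeff_top 0 _ _ (by rw [toQ_coeff]; exact_mod_cast htop)
  have h1 : Z1.card ≤ L^2 := by
    have hz : pderiv 0 (toQ f) ≠ 0 := pderiv_ne_zero_of_top 0 _ (δ-1) (by
      rw [Nat.sub_add_cancel (by omega), toQ_coeff]; exact_mod_cast htop)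
    have := bez_int (toQ f) (pderiv 0 (toQ f)) hirr (not_dvd_of_degreeOf_lt 0 _ _ hz (degreeOf_pderiv_lt _ _ (by omega))) Z1 (by
      intro v hv
      rw [Finset.mem_filter] at hv
      rw [← toQ_pderiv, aeval_toQ_iff, aeval_toQ_iff]
      exact ⟨(hZ v hv.1).1, hv.2⟩)
    refine this.trans ?_
    rw [sq]
    refine Nat.mul_le_mul ?_ ((totalDegree_pderiv_le _ _).trans ?_) <;> rw [toQ_deg] <;> omega
  obtain ⟨p, hp, hpM, hp2⟩ := pick_prime Z2 (fun v => aeval v (pderiv 0 f)) M hM (fun v hv => (Finset.mem_filter.1 hv).2)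
    (fun v hv => (hZ v (Finset.mem_filter.1 hv).1).2.2)
  set Z3 := Z2.filter fun v => ¬ (p:ℤ) ∣ aeval v (pderiv 0 f)
  have hsB : 1 ≤ Real.sqrt B := by rw [Real.one_le_sqrt]; exact_mod_cast hB
  obtain ⟨k, hk1, hk2, hk3⟩ := exists_pow_mid p hp.two_le (30 * Real.sqrt B) (by linarith)
  have hB0 : (0:ℝ) < B := by exact_mod_cast hB
  have hkp : Real.log B / 2 + 3 ≤ k * Real.log p := by
    have := Real.log_le_log (by positivity) hk2
    rw [Real.log_pow, Real.log_mul (by norm_num) (by positivity), Real.log_sqrt hB0.le] at this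
    have h30 : 3 ≤ Real.log 30 := by
      rw [Real.le_log_iff_exp_le (by norm_num)]
      have h := Real.exp_one_lt_d9
      have : Real.exp 3 = (Real.exp 1)^3 := by rw [← Real.exp_nat_mul]; norm_num
      rw [this]
      calc (Real.exp 1)^3 ≤ 2.72^3 := by gcongr; linarith
        _ ≤ 30 := by norm_num
    linarith
  haveI : NeZero (p^k) := ⟨(pow_pos hp.pos k).ne'⟩
  haveI : NeZero p := ⟨hp.pos.ne'⟩
  have h3 : Z3.card ≤ (p^k * p) * (L * (D+1)) := by
    have := Finset.card_le_mul_card_image_of_maps_to (f := fun v => cls p k v) (s := Z3) (t := Finset.univ) (fun _ _ => Finset.mem_univ _) (L * (D+1)) (by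
      intro c _
      obtain ⟨g, hg0, hg1, hg2, hg3⟩ := cb_class f p k D B hp hk1 hD hB hBD hkp {v | v ∈ Z3 ∧ cls p k v = c} (by
        rintro v ⟨hv, _⟩
        have h := Finset.mem_filter.1 hv
        have h' := hZ v (Finset.mem_filter.1 h.1).1
        exact ⟨h'.1, h'.2.1, h.2⟩) (fun v hv w hw => hv.2.trans hw.2.symm)
      have hgd : (toQ g).degreeOf 0 ≤ 1 := by
        rw [degreeOf_le_iff] at hg1 ⊢
        intro m hm
        apply hg1
        rw [mem_support_iff, toQ_coeff] at hm
        rw [mem_support_iff]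
        exact_mod_cast hm
      have := bez_int (toQ f) (toQ g) hirr (not_dvd_of_degreeOf_lt 0 _ _ (by rwa [Ne, toQ_ne]) (by omega)) (Z3.filter fun v => cls p k v = c) (by
        intro v hv
        have hv' := Finset.mem_filter.1 hv
        rw [aeval_toQ_iff, aeval_toQ_iff]
        exact ⟨(hZ v (Finset.mem_filter.1 (Finset.mem_filter.1 hv'.1).1).1).1, hg3 v hv'⟩)
      refine this.trans ?_
      rw [toQ_deg, toQ_deg]
      exact Nat.mul_le_mul (by omega) hg2)
    rw [Finset.card_univ, Fintype.card_prod, Fintype.card_fun, ZMod.card, ZMod.card, Fintype.card_fin, pow_one] at this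
    rw [mul_comm]; exact this
  have h4 : Z.card = Z1.card + Z2.card := (Finset.card_filter_add_card_filter_not _).symm
  have h5 : Z.card ≤ L^2 + 2 * ((p^k*p) * (L * (D+1))) := by omega
  have h6 : (Z.card : ℝ) ≤ L^2 + 2 * (((p:ℝ)^k*p) * (L * (D+1))) := by exact_mod_cast h5
  refine h6.trans ?_
  have hpM' : (p:ℝ) ≤ 256 * M^2 := by exact_mod_cast hpM
  have : (p:ℝ)^k * p ≤ (256 * M^2)^2 * (30 * Real.sqrt B) := by
    calc (p:ℝ)^k * p ≤ (p * (30 * Real.sqrt B)) * p := by gcongr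
      _ = p^2 * (30 * Real.sqrt B) := by ring
      _ ≤ _ := by gcongr
  have h0 : (0:ℝ) ≤ L * (D+1) := by positivity
  have := mul_le_mul_of_nonneg_right this h0
  linarith

end DG

end

section
namespace DG
open MvPolynomial

/-- replacing a rational polynomial by a small integral one -/
lemma height_red {r : ℕ} (S : Set (Fin r → ℤ)) (B δ : ℕ) (hB : 1 ≤ B) (hS : ∀ v ∈ S, ∀ i, |v i| ≤ (B:ℤ))
    (P : MvPolynomial (Fin r) ℚ) (hP0 : P ≠ 0) (hPd : P.totalDegree ≤ δ) (hPS : ∀ v ∈ S, aeval (zq v) P = 0) :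
    ∃ Q : MvPolynomial (Fin r) ℤ, Q ≠ 0 ∧ Q.totalDegree ≤ δ ∧ (∀ v ∈ S, aeval v Q = 0) ∧
      ∀ m, |coeff m Q| ≤ (((tix r (δ+1)).card * B^δ)^((tix r (δ+1)).card) : ℕ) := by
  classical
  rcases rank_siegel S (fun (j : tix r (δ+1)) v => aeval v (monomial j.1 (1:ℤ))) (B^δ) (Nat.one_le_pow _ _ hB) (by
    intro v hv j
    refine (monom_eval_le' _ _ B (hS v hv)).trans ?_
    push_cast
    apply pow_le_pow_right₀ (by exact_mod_cast hB)
    have := mem_tix.1 j.2; omega) with ⟨e, heS, hdet⟩ | ⟨c, hc0, hcS, hc⟩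
  · exfalso
    have h := det_zero_of_rel S (fun (j : tix r (δ+1)) v => aeval (zq v) (monomial j.1 (1:ℚ))) (fun j => coeff j.1 P) (by
      intro h
      apply hP0
      ext m
      rw [coeff_zero]
      by_cases hm : m.degree < δ+1
      · exact congrFun h ⟨m, mem_tix.2 hm⟩
      · apply coeff_eq_zero_of_totalDegree_lt
        change _ < m.degree
        omega) (by
      intro v hv
      rw [← hPS v hv]
      conv_rhs => rw [P.as_sum, map_sum]
      rw [Finset.sum_coe_sort (tix r (δ+1)) (fun m => coeff m P * aeval (zq v) (monomial m (1:ℚ)))]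
      symm
      have hsub : P.support ⊆ tix r (δ+1) := by
        intro m hm
        have h1 : m.degree ≤ _ := (le_totalDegree hm).trans hPd
        rw [mem_tix]; omega
      rw [Finset.sum_subset hsub]
      · refine Finset.sum_congr rfl fun m _ => ?_
        simp [aeval_monomial]
      · intro m _ hm
        rw [notMem_support_iff.1 hm]; simp) e heS
    apply hdet
    have h2 : (Matrix.of fun i j => aeval (zq (e i)) (monomial j.1 (1:ℚ))) =
        (Int.castRingHom ℚ).mapMatrix (Matrix.of fun i j : tix r (δ+1) => aeval (e i) (monomial j.1 (1:ℤ))) := by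
      ext i j
      simp [aeval_monomial, zq, Finsupp.prod]
    rw [h2, ← RingHom.map_det] at h
    simpa using h
  · refine ⟨∑ j : tix r (δ+1), monomial j.1 (c j), ?_, ?_, ?_, ?_⟩
    · obtain ⟨j, hj⟩ := Function.ne_iff.1 hc0
      intro h
      apply hj
      have := congrArg (coeff j.1) h
      rw [coeff_sum, Finset.sum_eq_single j] at this
      · simpa using this
      · intro b _ hb
        rw [coeff_monomial, if_neg fun h => hb (Subtype.ext h)]
      · simp
    · refine totalDegree_finsetSum_le fun j _ => (totalDegree_monomial_le _ _).trans ?_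
      change j.1.degree ≤ _
      have := mem_tix.1 j.2; omega
    · intro v hv
      rw [map_sum, ← hcS v hv]
      refine Finset.sum_congr rfl fun j _ => ?_
      simp [aeval_monomial]
    · intro m
      rw [coeff_sum]
      by_cases hm : m ∈ tix r (δ+1)
      · rw [Finset.sum_eq_single ⟨m, hm⟩]
        · rw [coeff_monomial, if_pos rfl]
          have := hc ⟨m, hm⟩
          rwa [Fintype.card_coe] at this
        · intro b _ hb
          rw [coeff_monomial, if_neg fun h => hb (Subtype.ext h)]
        · simp
      · rw [Finset.sum_eq_zero]
        · simp; positivity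
        · intro j _
          rw [coeff_monomial, if_neg]
          rintro rfl; exact hm j.2

lemma pderiv_eval_le {r : ℕ} (i : Fin r) (f : MvPolynomial (Fin r) ℤ) (δ B K : ℕ) (hB : 1 ≤ B) (hd : f.totalDegree ≤ δ)
    (hK : ∀ m, |coeff m f| ≤ K) (v : Fin r → ℤ) (hv : ∀ i, |v i| ≤ (B:ℤ)) :
    |aeval v (pderiv i f)| ≤ ((tix r (δ+1)).card * (K * δ * B^δ) : ℕ) := by
  classical
  have hsub : f.support ⊆ tix r (δ+1) := by
    intro m hm
    have h1 : m.degree ≤ _ := (le_totalDegree hm).trans hd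
    rw [mem_tix]; omega
  conv_lhs => rw [f.as_sum, map_sum, map_sum]
  refine (Finset.abs_sum_le_sum_abs _ _).trans ?_
  refine (Finset.sum_le_card_nsmul _ _ ((K * δ * B^δ : ℕ):ℤ) ?_).trans ?_
  · intro m hm
    have hmd : m.degree ≤ δ := (le_totalDegree hm).trans hd
    rw [pderiv_monomial]
    have h1 : monomial (m - Finsupp.single i 1) (coeff m f * (m i : ℤ)) = C (coeff m f * (m i:ℤ)) * monomial (m - Finsupp.single i 1) 1 := by
      rw [C_mul_monomial, mul_one]
    rw [h1, map_mul, aeval_C, abs_mul]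
    push_cast
    have h2 : |(algebraMap ℤ ℤ) (coeff m f * (m i : ℤ))| ≤ K * δ := by
      rw [eq_intCast, Int.cast_id, abs_mul]
      refine mul_le_mul (hK m) ?_ (abs_nonneg _) (by positivity)
      rw [abs_of_nonneg (by positivity)]
      have : m i ≤ m.degree := Finsupp.le_degree i m
      exact_mod_cast this.trans hmd
    refine mul_le_mul h2 ((monom_eval_le' _ _ B hv).trans ?_) (abs_nonneg _) (by positivity)
    apply pow_le_pow_right₀ (by exact_mod_cast hB)
    exact (Finsupp.degree_mono (tsub_le_self)).trans hmd
  · rw [nsmul_eq_mul]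
    push_cast
    have := Finset.card_le_card hsub
    gcongr

lemma log_pderiv_le {r : ℕ} (i : Fin r) (f : MvPolynomial (Fin r) ℤ) (δ B N : ℕ) (hB : 1 ≤ B) (hd : f.totalDegree ≤ δ)
    (hN : (tix r (δ+1)).card ≤ N) (hN1 : 1 ≤ N) (hδ : δ ≤ N)
    (hK : ∀ m, |coeff m f| ≤ (((tix r (δ+1)).card * B^δ)^((tix r (δ+1)).card) : ℕ)) (v : Fin r → ℤ) (hv : ∀ i, |v i| ≤ (B:ℤ)) :
    Real.log |((aeval v (pderiv i f) : ℤ) : ℝ)| ≤ (N+2) * (N + δ * Real.log B) := by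
  have hB0 : (1:ℝ) ≤ B := by exact_mod_cast hB
  have hlB : 0 ≤ Real.log B := Real.log_natCast_nonneg B
  by_cases h0 : aeval v (pderiv i f) = 0
  · rw [h0]; simp; positivity
  have hK' : ∀ m, |coeff m f| ≤ ((N * B^δ)^N : ℕ) := by
    intro m
    refine (hK m).trans ?_
    have h1 : ((tix r (δ+1)).card * B^δ)^((tix r (δ+1)).card) ≤ (N * B^δ)^((tix r (δ+1)).card) := Nat.pow_le_pow_left (Nat.mul_le_mul_right _ hN) _
    have h2 : (N * B^δ)^((tix r (δ+1)).card) ≤ (N * B^δ)^N := Nat.pow_le_pow_right (Nat.mul_pos hN1 (pow_pos hB _)) hN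
    exact_mod_cast h1.trans h2
  have h1 := pderiv_eval_le i f δ B _ hB hd hK' v hv
  have h2 : (tix r (δ+1)).card * ((N * B^δ)^N * δ * B^δ) ≤ (N * B^δ)^(N+2) := by
    have h3 : 1 ≤ B^δ := Nat.one_le_pow _ _ hB
    calc (tix r (δ+1)).card * ((N * B^δ)^N * δ * B^δ) ≤ N * ((N * B^δ)^N * N * (B^δ)) := by gcongr
      _ = (N * B^δ)^N * (N^2 * (B^δ)^1) := by ring
      _ ≤ (N * B^δ)^N * (N^2 * (B^δ)^2) := by gcongr; norm_num
      _ = _ := by ring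
  have h4 : |((aeval v (pderiv i f) : ℤ) : ℝ)| ≤ ((N:ℝ) * B^δ)^(N+2) := by
    have := h1.trans (Int.ofNat_le.2 h2)
    exact_mod_cast this
  have hN0 : (1:ℝ) ≤ N := by exact_mod_cast hN1
  refine (Real.log_le_log (by positivity) h4).trans ?_
  rw [Real.log_pow, Real.log_mul (by positivity) (by positivity), Real.log_pow]
  push_cast
  have := Real.log_le_sub_one_of_pos (show (0:ℝ) < N by linarith)
  gcongr
  linarith

lemma log_le_lam (B : ℕ) : Real.log B ≤ (Nat.log 2 B + 1 : ℕ) := by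
  rcases Nat.eq_zero_or_pos B with rfl | hB
  · simp
  have h : B < 2^(Nat.log 2 B + 1) := Nat.lt_pow_succ_log_self (by norm_num) B
  have h1 : (B:ℝ) ≤ 2^(Nat.log 2 B+1) := by exact_mod_cast h.le
  refine (Real.log_le_log (by exact_mod_cast hB) h1).trans ?_
  rw [Real.log_pow]
  have := Real.log_two_lt_d9
  have h0 : (0:ℝ) ≤ (Nat.log 2 B + 1 : ℕ) := by positivity
  nlinarith

lemma dvd_eq_C_mul {k : Type*} [Field k] {n : ℕ} (P Q : MvPolynomial (Fin n) k) (h : P ∣ Q) (hQ : Q ≠ 0) (hd : Q.totalDegree ≤ P.totalDegree) :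
    ∃ c : k, c ≠ 0 ∧ Q = C c * P := by
  obtain ⟨q, rfl⟩ := h
  rw [totalDegree_mul_of_isDomain (left_ne_zero_of_mul hQ) (right_ne_zero_of_mul hQ)] at hd
  have : q = C (coeff 0 q) := (totalDegree_eq_zero_iff_eq_C).1 (by omega)
  refine ⟨coeff 0 q, ?_, by rw [← this, mul_comm]⟩
  intro h
  rw [h, map_zero] at this
  exact right_ne_zero_of_mul hQ this

/-- curve bound with nonzero top coefficient -/
lemma cb_top (P : MvPolynomial (Fin 2) ℚ) (L : ℕ) (hirr : Irreducible P) (h2 : 2 ≤ P.totalDegree) (hL : P.totalDegree ≤ L)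
    (htop : coeff (Finsupp.single 0 P.totalDegree) P ≠ 0) (B l : ℕ) (hB : 1 ≤ B) (hl : Real.log B ≤ l) (hl1 : 1 ≤ l)
    (Z : Finset (Fin 2 → ℤ)) (hZ : ∀ v ∈ Z, aeval (zq v) P = 0 ∧ (∀ i, |v i| ≤ (B:ℤ))) :
    (Z.card : ℝ) ≤ L^2 + 2 * ((256 * (20 * L^4 * l)^2)^2 * (30 * Real.sqrt B)) * (L * (l+1)) := by
  classical
  obtain ⟨Q, hQ0, hQd, hQZ, hQc⟩ := height_red (Z : Set (Fin 2 → ℤ)) B P.totalDegree hB (fun v hv => (hZ v hv).2) P hirr.ne_zero le_rfl (fun v hv => (hZ v hv).1)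
  by_cases hdv : P ∣ toQ Q
  · obtain ⟨c, hc0, hc⟩ := dvd_eq_C_mul P (toQ Q) hdv (by rwa [Ne, toQ_ne]) (by rwa [toQ_deg])
    have hu : IsUnit (C c : MvPolynomial (Fin 2) ℚ) := (isUnit_iff_ne_zero.2 hc0).map C
    have hdeg : Q.totalDegree = P.totalDegree := by
      rw [← toQ_deg, hc, totalDegree_mul_of_isDomain (by simpa using hc0) hirr.ne_zero, totalDegree_C, zero_add]
    have hN : (tix 2 (P.totalDegree+1)).card ≤ (L+1)^2 := by
      have := tix_two (P.totalDegree+1)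
      have h3 : (P.totalDegree+1)*(P.totalDegree+1+1) ≤ (L+1)*(L+1+1) := by gcongr
      nlinarith
    have := cb_core Q P.totalDegree L (by rw [hc]; exact (irreducible_isUnit_mul hu).2 hirr) hdeg h2 hL (by
      intro h
      have h3 := toQ_coeff Q (Finsupp.single 0 P.totalDegree)
      rw [h, hc, coeff_C_mul] at h3
      simp [hc0, htop] at h3) B l (20 * L^4 * l) hB hl1 (by
        have : 1 ≤ L^4 := Nat.one_le_pow _ _ (by omega)
        nlinarith) hl Z (by
        intro v hv
        refine ⟨hQZ v hv, (hZ v hv).2, ?_⟩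
        refine (log_pderiv_le 0 Q P.totalDegree B ((L+1)^2) hB hQd hN (Nat.one_le_pow _ _ (by omega)) (by nlinarith) hQc v (hZ v hv).2).trans ?_
        push_cast
        have hLr : (2:ℝ) ≤ L := by exact_mod_cast h2.trans hL
        have hlr : (1:ℝ) ≤ l := by exact_mod_cast hl1
        have hPL : (P.totalDegree:ℝ) ≤ L := by exact_mod_cast hL
        have a1 : ((L:ℝ)+1)^2 + 2 ≤ 4 * L^2 := by nlinarith
        have a2 : ((L:ℝ)+1)^2 + P.totalDegree * Real.log B ≤ 5 * L^2 * l := by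
          have a3 : P.totalDegree * Real.log B ≤ L * l := mul_le_mul hPL hl (Real.log_natCast_nonneg B) (by positivity)
          have a4 : ((L:ℝ)+1)^2 ≤ 4 * L^2 := by nlinarith
          have a5 : (L:ℝ) * l ≤ L^2 * l := by
            have : (L:ℝ) ≤ L^2 := by nlinarith
            gcongr
          have a6 : (L:ℝ)^2 ≤ L^2 * l := by nlinarith [sq_nonneg (L:ℝ)]
          linarith
        calc _ ≤ 4 * (L:ℝ)^2 * (5 * L^2 * l) := mul_le_mul a1 a2 (by
                have := Real.log_natCast_nonneg B
                positivity) (by positivity)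
          _ = _ := by ring)
    push_cast at this
    exact this
  · have h1 := bez_int P (toQ Q) hirr hdv Z (fun v hv => ⟨(hZ v hv).1, by rw [aeval_toQ_iff]; exact hQZ v hv⟩)
    have h3 : Z.card ≤ L^2 := by
      refine h1.trans ?_
      rw [sq, toQ_deg]
      exact Nat.mul_le_mul hL (hQd.trans hL)
    have h4 : (Z.card:ℝ) ≤ L^2 := by exact_mod_cast h3
    refine h4.trans (le_add_of_nonneg_right (by positivity))

end DG

end

section
namespace DG
open MvPolynomial

lemma hom_scale {R A : Type*} [CommRing R] [CommRing A] [Algebra R A] {σ : Type*} (P : MvPolynomial σ R) (d : ℕ) (hP : P.IsHomogeneous d)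
    (c : A) (v : σ → A) : aeval (fun i => c * v i) P = c^d * aeval v P := by
  rw [aeval_def, aeval_def, eval₂_eq, eval₂_eq, Finset.mul_sum]
  refine Finset.sum_congr rfl fun m hm => ?_
  have h : m.degree = d := by
    by_contra h
    exact (mem_support_iff.1 hm) (hP.coeff_eq_zero h)
  simp only [mul_pow, Finset.prod_mul_distrib, Finset.prod_pow_eq_pow_sum]
  rw [← h, Finsupp.degree_apply]
  ring

lemma hom_top_ne {R : Type*} [CommRing R] {σ : Type*} (P : MvPolynomial σ R) (h0 : P ≠ 0) : homogeneousComponent P.totalDegree P ≠ 0 := by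
  obtain ⟨m, hm, hmd⟩ := Finset.exists_mem_eq_sup P.support (by simpa using h0) (fun m => m.sum fun _ e => e)
  intro h
  have h3 := congrArg (coeff m) h
  rw [coeff_homogeneousComponent, if_pos (by exact hmd.symm), coeff_zero] at h3
  exact (mem_support_iff.1 hm) h3

lemma exists_shear (P : MvPolynomial (Fin 2) ℚ) (δ : ℕ) (hP : P.IsHomogeneous δ) (h0 : P ≠ 0) :
    ∃ t : ℕ, t ≤ δ ∧ aeval ![(1:ℚ), (t:ℚ)] P ≠ 0 := by
  classical
  set q : Polynomial ℚ := aeval ![(1:Polynomial ℚ), Polynomial.X] P with hq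
  have hev : ∀ t : ℚ, q.eval t = aeval ![(1:ℚ), t] P := by
    intro t
    rw [hq, ← Polynomial.coe_evalRingHom, aeval_def, hom_eval₂, aeval_def]
    congr 1
    · ext; simp
    · funext i; fin_cases i <;> simp
  have hdeg : q.natDegree ≤ δ := by
    rw [hq, aeval_def, eval₂_eq]
    refine Polynomial.natDegree_sum_le_of_forall_le _ _ fun m hm => ?_
    refine (Polynomial.natDegree_C_mul_le _ _).trans ?_
    have hm' : m.degree = δ := by
      by_contra h
      exact (mem_support_iff.1 hm) (hP.coeff_eq_zero h)
    rw [Finset.prod_subset (Finset.subset_univ _) (by intro i _ hi; simp [Finsupp.notMem_support_iff.1 hi]), Fin.prod_univ_two]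
    simp only [Matrix.cons_val_zero, Matrix.cons_val_one, one_pow, one_mul, Polynomial.natDegree_X_pow]
    rw [← hm']
    exact Finsupp.le_degree 1 m
  have hq0 : q ≠ 0 := by
    intro hz
    have : X 0 * P = 0 := by
      apply MvPolynomial.funext
      intro v
      rw [map_zero, map_mul, eval_X]
      by_cases hv : v 0 = 0
      · rw [hv, zero_mul]
      have h1 := hev (v 1 / v 0)
      rw [hz, Polynomial.eval_zero] at h1
      have h2 : v = fun i => v 0 * ![(1:ℚ), v 1 / v 0] i := by
        funext i; fin_cases i
        · simp
        · simp; field_simp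
      have h3 : eval v P = (v 0)^δ * eval ![(1:ℚ), v 1 / v 0] P := by
        conv_lhs => rw [h2]
        exact hom_scale P δ hP (v 0) _
      rw [h3]
      rw [show eval ![(1:ℚ), v 1 / v 0] P = 0 from by rw [← aeval_eq_eval]; exact h1.symm]
      simp
    rcases mul_eq_zero.1 this with h | h
    · exact X_ne_zero 0 h
    · exact h0 h
  by_contra hcon
  push Not at hcon
  apply hq0
  apply Polynomial.eq_zero_of_natDegree_lt_card_of_eval_eq_zero (f := fun t : Fin (δ+1) => ((t:ℕ):ℚ))
  · intro a b h; exact Fin.ext (by simpa using h)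
  · intro t; rw [hev]; exact hcon t (by omega)
  · rw [Fintype.card_fin]; omega

/-- the shear `x ↦ x + t z` -/
noncomputable def shear (t : ℚ) : MvPolynomial (Fin 2) ℚ ≃ₐ[ℚ] MvPolynomial (Fin 2) ℚ :=
  AlgEquiv.ofAlgHom (aeval ![X 0, X 1 + C t * X 0]) (aeval ![X 0, X 1 - C t * X 0])
    (by ext i : 1; fin_cases i <;> simp [algHom_C]) (by ext i : 1; fin_cases i <;> simp [algHom_C])

theorem CB (P : MvPolynomial (Fin 2) ℚ) (L : ℕ) (hirr : Irreducible P) (h2 : 2 ≤ P.totalDegree) (hL : P.totalDegree ≤ L)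
    (B : ℕ) (hB : 1 ≤ B) (Z : Finset (Fin 2 → ℤ)) (hZ : ∀ v ∈ Z, aeval (zq v) P = 0 ∧ (∀ i, |v i| ≤ (B:ℤ))) :
    (Z.card : ℝ) ≤ (30 * L * (Nat.log 2 B + 1 : ℕ))^30 * Real.sqrt B := by
  classical
  set δ := P.totalDegree with hδ
  set l := Nat.log 2 B + 1 with hl
  have hh0 : homogeneousComponent δ P ≠ 0 := hom_top_ne P hirr.ne_zero
  obtain ⟨t, ht, htt⟩ := exists_shear _ δ (homogeneousComponent_isHomogeneous δ P) hh0
  set P' := shear t P with hP'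
  have hPs : P' = aeval ![X 0, X 1 + C (t:ℚ) * X 0] P := rfl
  obtain ⟨hd, htop⟩ := coeff_top_subst (n := 1) P δ le_rfl ![X 0, X 1 + C (t:ℚ) * X 0] (by
    intro i; fin_cases i
    · simp
    · refine (totalDegree_add _ _).trans (max_le (by simp) ((totalDegree_mul _ _).trans (by rw [totalDegree_C]; simp))))
  rw [← hPs] at hd htop
  have hcf : (fun i => coeff (Finsupp.single 0 1) ((![X 0, X 1 + C (t:ℚ) * X 0] : Fin 2 → MvPolynomial (Fin 2) ℚ) i)) = ![(1:ℚ), (t:ℚ)] := by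
    funext i; fin_cases i
    · simp [coeff_X]
    · change coeff _ (X 1 + C (t:ℚ) * X 0) = (t:ℚ)
      rw [coeff_add, coeff_C_mul]
      simp [coeff_X, Finsupp.single_eq_single_iff]
  rw [hcf] at htop
  have htop' : coeff (Finsupp.single 0 δ) P' ≠ 0 := by rw [htop]; exact htt
  have hdeg : P'.totalDegree = δ := by
    refine le_antisymm hd ?_
    have := le_totalDegree (mem_support_iff.2 htop')
    simpa using this
  have hirr' : Irreducible P' := (MulEquiv.irreducible_iff (shear t)).2 hirr
  let φ : (Fin 2 → ℤ) → (Fin 2 → ℤ) := fun v => ![v 0, v 1 - t * v 0]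
  have hφ : Function.Injective φ := by
    intro v w h
    have h0 := congrFun h 0
    have h1 := congrFun h 1
    simp [φ] at h0 h1
    funext i; fin_cases i
    · exact h0
    · rw [h0] at h1; simpa using h1
  have hB' : 1 ≤ B * (L+1) := Nat.mul_pos hB (by omega)
  have hBr : (1:ℝ) ≤ B := by exact_mod_cast hB
  have key := cb_top P' L hirr' (by omega) (by omega) (by rw [hdeg]; exact htop') (B * (L+1)) (l + L) hB' (by
      push_cast
      rw [Real.log_mul (by positivity) (by positivity)]
      have h3 := log_le_lam B
      have h4 := Real.log_le_sub_one_of_pos (show (0:ℝ) < L + 1 by positivity)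
      rw [← hl] at h3
      linarith) (by omega) (Z.image φ) (by
      intro x hx
      obtain ⟨v, hv, rfl⟩ := Finset.mem_image.1 hx
      constructor
      · rw [← (hZ v hv).1, hPs, ← AlgHom.comp_apply, comp_aeval]
        congr 2
        funext i; fin_cases i <;> simp [φ, zq, aeval_C]
      · intro i
        have h0 := (hZ v hv).2 0
        have h1 := (hZ v hv).2 1
        have htL : (t:ℤ) ≤ L := by exact_mod_cast ht.trans hL
        push_cast
        fin_cases i
        · simp [φ]
          nlinarith [abs_nonneg (v 0)]
        · simp [φ]
          refine (abs_sub _ _).trans ?_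
          rw [abs_mul, abs_of_nonneg (show (0:ℤ) ≤ t by positivity)]
          have : (t:ℤ) * |v 0| ≤ L * B := mul_le_mul htL h0 (abs_nonneg _) (by positivity)
          linarith)
  rw [Finset.card_image_of_injective _ hφ] at key
  refine key.trans ?_
  have hLr : (2:ℝ) ≤ L := by exact_mod_cast h2.trans hL
  have hlr : (1:ℝ) ≤ l := by exact_mod_cast (show 1 ≤ l by omega)
  have hs1 : 1 ≤ Real.sqrt B := by rwa [Real.one_le_sqrt]
  have hs : Real.sqrt ((B * (L+1) : ℕ):ℝ) ≤ 2 * L * Real.sqrt B := by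
    push_cast
    rw [Real.sqrt_mul (by positivity), mul_comm]
    gcongr
    rw [Real.sqrt_le_iff]
    constructor
    · positivity
    · nlinarith
  push_cast
  have hll : (l:ℝ) + L ≤ 2 * L * l := by nlinarith
  have hll2 : (l:ℝ) + L + 1 ≤ 3 * L * l := by nlinarith
  set w : ℝ := L * l with hw
  have hw1 : 2 ≤ w := by nlinarith
  have hLw : (L:ℝ) ≤ w := by nlinarith
  have hb1 : 20 * (L:ℝ)^4 * (l+L) ≤ 40 * w^5 := by
    calc 20 * (L:ℝ)^4 * (l+L) ≤ 20 * w^4 * (2 * L * l) := by gcongr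
      _ = 40 * w^5 := by rw [hw]; ring
  calc (L:ℝ)^2 + 2 * ((256 * (20 * L^4 * (l+L))^2)^2 * (30 * Real.sqrt (B * (L+1)))) * (L * (l+L+1))
      ≤ w^2 * Real.sqrt B + 2 * ((256 * (40 * w^5)^2)^2 * (30 * (2 * w * Real.sqrt B))) * (w * (3 * L * l)) := by
        push_cast at hs
        have h5 : (L:ℝ)^2 ≤ w^2 * Real.sqrt B := by
          have : (L:ℝ)^2 ≤ w^2 := by gcongr
          nlinarith [sq_nonneg w]
        gcongr
        exact hs.trans (by gcongr)
    _ = (w^2 + 60397977600000 * w^23) * Real.sqrt B := by rw [hw]; ring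
    _ ≤ (30 * w)^30 * Real.sqrt B := by
        gcongr
        have h6 : w^2 ≤ w^30 := pow_le_pow_right₀ (by linarith) (by norm_num)
        have h7 : w^23 ≤ w^30 := pow_le_pow_right₀ (by linarith) (by norm_num)
        rw [mul_pow]
        have : (0:ℝ) ≤ w^30 := by positivity
        norm_num
        linarith
    _ = _ := by rw [hw]; ring

end DG

end

section
namespace DG
open MvPolynomial

lemma totalDegree_prod_eq {k σ : Type*} [Field k] (s : Multiset (MvPolynomial σ k)) (h : ∀ P ∈ s, P ≠ 0) :
    s.prod.totalDegree = (s.map totalDegree).sum := by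
  classical
  induction s using Multiset.induction_on with
  | empty => simp
  | cons a s ih =>
    rw [Multiset.prod_cons, Multiset.map_cons, Multiset.sum_cons,
      totalDegree_mul_of_isDomain (h a (Multiset.mem_cons_self _ _)) (Multiset.prod_ne_zero fun h0 => h 0 (Multiset.mem_cons_of_mem h0) rfl),
      ih fun P hP => h P (Multiset.mem_cons_of_mem hP)]

lemma totalDegree_assoc {k σ : Type*} [Field k] {P Q : MvPolynomial σ k} (h : Associated P Q) (hQ : Q ≠ 0) : P.totalDegree = Q.totalDegree := by
  have hP : P ≠ 0 := fun h0 => hQ (by rw [h0] at h; exact (associated_zero_iff_eq_zero Q).1 h.symm)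
  exact le_antisymm (totalDegree_le_of_dvd_of_isDomain h.dvd hQ) (totalDegree_le_of_dvd_of_isDomain h.symm.dvd hP)

lemma irr_deg_pos {k σ : Type*} [Field k] {P : MvPolynomial σ k} (h : Irreducible P) : 1 ≤ P.totalDegree := by
  by_contra h0
  have h1 : P = C (coeff 0 P) := totalDegree_eq_zero_iff_eq_C.1 (by omega)
  apply h.not_isUnit
  rw [h1]
  refine (isUnit_iff_ne_zero.2 fun h2 => ?_).map C
  rw [h2, map_zero] at h1
  exact h.ne_zero h1

/-- irreducible factors -/
lemma factors_cover {n : ℕ} (G : MvPolynomial (Fin n) ℚ) (hG : G ≠ 0) :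
    ∃ Ps : Finset (MvPolynomial (Fin n) ℚ), (∀ P ∈ Ps, Irreducible P ∧ P ∣ G) ∧ ∑ P ∈ Ps, P.totalDegree ≤ G.totalDegree ∧
      Ps.card ≤ G.totalDegree ∧ (∀ P, Irreducible P → P ∣ G → ∃ Q ∈ Ps, Associated P Q) ∧
      (∀ v : Fin n → ℚ, aeval v G = 0 → ∃ P ∈ Ps, aeval v P = 0) := by
  classical
  set fs := UniqueFactorizationMonoid.factors G with hfs
  have hirr : ∀ P ∈ fs, Irreducible P := UniqueFactorizationMonoid.irreducible_of_factor
  have hprod : Associated fs.prod G := UniqueFactorizationMonoid.factors_prod hG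
  have hdeg : (fs.map totalDegree).sum = G.totalDegree := by
    rw [← totalDegree_prod_eq _ fun P hP => (hirr P hP).ne_zero, totalDegree_assoc hprod hG]
  have hsum : ∑ P ∈ fs.toFinset, P.totalDegree ≤ G.totalDegree := by
    rw [← hdeg]
    change (fs.toFinset.1.map totalDegree).sum ≤ _
    rw [Multiset.toFinset_val]
    obtain ⟨t, ht⟩ := Multiset.le_iff_exists_add.1 (Multiset.dedup_le fs)
    conv_rhs => rw [ht]
    rw [Multiset.map_add, Multiset.sum_add]
    omega
  refine ⟨fs.toFinset, ?_, hsum, ?_, ?_, ?_⟩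
  · intro P hP
    rw [Multiset.mem_toFinset] at hP
    exact ⟨hirr P hP, UniqueFactorizationMonoid.dvd_of_mem_factors hP⟩
  · refine le_trans ?_ hsum
    rw [Finset.card_eq_sum_ones]
    exact Finset.sum_le_sum fun P hP => irr_deg_pos (hirr P (Multiset.mem_toFinset.1 hP))
  · intro P hP hPG
    obtain ⟨q, hq, h⟩ := UniqueFactorizationMonoid.exists_mem_factors_of_dvd hG hP hPG
    exact ⟨q, Multiset.mem_toFinset.2 hq, h⟩
  · intro v hv
    have h1 : aeval v fs.prod = 0 := by
      obtain ⟨u, hu⟩ := hprod.symm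
      rw [← hu, map_mul, hv, zero_mul]
    rw [map_multiset_prod, Multiset.prod_eq_zero_iff, Multiset.mem_map] at h1
    obtain ⟨P, hP, h2⟩ := h1
    exact ⟨P, Multiset.mem_toFinset.2 hP, h2⟩

lemma aeval_zero_of_dvd {n : ℕ} {P Q : MvPolynomial (Fin n) ℚ} (h : P ∣ Q) (v : Fin n → ℚ) (hv : aeval v P = 0) : aeval v Q = 0 := by
  obtain ⟨q, rfl⟩ := h
  rw [map_mul, hv, zero_mul]

/-- Bezout variant -/
lemma bez_var (G G' : MvPolynomial (Fin 2) ℚ) (hG : G ≠ 0) (Z : Finset (Fin 2 → ℤ))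
    (hZ : ∀ v ∈ Z, ∃ P, Irreducible P ∧ P ∣ G ∧ ¬ P ∣ G' ∧ aeval (zq v) P = 0 ∧ aeval (zq v) G' = 0) :
    Z.card ≤ G.totalDegree * G'.totalDegree := by
  classical
  obtain ⟨Ps, h1, h2, _, h4, _⟩ := factors_cover G hG
  have hsub : Z ⊆ (Ps.filter fun P => ¬ P ∣ G').biUnion fun P => Z.filter fun v => aeval (zq v) P = 0 ∧ aeval (zq v) G' = 0 := by
    intro v hv
    obtain ⟨P, hP, hPG, hPG', hP0, hG0⟩ := hZ v hv
    obtain ⟨Q, hQ, hPQ⟩ := h4 P hP hPG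
    simp only [Finset.mem_biUnion, Finset.mem_filter]
    exact ⟨Q, ⟨hQ, fun h => hPG' (hPQ.dvd.trans h)⟩, hv, aeval_zero_of_dvd hPQ.dvd _ hP0, hG0⟩
  refine (Finset.card_le_card hsub).trans (Finset.card_biUnion_le.trans ?_)
  refine le_trans (Finset.sum_le_sum (g := fun P => P.totalDegree * G'.totalDegree) fun P hP => ?_) ?_
  · rw [Finset.mem_filter] at hP
    exact bez_int P G' (h1 P hP.1).1 hP.2 _ fun v hv => (Finset.mem_filter.1 hv).2
  · rw [← Finset.sum_mul]
    exact Nat.mul_le_mul_right _ ((Finset.sum_le_sum_of_subset (Finset.filter_subset _ _)).trans h2)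

/-- resultants for quartics with integer coefficients -/
lemma res_int (f : MvPolynomial (Fin 3) ℤ) (hf : f.totalDegree ≤ 4) (ha : coeff (Finsupp.single 0 4) f ≠ 0) (hi : Irreducible (toQ f))
    (g : MvPolynomial (Fin 3) ℤ) (e : ℕ) (hg : g.totalDegree ≤ e) (hfg : ¬ toQ f ∣ toQ g) :
    ∃ G : MvPolynomial (Fin 2) ℚ, G ≠ 0 ∧ G.totalDegree ≤ 8 * e ∧ ∀ v : Fin 3 → ℤ, aeval v f = 0 → aeval v g = 0 →
      aeval (zq (Fin.tail v)) G = 0 := by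
  set a : ℚ := ((coeff (Finsupp.single 0 4) f : ℤ) : ℚ) with haq
  have ha0 : a ≠ 0 := by rw [haq]; exact_mod_cast ha
  have hu : IsUnit (C a⁻¹ : MvPolynomial (Fin 3) ℚ) := (isUnit_iff_ne_zero.2 (inv_ne_zero ha0)).map C
  obtain ⟨G, h1, h2, h3⟩ := res_exists (C a⁻¹ * toQ f) 4 ((totalDegree_mul _ _).trans (by rw [totalDegree_C, toQ_deg]; omega)) (by norm_num)
    (by rw [coeff_C_mul, toQ_coeff, ← haq, inv_mul_cancel₀ ha0]) ((irreducible_isUnit_mul hu).2 hi) (toQ g) e (by rwa [toQ_deg])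
    (fun h => hfg ((dvd_mul_left _ _).trans h))
  refine ⟨G, h1, by omega, fun v hv hg => ?_⟩
  exact h3 (zq v) (by rw [map_mul, (aeval_toQ_iff f v).2 hv, mul_zero]) ((aeval_toQ_iff g v).2 hg)

lemma fiber4 (f : MvPolynomial (Fin 3) ℤ) (hf : f.totalDegree ≤ 4) (ha : coeff (Finsupp.single 0 4) f ≠ 0) (S : Finset (Fin 3 → ℤ))
    (hS : ∀ v ∈ S, aeval v f = 0) (T : Finset (Fin 2 → ℤ)) (hT : ∀ v ∈ S, Fin.tail v ∈ T) : S.card ≤ 4 * T.card := by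
  classical
  refine Finset.card_le_mul_card_image_of_maps_to (f := fun v : Fin 3 → ℤ => (Fin.tail v : Fin 2 → ℤ)) hT 4 fun x _ => ?_
  have h := roots_le (k := ℚ) f 4 hf (by exact_mod_cast ha) (zq x) ((S.filter fun v => Fin.tail v = x).image fun v => (v 0 : ℚ)) (by
    intro z hz
    obtain ⟨v, hv, rfl⟩ := Finset.mem_image.1 hz
    rw [Finset.mem_filter] at hv
    have h1 := aeval_intCast ℚ v f
    rw [hS v hv.1, Int.cast_zero] at h1
    rw [← h1]
    congr 2
    funext j
    refine Fin.cases ?_ (fun j => ?_) j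
    · simp
    · simp [zq, ← hv.2, Fin.tail])
  rwa [Finset.card_image_of_injOn] at h
  intro v hv w hw h
  rw [Finset.mem_coe, Finset.mem_filter] at hv hw
  have h0 : v 0 = w 0 := by simpa using h
  rw [← Fin.cons_self_tail v, ← Fin.cons_self_tail w, hv.2, hw.2, h0]

/-- a point lying on a line of the surface with short direction -/
def Short (f : MvPolynomial (Fin 3) ℤ) (s : ℕ) (v : Fin 3 → ℤ) : Prop :=
  ∃ w : Fin 3 → ℤ, w ≠ 0 ∧ (∀ i, |w i| ≤ (s:ℤ)) ∧ ∀ t : ℤ, aeval (fun i => v i + t * w i) f = 0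

lemma line_count (f : MvPolynomial (Fin 3) ℤ) (S : Finset (Fin 3 → ℤ)) (B : ℕ) (hB : 1 ≤ B) (hS : ∀ v ∈ S, ∀ i, |v i| ≤ (B:ℤ))
    (hns : ∀ v ∈ S, ¬ Short f (Nat.sqrt B) v) (i : Fin 3) (γ β : Fin 3 → ℚ) (hl : ∀ v ∈ S, ∀ j, (v j : ℚ) = γ j + β j * v i)
    (hf : ∀ t : ℚ, aeval (fun j => γ j + β j * t) (toQ f) = 0) : (S.card : ℝ) ≤ 3 * Real.sqrt B := by
  classical
  have hsB : 1 ≤ Real.sqrt B := by rw [Real.one_le_sqrt]; exact_mod_cast hB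
  by_cases hc : S.card ≤ 1
  · have : (S.card : ℝ) ≤ 1 := by exact_mod_cast hc
    linarith
  push Not at hc
  obtain ⟨j, _, hj⟩ := Finset.exists_max_image Finset.univ (fun j => |β j|) Finset.univ_nonempty
  set s := Nat.sqrt B with hs
  -- the j-th coordinates are well separated
  have hsep : ∀ v ∈ S, ∀ w ∈ S, v ≠ w → (s:ℤ) < |v j - w j| := by
    intro v hv w hw hvw
    by_contra hcon
    push Not at hcon
    refine hns v hv ⟨fun l => v l - w l, ?_, ?_, ?_⟩
    · intro h; apply hvw; funext l; have := congrFun h l; simp at this; linarith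
    · intro l
      refine le_trans ?_ hcon
      have h1 : ((|v l - w l| : ℤ):ℚ) ≤ ((|v j - w j| : ℤ):ℚ) := by
        push_cast
        rw [hl v hv l, hl w hw l, hl v hv j, hl w hw j]
        rw [show γ l + β l * v i - (γ l + β l * w i) = β l * (v i - w i) by ring, show γ j + β j * v i - (γ j + β j * w i) = β j * (v i - w i) by ring, abs_mul, abs_mul]
        exact mul_le_mul_of_nonneg_right (hj l (Finset.mem_univ _)) (abs_nonneg _)
      exact_mod_cast h1
    · intro t
      rw [← aeval_toQ_iff, ← hf (v i + t * (v i - w i))]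
      congr 2
      funext l
      simp only [zq]
      push_cast
      rw [hl v hv l, hl w hw l]; ring
  have hmaps : ∀ v ∈ S, (v j + B) / ((s:ℤ)+1) ∈ Finset.Icc (0:ℤ) (2 * B / (s+1)) := by
    intro v hv
    have := abs_le.1 (hS v hv j)
    rw [Finset.mem_Icc]
    constructor
    · apply Int.ediv_nonneg <;> omega
    · apply Int.ediv_le_ediv <;> omega
  have hinj : Set.InjOn (fun v : Fin 3 → ℤ => (v j + B) / ((s:ℤ)+1)) S := by
    intro v hv w hw h
    by_contra hne
    have h1 := hsep v hv w hw hne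
    have hp : (0:ℤ) < s + 1 := by omega
    have a1 := Int.mul_ediv_add_emod (v j + B) (s+1)
    have a2 := Int.mul_ediv_add_emod (w j + B) (s+1)
    have b1 := Int.emod_nonneg (v j + B) hp.ne'
    have b2 := Int.emod_nonneg (w j + B) hp.ne'
    have c1 := Int.emod_lt_of_pos (v j + B) hp
    have c2 := Int.emod_lt_of_pos (w j + B) hp
    simp only at h
    rw [h] at a1
    have : |v j - w j| ≤ s := by rw [abs_le]; constructor <;> linarith
    omega
  have hcard := Finset.card_le_card_of_injOn _ hmaps hinj
  rw [Int.card_Icc] at hcard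
  have h1 : (2 * (B:ℤ) / (s+1)).toNat = 2 * B / (s+1) := by
    have : (2 * (B:ℤ) / (s+1)) = ((2 * B / (s+1) : ℕ) : ℤ) := by push_cast; rfl
    rw [this, Int.toNat_natCast]
  have h2 : S.card ≤ 2 * B / (s+1) + 1 := by omega
  have h3 : (S.card:ℝ) ≤ ((2 * B / (s+1) : ℕ):ℝ) + 1 := by exact_mod_cast h2
  have h4 : ((2 * B / (s+1) : ℕ):ℝ) ≤ 2 * B / (s+1) := by
    have := @Nat.cast_div_le ℝ _ _ _ (2*B) (s+1)
    push_cast at this; exact this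
  have h5 : Real.sqrt B ≤ s + 1 := by
    rw [Real.sqrt_le_left (by positivity)]
    have := Nat.lt_succ_sqrt' B
    exact_mod_cast this.le
  have h6 : 2 * (B:ℝ) / (s+1) ≤ 2 * Real.sqrt B := by
    rw [div_le_iff₀ (by positivity)]
    have := Real.mul_self_sqrt (Nat.cast_nonneg (α := ℝ) B)
    nlinarith
  linarith

end DG

end

section
namespace DG
open MvPolynomial

lemma deg_one_eval {k A : Type*} [Field k] [CommRing A] [Algebra k A] (P : MvPolynomial (Fin 2) k) (h : P.totalDegree ≤ 1) (v : Fin 2 → A) :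
    aeval v P = algebraMap k A (coeff 0 P) + algebraMap k A (coeff (Finsupp.single 0 1) P) * v 0
      + algebraMap k A (coeff (Finsupp.single 1 1) P) * v 1 := by
  classical
  rw [aeval_def, eval₂_eq']
  have hne : (Finsupp.single (0:Fin 2) 1 : Fin 2 →₀ ℕ) ≠ Finsupp.single 1 1 := by
    intro h; have := DFunLike.congr_fun h 0; simp at this
  have hne0 : (0 : Fin 2 →₀ ℕ) ≠ Finsupp.single 0 1 := by
    intro h; have := DFunLike.congr_fun h 0; simp at this
  have hne1 : (0 : Fin 2 →₀ ℕ) ≠ Finsupp.single 1 1 := by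
    intro h; have := DFunLike.congr_fun h 1; simp at this
  rw [Finset.sum_subset (s₂ := {0, Finsupp.single 0 1, Finsupp.single 1 1})]
  · rw [Finset.sum_insert (by simp [hne0, hne1]), Finset.sum_insert (by simp [hne]), Finset.sum_singleton]
    simp [Fin.prod_univ_two, add_assoc]
  · intro m hm
    have h1 : m.degree ≤ 1 := (show m.degree ≤ P.totalDegree from le_totalDegree hm).trans h
    rw [Finsupp.degree_eq_sum, Fin.sum_univ_two] at h1
    simp only [Finset.mem_insert, Finset.mem_singleton]
    have : (m 0 = 0 ∧ m 1 = 0) ∨ (m 0 = 1 ∧ m 1 = 0) ∨ (m 0 = 0 ∧ m 1 = 1) := by omega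
    rcases this with h | h | h
    · left; ext i; fin_cases i <;> simp [h]
    · right; left; ext i; fin_cases i <;> simp [h]
    · right; right; ext i; fin_cases i <;> simp [h]
  · intro m _ hm
    rw [notMem_support_iff.1 hm, map_zero, zero_mul]

set_option maxHeartbeats 1000000 in
lemma section_count (f : MvPolynomial (Fin 3) ℤ) (hf : f.totalDegree ≤ 4) (ha : coeff (Finsupp.single 0 4) f ≠ 0)
    (S : Finset (Fin 3 → ℤ)) (B : ℕ) (hB : 1 ≤ B) (hS : ∀ v ∈ S, aeval v f = 0 ∧ ∀ i, |v i| ≤ (B:ℤ))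
    (hns : ∀ v ∈ S, ¬ Short f (Nat.sqrt B) v) (i : Fin 3) (γ β : Fin 3 → ℚ)
    (hl : ∀ v ∈ S, ∀ j, j ≠ 0 → (v j : ℚ) = γ j + β j * v i) :
    (S.card : ℝ) ≤ 4 * ((120 * (Nat.log 2 B + 1 : ℕ))^30 * Real.sqrt B) := by
  classical
  have hsB : 1 ≤ Real.sqrt B := by rw [Real.one_le_sqrt]; exact_mod_cast hB
  set l : Fin 3 → MvPolynomial (Fin 2) ℚ := fun j => if j = 0 then X 0 else C (γ j) + C (β j) * X 1 with hldef
  have hl1 : ∀ j, (l j).totalDegree ≤ 1 := by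
    intro j
    simp only [hldef]
    split_ifs
    · rw [totalDegree_X]
    · refine (totalDegree_add _ _).trans (max_le (by rw [totalDegree_C]; omega) ((totalDegree_mul _ _).trans ?_))
      rw [totalDegree_C, totalDegree_X]
  set Q := aeval l (toQ f) with hQ
  obtain ⟨hQd, hQc⟩ := coeff_top_subst (toQ f) 4 (by rwa [toQ_deg]) l hl1
  have hX := (coeff_top_subst (toQ f) 4 (by rwa [toQ_deg]) (fun j : Fin 3 => (X j : MvPolynomial (Fin 3) ℚ)) (fun j => by rw [totalDegree_X])).2
  have hvec : (fun j : Fin 3 => coeff (Finsupp.single 0 1) (l j)) = fun j : Fin 3 => coeff (Finsupp.single 0 1) (X j : MvPolynomial (Fin 3) ℚ) := by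
    funext j
    simp only [hldef]
    by_cases hj : j = 0
    · subst hj; simp [coeff_X]
    · have h1 : (Finsupp.single (1 : Fin 2) 1 : Fin 2 →₀ ℕ) ≠ Finsupp.single 0 1 := by
        intro h; have := DFunLike.congr_fun h 0; simp at this
      have h2 : (0 : Fin 2 →₀ ℕ) ≠ Finsupp.single 0 1 := by
        intro h; have := DFunLike.congr_fun h 0; simp at this
      have h3 : (Finsupp.single j 1 : Fin 3 →₀ ℕ) ≠ Finsupp.single 0 1 := by
        intro h; have := DFunLike.congr_fun h 0; simp [hj] at this
      rw [if_neg hj, coeff_add, coeff_C, coeff_C_mul, coeff_X, coeff_X, if_neg h1, if_neg h2, if_neg h3]; simp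
  have hQtop : coeff (Finsupp.single 0 4) Q ≠ 0 := by
    rw [hQ, hQc, hvec, ← hX, aeval_X_left_apply, toQ_coeff]
    exact_mod_cast ha
  have hQ0 : Q ≠ 0 := by intro h; rw [h] at hQtop; simp at hQtop
  have hev : ∀ z x : ℚ, aeval ![z, x] Q = aeval (fun j => if j = 0 then z else γ j + β j * x) (toQ f) := by
    intro z x
    rw [hQ, ← AlgHom.comp_apply]
    congr 1
    ext j
    simp only [AlgHom.comp_apply, aeval_X, hldef]
    split_ifs <;> simp
  have hvQ : ∀ v ∈ S, aeval ![(v 0 : ℚ), (v i : ℚ)] Q = 0 := by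
    intro v hv
    rw [hev, ← (aeval_toQ_iff f v).2 (hS v hv).1]
    congr 2
    funext j
    by_cases hj : j = 0
    · simp [hj, zq]
    · simp [hj, zq, hl v hv j hj]
  obtain ⟨Ps, h1, _, h3, _, h5⟩ := factors_cover Q hQ0
  have hPs4 : (Ps.card : ℝ) ≤ 4 := by exact_mod_cast h3.trans hQd
  have hsub : S ⊆ Ps.biUnion fun P => S.filter fun v => aeval ![(v 0 : ℚ), (v i : ℚ)] P = 0 := by
    intro v hv
    obtain ⟨P, hP, hP0⟩ := h5 _ (hvQ v hv)
    simp only [Finset.mem_biUnion, Finset.mem_filter]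
    exact ⟨P, hP, hv, hP0⟩
  have hcard : (S.card : ℝ) ≤ ∑ P ∈ Ps, ((S.filter fun v => aeval ![(v 0 : ℚ), (v i : ℚ)] P = 0).card : ℝ) := by
    exact_mod_cast (Finset.card_le_card hsub).trans Finset.card_biUnion_le
  have hlam : (1:ℝ) ≤ (Nat.log 2 B + 1 : ℕ) := by exact_mod_cast Nat.le_add_left 1 _
  have hbig : (3:ℝ) ≤ (120 * (Nat.log 2 B + 1 : ℕ))^30 := by
    have : (120:ℝ) ≤ 120 * (Nat.log 2 B + 1 : ℕ) := by linarith
    calc (3:ℝ) ≤ 120^30 := by norm_num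
      _ ≤ _ := by gcongr
  have hterm : ∀ P ∈ Ps, ((S.filter fun v => aeval ![(v 0 : ℚ), (v i : ℚ)] P = 0).card : ℝ) ≤ (120 * (Nat.log 2 B + 1 : ℕ))^30 * Real.sqrt B := by
    intro P hP
    obtain ⟨hPi, R, hR⟩ := h1 P hP
    have hR0 : R ≠ 0 := by rintro rfl; rw [mul_zero] at hR; exact hQ0 hR
    have hPd : P.totalDegree + R.totalDegree ≤ 4 := by
      rw [← totalDegree_mul_of_isDomain hPi.ne_zero hR0, ← hR]; exact hQd
    by_cases hd : 2 ≤ P.totalDegree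
    · have := CB P 4 hPi hd (by omega) B hB ((S.filter fun v => aeval ![(v 0 : ℚ), (v i : ℚ)] P = 0).image fun v => ![v 0, v i]) (by
        intro w hw
        obtain ⟨v, hv, rfl⟩ := Finset.mem_image.1 hw
        rw [Finset.mem_filter] at hv
        constructor
        · rw [← hv.2]; congr 2; funext j; fin_cases j <;> simp [zq]
        · intro j; fin_cases j
          · exact (hS v hv.1).2 0
          · exact (hS v hv.1).2 i)
      rw [Finset.card_image_of_injOn] at this
      · norm_num at this ⊢; exact this
      · intro v hv w hw h
        rw [Finset.mem_coe, Finset.mem_filter] at hv hw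
        have e0 : v 0 = w 0 := congrFun h 0
        have e1 : v i = w i := congrFun h 1
        funext j
        by_cases hj : j = 0
        · rw [hj, e0]
        · have := hl v hv.1 j hj
          rw [e1, ← hl w hw.1 j hj] at this
          exact_mod_cast this
    · have hd1 : P.totalDegree = 1 := by have := irr_deg_pos hPi; omega
      have hr1 : coeff (Finsupp.single 0 1) P ≠ 0 := by
        intro h0
        apply hQtop
        rw [hR, show (4:ℕ) = 1 + 3 by norm_num, coeff_top_mul P R 1 3 hd1.le (by omega), h0, zero_mul]
      have hPe : ∀ z x : ℚ, aeval ![z, x] P = coeff 0 P + coeff (Finsupp.single 0 1) P * z + coeff (Finsupp.single 1 1) P * x := by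
        intro z x
        have := deg_one_eval P hd1.le ![z, x]
        simpa using this
      set r0 := coeff 0 P
      set r1 := coeff (Finsupp.single 0 1) P
      set r2 := coeff (Finsupp.single 1 1) P
      have := line_count f (S.filter fun v => aeval ![(v 0 : ℚ), (v i : ℚ)] P = 0) B hB (fun v hv => (hS v (Finset.mem_filter.1 hv).1).2)
        (fun v hv => hns v (Finset.mem_filter.1 hv).1) i (fun j => if j = 0 then -r0/r1 else γ j) (fun j => if j = 0 then -r2/r1 else β j) (by
          intro v hv j
          rw [Finset.mem_filter] at hv
          by_cases hj : j = 0
          · rw [if_pos hj, if_pos hj, hj]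
            have := hv.2
            rw [hPe] at this
            field_simp
            linarith
          · rw [if_neg hj, if_neg hj]; exact hl v hv.1 j hj) (by
          intro t
          have h0 : aeval ![-r0/r1 + -r2/r1*t, t] Q = 0 := by
            rw [hR, map_mul, hPe]
            have : r0 + r1 * (-r0/r1 + -r2/r1*t) + r2 * t = 0 := by field_simp; ring
            rw [this, zero_mul]
          rw [hev] at h0
          rw [← h0]
          congr 2
          funext j
          split_ifs <;> rfl)
      refine this.trans ?_
      gcongr
  calc (S.card : ℝ) ≤ _ := hcard
    _ ≤ ∑ P ∈ Ps, (120 * (Nat.log 2 B + 1 : ℕ))^30 * Real.sqrt B := Finset.sum_le_sum hterm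
    _ = Ps.card * ((120 * (Nat.log 2 B + 1 : ℕ))^30 * Real.sqrt B) := by rw [Finset.sum_const, nsmul_eq_mul]
    _ ≤ _ := by gcongr

/-- points over one plane curve -/
lemma cover_count (f : MvPolynomial (Fin 3) ℤ) (hf : f.totalDegree ≤ 4) (ha : coeff (Finsupp.single 0 4) f ≠ 0)
    (S : Finset (Fin 3 → ℤ)) (B : ℕ) (hB : 1 ≤ B) (hS : ∀ v ∈ S, aeval v f = 0 ∧ ∀ i, |v i| ≤ (B:ℤ))
    (hns : ∀ v ∈ S, ¬ Short f (Nat.sqrt B) v) (P : MvPolynomial (Fin 2) ℚ) (hP : Irreducible P) (L : ℕ) (hL : P.totalDegree ≤ L)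
    (hPS : ∀ v ∈ S, aeval (zq (Fin.tail v)) P = 0) :
    (S.card : ℝ) ≤ 4 * ((120 * L * (Nat.log 2 B + 1 : ℕ))^30 * Real.sqrt B) := by
  classical
  have hL1 : 1 ≤ L := (irr_deg_pos hP).trans hL
  have hL1' : (1:ℝ) ≤ L := by exact_mod_cast hL1
  by_cases hd : 2 ≤ P.totalDegree
  · have h1 := fiber4 f hf ha S (fun v hv => (hS v hv).1) (S.image fun v => (Fin.tail v : Fin 2 → ℤ)) (fun v hv => Finset.mem_image_of_mem _ hv)
    have h2 := CB P L hP hd hL B hB (S.image fun v => (Fin.tail v : Fin 2 → ℤ)) (by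
      intro w hw
      obtain ⟨v, hv, rfl⟩ := Finset.mem_image.1 hw
      exact ⟨hPS v hv, fun i => (hS v hv).2 i.succ⟩)
    have h3 : (S.card:ℝ) ≤ 4 * ((S.image fun v => (Fin.tail v : Fin 2 → ℤ)).card : ℝ) := by exact_mod_cast h1
    refine h3.trans ?_
    refine mul_le_mul_of_nonneg_left (h2.trans ?_) (by norm_num)
    gcongr
    norm_num
  · have hd1 : P.totalDegree = 1 := by have := irr_deg_pos hP; omega
    have key : (S.card : ℝ) ≤ 4 * ((120 * (Nat.log 2 B + 1 : ℕ))^30 * Real.sqrt B) := by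
      have hPe : ∀ v ∈ S, coeff 0 P + coeff (Finsupp.single 0 1) P * v 1 + coeff (Finsupp.single 1 1) P * v 2 = 0 := by
        intro v hv
        have := deg_one_eval P hd1.le (zq (Fin.tail v))
        rw [hPS v hv] at this
        simpa [zq, Fin.tail] using this.symm
      by_cases h2 : coeff (Finsupp.single 1 1) P = 0
      · have h1 : coeff (Finsupp.single 0 1) P ≠ 0 := by
          intro h1
          have h3 : P = C (coeff 0 P) := by
            have := deg_one_eval P hd1.le (X : Fin 2 → MvPolynomial (Fin 2) ℚ)
            rw [h1, h2, aeval_X_left_apply] at this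
            simpa using this
          rw [h3, totalDegree_C] at hd1
          omega
        refine section_count f hf ha S B hB hS hns 2 (fun j => if j = 1 then - coeff 0 P / coeff (Finsupp.single 0 1) P else 0)
          (fun j => if j = 1 then 0 else 1) ?_
        intro v hv j hj
        have := hPe v hv
        rw [h2] at this
        fin_cases j
        · exact absurd rfl hj
        · simp; field_simp; linarith
        · simp
      · refine section_count f hf ha S B hB hS hns 1 (fun j => if j = 1 then 0 else - coeff 0 P / coeff (Finsupp.single 1 1) P)
          (fun j => if j = 1 then 1 else - coeff (Finsupp.single 0 1) P / coeff (Finsupp.single 1 1) P) ?_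
        intro v hv j hj
        have := hPe v hv
        fin_cases j
        · exact absurd rfl hj
        · simp
        · simp; field_simp; linarith
    refine key.trans ?_
    gcongr
    nlinarith

end DG

end

section
namespace DG
open MvPolynomial

lemma degreeOf_toQ_le {n : ℕ} (i : Fin n) (g : MvPolynomial (Fin n) ℤ) : degreeOf i (toQ g) ≤ degreeOf i g := by
  rw [degreeOf_le_iff]
  intro m hm
  exact monomial_le_degreeOf i (support_map_subset _ _ hm)

lemma toQ_not_dvd (f g : MvPolynomial (Fin 3) ℤ) (ha : coeff (Finsupp.single 0 4) f ≠ 0) (hg : g ≠ 0) (h : degreeOf 0 g ≤ 3) : ¬ toQ f ∣ toQ g := by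
  refine not_dvd_of_degreeOf_lt 0 _ _ (fun h0 => hg ((toQ_ne g).1 h0)) ?_
  have h1 := degreeOf_toQ_le 0 g
  have h2 := degreeOf_of_coeff_top 0 (toQ f) 4 (by rw [toQ_coeff]; exact_mod_cast ha)
  omega

/-- the discriminating number attached to a quartic -/
noncomputable def N0 (f : MvPolynomial (Fin 3) ℤ) (ψ : MvPolynomial (Fin 2 →₀ ℕ) ℤ) : ℤ :=
  coeff (Finsupp.single 0 4) f * aeval (fun m => coeff m (slE f (0:ℤ))) ψ

lemma level_poly : ∃ a : ℕ, ∀ (f : MvPolynomial (Fin 3) ℤ), f.totalDegree ≤ 4 → Irreducible (toQ f) → ∀ ψ ∈ noe, ∀ M : ℕ, 1 ≤ M →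
    N0 f ψ ≠ 0 → Real.log |(N0 f ψ : ℝ)| ≤ M → ∀ B : ℕ, 1 ≤ B → ∀ p k : ℕ, p.Prime → (p:ℝ)^k ≤ Real.sqrt B →
    ∀ S : Set (Fin 3 → ℤ), (∀ v ∈ S, aeval v f = 0 ∧ (∀ i, |v i| ≤ (B:ℤ)) ∧ Real.log |((aeval v (pderiv 0 f) : ℤ) : ℝ)| ≤ M ∧
      ¬ (p:ℤ) ∣ aeval v (pderiv 0 f)) → (∀ v ∈ S, ∀ w ∈ S, cls p k v = cls p k w) →
    ∃ G : MvPolynomial (Fin 2) ℚ, G ≠ 0 ∧ (G.totalDegree : ℝ) ≤ 64 * (Nat.log 2 B + 1 : ℕ) * (3 * M : ℝ)^a * Real.sqrt B / p^k ∧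
      ∀ v ∈ S, aeval (zq (Fin.tail v)) G = 0 := by
  obtain ⟨A, hA, hglob⟩ := glob
  refine ⟨⌈A⌉₊, ?_⟩
  intro f hf hi ψ hψ M hM hN hNM B hB p k hp hpk S hS hcls
  set lam := Nat.log 2 B + 1 with hlam
  have hlam1 : (1:ℝ) ≤ (lam:ℝ) := by exact_mod_cast Nat.le_add_left 1 _
  have hM' : (1:ℝ) ≤ M := by exact_mod_cast hM
  have hBr : (1:ℝ) ≤ B := by exact_mod_cast hB
  have hs1 : 1 ≤ Real.sqrt B := by rw [Real.one_le_sqrt]; exact hBr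
  have hpp : (0:ℝ) < (p:ℝ)^k := by have : (0:ℝ) < p := by exact_mod_cast hp.pos
                                   positivity
  set U : ℝ := (3 * M : ℝ)^⌈A⌉₊ with hU
  have hU1 : 1 ≤ U := one_le_pow₀ (by linarith)
  set W := U * Real.sqrt B / p^k with hW
  have hW1 : 1 ≤ W := by
    rw [hW, le_div_iff₀ hpp]; nlinarith
  set D := lam * ⌈W⌉₊ with hD
  have hceil : (⌈W⌉₊:ℝ) < W + 1 := Nat.ceil_lt_add_one (by linarith)
  have hceil' : W ≤ ⌈W⌉₊ := Nat.le_ceil W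
  have hDr : (D:ℝ) = lam * ⌈W⌉₊ := by rw [hD]; push_cast; ring
  have hDW : W ≤ D := by rw [hDr]; nlinarith
  have hDl : (lam:ℝ) ≤ D := by rw [hDr]; nlinarith
  have hD1 : (1:ℝ) ≤ D := hW1.trans hDW
  obtain ⟨g, hg0, hg3, hgd, hgS⟩ := hglob f hf ψ hψ M hM hN hNM B hB p k D hp (by exact_mod_cast hD1)
    ((log_le_lam B).trans hDl) (by
      have h1 : Real.log W ≤ Real.log D := Real.log_le_log (by linarith) hDW
      rw [hW, Real.log_div (by positivity) hpp.ne', Real.log_mul (by positivity) (by positivity), hU, Real.log_pow, Real.log_sqrt (by positivity), Real.log_pow,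
        Real.log_mul (by norm_num) (by positivity)] at h1
      have h3 : 1 ≤ Real.log 3 := by
        rw [Real.le_log_iff_exp_le (by norm_num)]
        have := Real.exp_one_lt_d9
        linarith
      have h4 : 0 ≤ Real.log M := Real.log_nonneg hM'
      have h5 : A * (1 + Real.log M) ≤ ⌈A⌉₊ * (Real.log 3 + Real.log M) := by
        have := Nat.le_ceil A
        apply mul_le_mul this (by linarith) (by linarith) (by positivity)
      linarith) S hS (fun _ => hcls)
  have ha : coeff (Finsupp.single 0 4) f ≠ 0 := left_ne_zero_of_mul hN
  obtain ⟨G, h1, h2, h3⟩ := res_int f hf ha hi g (D+3) hgd (toQ_not_dvd f g ha hg0 hg3)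
  refine ⟨G, h1, ?_, fun v hv => h3 v (hS v hv).1 (hgS v hv)⟩
  have h4 : (G.totalDegree:ℝ) ≤ 8 * (D + 3) := by exact_mod_cast h2
  calc (G.totalDegree:ℝ) ≤ 8 * (D + 3) := h4
    _ ≤ 32 * D := by linarith
    _ = 32 * lam * ⌈W⌉₊ := by rw [hDr]; ring
    _ ≤ 32 * lam * (2 * W) := by gcongr; linarith
    _ = _ := by rw [hW]; ring

lemma cls_mono {p k : ℕ} {v w : Fin 3 → ℤ} (h : cls p (k+1) v = cls p (k+1) w) : cls p k v = cls p k w := by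
  simp only [cls, Prod.mk.injEq] at h ⊢
  refine ⟨funext fun i => ?_, h.2⟩
  have := congrFun h.1 i
  rw [ZMod.intCast_eq_intCast_iff] at this ⊢
  apply this.of_dvd
  push_cast
  exact pow_dvd_pow _ (Nat.le_succ k)

lemma card_cls (p k : ℕ) [NeZero p] (S : Finset (Fin 3 → ℤ)) [DecidableEq ((Fin 2 → ZMod (p^k)) × ZMod p)] :
    (S.image (cls p k)).card ≤ p^(2*k+1) := by
  haveI : NeZero (p^k) := ⟨pow_ne_zero _ (NeZero.ne p)⟩
  refine (Finset.card_le_univ _).trans (le_of_eq ?_)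
  rw [Fintype.card_prod, Fintype.card_fun, ZMod.card, ZMod.card, Fintype.card_fin]
  ring

end DG

end

section
namespace DG
open MvPolynomial

set_option maxHeartbeats 2000000 in
/-- the nested determinant argument -/
lemma nest : ∃ a : ℕ, ∀ (f : MvPolynomial (Fin 3) ℤ), f.totalDegree ≤ 4 → Irreducible (toQ f) → ∀ ψ ∈ noe, ∀ M : ℕ, 1 ≤ M →
    N0 f ψ ≠ 0 → Real.log |(N0 f ψ : ℝ)| ≤ M → ∀ B : ℕ, 1 ≤ B → ∀ p : ℕ, p.Prime →
    ∀ S : Finset (Fin 3 → ℤ), (∀ v ∈ S, aeval v f = 0 ∧ (∀ i, |v i| ≤ (B:ℤ)) ∧ Real.log |((aeval v (pderiv 0 f) : ℤ) : ℝ)| ≤ M ∧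
      ¬ (p:ℤ) ∣ aeval v (pderiv 0 f)) →
    ∀ Y : ℝ, Y = 64 * (Nat.log 2 B + 1 : ℕ) * (3 * M : ℝ)^a * p →
    ∃ (E : Finset (Fin 3 → ℤ)) (Ps : Finset (MvPolynomial (Fin 2) ℚ)), (E.card : ℝ) ≤ Y^3 * B ∧ (Ps.card : ℝ) ≤ Y * Real.sqrt B ∧
      (∀ P ∈ Ps, Irreducible P ∧ (P.totalDegree : ℝ) ≤ Y) ∧ ∀ v ∈ S, v ∈ E ∨ ∃ P ∈ Ps, aeval (zq (Fin.tail v)) P = 0 := by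
  classical
  obtain ⟨a, ha⟩ := level_poly
  refine ⟨a, ?_⟩
  intro f hf hi ψ hψ M hM hN hNM B hB p hp S hS Y hY
  haveI : NeZero p := ⟨hp.ne_zero⟩
  set lam := Nat.log 2 B + 1 with hlam
  have hlam1 : (1:ℝ) ≤ (lam:ℝ) := by exact_mod_cast Nat.le_add_left 1 _
  have hM' : (1:ℝ) ≤ M := by exact_mod_cast hM
  have hBr : (1:ℝ) ≤ B := by exact_mod_cast hB
  have hs1 : 1 ≤ Real.sqrt B := by rw [Real.one_le_sqrt]; exact hBr
  have hp2 : (2:ℝ) ≤ p := by exact_mod_cast hp.two_le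
  have hp0 : (0:ℝ) < p := by linarith
  set U : ℝ := 64 * lam * (3 * M : ℝ)^a with hU
  have hU1 : 64 * lam ≤ U := by
    have : (1:ℝ) ≤ (3 * M : ℝ)^a := one_le_pow₀ (by linarith)
    rw [hU]; nlinarith
  have hU0 : 0 < U := by linarith
  have hs0 : 0 < Real.sqrt B := by linarith
  have hss : Real.sqrt B * Real.sqrt B = B := Real.mul_self_sqrt (by linarith)
  -- the top level
  obtain ⟨K, hK1, hK2⟩ := exists_nat_pow_near hs1 (show (1:ℝ) < p by linarith)
  have hKlam : K + 1 ≤ lam := by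
    rw [hlam]
    have h1 : (2:ℝ)^K ≤ B := by
      calc (2:ℝ)^K ≤ p^K := by gcongr
        _ ≤ Real.sqrt B := hK1
        _ ≤ B := by nlinarith
    have h2 : 2^K ≤ B := by exact_mod_cast h1
    have := Nat.le_log_of_pow_le (by norm_num) h2
    omega
  have hKle : ∀ k ≤ K, (p:ℝ)^k ≤ Real.sqrt B := fun k hk => (pow_le_pow_right₀ (by linarith) hk).trans hK1
  have hex : ∀ (k : ℕ) (c : (Fin 2 → ZMod (p^k)) × ZMod p), ∃ G : MvPolynomial (Fin 2) ℚ, k ≤ K → (G ≠ 0 ∧ (G.totalDegree : ℝ) ≤ U * Real.sqrt B / p^k ∧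
      ∀ v ∈ S, cls p k v = c → aeval (zq (Fin.tail v)) G = 0) := by
    intro k c
    by_cases hk : k ≤ K
    · obtain ⟨G, h1, h2, h3⟩ := ha f hf hi ψ hψ M hM hN hNM B hB p k hp (hKle k hk) {v | v ∈ S ∧ cls p k v = c} (fun v hv => hS v hv.1)
        (fun v hv w hw => hv.2.trans hw.2.symm)
      exact ⟨G, fun _ => ⟨h1, h2, fun v hv hc => h3 v ⟨hv, hc⟩⟩⟩
    · exact ⟨0, fun h => absurd h hk⟩
  choose G hG using hex
  have hfac : ∀ c : (Fin 2 → ZMod (p^0)) × ZMod p, ∃ Ps : Finset (MvPolynomial (Fin 2) ℚ), (∀ P ∈ Ps, Irreducible P ∧ P ∣ G 0 c) ∧ Ps.card ≤ (G 0 c).totalDegree ∧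
      (∀ v : Fin 2 → ℚ, aeval v (G 0 c) = 0 → ∃ P ∈ Ps, aeval v P = 0) := by
    intro c
    obtain ⟨Ps, h1, _, h3, _, h5⟩ := factors_cover (G 0 c) (hG 0 c (Nat.zero_le _)).1
    exact ⟨Ps, h1, h3, h5⟩
  choose Fs hF1 hF2 hF3 using hfac
  set Ek : ℕ → Finset (Fin 3 → ℤ) := fun k => S.filter fun v => ∃ P, Irreducible P ∧ P ∣ G k (cls p k v) ∧ ¬ P ∣ G (k+1) (cls p (k+1) v) ∧
    aeval (zq (Fin.tail v)) P = 0 with hEk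
  refine ⟨(Finset.range K).biUnion Ek, ((S.image (cls p 0)).biUnion Fs).filter fun P => (P.totalDegree : ℝ) ≤ Y, ?_, ?_, ?_, ?_⟩
  · -- exceptional points
    have hk : ∀ k ∈ Finset.range K, ((Ek k).card : ℝ) ≤ 4 * p^2 * U^2 * B := by
      intro k hk
      rw [Finset.mem_range] at hk
      have hT : (Ek k).card ≤ ∑ c ∈ S.image (cls p (k+1)), ((Ek k).filter fun v => cls p (k+1) v = c).card := by
        rw [← Finset.card_eq_sum_card_fiberwise]
        intro v hv
        exact Finset.mem_image_of_mem _ (Finset.mem_filter.1 hv).1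
      have hc : ∀ c ∈ S.image (cls p (k+1)), (((Ek k).filter fun v => cls p (k+1) v = c).card : ℝ) ≤ 4 * ((U * Real.sqrt B / p^k) * (U * Real.sqrt B / p^(k+1))) := by
        intro c hc
        obtain ⟨w, hw, rfl⟩ := Finset.mem_image.1 hc
        set Z := (Ek k).filter fun v => cls p (k+1) v = cls p (k+1) w with hZ
        have h1 := fiber4 f hf (left_ne_zero_of_mul hN) Z (fun v hv => (hS v (Finset.mem_filter.1 (Finset.mem_filter.1 hv).1).1).1)
          (Z.image fun v => (Fin.tail v : Fin 2 → ℤ)) (fun v hv => Finset.mem_image_of_mem _ hv)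
        have h2 := bez_var (G k (cls p k w)) (G (k+1) (cls p (k+1) w)) (hG k _ hk.le).1 (Z.image fun v => (Fin.tail v : Fin 2 → ℤ)) (by
          intro x hx
          obtain ⟨v, hv, rfl⟩ := Finset.mem_image.1 hx
          rw [hZ, Finset.mem_filter] at hv
          obtain ⟨hvS, P, hP1, hP2, hP3, hP4⟩ := Finset.mem_filter.1 hv.1
          rw [hv.2] at hP3
          rw [cls_mono hv.2] at hP2
          exact ⟨P, hP1, hP2, hP3, hP4, (hG (k+1) _ hk).2.2 v hvS hv.2⟩)
        have h3 := (hG k (cls p k w) hk.le).2.1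
        have h4 := (hG (k+1) (cls p (k+1) w) hk).2.1
        have h5 : (Z.card : ℝ) ≤ 4 * ((G k (cls p k w)).totalDegree * (G (k+1) (cls p (k+1) w)).totalDegree) := by
          exact_mod_cast h1.trans (Nat.mul_le_mul_left 4 h2)
        refine h5.trans ?_
        gcongr
      have h6 : ((S.image (cls p (k+1))).card : ℝ) ≤ (p:ℝ)^(2*(k+1)+1) := by exact_mod_cast card_cls p (k+1) S
      calc ((Ek k).card : ℝ) ≤ ∑ c ∈ S.image (cls p (k+1)), (((Ek k).filter fun v => cls p (k+1) v = c).card : ℝ) := by exact_mod_cast hT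
        _ ≤ ∑ c ∈ S.image (cls p (k+1)), 4 * ((U * Real.sqrt B / p^k) * (U * Real.sqrt B / p^(k+1))) := Finset.sum_le_sum hc
        _ = (S.image (cls p (k+1))).card * (4 * ((U * Real.sqrt B / p^k) * (U * Real.sqrt B / p^(k+1)))) := by rw [Finset.sum_const, nsmul_eq_mul]
        _ ≤ (p:ℝ)^(2*(k+1)+1) * (4 * ((U * Real.sqrt B / p^k) * (U * Real.sqrt B / p^(k+1)))) := by gcongr
        _ = 4 * p^2 * U^2 * (Real.sqrt B * Real.sqrt B) := by field_simp; ring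
        _ = _ := by rw [hss]
    have h1 : (((Finset.range K).biUnion Ek).card : ℝ) ≤ ∑ k ∈ Finset.range K, ((Ek k).card : ℝ) := by exact_mod_cast Finset.card_biUnion_le
    have h2 := h1.trans (Finset.sum_le_sum hk)
    rw [Finset.sum_const, nsmul_eq_mul, Finset.card_range] at h2
    refine h2.trans ?_
    have hKl : (K:ℝ) ≤ lam := by exact_mod_cast (Nat.le_succ K).trans hKlam
    rw [hY]
    have h4 : 4 * (K:ℝ) ≤ U * p := by nlinarith
    calc (K:ℝ) * (4 * p^2 * U^2 * B) = (4 * K) * (p^2 * U^2 * B) := by ring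
      _ ≤ (U * p) * (p^2 * U^2 * B) := by gcongr
      _ = _ := by ring
  · -- number of curves
    have h1 : ((((S.image (cls p 0)).biUnion Fs).filter fun P => (P.totalDegree : ℝ) ≤ Y).card : ℝ) ≤ ∑ c ∈ S.image (cls p 0), ((Fs c).card : ℝ) := by
      exact_mod_cast (Finset.card_filter_le _ _).trans Finset.card_biUnion_le
    refine h1.trans ((Finset.sum_le_sum (g := fun c => U * Real.sqrt B) fun c _ => ?_).trans ?_)
    · have h2 := (hG 0 c (Nat.zero_le _)).2.1
      rw [pow_zero, div_one] at h2
      have h3 : ((Fs c).card : ℝ) ≤ (G 0 c).totalDegree := by exact_mod_cast hF2 c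
      exact h3.trans h2
    · rw [Finset.sum_const, nsmul_eq_mul]
      have h6 : ((S.image (cls p 0)).card : ℝ) ≤ p := by
        have := card_cls p 0 S
        rw [mul_zero, zero_add, pow_one] at this
        exact_mod_cast this
      rw [hY]
      calc ((S.image (cls p 0)).card : ℝ) * (U * Real.sqrt B) ≤ p * (U * Real.sqrt B) := by gcongr
        _ = _ := by ring
  · intro P hP
    rw [Finset.mem_filter, Finset.mem_biUnion] at hP
    obtain ⟨⟨c, _, hc⟩, hd⟩ := hP
    exact ⟨(hF1 c P hc).1, hd⟩
  · intro v hv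
    obtain ⟨P, hP, hP0⟩ := hF3 (cls p 0 v) _ ((hG 0 _ (Nat.zero_le _)).2.2 v hv rfl)
    by_cases hall : ∀ k ≤ K, P ∣ G k (cls p k v)
    · right
      refine ⟨P, ?_, hP0⟩
      rw [Finset.mem_filter, Finset.mem_biUnion]
      refine ⟨⟨_, Finset.mem_image_of_mem _ hv, hP⟩, ?_⟩
      have h1 := hG K (cls p K v) le_rfl
      have h2 : (P.totalDegree:ℝ) ≤ (G K (cls p K v)).totalDegree := by exact_mod_cast totalDegree_le_of_dvd_of_isDomain (hall K le_rfl) h1.1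
      refine (h2.trans h1.2.1).trans ?_
      rw [hY, div_le_iff₀ (by positivity)]
      rw [pow_succ] at hK2
      calc U * Real.sqrt B ≤ U * (p^K * p) := by gcongr
        _ = _ := by ring
    · left
      push Not at hall
      obtain ⟨k, ⟨hkK, hk⟩, hmin⟩ : ∃ k, (k ≤ K ∧ ¬ P ∣ G k (cls p k v)) ∧ ∀ j < k, ¬ (j ≤ K ∧ ¬ P ∣ G j (cls p j v)) :=
        ⟨Nat.find hall, Nat.find_spec hall, fun j hj => Nat.find_min hall hj⟩
      rcases k with _ | k
      · exact absurd (hF1 _ P hP).2 hk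
      · rw [Finset.mem_biUnion]
        refine ⟨k, Finset.mem_range.2 (by omega), Finset.mem_filter.2 ⟨hv, P, (hF1 _ P hP).1, ?_, hk, hP0⟩⟩
        by_contra hcon
        exact hmin k (Nat.lt_succ_self k) ⟨by omega, hcon⟩

end DG

end

section
namespace DG
open MvPolynomial

lemma curves_count (f : MvPolynomial (Fin 3) ℤ) (hf : f.totalDegree ≤ 4) (ha : coeff (Finsupp.single 0 4) f ≠ 0)
    (S : Finset (Fin 3 → ℤ)) (B : ℕ) (hB : 1 ≤ B) (hS : ∀ v ∈ S, aeval v f = 0 ∧ ∀ i, |v i| ≤ (B:ℤ))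
    (hns : ∀ v ∈ S, ¬ Short f (Nat.sqrt B) v) (Ps : Finset (MvPolynomial (Fin 2) ℚ)) (L : ℕ) (hP : ∀ P ∈ Ps, Irreducible P ∧ P.totalDegree ≤ L)
    (hPS : ∀ v ∈ S, ∃ P ∈ Ps, aeval (zq (Fin.tail v)) P = 0) :
    (S.card : ℝ) ≤ Ps.card * (4 * ((120 * L * (Nat.log 2 B + 1 : ℕ))^30 * Real.sqrt B)) := by
  classical
  have hsub : S ⊆ Ps.biUnion fun P => S.filter fun v => aeval (zq (Fin.tail v)) P = 0 := by
    intro v hv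
    obtain ⟨P, hP, hP0⟩ := hPS v hv
    simp only [Finset.mem_biUnion, Finset.mem_filter]
    exact ⟨P, hP, hv, hP0⟩
  have hcard : (S.card : ℝ) ≤ ∑ P ∈ Ps, ((S.filter fun v => aeval (zq (Fin.tail v)) P = 0).card : ℝ) := by
    exact_mod_cast (Finset.card_le_card hsub).trans Finset.card_biUnion_le
  refine hcard.trans ?_
  rw [← nsmul_eq_mul, ← Finset.sum_const]
  refine Finset.sum_le_sum fun P hPm => ?_
  exact cover_count f hf ha _ B hB (fun v hv => hS v (Finset.mem_filter.1 hv).1) (fun v hv => hns v (Finset.mem_filter.1 hv).1) P (hP P hPm).1 L (hP P hPm).2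
    (fun v hv => (Finset.mem_filter.1 hv).2)

lemma second_count (f : MvPolynomial (Fin 3) ℤ) (hf : f.totalDegree ≤ 4) (ha : coeff (Finsupp.single 0 4) f ≠ 0) (hi : Irreducible (toQ f))
    (S : Finset (Fin 3 → ℤ)) (B : ℕ) (hB : 1 ≤ B) (hS : ∀ v ∈ S, aeval v f = 0 ∧ ∀ i, |v i| ≤ (B:ℤ))
    (hns : ∀ v ∈ S, ¬ Short f (Nat.sqrt B) v) (g : MvPolynomial (Fin 3) ℤ) (hg : g.totalDegree ≤ 4) (hfg : ¬ toQ f ∣ toQ g)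
    (hgS : ∀ v ∈ S, aeval v g = 0) :
    (S.card : ℝ) ≤ 128 * 3840^30 * ((Nat.log 2 B + 1 : ℕ):ℝ)^30 * B := by
  obtain ⟨G, h1, h2, h3⟩ := res_int f hf ha hi g 4 hg hfg
  obtain ⟨Ps, p1, _, p3, _, p5⟩ := factors_cover G h1
  have := curves_count f hf ha S B hB hS hns Ps 32 (fun P hP => ⟨(p1 P hP).1, (totalDegree_le_of_dvd_of_isDomain (p1 P hP).2 h1).trans h2⟩)
    (fun v hv => p5 _ (h3 v (hS v hv).1 (hgS v hv)))
  have hc : (Ps.card:ℝ) ≤ 32 := by exact_mod_cast p3.trans h2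
  have hBr : (1:ℝ) ≤ B := by exact_mod_cast hB
  have hs : Real.sqrt B ≤ B := by
    rw [Real.sqrt_le_left (by linarith)]; nlinarith
  calc (S.card:ℝ) ≤ _ := this
    _ ≤ 32 * (4 * ((120 * (32:ℕ) * (Nat.log 2 B + 1 : ℕ))^30 * B)) := by gcongr
    _ = _ := by push_cast; ring

lemma aeval_abs_le {σ : Type*} (ψ : MvPolynomial σ ℤ) (x : σ → ℤ) (X : ℤ) (hX : 1 ≤ X) (hx : ∀ i, |x i| ≤ X) :
    |aeval x ψ| ≤ (∑ m ∈ ψ.support, |coeff m ψ|) * X ^ ψ.totalDegree := by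
  classical
  rw [aeval_def, eval₂_eq, Finset.sum_mul]
  refine (Finset.abs_sum_le_sum_abs _ _).trans (Finset.sum_le_sum fun m hm => ?_)
  rw [abs_mul]
  simp only [algebraMap_int_eq, eq_intCast, Int.cast_id]
  refine mul_le_mul_of_nonneg_left ?_ (abs_nonneg _)
  rw [Finset.abs_prod]
  calc ∏ i ∈ m.support, |x i ^ m i| ≤ ∏ i ∈ m.support, X ^ m i := by
        refine Finset.prod_le_prod (fun _ _ => abs_nonneg _) fun i _ => ?_
        rw [abs_pow]; exact pow_le_pow_left₀ (abs_nonneg _) (hx i) _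
    _ = X ^ (∑ i ∈ m.support, m i) := Finset.prod_pow_eq_pow_sum _ _ _
    _ ≤ _ := pow_le_pow_right₀ hX (le_totalDegree hm)

lemma supp_tix {r : ℕ} {R : Type*} [CommRing R] (f : MvPolynomial (Fin r) R) (d : ℕ) (hf : f.totalDegree ≤ d) : f.support ⊆ tix r (d+1) := by
  intro m hm
  have h1 : m.degree ≤ _ := (le_totalDegree hm).trans hf
  rw [mem_tix]; omega

lemma slE_coeff_le (f : MvPolynomial (Fin 3) ℤ) (hf : f.totalDegree ≤ 4) (X : ℕ) (hX : ∀ m, |coeff m f| ≤ (X:ℤ)) (m : Fin 2 →₀ ℕ) :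
    |coeff m (slE f (0:ℤ))| ≤ ((tix 3 5).card * X : ℕ) := by
  classical
  rw [slE_eq, coeff_sum]
  refine (Finset.abs_sum_le_sum_abs _ _).trans ?_
  refine (Finset.sum_le_sum (g := fun _ => (X:ℤ)) fun e he => ?_).trans ?_
  · rw [coeff_monomial]
    split_ifs
    · simp only [Int.cast_id]
      rw [abs_mul]
      have h2 : |(0:ℤ) ^ (4 - e.degree)| ≤ 1 := by
        rw [abs_pow, abs_zero]; exact pow_le_one₀ le_rfl (by norm_num)
      calc |coeff e f| * |(0:ℤ)^(4-e.degree)| ≤ |coeff e f| * 1 := by gcongr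
        _ ≤ X := by rw [mul_one]; exact hX e
    · simp
  · rw [Finset.sum_const, nsmul_eq_mul]
    push_cast
    have := Finset.card_le_card (supp_tix f 4 hf)
    gcongr

lemma N0_log : ∃ C : ℕ, ∀ ψ ∈ noe, ∀ B : ℕ, 1 ≤ B → ∀ f : MvPolynomial (Fin 3) ℤ, f.totalDegree ≤ 4 →
    (∀ m, |coeff m f| ≤ (((tix 3 5).card * B^4)^(tix 3 5).card : ℕ)) → N0 f ψ ≠ 0 → Real.log |(N0 f ψ : ℝ)| ≤ (C * (Nat.log 2 B + 1) : ℕ) := by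
  classical
  set n := (tix 3 5).card with hn
  have hn1 : 1 ≤ n := Finset.card_pos.2 ⟨0, by rw [mem_tix]; simp⟩
  obtain ⟨c1, hc1⟩ : ∃ c1 : ℕ, c1 = n * (n + 4) := ⟨_, rfl⟩
  let s : MvPolynomial (Fin 2 →₀ ℕ) ℤ → ℕ := fun ψ => (∑ m ∈ ψ.support, |coeff m ψ|).toNat
  refine ⟨c1 + ∑ ψ ∈ noe, (s ψ + ψ.totalDegree * (n + c1)), ?_⟩
  intro ψ hψ B hB f hf hc hN
  obtain ⟨X, hX⟩ : ∃ X : ℕ, X = (n * B^4)^n := ⟨_, rfl⟩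
  rw [← hX] at hc
  have hX1 : 1 ≤ X := hX ▸ Nat.one_le_pow _ _ (Nat.mul_pos hn1 (Nat.pow_pos hB))
  have hXr : (1:ℝ) ≤ X := by exact_mod_cast hX1
  set lam := Nat.log 2 B + 1 with hlam
  have hl1 : (1:ℝ) ≤ (lam:ℝ) := by exact_mod_cast Nat.le_add_left 1 _
  have hBr : (1:ℝ) ≤ B := by exact_mod_cast hB
  have hnr : (1:ℝ) ≤ n := by exact_mod_cast hn1
  have hlogB := log_le_lam B
  have hlogX : Real.log X ≤ c1 * lam := by
    rw [hX]; push_cast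
    rw [Real.log_pow, Real.log_mul (by positivity) (by positivity), Real.log_pow]
    have h1 : Real.log n ≤ n * lam := by
      have := Real.log_le_sub_one_of_pos (show (0:ℝ) < n by linarith)
      nlinarith
    rw [hc1]; push_cast
    calc (n:ℝ) * (Real.log n + 4 * Real.log B) ≤ n * (n * lam + 4 * lam) := by gcongr
      _ = _ := by ring
  have hb := aeval_abs_le ψ (fun m => coeff m (slE f (0:ℤ))) ((n * X : ℕ) : ℤ) (by exact_mod_cast Nat.mul_pos hn1 hX1) (slE_coeff_le f hf X hc)
  have hs0 : (0:ℤ) ≤ ∑ m ∈ ψ.support, |coeff m ψ| := Finset.sum_nonneg fun _ _ => abs_nonneg _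
  have hs : ∑ m ∈ ψ.support, |coeff m ψ| = (s ψ : ℤ) := (Int.toNat_of_nonneg hs0).symm
  rw [hs] at hb
  have hsne : s ψ ≠ 0 := by
    intro h0
    rw [h0] at hb
    have : aeval (fun m => coeff m (slE f (0:ℤ))) ψ = 0 := by
      rw [← abs_nonpos_iff]; simpa using hb
    exact right_ne_zero_of_mul hN this
  have hs1 : (1:ℝ) ≤ s ψ := by exact_mod_cast Nat.one_le_iff_ne_zero.2 hsne
  have htot : |(N0 f ψ : ℝ)| ≤ X * (s ψ * (n * X)^ψ.totalDegree) := by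
    have h1 : |N0 f ψ| ≤ (X:ℤ) * ((s ψ : ℤ) * ((n * X : ℕ) : ℤ)^ψ.totalDegree) := by
      rw [N0, abs_mul]
      exact mul_le_mul (hc _) hb (abs_nonneg _) (by positivity)
    have h2 : ((|N0 f ψ| : ℤ) : ℝ) ≤ (((X:ℤ) * ((s ψ : ℤ) * ((n * X : ℕ) : ℤ)^ψ.totalDegree) : ℤ) : ℝ) := by exact_mod_cast h1
    push_cast at h2
    exact h2
  have hNr : (0:ℝ) < |(N0 f ψ : ℝ)| := abs_pos.2 (by exact_mod_cast hN)
  have hlog := Real.log_le_log hNr htot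
  have n0 : (n:ℝ) ≠ 0 := by linarith
  have x0 : (X:ℝ) ≠ 0 := by linarith
  have s0 : (s ψ:ℝ) ≠ 0 := by linarith
  rw [Real.log_mul x0 (mul_ne_zero s0 (pow_ne_zero _ (mul_ne_zero n0 x0))), Real.log_mul s0 (pow_ne_zero _ (mul_ne_zero n0 x0)), Real.log_pow,
    Real.log_mul n0 x0] at hlog
  have h1 : Real.log n ≤ n * lam := by
    have := Real.log_le_sub_one_of_pos (show (0:ℝ) < n by linarith)
    nlinarith
  have h2 : Real.log (s ψ) ≤ s ψ * lam := by
    have := Real.log_le_sub_one_of_pos (show (0:ℝ) < s ψ by linarith)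
    nlinarith
  have hsum : s ψ + ψ.totalDegree * (n + c1) ≤ ∑ ψ ∈ noe, (s ψ + ψ.totalDegree * (n + c1)) :=
    Finset.single_le_sum (f := fun ψ => s ψ + ψ.totalDegree * (n + c1)) (fun _ _ => Nat.zero_le _) hψ
  have hsum' : (s ψ:ℝ) + ψ.totalDegree * (n + c1) ≤ ((∑ ψ ∈ noe, (s ψ + ψ.totalDegree * (n + c1)) : ℕ) : ℝ) := by exact_mod_cast hsum
  calc Real.log |(N0 f ψ : ℝ)| ≤ _ := hlog
    _ ≤ c1 * lam + (s ψ * lam + ψ.totalDegree * (n * lam + c1 * lam)) := by gcongr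
    _ = (c1 + (s ψ + ψ.totalDegree * (n + c1))) * lam := by ring
    _ ≤ (c1 + ((∑ ψ ∈ noe, (s ψ + ψ.totalDegree * (n + c1)) : ℕ) : ℝ)) * lam := by gcongr
    _ = _ := by rw [Nat.cast_mul, Nat.cast_add c1]

set_option maxHeartbeats 1000000 in
lemma T1_small : ∃ (C : ℝ) (κ : ℕ), 0 ≤ C ∧ ∀ f : MvPolynomial (Fin 3) ℤ, f.totalDegree ≤ 4 → Irreducible (toQ f) → ∀ ψ ∈ noe, N0 f ψ ≠ 0 →
    ∀ B : ℕ, 1 ≤ B → (∀ m, |coeff m f| ≤ (((tix 3 5).card * B^4)^(tix 3 5).card : ℕ)) →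
    ∀ S : Finset (Fin 3 → ℤ), (∀ v ∈ S, aeval v f = 0 ∧ ∀ i, |v i| ≤ (B:ℤ)) → (∀ v ∈ S, ¬ Short f (Nat.sqrt B) v) →
    (S.card : ℝ) ≤ C * ((Nat.log 2 B + 1 : ℕ):ℝ)^κ * B := by
  classical
  obtain ⟨a, hnest⟩ := nest
  obtain ⟨C2, hC2⟩ := N0_log
  set n := (tix 3 5).card with hn
  set C0 : ℕ := C2 + (n + 4 + 2) * (n + 4 + 4) with hC0
  set C1 : ℝ := 64 * (3 * C0)^a * (256 * C0^2) with hC1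
  refine ⟨10 * (120 * C1)^31 + 128 * 3840^30, 31 * (a + 4), by positivity, ?_⟩
  intro f hf hi ψ hψ hN B hB hc S hS hns
  have ha : coeff (Finsupp.single 0 4) f ≠ 0 := left_ne_zero_of_mul hN
  set lam := Nat.log 2 B + 1 with hlam
  have hl1 : (1:ℝ) ≤ (lam:ℝ) := by exact_mod_cast Nat.le_add_left 1 _
  have hC01 : 1 ≤ C0 := by rw [hC0]; nlinarith [Nat.zero_le C2, Nat.zero_le n]
  have hC0r : (1:ℝ) ≤ C0 := by exact_mod_cast hC01
  set M := C0 * lam with hM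
  have hMr : (M:ℝ) = C0 * lam := by rw [hM]; push_cast; ring
  have hM1 : 1 ≤ M := Nat.mul_pos hC01 (by omega)
  have hBr : (1:ℝ) ≤ B := by exact_mod_cast hB
  have hss : Real.sqrt B * Real.sqrt B = B := Real.mul_self_sqrt (by linarith)
  have hNM : Real.log |(N0 f ψ : ℝ)| ≤ M := by
    refine (hC2 ψ hψ B hB f hf hc hN).trans ?_
    rw [hM, hC0]
    exact_mod_cast Nat.mul_le_mul_right _ (Nat.le_add_right _ _)
  have hfz : ∀ v ∈ S, Real.log |((aeval v (pderiv 0 f) : ℤ) : ℝ)| ≤ M := by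
    intro v hv
    have h1 := log_pderiv_le 0 f 4 B (n+4) hB hf (by rw [hn]; exact Nat.le_add_right _ 4) (by omega) (by omega) hc v (hS v hv).2
    refine h1.trans ?_
    have h2 := log_le_lam B
    rw [hMr, hC0]; push_cast
    have h3 : ((n:ℝ) + 4 + 2) * (n + 4 + 4 * Real.log B) ≤ (n + 4 + 2) * ((n + 4 + 4) * lam) := by
      gcongr
      nlinarith
    have : 0 ≤ (C2:ℝ) * lam := by positivity
    nlinarith
  -- split
  set S0 := S.filter fun v => aeval v (pderiv 0 f) = 0 with hS0
  set S1 := S.filter fun v => ¬ aeval v (pderiv 0 f) = 0 with hS1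
  have hsplit : S.card = S0.card + S1.card := (Finset.card_filter_add_card_filter_not _).symm
  have hf4 : 4 ≤ f.degreeOf 0 := degreeOf_of_coeff_top 0 f 4 ha
  have hb0 : (S0.card:ℝ) ≤ 128 * 3840^30 * (lam:ℝ)^30 * B := by
    refine second_count f hf ha hi S0 B hB (fun v hv => hS v (Finset.mem_filter.1 hv).1) (fun v hv => hns v (Finset.mem_filter.1 hv).1)
      (pderiv 0 f) ((totalDegree_pderiv_le 0 f).trans hf) (toQ_not_dvd f _ ha (pderiv_ne_zero_of_top 0 f 3 ha) ?_) (fun v hv => (Finset.mem_filter.1 hv).2)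
    have h1 := degreeOf_pderiv_lt 0 f (by omega)
    have h2 : f.degreeOf 0 ≤ 4 := (degreeOf_le_totalDegree f 0).trans hf
    omega
  obtain ⟨p, hp, hpM, hhalf⟩ := pick_prime S1 (fun v => aeval v (pderiv 0 f)) M hM1 (fun v hv => (Finset.mem_filter.1 hv).2)
    (fun v hv => hfz v (Finset.mem_filter.1 hv).1)
  set S2 := S1.filter fun v => ¬ (p:ℤ) ∣ aeval v (pderiv 0 f) with hS2
  have hS2S : ∀ v ∈ S2, v ∈ S := fun v hv => (Finset.mem_filter.1 (Finset.mem_filter.1 hv).1).1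
  set Y : ℝ := 64 * lam * (3 * M : ℝ)^a * p with hY
  obtain ⟨E, Ps, hE, hPs, hPd, hcov⟩ := hnest f hf hi ψ hψ M hM1 hN hNM B hB p hp S2 (fun v hv =>
    ⟨(hS v (hS2S v hv)).1, (hS v (hS2S v hv)).2, hfz v (hS2S v hv), (Finset.mem_filter.1 hv).2⟩) Y hY
  have hpr : (1:ℝ) ≤ p := by exact_mod_cast hp.one_lt.le
  have hMr1 : (1:ℝ) ≤ M := by exact_mod_cast hM1
  have hY0 : 0 ≤ Y := by positivity
  have hYX : Y ≤ C1 * lam^(a+3) := by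
    have : (p:ℝ) ≤ 256 * M^2 := by exact_mod_cast hpM
    calc Y ≤ 64 * lam * (3 * M : ℝ)^a * (256 * M^2) := by rw [hY]; gcongr
      _ = _ := by rw [hMr, hC1]; ring
  set Z := S2.filter fun v => ∃ P ∈ Ps, aeval (zq (Fin.tail v)) P = 0 with hZ
  have hb2 : (S2.card:ℝ) ≤ E.card + Z.card := by
    have : S2 ⊆ E ∪ Z := by
      intro v hv
      rw [Finset.mem_union]
      rcases hcov v hv with h | h
      · exact Or.inl h
      · exact Or.inr (Finset.mem_filter.2 ⟨hv, h⟩)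
    exact_mod_cast (Finset.card_le_card this).trans (Finset.card_union_le _ _)
  have hbZ := curves_count f hf ha Z B hB (fun v hv => hS v (hS2S v (Finset.mem_filter.1 hv).1)) (fun v hv => hns v (hS2S v (Finset.mem_filter.1 hv).1))
    Ps ⌊Y⌋₊ (fun P hP => ⟨(hPd P hP).1, Nat.le_floor (hPd P hP).2⟩) (fun v hv => (Finset.mem_filter.1 hv).2)
  set T : ℝ := 120 * C1 * lam^(a+4) with hT
  have hC11 : 1 ≤ C1 := by
    rw [hC1]
    have h1 : (1:ℝ) ≤ (3 * C0)^a := one_le_pow₀ (by linarith)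
    have h2 : (1:ℝ) ≤ C0^2 := one_le_pow₀ hC0r
    nlinarith
  have hT1 : 1 ≤ T := by
    have : (1:ℝ) ≤ (lam:ℝ)^(a+4) := one_le_pow₀ hl1
    rw [hT]; nlinarith
  have hYT : 120 * Y * lam ≤ T := by
    calc 120 * Y * lam ≤ 120 * (C1 * lam^(a+3)) * lam := by gcongr
      _ = _ := by rw [hT]; ring
  have hYT' : Y ≤ T := by nlinarith
  have hfl : (⌊Y⌋₊:ℝ) ≤ Y := Nat.floor_le hY0
  have hbZ' : (Z.card:ℝ) ≤ 4 * T^31 * B := by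
    calc (Z.card:ℝ) ≤ _ := hbZ
      _ ≤ (Y * Real.sqrt B) * (4 * ((120 * Y * lam)^30 * Real.sqrt B)) := by gcongr
      _ ≤ (T * Real.sqrt B) * (4 * (T^30 * Real.sqrt B)) := by gcongr
      _ = 4 * T^31 * (Real.sqrt B * Real.sqrt B) := by ring
      _ = _ := by rw [hss]
  have hbE : (E.card:ℝ) ≤ T^31 * B := by
    calc (E.card:ℝ) ≤ Y^3 * B := hE
      _ ≤ T^3 * B := by gcongr
      _ ≤ T^31 * B := by gcongr <;> first | exact hT1 | norm_num
  have hb1 : (S1.card:ℝ) ≤ 2 * S2.card := by exact_mod_cast hhalf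
  have hTe : T^31 = (120*C1)^31 * lam^(31*(a+4)) := by rw [hT, mul_pow, ← pow_mul]; ring_nf
  have hlp : (lam:ℝ)^30 ≤ lam^(31*(a+4)) := pow_le_pow_right₀ hl1 (by omega)
  have h10 : 128 * 3840^30 * (lam:ℝ)^30 * B ≤ 128 * 3840^30 * lam^(31*(a+4)) * B := by gcongr
  calc (S.card:ℝ) = S0.card + S1.card := by exact_mod_cast hsplit
    _ ≤ 128 * 3840^30 * lam^(31*(a+4)) * B + 10 * T^31 * B := by linarith
    _ = _ := by rw [hTe]; ring

end DG

end

section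
namespace DG
open MvPolynomial

lemma hom_map {R S : Type*} [CommRing R] [CommRing S] (φ : R →+* S) {σ : Type*} (d : ℕ) (P : MvPolynomial σ R) :
    homogeneousComponent d (map φ P) = map φ (homogeneousComponent d P) := by
  ext m
  rw [coeff_homogeneousComponent, coeff_map, coeff_map, coeff_homogeneousComponent]
  split_ifs <;> simp

lemma td_map {R S : Type*} [CommRing R] [CommRing S] (φ : R →+* S) {σ : Type*} (P : MvPolynomial σ R) : (map φ P).totalDegree ≤ P.totalDegree :=
  Finset.sup_mono (support_map_subset _ _)

lemma hom_mul_eval {R : Type*} [CommRing R] {m : ℕ} (A B : MvPolynomial (Fin m) R) (a b : ℕ) (hA : A.totalDegree ≤ a) (hB : B.totalDegree ≤ b) (w : Fin m → R) :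
    aeval w (homogeneousComponent (a+b) (A*B)) = aeval w (homogeneousComponent a A) * aeval w (homogeneousComponent b B) := by
  have hl : ∀ i, (C (w i) * X 0 : MvPolynomial (Fin 1) R).totalDegree ≤ 1 := by
    intro i
    refine (totalDegree_mul _ _).trans ?_
    rw [totalDegree_C, zero_add]
    exact (totalDegree_monomial_le _ _).trans (by simp)
  have hc : (fun i => coeff (Finsupp.single 0 1) (C (w i) * X 0 : MvPolynomial (Fin 1) R)) = w := by
    funext i; rw [coeff_C_mul]; simp [coeff_X]
  have h1 := coeff_top_subst (A*B) (a+b) ((totalDegree_mul _ _).trans (add_le_add hA hB)) (fun i => (C (w i) * X 0 : MvPolynomial (Fin 1) R)) hl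
  have h2 := coeff_top_subst A a hA (fun i => (C (w i) * X 0 : MvPolynomial (Fin 1) R)) hl
  have h3 := coeff_top_subst B b hB (fun i => (C (w i) * X 0 : MvPolynomial (Fin 1) R)) hl
  rw [hc] at h1 h2 h3
  rw [← h1.2, ← h2.2, ← h3.2, map_mul, coeff_top_mul _ _ a b h2.1 h3.1]

lemma hom_mul {K : Type*} [Field K] [Infinite K] {m : ℕ} (A B : MvPolynomial (Fin m) K) (a b : ℕ) (hA : A.totalDegree ≤ a) (hB : B.totalDegree ≤ b) :
    homogeneousComponent (a+b) (A*B) = homogeneousComponent a A * homogeneousComponent b B := by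
  apply MvPolynomial.funext
  intro w
  have := hom_mul_eval A B a b hA hB w
  rw [aeval_eq_eval] at this
  exact this.trans (map_mul (eval w) _ _).symm

/-- the dehomogenisation substitution -/
noncomputable def dh (R : Type*) [CommRing R] : Fin 3 → MvPolynomial (Fin 2) R := ![X 0, X 1, 1]

lemma dh_deg {R : Type*} [CommRing R] (i : Fin 3) : (dh R i).totalDegree ≤ 1 := by
  fin_cases i
  · exact (totalDegree_monomial_le _ _).trans (by simp)
  · exact (totalDegree_monomial_le _ _).trans (by simp)
  · simp [dh]

lemma slE_hom {R : Type*} [CommRing R] (f : MvPolynomial (Fin 3) ℤ) (hf : f.totalDegree ≤ 4) :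
    slE f (0:R) = aeval (dh R) (homogeneousComponent 4 (map (Int.castRingHom R) f)) := by
  classical
  rw [hom_map, show (Int.castRingHom R) = algebraMap ℤ R from rfl, aeval_map_algebraMap, homogeneousComponent_apply, map_sum, Finset.sum_filter, slE_eq]
  refine Finset.sum_congr rfl fun m hm => ?_
  have h1 : m.degree ≤ 4 := (le_totalDegree hm).trans hf
  split_ifs with h
  · rw [h, aeval_monomial, Finsupp.prod_fintype _ _ (by simp), Fin.prod_univ_three, monomial_eq, Finsupp.prod_fintype _ _ (by simp), Fin.prod_univ_two, prj_zero, prj_one]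
    simp [dh]
  · rw [zero_pow (by omega), mul_zero, monomial_zero]

lemma slE_homc {R : Type*} [CommRing R] (f : MvPolynomial (Fin 3) ℤ) (hf : f.totalDegree ≤ 4) :
    slE (homogeneousComponent 4 f) (0:R) = slE f (0:R) := by
  rw [slE_hom f hf, slE_hom _ ((homogeneousComponent_isHomogeneous 4 f).totalDegree_le), hom_map, hom_map]
  congr 2
  rw [homogeneousComponent_of_mem (homogeneousComponent_mem 4 f), if_pos rfl]

lemma slE_map (R : Type*) [CommRing R] (f : MvPolynomial (Fin 3) ℤ) : slE f (0:R) = map (Int.castRingHom R) (slE f (0:ℤ)) := by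
  rw [slE_eq, slE_eq, map_sum]
  refine Finset.sum_congr rfl fun m _ => ?_
  rw [map_monomial]; simp

lemma exists_N0 (f : MvPolynomial (Fin 3) ℤ) (hf : f.totalDegree ≤ 4) (ha : coeff (Finsupp.single 0 4) f ≠ 0) (hI : Irreducible (slE f (0:ℂ))) :
    ∃ ψ ∈ noe, N0 f ψ ≠ 0 := by
  obtain ⟨ψ, hψ, h⟩ := noe_spec1 ℂ (slE f (0:ℂ)) (slE_deg f hf 0) (by rw [slE_top f hf]; exact_mod_cast ha) hI
  refine ⟨ψ, hψ, mul_ne_zero ha fun h0 => h ?_⟩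
  have h1 := aeval_intCast ℂ (fun m => coeff m (slE f (0:ℤ))) ψ
  rw [h0, Int.cast_zero] at h1
  have h2 : (fun m => coeff m (slE f (0:ℂ))) = fun m => ((coeff m (slE f (0:ℤ)) : ℤ) : ℂ) := by
    funext m
    rw [slE_map ℂ f, coeff_map]; simp
  rw [h2, h1]

lemma irr_toQ (f : MvPolynomial (Fin 3) ℤ) (hf : f.totalDegree ≤ 4) (ha : coeff (Finsupp.single 0 4) f ≠ 0) (hI : Irreducible (slE f (0:ℂ))) :
    Irreducible (toQ f) := by
  have hf0 : toQ f ≠ 0 := by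
    rw [Ne, toQ_ne]; rintro rfl; simp at ha
  have key : ∀ A B : MvPolynomial (Fin 3) ℚ, toQ f = A * B → IsUnit (aeval (dh ℂ) (homogeneousComponent A.totalDegree (map (algebraMap ℚ ℂ) A))) →
      slE f (0:ℂ) = aeval (dh ℂ) (homogeneousComponent A.totalDegree (map (algebraMap ℚ ℂ) A)) * aeval (dh ℂ) (homogeneousComponent B.totalDegree (map (algebraMap ℚ ℂ) B)) →
      IsUnit A := by
    intro A B hAB hU hE
    have hA0 : A ≠ 0 := by rintro rfl; exact hf0 (by rw [hAB, zero_mul])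
    have hB0 : B ≠ 0 := by rintro rfl; exact hf0 (by rw [hAB, mul_zero])
    have hdeg : A.totalDegree + B.totalDegree ≤ 4 := by
      rw [← totalDegree_mul_of_isDomain hA0 hB0, ← hAB, toQ_deg]; exact hf
    have h1 := (coeff_top_subst (homogeneousComponent B.totalDegree (map (algebraMap ℚ ℂ) B)) B.totalDegree
      ((homogeneousComponent_isHomogeneous _ _).totalDegree_le) (dh ℂ) dh_deg).1
    set V := aeval (dh ℂ) (homogeneousComponent B.totalDegree (map (algebraMap ℚ ℂ) B)) with hV
    have hass : Associated (slE f (0:ℂ)) V := by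
      obtain ⟨u, hu⟩ := hU
      rw [hE, ← hu, mul_comm]
      exact (associated_mul_unit_left V _ u.isUnit)
    have hV0 : V ≠ 0 := fun h0 => hI.ne_zero (by rw [h0] at hass; exact (associated_zero_iff_eq_zero _).1 hass)
    have h2 : 4 ≤ (slE f (0:ℂ)).totalDegree := by
      have h3 : coeff (Finsupp.single 0 4) (slE f (0:ℂ)) ≠ 0 := by rw [slE_top f hf]; exact_mod_cast ha
      have := le_totalDegree (mem_support_iff.2 h3)
      simpa using this
    rw [totalDegree_assoc hass hV0] at h2
    have hA : A.totalDegree = 0 := by omega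
    rw [totalDegree_eq_zero_iff_eq_C] at hA
    rw [hA]
    refine (isUnit_iff_ne_zero.2 fun h => ?_).map C
    rw [h, map_zero] at hA; exact hA0 hA
  have hd4 : 4 ≤ (toQ f).totalDegree := by
    have h3 : coeff (Finsupp.single 0 4) (toQ f) ≠ 0 := by rw [toQ_coeff]; exact_mod_cast ha
    have := le_totalDegree (mem_support_iff.2 h3)
    simpa using this
  have hE : ∀ A B : MvPolynomial (Fin 3) ℚ, toQ f = A * B →
      slE f (0:ℂ) = aeval (dh ℂ) (homogeneousComponent A.totalDegree (map (algebraMap ℚ ℂ) A)) * aeval (dh ℂ) (homogeneousComponent B.totalDegree (map (algebraMap ℚ ℂ) B)) := by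
    intro A B hAB
    have hA0 : A ≠ 0 := by rintro rfl; exact hf0 (by rw [hAB, zero_mul])
    have hB0 : B ≠ 0 := by rintro rfl; exact hf0 (by rw [hAB, mul_zero])
    have hdeg : A.totalDegree + B.totalDegree = 4 := by
      rw [← totalDegree_mul_of_isDomain hA0 hB0, ← hAB]
      have := toQ_deg f
      omega
    have h1 : map (Int.castRingHom ℂ) f = map (algebraMap ℚ ℂ) A * map (algebraMap ℚ ℂ) B := by
      rw [← map_mul, ← hAB, toQ, map_map]
      congr 1
    rw [slE_hom f hf, h1, ← hdeg, hom_mul _ _ _ _ (td_map _ _) (td_map _ _), map_mul]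
  refine ⟨fun hu => ?_, fun A B hAB => ?_⟩
  · rw [MvPolynomial.isUnit_iff_totalDegree_of_isReduced] at hu
    omega
  · have h := hE A B hAB
    rcases hI.isUnit_or_isUnit h with hu | hu
    · exact Or.inl (key A B hAB hu h)
    · exact Or.inr (key B A (by rw [hAB, mul_comm]) hu (by rw [h, mul_comm]))

lemma T1 : ∃ (C : ℝ) (κ : ℕ), 0 ≤ C ∧ ∀ f : MvPolynomial (Fin 3) ℤ, f.totalDegree ≤ 4 → coeff (Finsupp.single 0 4) f ≠ 0 → Irreducible (slE f (0:ℂ)) →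
    ∀ B : ℕ, 1 ≤ B → ∀ S : Finset (Fin 3 → ℤ), (∀ v ∈ S, aeval v f = 0 ∧ ∀ i, |v i| ≤ (B:ℤ)) → (∀ v ∈ S, ¬ Short f (Nat.sqrt B) v) →
    (S.card : ℝ) ≤ C * ((Nat.log 2 B + 1 : ℕ):ℝ)^κ * B := by
  obtain ⟨C1, κ, hC1, hT⟩ := T1_small
  refine ⟨C1 + 128 * 3840^30, κ + 30, by positivity, ?_⟩
  intro f hf ha hI B hB S hS hns
  have hi := irr_toQ f hf ha hI
  have hl1 : (1:ℝ) ≤ ((Nat.log 2 B + 1 : ℕ):ℝ) := by exact_mod_cast Nat.le_add_left 1 _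
  set lam : ℝ := ((Nat.log 2 B + 1 : ℕ):ℝ) with hlam
  obtain ⟨Q, hQ0, hQd, hQS, hQc⟩ := height_red (S : Set (Fin 3 → ℤ)) B 4 hB (fun v hv => (hS v hv).2) (toQ f) hi.ne_zero (by rwa [toQ_deg])
    (fun v hv => (aeval_toQ_iff f v).2 (hS v hv).1)
  by_cases hdvd : toQ f ∣ toQ Q
  · have h4 : 4 ≤ (toQ f).totalDegree := by
      have h3 : coeff (Finsupp.single 0 4) (toQ f) ≠ 0 := by rw [toQ_coeff]; exact_mod_cast ha
      have := le_totalDegree (mem_support_iff.2 h3)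
      simpa using this
    obtain ⟨c, hc0, hc⟩ := dvd_eq_C_mul _ _ hdvd (by rwa [Ne, toQ_ne]) (by rw [toQ_deg Q]; omega)
    have haQ : coeff (Finsupp.single 0 4) Q ≠ 0 := by
      intro h0
      have := congrArg (coeff (Finsupp.single 0 4)) hc
      rw [coeff_C_mul, toQ_coeff, toQ_coeff, h0, Int.cast_zero, eq_comm, mul_eq_zero] at this
      rcases this with h | h
      · exact hc0 h
      · exact ha (by exact_mod_cast h)
    have hmapC : map (Int.castRingHom ℂ) Q = C (c:ℂ) * map (Int.castRingHom ℂ) f := by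
      have := congrArg (map (algebraMap ℚ ℂ)) hc
      rw [map_mul, map_C, toQ, toQ, map_map, map_map] at this
      rw [show (algebraMap ℚ ℂ).comp (Int.castRingHom ℚ) = Int.castRingHom ℂ from RingHom.ext_int _ _] at this
      exact this
    have hIQ : Irreducible (slE Q (0:ℂ)) := by
      rw [slE_hom Q hQd, hmapC, homogeneousComponent_C_mul, map_mul, ← slE_hom f hf, aeval_C]
      refine (irreducible_isUnit_mul ?_).2 hI
      exact (isUnit_iff_ne_zero.2 (by exact_mod_cast hc0 : (c:ℂ) ≠ 0)).map _
    obtain ⟨ψ, hψ, hN⟩ := exists_N0 Q hQd haQ hIQ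
    have hz : ∀ v : Fin 3 → ℤ, aeval v Q = 0 → aeval v f = 0 := by
      intro v hv
      rw [← aeval_toQ_iff, hc, map_mul, aeval_C, mul_eq_zero] at hv
      rcases hv with h | h
      · exact absurd h hc0
      · exact (aeval_toQ_iff f v).1 h
    have := hT Q hQd (irr_toQ Q hQd haQ hIQ) ψ hψ hN B hB hQc S (fun v hv => ⟨hQS v hv, (hS v hv).2⟩) (by
      rintro v hv ⟨w, hw0, hw1, hw2⟩
      exact hns v hv ⟨w, hw0, hw1, fun t => hz _ (hw2 t)⟩)
    refine this.trans ?_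
    gcongr
    · have : (0:ℝ) ≤ 128 * 3840^30 := by positivity
      linarith
    · omega
  · refine (second_count f hf ha hi S B hB hS hns Q hQd hdvd hQS).trans ?_
    rw [← hlam]
    gcongr
    · linarith
    · omega

end DG

end

section
namespace DG
open MvPolynomial

/-- parametrised line -/
noncomputable def ln {R : Type*} [CommRing R] {n : ℕ} (v w : Fin n → R) : Fin n → MvPolynomial (Fin 1) R := fun i => C (v i) + C (w i) * X 0

lemma ln_deg {R : Type*} [CommRing R] {n : ℕ} (v w : Fin n → R) (i) : (ln v w i).totalDegree ≤ 1 := by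
  refine (totalDegree_add _ _).trans (max_le (by rw [totalDegree_C]; omega) ((totalDegree_mul _ _).trans ?_))
  rw [totalDegree_C, zero_add]
  exact (totalDegree_monomial_le _ _).trans (by simp)

lemma ln_coeff {R : Type*} [CommRing R] {n : ℕ} (v w : Fin n → R) : (fun i => coeff (Finsupp.single 0 1) (ln v w i)) = w := by
  funext i
  rw [ln, coeff_add, coeff_C_mul, coeff_C, if_neg (by intro h; simpa using congrArg (fun m => m 0) h)]
  simp [coeff_X]

lemma ln_eval {R A : Type*} [CommRing R] [CommRing A] [Algebra R A] {n : ℕ} (v w : Fin n → R) (f : MvPolynomial (Fin n) R) (t : Fin 1 → A) :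
    aeval t (aeval (ln v w) f) = aeval (fun i => algebraMap R A (v i) + t 0 * algebraMap R A (w i)) f := by
  rw [← AlgHom.comp_apply, comp_aeval]
  congr 2
  funext i
  simp [ln, mul_comm]

lemma line_q {n : ℕ} (f : MvPolynomial (Fin n) ℤ) (v w : Fin n → ℤ) (h : ∀ t : ℤ, aeval (fun i => v i + t * w i) f = 0) : aeval (ln v w) f = 0 := by
  apply MvPolynomial.funext
  intro t
  have := ln_eval (A := ℤ) v w f t
  rw [aeval_eq_eval] at this
  exact this.trans ((h (t 0)).trans (map_zero _).symm)

lemma line_all {n : ℕ} (f : MvPolynomial (Fin n) ℤ) (v w : Fin n → ℤ) (h : ∀ t : ℤ, aeval (fun i => v i + t * w i) f = 0)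
    (A : Type*) [CommRing A] (t : A) : aeval (fun i => (v i : A) + t * (w i : A)) f = 0 := by
  have := ln_eval (A := A) v w f (fun _ => t)
  rw [line_q f v w h, map_zero] at this
  exact this.symm

lemma top_dir {n : ℕ} (f : MvPolynomial (Fin n) ℤ) (hf : f.totalDegree ≤ 4) (v w : Fin n → ℤ) (h : ∀ t : ℤ, aeval (fun i => v i + t * w i) f = 0) :
    aeval w (homogeneousComponent 4 f) = 0 := by
  have := (coeff_top_subst f 4 hf (ln v w) (ln_deg v w)).2
  rw [line_q f v w h, coeff_zero, ln_coeff] at this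
  exact this.symm

/-- value of a quartic form at a multiple of the first basis vector -/
lemma hom_e0 {A : Type*} [CommRing A] (f : MvPolynomial (Fin 3) ℤ) (v : Fin 3 → A) (h1 : v 1 = 0) (h2 : v 2 = 0) :
    aeval v (homogeneousComponent 4 f) = ((coeff (Finsupp.single 0 4) f : ℤ) : A) * v 0 ^ 4 := by
  classical
  have hv : v = fun i => v 0 * (![1,0,0] : Fin 3 → A) i := by
    funext i; fin_cases i <;> simp [h1, h2]
  rw [hv, hom_scale _ 4 (homogeneousComponent_isHomogeneous 4 f), aeval_def, eval₂_eq', Finset.sum_eq_single (Finsupp.single 0 4)]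
  · rw [Fin.prod_univ_three, coeff_homogeneousComponent, if_pos (by simp)]
    simp [mul_comm]
  · intro m hm hne
    have hd : m.degree = 4 := by
      by_contra h
      exact (mem_support_iff.1 hm) ((homogeneousComponent_isHomogeneous 4 f).coeff_eq_zero h)
    rw [deg3] at hd
    rw [Fin.prod_univ_three]
    by_cases a1 : m 1 = 0
    · by_cases a2 : m 2 = 0
      · exfalso; apply hne; ext i; fin_cases i <;> simp [a1, a2]; omega
      · simp [a2]
    · simp [a1]
  · intro h
    rw [notMem_support_iff.1 h]; simp

/-- no plane through the origin on the cone -/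
lemma np_plane (f : MvPolynomial (Fin 3) ℤ) (hf : f.totalDegree ≤ 4) (ha : coeff (Finsupp.single 0 4) f ≠ 0) (hI : Irreducible (slE f (0:ℂ)))
    (u w : Fin 3 → ℂ) (h : ∀ α β : ℂ, aeval (fun i => α * u i + β * w i) (homogeneousComponent 4 f) = 0) : u 1 * w 2 = u 2 * w 1 := by
  by_contra hne
  set a := u 1 * w 2 - u 2 * w 1 with had
  have ha0 : a ≠ 0 := sub_ne_zero.2 hne
  set E := slE f (0:ℂ) with hE
  have hev : ∀ P : Fin 2 → ℂ, aeval P E = aeval (![P 0, P 1, 1] : Fin 3 → ℂ) (homogeneousComponent 4 f) := by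
    intro P
    rw [hE, slE_hom f hf, hom_map, ← AlgHom.comp_apply, comp_aeval, show (Int.castRingHom ℂ) = algebraMap ℤ ℂ from rfl, aeval_map_algebraMap]
    congr 2
    funext i; fin_cases i <;> simp [dh]
  set r : MvPolynomial (Fin 1) ℂ := C a⁻¹ * (C (u 0) * (C (w 2) * X 0 - C (w 1)) + C (w 0) * (C (u 1) - C (u 2) * X 0)) with hr
  have hroot : (finSuccEquiv ℂ 1 E).IsRoot r := by
    rw [Polynomial.IsRoot]
    have h1 := aeval_cons_fse E r (X : Fin 1 → MvPolynomial (Fin 1) ℂ)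
    rw [aeval_X_left] at h1
    rw [show (Polynomial.map (AlgHom.id ℂ (MvPolynomial (Fin 1) ℂ)).toRingHom (finSuccEquiv ℂ 1 E)) = finSuccEquiv ℂ 1 E from Polynomial.map_id] at h1
    rw [← h1]
    apply MvPolynomial.funext
    intro x
    rw [map_zero, ← aeval_eq_eval, ← AlgHom.comp_apply, comp_aeval, hev]
    rw [← h ((x 0 * w 2 - w 1)/a) ((u 1 - x 0 * u 2)/a)]
    congr 2
    funext i
    fin_cases i
    · simp [hr]; field_simp
    · simp; field_simp; rw [had]; ring
    · simp; field_simp; rw [had]; ring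
  obtain ⟨q, hq⟩ := Polynomial.dvd_iff_isRoot.2 hroot
  have hirr : Irreducible (finSuccEquiv ℂ 1 E) := (MulEquiv.irreducible_iff (finSuccEquiv ℂ 1).toMulEquiv).2 hI
  have hc : (finSuccEquiv ℂ 1 E).coeff 4 ≠ 0 := by
    rw [fse_coeff_top E 4 (slE_deg f hf 0), slE_top f hf, Ne, C_eq_zero]; exact_mod_cast ha
  have hd : 4 ≤ (finSuccEquiv ℂ 1 E).natDegree := Polynomial.le_natDegree_of_ne_zero hc
  rcases hirr.isUnit_or_isUnit hq with h1 | h1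
  · exact Polynomial.not_isUnit_X_sub_C _ h1
  · have h2 := Polynomial.natDegree_eq_zero_of_isUnit h1
    rw [hq] at hd
    have h3 := Polynomial.natDegree_mul_le (p := Polynomial.X - Polynomial.C r) (q := q)
    rw [Polynomial.natDegree_X_sub_C, h2] at h3
    omega

/-- two zeros of the cone joined by a line on the cone are proportional -/
lemma cone_par (f : MvPolynomial (Fin 3) ℤ) (hf : f.totalDegree ≤ 4) (ha : coeff (Finsupp.single 0 4) f ≠ 0) (hI : Irreducible (slE f (0:ℂ)))
    (u w : Fin 3 → ℂ) (hw : aeval w (homogeneousComponent 4 f) = 0) (h : ∀ t : ℂ, aeval (fun i => u i + t * w i) (homogeneousComponent 4 f) = 0) :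
    u 1 * w 2 = u 2 * w 1 := by
  refine np_plane f hf ha hI u w fun α β => ?_
  by_cases h0 : α = 0
  · have := hom_scale _ 4 (homogeneousComponent_isHomogeneous 4 f) β w
    rw [hw, mul_zero] at this
    simpa [h0] using this
  · have := hom_scale _ 4 (homogeneousComponent_isHomogeneous 4 f) α (fun i => u i + (β/α) * w i)
    rw [h, mul_zero] at this
    rw [← this]
    congr 2
    funext i; field_simp

/-- a nonzero zero of the form has nonzero tail -/
lemma tail_ne {A : Type*} [Field A] [CharZero A] (f : MvPolynomial (Fin 3) ℤ) (ha : coeff (Finsupp.single 0 4) f ≠ 0) (w : Fin 3 → A)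
    (hw : aeval w (homogeneousComponent 4 f) = 0) (h1 : w 1 = 0) (h2 : w 2 = 0) : w = 0 := by
  rw [hom_e0 f w h1 h2, mul_eq_zero] at hw
  have h0 : w 0 = 0 := by
    rcases hw with h | h
    · exact absurd (by exact_mod_cast h) ha
    · exact pow_eq_zero_iff (by norm_num) |>.1 h
  funext i; fin_cases i <;> assumption

/-- the form is not invariant under a translation along one of its zeros -/
lemma not_inv (f : MvPolynomial (Fin 3) ℤ) (hf : f.totalDegree ≤ 4) (ha : coeff (Finsupp.single 0 4) f ≠ 0) (hI : Irreducible (slE f (0:ℂ)))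
    (w : Fin 3 → ℤ) (hw0 : w ≠ 0) (hw : aeval w (homogeneousComponent 4 f) = 0)
    (h : ∀ (y : Fin 3 → ℂ) (t : ℂ), aeval (fun i => y i + t * (w i : ℂ)) (homogeneousComponent 4 f) = aeval y (homogeneousComponent 4 f)) : False := by
  have hwC : aeval (fun i => (w i : ℂ)) (homogeneousComponent 4 f) = 0 := by
    rw [aeval_intCast ℂ w, hw, Int.cast_zero]
  -- a root
  obtain ⟨z, hz⟩ : ∃ z : ℂ, aeval (Fin.cons z ![-(w 2 : ℂ), (w 1 : ℂ)] : Fin 3 → ℂ) (homogeneousComponent 4 f) = 0 := by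
    set g := homogeneousComponent 4 f with hg
    have hgd : g.totalDegree ≤ 4 := (homogeneousComponent_isHomogeneous 4 f).totalDegree_le
    set q := Polynomial.map (aeval (![-(w 2 : ℂ), (w 1 : ℂ)]) : MvPolynomial (Fin 2) ℤ →ₐ[ℤ] ℂ).toRingHom (finSuccEquiv ℤ 2 g) with hqd
    have hq : q.coeff 4 ≠ 0 := by
      rw [hqd, Polynomial.coeff_map, fse_coeff_top g 4 hgd, hg, coeff_homogeneousComponent, if_pos (by simp)]
      simpa using ha
    obtain ⟨z, hz⟩ := IsAlgClosed.exists_root q (by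
      intro h0
      have h1 : q.natDegree = 0 := Polynomial.natDegree_eq_of_degree_eq_some h0
      have := Polynomial.le_natDegree_of_ne_zero hq
      omega)
    exact ⟨z, by rw [aeval_cons_fse]; exact hz⟩
  have := cone_par f hf ha hI _ (fun i => (w i : ℂ)) hwC (fun t => (h _ t).trans hz)
  simp only [show (1 : Fin 3) = Fin.succ 0 from rfl, show (2 : Fin 3) = Fin.succ 1 from rfl, Fin.cons_succ] at this
  simp only [Matrix.cons_val_zero, Matrix.cons_val_one] at this
  have h2 : w 1 * w 1 + w 2 * w 2 = 0 := by
    have : -((w 2 : ℂ) * (w 2)) = w 1 * w 1 := by simpa using this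
    have h3 : (w 1 : ℂ) * w 1 + w 2 * w 2 = 0 := by rw [← this]; ring
    exact_mod_cast h3
  have e1 : w 1 = 0 := by nlinarith [mul_self_nonneg (w 1), mul_self_nonneg (w 2)]
  have e2 : w 2 = 0 := by nlinarith [mul_self_nonneg (w 1), mul_self_nonneg (w 2)]
  apply hw0
  have := tail_ne (A := ℂ) f ha _ hwC (by simp [e1]) (by simp [e2])
  funext i
  have := congrFun this i
  simpa using this

end DG

end

section
namespace DG
open MvPolynomial

def Prim (w : Fin 3 → ℤ) : Prop := ∃ c : Fin 3 → ℤ, ∑ j, c j * w j = 1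

lemma exists_prim (w : Fin 3 → ℤ) (hw : w ≠ 0) : ∃ (d : ℤ) (w' : Fin 3 → ℤ), d ≠ 0 ∧ (∀ i, w i = d * w' i) ∧ Prim w' := by
  obtain ⟨d, hd⟩ := (IsPrincipalIdealRing.principal (Ideal.span (Set.range w))).principal
  have h1 : ∀ i, d ∣ w i := fun i => by
    have : w i ∈ Ideal.span (Set.range w) := Ideal.subset_span ⟨i, rfl⟩
    rw [hd] at this
    exact Ideal.mem_span_singleton.1 this
  have h2 : d ∈ Ideal.span (Set.range w) := by rw [hd]; exact Submodule.mem_span_singleton_self d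
  choose w' hw' using h1
  obtain ⟨c, hc⟩ := Ideal.mem_span_range_iff_exists_fun.1 h2
  have hd0 : d ≠ 0 := by
    rintro rfl
    apply hw; funext i; rw [hw' i]; simp
  refine ⟨d, w', hd0, hw', c, ?_⟩
  apply mul_left_cancel₀ hd0
  rw [Finset.mul_sum, mul_one]
  conv_rhs => rw [← hc]
  refine Finset.sum_congr rfl fun i _ => ?_
  rw [hw' i]; ring

lemma prim_ne {w : Fin 3 → ℤ} (h : Prim w) : w ≠ 0 := by
  rintro rfl
  obtain ⟨c, hc⟩ := h
  simp at hc

lemma prim_le (v w : Fin 3 → ℤ) (hv : Prim v) (hw : w ≠ 0) (h : ∀ i j, w i * v j = w j * v i) (s : ℤ) (hs : ∀ i, |w i| ≤ s) : ∀ i, |v i| ≤ s := by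
  obtain ⟨c, hc⟩ := hv
  have hk : ∀ i, w i = (∑ j, c j * w j) * v i := by
    intro i
    calc w i = w i * ∑ j, c j * v j := by rw [hc, mul_one]
      _ = _ := by
        rw [Finset.mul_sum, Finset.sum_mul]
        refine Finset.sum_congr rfl fun j _ => ?_
        linear_combination c j * h i j
  have hk0 : (∑ j, c j * w j) ≠ 0 := fun h0 => hw (by funext i; rw [hk i, h0]; simp)
  intro i
  refine le_trans ?_ (hs i)
  rw [hk i, abs_mul]
  exact le_mul_of_one_le_left (abs_nonneg _) (Int.one_le_abs hk0)

/-- integral version of `cone_par` -/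
lemma cone_par_int (f : MvPolynomial (Fin 3) ℤ) (hf : f.totalDegree ≤ 4) (ha : coeff (Finsupp.single 0 4) f ≠ 0) (hI : Irreducible (slE f (0:ℂ)))
    (u w : Fin 3 → ℤ) (h : ∀ t : ℤ, aeval (fun i => u i + t * w i) (homogeneousComponent 4 f) = 0) :
    ∀ i j, w i * u j = w j * u i := by
  have hg : (homogeneousComponent 4 f).totalDegree ≤ 4 := (homogeneousComponent_isHomogeneous 4 f).totalDegree_le
  have hw := top_dir _ hg u w h
  have hgg : homogeneousComponent 4 (homogeneousComponent 4 f) = homogeneousComponent 4 f := by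
    ext m; rw [coeff_homogeneousComponent]; split_ifs with h
    · rfl
    · rw [coeff_homogeneousComponent, if_neg h]
  rw [hgg] at hw
  have hwC : aeval (fun i => (w i : ℂ)) (homogeneousComponent 4 f) = 0 := by
    rw [aeval_intCast ℂ w, hw, Int.cast_zero]
  have hlC := line_all _ u w h ℂ
  have e12 : u 1 * w 2 = u 2 * w 1 := by
    have := cone_par f hf ha hI (fun i => (u i : ℂ)) (fun i => (w i : ℂ)) hwC hlC
    exact_mod_cast this
  -- combinations with zero tail vanish
  have key : ∀ p q : ℂ, p * u 1 + q * w 1 = 0 → p * u 2 + q * w 2 = 0 → p * u 0 + q * w 0 = 0 := by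
    intro p q h1 h2
    have h3 : aeval (fun i => p * (u i : ℂ) + q * (w i : ℂ)) (homogeneousComponent 4 f) = 0 := by
      by_cases hp : p = 0
      · have := hom_scale _ 4 (homogeneousComponent_isHomogeneous 4 f) q (fun i => (w i : ℂ))
        rw [hwC, mul_zero] at this
        simpa [hp] using this
      · have := hom_scale _ 4 (homogeneousComponent_isHomogeneous 4 f) p (fun i => (u i : ℂ) + (q/p) * w i)
        rw [hlC, mul_zero] at this
        rw [← this]; congr 2; funext i; field_simp
    exact congrFun (tail_ne f ha _ h3 h1 h2) 0
  have e12C : (u 1 : ℂ) * w 2 = u 2 * w 1 := by exact_mod_cast e12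
  have k1 := key (w 1) (-(u 1)) (by ring) (by linear_combination -e12C)
  have k2 := key (w 2) (-(u 2)) (by linear_combination e12C) (by ring)
  have k1' : w 1 * u 0 = w 0 * u 1 := by
    have : (w 1 : ℂ) * u 0 = w 0 * u 1 := by linear_combination k1
    exact_mod_cast this
  have k2' : w 2 * u 0 = w 0 * u 2 := by
    have : (w 2 : ℂ) * u 0 = w 0 * u 2 := by linear_combination k2
    exact_mod_cast this
  intro i j
  fin_cases i <;> fin_cases j <;> simp <;> linarith

lemma dirs_count : ∃ (C : ℝ) (κ : ℕ), 0 ≤ C ∧ ∀ f : MvPolynomial (Fin 3) ℤ, f.totalDegree ≤ 4 → coeff (Finsupp.single 0 4) f ≠ 0 → Irreducible (slE f (0:ℂ)) →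
    ∀ V : ℕ, 1 ≤ V → ∀ W : Finset (Fin 3 → ℤ), (∀ v ∈ W, Prim v ∧ aeval v (homogeneousComponent 4 f) = 0 ∧ ∀ i, |v i| ≤ (V:ℤ)) →
    (W.card : ℝ) ≤ C * ((Nat.log 2 V + 1 : ℕ):ℝ)^κ * V := by
  classical
  obtain ⟨C, κ, hC, hT⟩ := T1
  refine ⟨C + 36, κ, by positivity, ?_⟩
  intro f hf ha hI V hV W hW
  set g := homogeneousComponent 4 f with hg
  have hgd : g.totalDegree ≤ 4 := (homogeneousComponent_isHomogeneous 4 f).totalDegree_le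
  have hga : coeff (Finsupp.single 0 4) g ≠ 0 := by
    rw [hg, coeff_homogeneousComponent, if_pos (by simp)]; exact ha
  have hgI : Irreducible (slE g (0:ℂ)) := by rw [hg, slE_homc f hf]; exact hI
  have h1 := hT g hgd hga hgI V hV (W.filter fun v => ¬ Short g (Nat.sqrt V) v)
    (fun v hv => (hW v (Finset.mem_filter.1 hv).1).2) (fun v hv => (Finset.mem_filter.1 hv).2)
  have h2 : (W.filter fun v => Short g (Nat.sqrt V) v).card ≤ 4 * (2 * Nat.sqrt V + 1)^2 := by
    refine (fiber4 g hgd hga _ (fun v hv => (hW v (Finset.mem_filter.1 hv).1).2.1)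
      (Fintype.piFinset fun _ : Fin 2 => Finset.Icc (-(Nat.sqrt V : ℤ)) (Nat.sqrt V)) ?_).trans ?_
    · intro v hv
      rw [Finset.mem_filter] at hv
      obtain ⟨w, hw0, hws, hwl⟩ := hv.2
      have := prim_le v w (hW v hv.1).1 hw0 (cone_par_int f hf ha hI v w hwl) _ hws
      rw [Fintype.mem_piFinset]
      intro j
      rw [Finset.mem_Icc, ← abs_le]
      exact this _
    · rw [Fintype.card_piFinset]
      simp only [Int.card_Icc, Finset.prod_const, Finset.card_univ, Fintype.card_fin]
      gcongr
      omega
  have h3 : (4 * (2 * Nat.sqrt V + 1)^2 : ℕ) ≤ 36 * V := by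
    have h4 : Nat.sqrt V * Nat.sqrt V ≤ V := Nat.sqrt_le V
    have h5 : 1 ≤ Nat.sqrt V := Nat.le_sqrt.2 (by omega)
    nlinarith
  have h4 := Finset.card_filter_add_card_filter_not (s := W) (fun v => Short g (Nat.sqrt V) v)
  have h5 : (W.card : ℝ) = ((W.filter fun v => Short g (Nat.sqrt V) v).card : ℝ) + ((W.filter fun v => ¬ Short g (Nat.sqrt V) v).card : ℝ) := by
    exact_mod_cast h4.symm
  have h6 : ((W.filter fun v => Short g (Nat.sqrt V) v).card : ℝ) ≤ 36 * V := by exact_mod_cast h2.trans h3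
  have hl1 : (1:ℝ) ≤ ((Nat.log 2 V + 1 : ℕ):ℝ)^κ := one_le_pow₀ (by exact_mod_cast Nat.le_add_left 1 _)
  have h7 : 36 * (V:ℝ) * 1 ≤ 36 * V * ((Nat.log 2 V + 1 : ℕ):ℝ)^κ := by gcongr
  rw [h5]
  nlinarith

end DG

end

section
namespace DG
open MvPolynomial

noncomputable def pln {K : Type*} [CommRing K] {n : ℕ} (v w : Fin n → K) : Fin n → Polynomial K := fun i => Polynomial.C (v i) + Polynomial.C (w i) * Polynomial.X

lemma pln_eval {K : Type*} [CommRing K] {n : ℕ} (v w : Fin n → K) (P : MvPolynomial (Fin n) K) (t : K) :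
    (aeval (pln v w) P).eval t = aeval (fun i => v i + t * w i) P := by
  rw [← Polynomial.coe_aeval_eq_eval, ← AlgHom.comp_apply, comp_aeval]
  congr 2
  funext i
  simp only [pln, map_add, map_mul, Polynomial.aeval_C, Polynomial.aeval_X, Algebra.algebraMap_self, RingHom.id_apply]
  ring

lemma pln_deg {K : Type*} [CommRing K] {n : ℕ} (v w : Fin n → K) (i) : (pln v w i).natDegree ≤ 1 := by
  unfold pln; compute_degree

lemma poly_line {K : Type*} [Field K] [CharZero K] {n : ℕ} (P : MvPolynomial (Fin n) K) (v w : Fin n → K) (c : K)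
    (h : ∀ k : ℕ, aeval (fun i => v i + (k:K) * w i) P = c) (t : K) : aeval (fun i => v i + t * w i) P = c := by
  have : aeval (pln v w) P = Polynomial.C c := by
    apply Polynomial.eq_of_infinite_eval_eq
    refine (Set.infinite_range_of_injective (Nat.cast_injective (R := K))).mono ?_
    rintro _ ⟨k, rfl⟩
    rw [Set.mem_ofPred_eq, pln_eval, h, Polynomial.eval_C]
  rw [← pln_eval, this, Polynomial.eval_C]

/-- difference polynomial along `w` -/
noncomputable def dif (f : MvPolynomial (Fin 3) ℤ) (w : Fin 3 → ℤ) : MvPolynomial (Fin 3) ℤ := aeval (fun i => X i + C (w i)) f - f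

lemma dif_aeval {A : Type*} [CommRing A] (f : MvPolynomial (Fin 3) ℤ) (w : Fin 3 → ℤ) (v : Fin 3 → A) :
    aeval v (dif f w) = aeval (fun i => v i + (w i : A)) f - aeval v f := by
  rw [dif, map_sub, ← AlgHom.comp_apply, comp_aeval]
  congr 3
  funext i; simp

lemma dif_lin (w : Fin 3 → ℤ) (i : Fin 3) : (X i + C (w i) : MvPolynomial (Fin 3) ℤ).totalDegree ≤ 1 :=
  (totalDegree_add _ _).trans (max_le ((totalDegree_monomial_le _ _).trans (by simp)) (by rw [totalDegree_C]; omega))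

lemma dif_deg (f : MvPolynomial (Fin 3) ℤ) (hf : f.totalDegree ≤ 4) (w : Fin 3 → ℤ) : (dif f w).totalDegree ≤ 4 :=
  (totalDegree_sub _ _).trans (max_le (coeff_top_subst f 4 hf _ (dif_lin w)).1 hf)

lemma dif_top (f : MvPolynomial (Fin 3) ℤ) (hf : f.totalDegree ≤ 4) (w : Fin 3 → ℤ) : coeff (Finsupp.single 0 4) (dif f w) = 0 := by
  rw [dif, coeff_sub, (coeff_top_subst f 4 hf _ (dif_lin w)).2, hom_e0]
  · have : coeff (Finsupp.single 0 1) (X 0 + C (w 0) : MvPolynomial (Fin 3) ℤ) = 1 := by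
      rw [coeff_add, coeff_C, if_neg (by intro h; simpa using congrArg (fun m => m 0) h)]
      simp [coeff_X]
    rw [this]; simp
  all_goals
    rw [coeff_add, coeff_C, if_neg (by intro h; simpa using congrArg (fun m => m 0) h)]
    simp [coeff_X, Finsupp.single_left_inj]

lemma inv_hom {K : Type*} [Field K] [Infinite K] (F : MvPolynomial (Fin 3) K) (hFd : F.totalDegree ≤ 4) (w : Fin 3 → K)
    (h3 : ∀ (y : Fin 3 → K) (t : K), aeval (fun i => y i + t * w i) F = aeval y F) (y : Fin 3 → K) (t : K) :
    aeval (fun i => y i + t * w i) (homogeneousComponent 4 F) = aeval y (homogeneousComponent 4 F) := by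
  have e1 := (coeff_top_subst F 4 hFd (ln (0 : Fin 3 → K) (fun i => y i + t * w i)) (ln_deg _ _)).2
  have e2 := (coeff_top_subst F 4 hFd (ln (0 : Fin 3 → K) y) (ln_deg _ _)).2
  rw [ln_coeff] at e1 e2
  rw [← e1, ← e2]
  have key : aeval (ln (0 : Fin 3 → K) (fun i => y i + t * w i)) F = aeval (ln (0 : Fin 3 → K) y) F := ?_
  · rw [key]
  apply MvPolynomial.funext
  intro s
  have g1 := ln_eval (A := K) (0 : Fin 3 → K) (fun i => y i + t * w i) F s
  have g2 := ln_eval (A := K) (0 : Fin 3 → K) y F s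
  rw [aeval_eq_eval] at g1 g2
  have h := h3 (fun i => s 0 * y i) (s 0 * t)
  simp only [Algebra.algebraMap_self, RingHom.id_apply, Pi.zero_apply, zero_add] at g1 g2
  rw [g1, g2, ← h]
  have e3 : (fun i => s 0 * (y i + t * w i)) = fun i => s 0 * y i + s 0 * t * w i := by funext i; ring
  rw [e3]

lemma dif_not_dvd (f : MvPolynomial (Fin 3) ℤ) (hf : f.totalDegree ≤ 4) (ha : coeff (Finsupp.single 0 4) f ≠ 0) (hI : Irreducible (slE f (0:ℂ)))
    (w : Fin 3 → ℤ) (hw0 : w ≠ 0) (hw : aeval w (homogeneousComponent 4 f) = 0) : ¬ toQ f ∣ toQ (dif f w) := by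
  intro hd
  have h0 : dif f w = 0 := by
    by_contra hne
    have h4 : 4 ≤ (toQ f).totalDegree := by
      have h3 : coeff (Finsupp.single 0 4) (toQ f) ≠ 0 := by rw [toQ_coeff]; exact_mod_cast ha
      have := le_totalDegree (mem_support_iff.2 h3)
      simpa using this
    obtain ⟨c, hc0, hc⟩ := dvd_eq_C_mul _ _ hd (by rwa [Ne, toQ_ne]) (by rw [toQ_deg (dif f w)]; exact (dif_deg f hf w).trans h4)
    have := congrArg (coeff (Finsupp.single 0 4)) hc
    rw [coeff_C_mul, toQ_coeff, toQ_coeff, dif_top f hf, Int.cast_zero, eq_comm, mul_eq_zero] at this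
    rcases this with h | h
    · exact hc0 h
    · exact ha (by exact_mod_cast h)
  obtain ⟨F, hF⟩ : ∃ F : MvPolynomial (Fin 3) ℂ, F = map (algebraMap ℤ ℂ) f := ⟨_, rfl⟩
  have hFe : ∀ y : Fin 3 → ℂ, aeval y F = aeval y f := fun y => by rw [hF, aeval_map_algebraMap]
  have h1 : ∀ y : Fin 3 → ℂ, aeval (fun i => y i + (w i : ℂ)) f = aeval y f := by
    intro y
    have := dif_aeval f w y
    rw [h0, map_zero] at this
    exact (sub_eq_zero.1 this.symm)
  have h2 : ∀ (y : Fin 3 → ℂ) (k : ℕ), aeval (fun i => y i + (k:ℂ) * (w i : ℂ)) F = aeval y F := by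
    intro y k
    rw [hFe, hFe]
    induction k with
    | zero => simp
    | succ k ih =>
      rw [← ih, ← h1 (fun i => y i + (k:ℂ) * (w i : ℂ))]
      congr 2; funext i; push_cast; ring
  have h3 : ∀ (y : Fin 3 → ℂ) (t : ℂ), aeval (fun i => y i + t * (w i : ℂ)) F = aeval y F :=
    fun y t => poly_line F y (fun i => (w i : ℂ)) _ (h2 y) t
  have hFd : F.totalDegree ≤ 4 := by rw [hF]; exact (td_map _ _).trans hf
  have hFh : ∀ y : Fin 3 → ℂ, aeval y (homogeneousComponent 4 F) = aeval y (homogeneousComponent 4 f) := by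
    intro y; rw [hF, hom_map, aeval_map_algebraMap]
  refine not_inv f hf ha hI w hw0 hw fun y t => ?_
  rw [← hFh, ← hFh]
  exact inv_hom F hFd (fun i => (w i : ℂ)) h3 y t

set_option maxHeartbeats 1000000 in
lemma fibre_count (f : MvPolynomial (Fin 3) ℤ) (hf : f.totalDegree ≤ 4) (ha : coeff (Finsupp.single 0 4) f ≠ 0) (hI : Irreducible (slE f (0:ℂ)))
    (w : Fin 3 → ℤ) (hp : Prim w) (i0 : Fin 3) (M B : ℕ) (hM : 1 ≤ M) (hi0 : (M:ℤ) ≤ |w i0|) (S : Finset (Fin 3 → ℤ))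
    (hS : ∀ v ∈ S, (∀ i, |v i| ≤ (B:ℤ)) ∧ ∀ t : ℤ, aeval (fun i => v i + t * w i) f = 0) :
    S.card ≤ (2 * (2 * B / M) + 1) * (4 * 32) := by
  classical
  rcases S.eq_empty_or_nonempty with rfl | ⟨v1, hv1⟩
  · simp
  have hw0 := prim_ne hp
  have hwh : aeval w (homogeneousComponent 4 f) = 0 := top_dir f hf v1 w (hS v1 hv1).2
  obtain ⟨G, hG0, hGd, hG⟩ := res_int f hf ha (irr_toQ f hf ha hI) (dif f w) 4 (dif_deg f hf w) (dif_not_dvd f hf ha hI w hw0 hwh)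
  -- vanishing of G on tail lines
  have hGl : ∀ v ∈ S, ∀ t : ℚ, aeval (fun i => zq (Fin.tail v) i + t * zq (Fin.tail w) i) G = 0 := by
    intro v hv
    refine poly_line G _ _ 0 fun k => ?_
    have h1 := hG (fun i => v i + (k:ℤ) * w i) ((hS v hv).2 k) (by
      rw [dif_aeval, (hS v hv).2 k, sub_zero, ← (hS v hv).2 (k+1)]
      congr 2; funext i; simp; ring)
    rw [← h1]
    congr 2; funext i; simp [zq, Fin.tail]
  have hfl : ∀ v ∈ S, ∀ t : ℚ, aeval (fun i => (v i : ℚ) + t * (w i : ℚ)) f = 0 := fun v hv t => line_all f v w (hS v hv).2 ℚ t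
  obtain ⟨x0, hx0⟩ : ∃ x0 : Fin 2 → ℚ, aeval x0 G ≠ 0 := by
    by_contra! h
    apply hG0
    apply MvPolynomial.funext
    intro x
    have := h x
    rw [aeval_eq_eval] at this
    exact this.trans (map_zero _).symm
  have hN : ((w 1 : ℚ)^2 + (w 2 : ℚ)^2) ≠ 0 := by
    intro h
    have e1 : (w 1 : ℚ) = 0 := by nlinarith [sq_nonneg (w 1 : ℚ), sq_nonneg (w 2 : ℚ)]
    have e2 : (w 2 : ℚ) = 0 := by nlinarith [sq_nonneg (w 1 : ℚ), sq_nonneg (w 2 : ℚ)]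
    have hwQ : aeval (fun i => (w i : ℚ)) (homogeneousComponent 4 f) = 0 := by
      rw [aeval_intCast ℚ w, hwh, Int.cast_zero]
    have := tail_ne (A := ℚ) f ha _ hwQ e1 e2
    apply hw0; funext i
    simpa using congrFun this i
  obtain ⟨N, hNd⟩ : ∃ N : ℚ, N = (w 1 : ℚ)^2 + (w 2 : ℚ)^2 := ⟨_, rfl⟩
  rw [← hNd] at hN
  set dd : Fin 2 → ℚ := ![(w 2 : ℚ), -(w 1 : ℚ)] with hdd
  obtain ⟨sv, hsv⟩ : ∃ sv : (Fin 3 → ℤ) → ℚ, ∀ v, sv v = ((w 2 : ℚ) * (v 1 - x0 0) - w 1 * (v 2 - x0 1)) / N := ⟨_, fun _ => rfl⟩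
  obtain ⟨tv, htv⟩ : ∃ tv : (Fin 3 → ℤ) → ℚ, ∀ v, tv v = - ((w 1 : ℚ) * (v 1 - x0 0) + w 2 * (v 2 - x0 1)) / N := ⟨_, fun _ => rfl⟩
  have hc1 : ∀ v, (v 1 : ℚ) + tv v * w 1 = x0 0 + sv v * w 2 := by
    intro v; rw [hsv, htv]; field_simp; rw [hNd]; ring
  have hc2 : ∀ v, (v 2 : ℚ) + tv v * w 2 = x0 1 + sv v * -(w 1) := by
    intro v; rw [hsv, htv]; field_simp; rw [hNd]; ring
  have htl : ∀ v, (fun i => zq (Fin.tail v) i + tv v * zq (Fin.tail w) i) = fun i => x0 i + sv v * dd i := by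
    intro v; funext i
    fin_cases i
    · exact hc1 v
    · exact hc2 v
  set u := aeval (pln x0 dd) G with hu
  have hu0 : u ≠ 0 := by
    intro h
    have := pln_eval x0 dd G 0
    rw [← hu, h] at this
    simp at this
    exact hx0 this.symm
  have hud : u.natDegree ≤ 32 := by
    have := aeval_natDegree_le G hGd (pln x0 dd) (pln_deg x0 dd)
    simpa using this
  have hsr : ∀ v ∈ S, sv v ∈ u.roots.toFinset := by
    intro v hv
    rw [Multiset.mem_toFinset, Polynomial.mem_roots hu0, Polynomial.IsRoot, hu, pln_eval, ← htl v]
    exact hGl v hv _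
  set key : (Fin 3 → ℤ) → ℚ × ℚ := fun v => (sv v, (v 0 : ℚ) + tv v * w 0) with hkey
  have hK : (S.image key).card ≤ 4 * 32 := by
    refine (Finset.card_le_mul_card_image_of_maps_to (f := Prod.fst) (t := u.roots.toFinset) ?_ 4 ?_).trans ?_
    · intro a ha
      obtain ⟨v, hv, rfl⟩ := Finset.mem_image.1 ha
      exact hsr v hv
    · intro s hs
      have h := roots_le (k := ℚ) f 4 hf (by exact_mod_cast ha) (fun i => x0 i + s * dd i) (((S.image key).filter fun a => a.1 = s).image Prod.snd) (by
        intro z hz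
        obtain ⟨a, ha1, rfl⟩ := Finset.mem_image.1 hz
        rw [Finset.mem_filter] at ha1
        obtain ⟨v, hv, rfl⟩ := Finset.mem_image.1 ha1.1
        have h1 := hfl v hv (tv v)
        rw [← h1]
        congr 2
        rw [← show sv v = s from ha1.2]
        rw [← htl v]
        funext j
        refine Fin.cases ?_ (fun j => ?_) j
        · simp [hkey]
        · simp [zq, Fin.tail])
      rwa [Finset.card_image_of_injOn] at h
      intro a ha b hb hab
      rw [Finset.mem_coe, Finset.mem_filter] at ha hb
      exact Prod.ext (ha.2.trans hb.2.symm) hab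
    · gcongr
      exact (Multiset.toFinset_card_le _).trans (u.card_roots'.trans hud)
  refine (Finset.card_le_mul_card_image (f := key) S (2 * (2 * B / M) + 1) ?_).trans (Nat.mul_le_mul_left _ hK)
  intro a haim
  obtain ⟨vs, hvs, rfl⟩ := Finset.mem_image.1 haim
  obtain ⟨c, hc⟩ := hp
  have hcQ : ∑ j, (c j : ℚ) * w j = 1 := by exact_mod_cast hc
  have hk : ∀ v ∈ S.filter (fun v => key v = key vs), ∀ i, v i - vs i = (∑ j, c j * (v j - vs j)) * w i := by
    intro v hv
    have hkv := (Finset.mem_filter.1 hv).2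
    have a1 : sv v = sv vs := congrArg Prod.fst hkv
    have a2 : (v 0 : ℚ) + tv v * w 0 = vs 0 + tv vs * w 0 := congrArg Prod.snd hkv
    have hq : ∀ i, (v i : ℚ) - vs i = (tv vs - tv v) * w i := by
      intro i
      fin_cases i
      · simp only [Fin.zero_eta, Fin.isValue]; linear_combination a2
      · simp only [Fin.mk_one, Fin.isValue]; linear_combination hc1 v - hc1 vs + w 2 * a1
      · simp only [Fin.reduceFinMk, Fin.isValue]; linear_combination hc2 v - hc2 vs - w 1 * a1
    have ht : (tv vs - tv v) = ∑ j, (c j : ℚ) * ((v j : ℚ) - vs j) := by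
      calc (tv vs - tv v) = (tv vs - tv v) * ∑ j, (c j : ℚ) * w j := by rw [hcQ, mul_one]
        _ = _ := by
          rw [Finset.mul_sum]
          refine Finset.sum_congr rfl fun j _ => ?_
          rw [hq j]; ring
    intro i
    have := hq i
    rw [ht] at this
    exact_mod_cast this
  have hcard := Finset.card_le_card_of_injOn (s := S.filter (fun v => key v = key vs))
    (t := Finset.Icc (-((2 * B / M : ℕ):ℤ)) ((2 * B / M : ℕ):ℤ)) (fun v => ∑ j, c j * (v j - vs j)) (by
      intro v hv
      have h1 := hk v hv i0
      have h2 := (hS v (Finset.mem_filter.1 hv).1).1 i0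
      have h3 := (hS vs hvs).1 i0
      have h4 : |v i0 - vs i0| ≤ 2 * B := (abs_sub _ _).trans (by linarith)
      rw [h1, abs_mul] at h4
      simp only [Finset.coe_Icc, Set.mem_Icc]
      rw [← abs_le]
      have h5 : |∑ j, c j * (v j - vs j)| * (M:ℤ) ≤ 2 * B := (mul_le_mul_of_nonneg_left hi0 (abs_nonneg _)).trans h4
      push_cast
      exact Int.le_ediv_of_mul_le (by exact_mod_cast hM) h5) (by
      intro v hv v' hv' h
      funext i
      have h1 := hk v hv i
      have h2 := hk v' hv' i
      simp only at h
      rw [h] at h1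
      linarith)
  refine hcard.trans ?_
  rw [Int.card_Icc]
  omega

end DG

end

section
namespace DG
open MvPolynomial

lemma short_prim (f : MvPolynomial (Fin 3) ℤ) (s : ℕ) (v : Fin 3 → ℤ) (h : Short f s v) :
    ∃ w : Fin 3 → ℤ, Prim w ∧ (∀ i, |w i| ≤ (s:ℤ)) ∧ ∀ t : ℤ, aeval (fun i => v i + t * w i) f = 0 := by
  obtain ⟨w, hw0, hws, hwl⟩ := h
  obtain ⟨d, w', hd, hw', hp⟩ := exists_prim w hw0
  refine ⟨w', hp, fun i => ?_, fun t => ?_⟩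
  · refine le_trans ?_ (hws i)
    rw [hw' i, abs_mul]
    exact le_mul_of_one_le_left (abs_nonneg _) (Int.one_le_abs hd)
  · have h1 := line_all f v w hwl ℚ ((t:ℚ)/d)
    have h2 := aeval_intCast ℚ (fun i => v i + t * w' i) f
    have h3 : (fun i => (v i : ℚ) + (t:ℚ)/d * w i) = fun i => ((v i + t * w' i : ℤ) : ℚ) := by
      funext i
      have : (d:ℚ) ≠ 0 := by exact_mod_cast hd
      rw [hw' i]; push_cast; field_simp
    rw [h3, h2] at h1
    exact_mod_cast h1

/-- the full three variable bound -/
theorem T3 : ∃ (C : ℝ) (κ : ℕ), 0 ≤ C ∧ ∀ f : MvPolynomial (Fin 3) ℤ, f.totalDegree ≤ 4 → coeff (Finsupp.single 0 4) f ≠ 0 → Irreducible (slE f (0:ℂ)) →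
    ∀ B : ℕ, 1 ≤ B → ∀ S : Finset (Fin 3 → ℤ), (∀ v ∈ S, aeval v f = 0 ∧ ∀ i, |v i| ≤ (B:ℤ)) →
    (S.card : ℝ) ≤ C * ((Nat.log 2 B + 1 : ℕ):ℝ)^κ * B := by
  classical
  obtain ⟨C1, κ1, hC1, hT⟩ := T1
  obtain ⟨C2, κ2, hC2, hD⟩ := dirs_count
  refine ⟨C1 + 1280 * C2 * 2^κ2, κ1 + κ2 + 1, by positivity, ?_⟩
  intro f hf ha hI B hB S hS
  have h1 := hT f hf ha hI B hB (S.filter fun v => ¬ Short f (Nat.sqrt B) v)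
    (fun v hv => hS v (Finset.mem_filter.1 hv).1) (fun v hv => (Finset.mem_filter.1 hv).2)
  have h4 := Finset.card_filter_add_card_filter_not (s := S) (fun v => Short f (Nat.sqrt B) v)
  have h5 : (S.card : ℝ) = ((S.filter fun v => Short f (Nat.sqrt B) v).card : ℝ) + ((S.filter fun v => ¬ Short f (Nat.sqrt B) v).card : ℝ) := by
    exact_mod_cast h4.symm
  have hl1 : (1:ℝ) ≤ ((Nat.log 2 B + 1 : ℕ):ℝ) := by exact_mod_cast Nat.le_add_left 1 _
  set Sh := S.filter fun v => Short f (Nat.sqrt B) v with hSh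
  have hex : ∀ v : Fin 3 → ℤ, ∃ w : Fin 3 → ℤ, v ∈ Sh → (Prim w ∧ (∀ i, |w i| ≤ (Nat.sqrt B:ℤ)) ∧ ∀ t : ℤ, aeval (fun i => v i + t * w i) f = 0) := by
    intro v
    by_cases hv : v ∈ Sh
    · obtain ⟨w, hw⟩ := short_prim f _ v (Finset.mem_filter.1 hv).2
      exact ⟨w, fun _ => hw⟩
    · exact ⟨0, fun h => absurd h hv⟩
  choose wv hwv using hex
  set mx : (Fin 3 → ℤ) → ℕ := fun w => Finset.univ.sup fun i => (w i).natAbs with hmx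
  have hmxle : ∀ v ∈ Sh, mx (wv v) ≤ Nat.sqrt B := by
    intro v hv
    refine Finset.sup_le fun i _ => ?_
    have := (hwv v hv).2.1 i
    rw [Int.abs_eq_natAbs] at this
    exact_mod_cast this
  have hmxpos : ∀ v ∈ Sh, mx (wv v) ≠ 0 := by
    intro v hv h0
    apply prim_ne (hwv v hv).1
    funext i
    have : ((wv v) i).natAbs ≤ mx (wv v) := Finset.le_sup (f := fun i => ((wv v) i).natAbs) (Finset.mem_univ i)
    rw [h0] at this
    simpa using this
  have hsB : Nat.sqrt B ≤ B := Nat.sqrt_le_self B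
  set jj : (Fin 3 → ℤ) → ℕ := fun v => Nat.log 2 (mx (wv v)) with hjj
  have hmaps : ∀ v ∈ Sh, jj v ∈ Finset.range (Nat.log 2 B + 1) := by
    intro v hv
    rw [Finset.mem_range, Nat.lt_succ_iff]
    exact Nat.log_mono_right ((hmxle v hv).trans hsB)
  have hpart := Finset.card_eq_sum_card_fiberwise hmaps
  have hone : ∀ j ∈ Finset.range (Nat.log 2 B + 1), ((Sh.filter fun v => jj v = j).card : ℝ) ≤ 1280 * C2 * 2^κ2 * ((Nat.log 2 B + 1 : ℕ):ℝ)^κ2 * B := by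
    intro j hj
    set Sj := Sh.filter fun v => jj v = j with hSj
    rcases Sj.eq_empty_or_nonempty with he | ⟨v1, hv1⟩
    · rw [he, Finset.card_empty, Nat.cast_zero]; positivity
    have hjB : 2^j ≤ B := by
      rw [hSj, Finset.mem_filter] at hv1
      rw [← hv1.2]
      exact (Nat.pow_log_le_self 2 (hmxpos v1 hv1.1)).trans ((hmxle v1 hv1.1).trans hsB)
    have hc := Finset.card_le_mul_card_image (f := wv) Sj ((2 * (2 * B / 2^j) + 1) * (4 * 32)) (by
      intro w hw
      obtain ⟨v0, hv0, rfl⟩ := Finset.mem_image.1 hw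
      have hv0' := Finset.mem_filter.1 hv0
      obtain ⟨i0, _, hi0⟩ := Finset.exists_mem_eq_sup Finset.univ ⟨0, Finset.mem_univ _⟩ (fun i => ((wv v0) i).natAbs)
      refine fibre_count f hf ha hI (wv v0) (hwv v0 hv0'.1).1 i0 (2^j) B (Nat.one_le_two_pow) ?_ _ ?_
      · have h6 : 2^j ≤ mx (wv v0) := by
          rw [← hv0'.2]; exact Nat.pow_log_le_self 2 (hmxpos v0 hv0'.1)
        rw [Int.abs_eq_natAbs, ← hi0]
        exact_mod_cast h6
      · intro v hv
        have hv' := Finset.mem_filter.1 hv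
        have hvs := (Finset.mem_filter.1 hv'.1).1
        refine ⟨(hS v (Finset.mem_filter.1 hvs).1).2, ?_⟩
        rw [← hv'.2]
        exact (hwv v hvs).2.2)
    have hW := hD f hf ha hI (2^(j+1)) Nat.one_le_two_pow (Sj.image wv) (by
      intro w hw
      obtain ⟨v, hv, rfl⟩ := Finset.mem_image.1 hw
      have hv' := Finset.mem_filter.1 hv
      refine ⟨(hwv v hv'.1).1, top_dir f hf v _ (hwv v hv'.1).2.2, fun i => ?_⟩
      have h6 : ((wv v) i).natAbs ≤ mx (wv v) := Finset.le_sup (f := fun i => ((wv v) i).natAbs) (Finset.mem_univ i)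
      have h7 : mx (wv v) < 2^(j+1) := by
        rw [← hv'.2]; exact Nat.lt_pow_succ_log_self (by norm_num) _
      rw [Int.abs_eq_natAbs]
      exact_mod_cast (h6.trans h7.le))
    rw [Nat.log_pow (by norm_num)] at hW
    have hj' : j + 1 ≤ Nat.log 2 B + 1 := Finset.mem_range.1 hj
    have hjl : ((j + 1 + 1 : ℕ):ℝ) ≤ 2 * ((Nat.log 2 B + 1 : ℕ):ℝ) := by
      have : j + 1 + 1 ≤ 2 * (Nat.log 2 B + 1) := by omega
      exact_mod_cast this
    have hP : (0:ℝ) < 2^j := by positivity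
    have hfib : (((2 * (2 * B / 2^j) + 1) * (4 * 32) : ℕ):ℝ) * 2^j ≤ 640 * B := by
      have h8 : (2 * B / 2^j) * 2^j ≤ 2 * B := Nat.div_mul_le_self _ _
      have h9 : ((2 * (2 * B / 2^j) + 1) * (4 * 32)) * 2^j ≤ 640 * B := by nlinarith
      exact_mod_cast h9
    obtain ⟨q, hq⟩ : ∃ q : ℕ, q = (2 * (2 * B / 2^j) + 1) * (4 * 32) := ⟨_, rfl⟩
    rw [← hq] at hc hfib
    obtain ⟨L, hL⟩ : ∃ L : ℝ, L = ((Nat.log 2 B + 1 : ℕ):ℝ) := ⟨_, rfl⟩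
    rw [← hL] at hjl ⊢
    calc (Sj.card : ℝ) ≤ q * ((Sj.image wv).card : ℝ) := by exact_mod_cast hc
      _ ≤ q * (C2 * ((j + 1 + 1 : ℕ):ℝ)^κ2 * ((2^(j+1) : ℕ):ℝ)) := by gcongr
      _ ≤ q * (C2 * (2 * L)^κ2 * ((2^(j+1) : ℕ):ℝ)) := by gcongr
      _ = (q * 2^j) * (2 * C2 * (2^κ2 * L^κ2)) := by rw [mul_pow]; push_cast; ring
      _ ≤ (640 * B) * (2 * C2 * (2^κ2 * L^κ2)) := by
        have : 0 ≤ L := by rw [hL]; positivity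
        gcongr
      _ = _ := by ring
  have hsum : (Sh.card : ℝ) ≤ 1280 * C2 * 2^κ2 * ((Nat.log 2 B + 1 : ℕ):ℝ)^(κ2+1) * B := by
    have : (Sh.card : ℝ) = ∑ j ∈ Finset.range (Nat.log 2 B + 1), ((Sh.filter fun v => jj v = j).card : ℝ) := by exact_mod_cast hpart
    rw [this]
    refine (Finset.sum_le_sum hone).trans ?_
    rw [Finset.sum_const, Finset.card_range, nsmul_eq_mul]
    apply le_of_eq; ring
  obtain ⟨L, hL⟩ : ∃ L : ℝ, L = ((Nat.log 2 B + 1 : ℕ):ℝ) := ⟨_, rfl⟩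
  rw [← hL] at hsum h1 hl1 ⊢
  rw [h5]
  have a1 : L^κ1 ≤ L^(κ1+κ2+1) := pow_le_pow_right₀ hl1 (by omega)
  have a2 : L^(κ2+1) ≤ L^(κ1+κ2+1) := pow_le_pow_right₀ hl1 (by omega)
  have b1 : C1 * L^κ1 * B ≤ C1 * L^(κ1+κ2+1) * B := by gcongr
  have b2 : 1280 * C2 * 2^κ2 * L^(κ2+1) * B ≤ 1280 * C2 * 2^κ2 * L^(κ1+κ2+1) * B := by gcongr
  linarith
end DG

end

section
namespace DG
open MvPolynomial

lemma relprime_of_red {K : Type} [Field K] (A B : Polynomial (MvPolynomial (Fin 1) K)) (hA : A.Monic)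
    (h : IsCoprime (A.map (constantCoeff : MvPolynomial (Fin 1) K →+* K)) (B.map constantCoeff)) :
    IsRelPrime A B := by
  intro d hd1 hd2
  have hu := hA.isUnit_leadingCoeff_of_dvd hd1
  have h1 : IsUnit (d.map (constantCoeff : MvPolynomial (Fin 1) K →+* K)) :=
    h.isUnit_of_dvd' (Polynomial.map_dvd _ hd1) (Polynomial.map_dvd _ hd2)
  have h2 : (d.map (constantCoeff : MvPolynomial (Fin 1) K →+* K)).natDegree = d.natDegree :=
    Polynomial.natDegree_map_of_leadingCoeff_ne_zero _ (hu.map constantCoeff).ne_zero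
  have h3 : d.natDegree = 0 := by rw [← h2]; exact Polynomial.natDegree_eq_zero_of_isUnit h1
  rw [Polynomial.eq_C_of_natDegree_eq_zero h3]
  rw [Polynomial.leadingCoeff, h3] at hu
  exact hu.map Polynomial.C

lemma fixed_factor {K : Type} [Field K] (A B F : Polynomial (MvPolynomial (Fin 1) K)) (hA : A.Monic)
    (hF : A * B = F) (hs : (F.map (constantCoeff : MvPolynomial (Fin 1) K →+* K)).Separable)
    (σ : K →+* K) (hσF : F.map (MvPolynomial.map σ) = F)
    (hσA : (A.map (constantCoeff : MvPolynomial (Fin 1) K →+* K)).map σ = A.map constantCoeff) :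
    A.map (MvPolynomial.map σ) = A := by
  have h0 : (A.map (MvPolynomial.map σ)).map (constantCoeff : MvPolynomial (Fin 1) K →+* K)
      = A.map constantCoeff := by
    rw [← hσA, Polynomial.map_map, Polynomial.map_map]
    congr 1
  have h1 : A.map (MvPolynomial.map σ) ∣ A * B := by
    rw [hF, ← hσF, ← hF, Polynomial.map_mul]
    exact dvd_mul_right _ _
  have h2 : A.map (MvPolynomial.map σ) ∣ A := by
    refine (relprime_of_red _ B (hA.map _) ?_).dvd_of_dvd_mul_right h1
    rw [h0]
    apply Polynomial.Separable.isCoprime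
    rw [← Polynomial.map_mul, hF]
    exact hs
  exact (Polynomial.eq_of_monic_of_dvd_of_natDegree_le (hA.map _) hA h2
    (by rw [hA.natDegree_map])).symm

lemma complex_coef {K : Type} [Field K] [Algebra ℂ K] (A : Polynomial K) (hA : A.Monic)
    (g : Polynomial ℂ) (hg : g.Monic) (h : A ∣ g.map (algebraMap ℂ K)) :
    ∃ a : Polynomial ℂ, A = a.map (algebraMap ℂ K) := by
  have : A ∈ Polynomial.lifts (algebraMap ℂ K) := by
    rw [Polynomial.lifts_iff_coeff_lifts]
    intro i
    have hi := Polynomial.isIntegral_coeff_of_dvd g A hg hA h i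
    have := minpoly.mem_range_of_degree_eq_one ℂ (A.coeff i)
      (IsAlgClosed.degree_eq_one_of_irreducible ℂ (minpoly.irreducible hi))
    simpa using this
  rw [Polynomial.lifts_iff_set_range] at this
  obtain ⟨a, ha⟩ := this
  exact ⟨a, ha.symm⟩

lemma lift_poly {k K : Type} [Field k] [Field K] [Algebra k K] [IsGalois k K]
    (A : Polynomial (MvPolynomial (Fin 1) K)) (hA : A.Monic)
    (h : ∀ σ : K ≃ₐ[k] K, A.map (MvPolynomial.map (σ : K →+* K)) = A) :
    ∃ A0 : Polynomial (MvPolynomial (Fin 1) k), A0.map (MvPolynomial.map (algebraMap k K)) = A ∧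
      A0.natDegree = A.natDegree ∧ A0.Monic := by
  apply Polynomial.lifts_and_natDegree_eq_and_monic _ hA
  rw [Polynomial.lifts_iff_coeff_lifts]
  intro i
  rw [MvPolynomial.mem_range_map_iff_coeffs_subset]
  intro c hc
  rw [Finset.mem_coe, MvPolynomial.mem_coeffs_iff] at hc
  obtain ⟨m, -, rfl⟩ := hc
  rw [InfiniteGalois.mem_range_algebraMap_iff_fixed]
  intro σ
  have := congrArg (fun P => coeff m (Polynomial.coeff P i)) (h σ)
  simpa [coeff_map] using this

/-- Irreducibility over the field `k` propagates to the algebraic closure. -/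
lemma descent_K {k K : Type} [Field k] [Field K] [Algebra k K] [IsGalois k K] [Algebra ℂ k]
    [Algebra ℂ K] [IsScalarTower ℂ k K]
    (F : Polynomial (MvPolynomial (Fin 1) k)) (hF : F.Monic) (hi : Irreducible F)
    (g : Polynomial ℂ) (hg : g.Separable)
    (h0 : F.map (constantCoeff : MvPolynomial (Fin 1) k →+* k) = g.map (algebraMap ℂ k)) :
    Irreducible (F.map (MvPolynomial.map (algebraMap k K))) := by
  have hinj : Function.Injective (MvPolynomial.map (algebraMap k K) : MvPolynomial (Fin 1) k →+* _) :=
    map_injective _ (algebraMap k K).injective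
  have hFK := hF.map (MvPolynomial.map (algebraMap k K) : MvPolynomial (Fin 1) k →+* _)
  have hgm : g.Monic := by
    have := hF.map (constantCoeff : MvPolynomial (Fin 1) k →+* k)
    rw [h0] at this
    exact Polynomial.monic_of_injective (algebraMap ℂ k).injective this
  have h0K : (F.map (MvPolynomial.map (algebraMap k K))).map
      (constantCoeff : MvPolynomial (Fin 1) K →+* K) = g.map (algebraMap ℂ K) := by
    rw [IsScalarTower.algebraMap_eq ℂ k K, ← Polynomial.map_map, ← h0, Polynomial.map_map,
      Polynomial.map_map]
    congr 1
  have hfix : ∀ A B : Polynomial (MvPolynomial (Fin 1) K), A.Monic →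
      A * B = F.map (MvPolynomial.map (algebraMap k K)) →
      ∀ σ : K ≃ₐ[k] K, A.map (MvPolynomial.map (σ : K →+* K)) = A := by
    intro A B hA hAB σ
    refine fixed_factor A B _ hA hAB ?_ _ ?_ ?_
    · rw [h0K]; exact hg.map
    · rw [Polynomial.map_map]
      congr 1
      ext <;> simp
    · obtain ⟨a, ha⟩ := complex_coef (A.map constantCoeff) (hA.map _) g hgm
        (by rw [← h0K, ← hAB, Polynomial.map_mul]; exact dvd_mul_right _ _)
      rw [ha, Polynomial.map_map]
      congr 1
      ext x
      simp only [RingHom.comp_apply]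
      rw [IsScalarTower.algebraMap_apply ℂ k K]
      simp
  rw [hFK.irreducible_iff_natDegree]
  rw [hF.irreducible_iff_natDegree] at hi
  constructor
  · intro h
    apply hi.1
    apply Polynomial.map_injective _ hinj
    rw [h, Polynomial.map_one]
  · intro A B hA hB hAB
    obtain ⟨A0, hA1, hA2, hA3⟩ := lift_poly A hA (hfix A B hA hAB)
    obtain ⟨B0, hB1, hB2, hB3⟩ := lift_poly B hB (hfix B A hB (by rw [mul_comm, hAB]))
    rw [← hA2, ← hB2]
    refine hi.2 A0 B0 hA3 hB3 ?_
    apply Polynomial.map_injective _ hinj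
    rw [Polynomial.map_mul, hA1, hB1, hAB]

lemma descent_R {R k : Type} [CommRing R] [IsDomain R] [IsIntegrallyClosed (MvPolynomial (Fin 1) R)]
    [Field k] [Algebra R k] [IsFractionRing R k]
    (F : Polynomial (MvPolynomial (Fin 1) R)) (hF : F.Monic) (hi : Irreducible F) :
    Irreducible (F.map (MvPolynomial.map (algebraMap R k))) := by
  obtain ⟨Q, iQ, iA, iF⟩ : ∃ (Q : Type) (_ : Field Q) (_ : Algebra (MvPolynomial (Fin 1) R) Q),
    IsFractionRing (MvPolynomial (Fin 1) R) Q :=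
    ⟨FractionRing (MvPolynomial (Fin 1) R), inferInstance, inferInstance, inferInstance⟩
  have hinj : Function.Injective ((algebraMap (MvPolynomial (Fin 1) R) Q).comp (C : R →+* _)) :=
    (IsFractionRing.injective _ _).comp (C_injective _ _)
  obtain ⟨j, hj⟩ : ∃ j : k →+* Q, ∀ r : R, j (algebraMap R k r) = algebraMap _ Q (C r) :=
    ⟨IsFractionRing.lift hinj, fun r => by rw [IsFractionRing.lift_algebraMap]; rfl⟩
  apply Polynomial.Monic.irreducible_of_irreducible_map
    (eval₂Hom j (fun i => algebraMap (MvPolynomial (Fin 1) R) Q (X i))) _ (hF.map _)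
  rw [hF.irreducible_iff_irreducible_map_fraction_map (K := Q)] at hi
  have he : (eval₂Hom j (fun i => algebraMap (MvPolynomial (Fin 1) R) Q (X i))).comp
      (MvPolynomial.map (algebraMap R k)) = algebraMap (MvPolynomial (Fin 1) R) Q := by
    ext <;> simp [hj]
  rw [Polynomial.map_map, he]
  exact hi

end DG

end

section
namespace DG
open MvPolynomial

/-- restriction to a line -/
noncomputable def PP {n : ℕ} {S A : Type} [CommRing S] [CommRing A] (φ : S →+* A) (h : MvPolynomial (Fin n) S)
    (u α : Fin n → A) : Polynomial A :=
  eval₂Hom (Polynomial.C.comp φ) (fun i => Polynomial.C (u i) + Polynomial.C (α i) * Polynomial.X) h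

/-- restriction to a plane -/
noncomputable def EE {n : ℕ} {S A : Type} [CommRing S] [CommRing A] (φ : S →+* A) (h : MvPolynomial (Fin n) S)
    (α β γ : Fin n → A) : MvPolynomial (Fin 2) A :=
  eval₂Hom (C.comp φ) (fun i => C (α i) * X 0 + C (β i) * X 1 + C (γ i)) h

lemma PP_map {n : ℕ} {S A B : Type} [CommRing S] [CommRing A] [CommRing B] (φ : S →+* A) (h : MvPolynomial (Fin n) S)
    (u α : Fin n → A) (j : A →+* B) :
    (PP φ h u α).map j = PP (j.comp φ) h (fun i => j (u i)) (fun i => j (α i)) := by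
  rw [PP, PP, ← Polynomial.coe_mapRingHom, ← RingHom.comp_apply]
  congr 1
  ext <;> simp

lemma EE_map {n : ℕ} {S A B : Type} [CommRing S] [CommRing A] [CommRing B] (φ : S →+* A) (h : MvPolynomial (Fin n) S)
    (α β γ : Fin n → A) (j : A →+* B) :
    MvPolynomial.map j (EE φ h α β γ) = EE (j.comp φ) h (fun i => j (α i)) (fun i => j (β i)) (fun i => j (γ i)) := by
  rw [EE, EE, ← RingHom.comp_apply]
  congr 1
  apply MvPolynomial.ringHom_ext
  · intro r; simp
  · intro i; simp

lemma EE_fse {n : ℕ} {S A : Type} [CommRing S] [CommRing A] (φ : S →+* A) (h : MvPolynomial (Fin n) S)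
    (α β γ : Fin n → A) :
    finSuccEquiv A 1 (EE φ h α β γ)
      = PP ((C : A →+* MvPolynomial (Fin 1) A).comp φ) h (fun i => C (γ i) + C (β i) * X 0) (fun i => C (α i)) := by
  have : ∀ P : MvPolynomial (Fin 2) A, finSuccEquiv A 1 P = (finSuccEquiv A 1).toRingEquiv.toRingHom P := fun P => rfl
  rw [this, EE, PP, ← RingHom.comp_apply]
  congr 1
  have h1 : finSuccEquiv A 1 (X 1) = Polynomial.C (X 0) := finSuccEquiv_X_succ (n := 1) (j := 0)
  have h2 : ∀ a : A, finSuccEquiv A 1 (C a) = Polynomial.C (C a) := by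
    intro a
    simp [finSuccEquiv_apply]
  have h3 : finSuccEquiv A 1 (X 0) = Polynomial.X := finSuccEquiv_X_zero
  apply MvPolynomial.ringHom_ext
  · intro r
    simp [h2]
  · intro i
    simp only [RingHom.comp_apply, ← this, eval₂Hom_X', map_add, map_mul, h1, h2, h3]
    ring

lemma EE_top {n : ℕ} {S A : Type} [CommRing S] [CommRing A] (φ : S →+* A) (h : MvPolynomial (Fin n) S)
    (hh : h.IsHomogeneous 4) (α β γ : Fin n → A) :
    (EE φ h α β γ).totalDegree ≤ 4 ∧ coeff (Finsupp.single 0 4) (EE φ h α β γ) = eval₂ φ α h := by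
  have h1 : EE φ h α β γ = aeval (fun i => C (α i) * X 0 + C (β i) * X 1 + C (γ i)) (MvPolynomial.map φ h) := by
    rw [EE, aeval_def, eval₂_map]; rfl
  have hm := hh.map φ
  have h2 := coeff_top_subst (n := 1) (MvPolynomial.map φ h) 4 hm.totalDegree_le
    (fun i => C (α i) * X 0 + C (β i) * X 1 + C (γ i)) (by
      intro i
      refine (totalDegree_add _ _).trans (max_le ((totalDegree_add _ _).trans (max_le ?_ ?_)) (by simp))
      all_goals
        refine (totalDegree_mul _ _).trans ?_
        rw [totalDegree_C, zero_add]
        exact (isHomogeneous_X _ _).totalDegree_le)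
  rw [← h1] at h2
  refine ⟨h2.1, ?_⟩
  rw [h2.2, homogeneousComponent_of_mem hm, if_pos rfl, aeval_def, eval₂_map]
  simp only [Algebra.algebraMap_self, RingHom.id_comp]
  congr 1
  funext i
  have e1 : coeff (Finsupp.single (0 : Fin 2) 1) (X 1 : MvPolynomial (Fin 2) A) = 0 := by
    rw [coeff_X, if_neg]; rw [Finsupp.single_left_inj one_ne_zero]; decide
  have e2 : (0 : Fin 2 →₀ ℕ) ≠ Finsupp.single (0 : Fin 2) 1 := by
    intro h; simpa using congrArg (fun m => m 0) h
  simp [coeff_C_mul, coeff_C, e1, e2]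

lemma PP_irred {n : ℕ} (h : MvPolynomial (Fin n) ℂ) (hi : Irreducible h) (α : Fin n → ℂ) :
    Irreducible (PP (C : ℂ →+* MvPolynomial (Fin n) ℂ) h X (fun i => C (α i))) := by
  obtain ⟨φ, hφ⟩ : ∃ φ : (Fin n → ℂ) → (Polynomial (MvPolynomial (Fin n) ℂ) →+* Polynomial (MvPolynomial (Fin n) ℂ)),
    ∀ a, φ a = Polynomial.eval₂RingHom (eval₂Hom (Polynomial.C.comp C)
      (fun i => Polynomial.C (X i) + Polynomial.C (C (a i)) * Polynomial.X)) Polynomial.X := ⟨_, fun _ => rfl⟩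
  have hc : ∀ a b : Fin n → ℂ, (∀ i, a i + b i = 0) → (φ a).comp (φ b) = RingHom.id _ := by
    intro a b hab
    rw [hφ, hφ]
    apply Polynomial.ringHom_ext'
    · apply MvPolynomial.ringHom_ext
      · intro r; simp
      · intro i
        have e : b i = - a i := by linear_combination hab i
        simp [e]
        ring
    · simp
  let e := RingEquiv.ofRingHom (φ α) (φ (-α)) (hc _ _ (by simp)) (hc _ _ (by simp))
  have h1 : PP (C : ℂ →+* MvPolynomial (Fin n) ℂ) h X (fun i => C (α i)) = e (Polynomial.C h) := by
    change _ = φ α (Polynomial.C h)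
    rw [hφ, PP]
    simp
  rw [h1]
  refine (MulEquiv.irreducible_iff e.toMulEquiv).2 ?_
  exact (Polynomial.prime_C_iff.2 hi.prime).irreducible

lemma sep_spec {n : ℕ} (P : Polynomial (MvPolynomial (Fin n) ℂ)) (hP : P.Monic) (hi : Irreducible P) :
    ∃ γ : Fin n → ℂ, (P.map (eval₂Hom (RingHom.id ℂ) γ)).Separable := by
  obtain ⟨k, ik, ia, iF⟩ : ∃ (k : Type) (_ : Field k) (_ : Algebra (MvPolynomial (Fin n) ℂ) k),
    IsFractionRing (MvPolynomial (Fin n) ℂ) k :=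
    ⟨FractionRing (MvPolynomial (Fin n) ℂ), inferInstance, inferInstance, inferInstance⟩
  have hinj : Function.Injective (algebraMap (MvPolynomial (Fin n) ℂ) k) := IsFractionRing.injective _ _
  haveI : CharZero k := charZero_of_injective_algebraMap hinj
  have hs := ((hP.irreducible_iff_irreducible_map_fraction_map (K := k)).1 hi).separable
  obtain ⟨a, b, hab⟩ := hs
  obtain ⟨s, hs, ha⟩ := IsLocalization.integerNormalization_spec (nonZeroDivisors (MvPolynomial (Fin n) ℂ)) a
  obtain ⟨t, ht, hb⟩ := IsLocalization.integerNormalization_spec (nonZeroDivisors (MvPolynomial (Fin n) ℂ)) b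
  generalize IsLocalization.integerNormalization (nonZeroDivisors (MvPolynomial (Fin n) ℂ)) a = a1 at ha
  generalize IsLocalization.integerNormalization (nonZeroDivisors (MvPolynomial (Fin n) ℂ)) b = b1 at hb
  have key : Polynomial.C t * a1 * P + Polynomial.C s * b1 * Polynomial.derivative P = Polynomial.C (s * t) := by
    apply Polynomial.map_injective _ hinj
    simp only [Polynomial.map_add, Polynomial.map_mul, ha, hb, Polynomial.map_C, map_mul]
    rw [← Polynomial.derivative_map]
    simp only [Algebra.smul_def]
    have e : ∀ r, algebraMap (MvPolynomial (Fin n) ℂ) (Polynomial k) r = Polynomial.C (algebraMap _ k r) := fun r => rfl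
    rw [e, e]
    linear_combination (Polynomial.C (algebraMap _ k s) * Polynomial.C (algebraMap _ k t)) * hab
  have hst : s * t ≠ 0 := mul_ne_zero (nonZeroDivisors.ne_zero hs) (nonZeroDivisors.ne_zero ht)
  obtain ⟨γ, hγ⟩ : ∃ γ : Fin n → ℂ, eval γ (s*t) ≠ 0 := by
    by_contra hc
    push Not at hc
    exact hst (MvPolynomial.funext fun x => by rw [hc x]; simp)
  refine ⟨γ, ?_⟩
  obtain ⟨j, hj⟩ : ∃ j : MvPolynomial (Fin n) ℂ →+* ℂ, j = eval₂Hom (RingHom.id ℂ) γ := ⟨_, rfl⟩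
  have hγ' : j (s*t) ≠ 0 := by rw [hj]; exact hγ
  rw [← hj]
  have k2 := congrArg (Polynomial.map j) key
  simp only [Polynomial.map_add, Polynomial.map_mul, Polynomial.map_C] at k2
  rw [← Polynomial.derivative_map] at k2
  refine ⟨Polynomial.C (j (s*t))⁻¹ * (Polynomial.C (j t) * a1.map j), Polynomial.C (j (s*t))⁻¹ * (Polynomial.C (j s) * b1.map j), ?_⟩
  have k3 : Polynomial.C (j (s*t))⁻¹ * Polynomial.C (j (s*t)) = 1 := by
    rw [← Polynomial.C_mul, inv_mul_cancel₀ hγ', Polynomial.C_1]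
  linear_combination (Polynomial.C (j (s*t))⁻¹) * k2 + k3

/-- generic plane sections of an irreducible quartic form are irreducible -/
lemma bert1 {n : ℕ} (h : MvPolynomial (Fin n) ℂ) (hi : Irreducible h) (hh : h.IsHomogeneous 4) :
    ∃ ψ ∈ noe, ∃ (K : Type) (_ : Field K) (φ : ℂ →+* K) (α β γ : Fin n → K),
      aeval (fun m => coeff m (EE φ h α β γ)) ψ ≠ 0 := by
  obtain ⟨α, hα⟩ : ∃ α : Fin n → ℂ, aeval α h = 1 := by
    obtain ⟨a, ha⟩ : ∃ a : Fin n → ℂ, eval a h ≠ 0 := by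
      by_contra hc
      push Not at hc
      exact hi.ne_zero (MvPolynomial.funext fun x => by rw [hc x]; simp)
    obtain ⟨z, hz⟩ := IsAlgClosed.exists_pow_nat_eq (eval a h)⁻¹ (n := 4) (by norm_num)
    refine ⟨fun i => z * a i, ?_⟩
    rw [hom_scale h 4 hh, hz, aeval_eq_eval]
    exact inv_mul_cancel₀ ha
  have hPi := PP_irred h hi α
  have hmon : ∀ {A : Type} [CommRing A] (φ : ℂ →+* A) (β γ : Fin n → A),
      (finSuccEquiv A 1 (EE φ h (fun i => φ (α i)) β γ)).Monic := by
    intro A _ φ β γ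
    have h1 := EE_top φ h hh (fun i => φ (α i)) β γ
    have h2 := fse_coeff_top _ 4 h1.1
    rw [h1.2] at h2
    have h3 : eval₂ φ (fun i => φ (α i)) h = 1 := by
      rw [← map_one φ, ← hα, aeval_def]
      have := eval₂_comp_left φ (algebraMap ℂ ℂ) α h
      rw [this]; rfl
    rw [h3, C_1] at h2
    exact Polynomial.monic_of_natDegree_le_of_coeff_eq_one 4 (fse_natDegree_le _ 4 h1.1) h2
  obtain ⟨FD, hFD⟩ : ∃ FD : (Fin n → ℂ) → Polynomial (MvPolynomial (Fin 1) (MvPolynomial (Fin n) ℂ)),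
    ∀ γ, FD γ = finSuccEquiv _ 1 (EE C h (fun i => C (α i)) (fun i => X i - C (γ i)) (fun i => C (γ i))) := ⟨_, fun _ => rfl⟩
  have hFm : ∀ γ, (FD γ).Monic := fun γ => by rw [hFD]; exact hmon _ _ _
  have hF1 : ∀ γ, (FD γ).map (eval₂Hom (RingHom.id _) (fun _ => 1)) = PP (C : ℂ →+* MvPolynomial (Fin n) ℂ) h X (fun i => C (α i)) := by
    intro γ
    rw [hFD, EE_fse, PP_map]
    congr 1
    · ext <;> simp
    · funext i; simp
    · funext i; simp
  have hPm : (PP (C : ℂ →+* MvPolynomial (Fin n) ℂ) h X (fun i => C (α i))).Monic := by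
    rw [← hF1 0]; exact (hFm 0).map _
  obtain ⟨γ, hγ⟩ := sep_spec _ hPm hPi
  have hFi : Irreducible (FD γ) := by
    apply Polynomial.Monic.irreducible_of_irreducible_map (eval₂Hom (RingHom.id _) (fun _ => 1)) _ (hFm γ)
    rw [hF1]; exact hPi
  obtain ⟨k, ik, ia, iF⟩ : ∃ (k : Type) (_ : Field k) (_ : Algebra (MvPolynomial (Fin n) ℂ) k),
    IsFractionRing (MvPolynomial (Fin n) ℂ) k :=
    ⟨FractionRing (MvPolynomial (Fin n) ℂ), inferInstance, inferInstance, inferInstance⟩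
  have hinj : Function.Injective (algebraMap (MvPolynomial (Fin n) ℂ) k) := IsFractionRing.injective _ _
  haveI : CharZero k := charZero_of_injective_algebraMap hinj
  have hk := descent_R (k := k) (FD γ) (hFm γ) hFi
  letI : Algebra ℂ k := ((algebraMap (MvPolynomial (Fin n) ℂ) k).comp C).toAlgebra
  have h0 : ((FD γ).map (MvPolynomial.map (algebraMap _ k))).map (constantCoeff : MvPolynomial (Fin 1) k →+* k)
      = (PP (RingHom.id ℂ) h γ α).map (algebraMap ℂ k) := by
    rw [hFD, EE_fse, PP_map, PP_map, PP_map]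
    congr 1
    · ext <;> simp [RingHom.algebraMap_toAlgebra]
    · funext i; simp [RingHom.algebraMap_toAlgebra]
    · funext i; simp [RingHom.algebraMap_toAlgebra]
  have hg : (PP (RingHom.id ℂ) h γ α).Separable := by
    have : PP (RingHom.id ℂ) h γ α = (PP (C : ℂ →+* MvPolynomial (Fin n) ℂ) h X (fun i => C (α i))).map (eval₂Hom (RingHom.id ℂ) γ) := by
      rw [PP_map]
      congr 1
      · ext <;> simp
      · funext i; simp
      · funext i; simp
    rw [this]; exact hγ
  have hK := descent_K (K := AlgebraicClosure k) _ ((hFm γ).map _) hk _ hg h0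
  rw [hFD, EE_fse, PP_map, PP_map] at hK
  obtain ⟨j, hj⟩ : ∃ j : MvPolynomial (Fin n) ℂ →+* AlgebraicClosure k, j = (algebraMap k (AlgebraicClosure k)).comp (algebraMap _ k) := ⟨_, rfl⟩
  obtain ⟨E, hE⟩ : ∃ E, E = EE (j.comp C) h (fun i => (j.comp C) (α i)) (fun i => j (X i - C (γ i))) (fun i => j (C (γ i))) := ⟨_, rfl⟩
  have hEi : Irreducible E := by
    refine (MulEquiv.irreducible_iff (finSuccEquiv (AlgebraicClosure k) 1).toMulEquiv).1 ?_
    change Irreducible (finSuccEquiv (AlgebraicClosure k) 1 E)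
    rw [hE, EE_fse]
    convert hK using 2
    · ext <;> simp [hj]
    · funext i; simp [hj]
    · funext i; simp [hj]
  have ht := EE_top (j.comp C) h hh (fun i => (j.comp C) (α i)) (fun i => j (X i - C (γ i))) (fun i => j (C (γ i)))
  rw [← hE] at ht
  have htop : coeff (Finsupp.single 0 4) E ≠ 0 := by
    have h1 := fse_coeff_top E 4 ht.1
    have h2 := hmon (j.comp C) (fun i => j (X i - C (γ i))) (fun i => j (C (γ i)))
    rw [← hE] at h2
    intro h3
    rw [h3, C_0] at h1
    rw [ht.2] at h3
    have h4 : eval₂ (j.comp C) (fun i => (j.comp C) (α i)) h = 1 := by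
      rw [← map_one (j.comp C), ← hα, aeval_def]
      have := eval₂_comp_left (j.comp C) (algebraMap ℂ ℂ) α h
      rw [this]; rfl
    rw [h4] at h3
    exact one_ne_zero h3
  obtain ⟨ψ, hψ, hne⟩ := noe_spec1 (AlgebraicClosure k) E ht.1 htop hEi
  refine ⟨ψ, hψ, AlgebraicClosure k, inferInstance, j.comp C, (fun i => (j.comp C) (α i)),
    (fun i => j (X i - C (γ i))), (fun i => j (C (γ i))), ?_⟩
  rw [← hE]; exact hne

end DG

end

section
namespace DG
open MvPolynomial

/-- all coefficients have degree at most `d` -/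
def CD {σ : Type} (d : ℕ) (P : MvPolynomial (Fin 2) (MvPolynomial σ ℤ)) : Prop :=
  ∀ m, (coeff m P).totalDegree ≤ d

lemma CD_add {σ : Type} {d : ℕ} {P Q : MvPolynomial (Fin 2) (MvPolynomial σ ℤ)} (hP : CD d P) (hQ : CD d Q) :
    CD d (P + Q) := fun m => by
  rw [coeff_add]; exact (totalDegree_add _ _).trans (max_le (hP m) (hQ m))

lemma CD_mul {σ : Type} {d e : ℕ} {P Q : MvPolynomial (Fin 2) (MvPolynomial σ ℤ)} (hP : CD d P) (hQ : CD e Q) :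
    CD (d + e) (P * Q) := fun m => by
  classical
  rw [coeff_mul]
  refine totalDegree_finsetSum_le fun x _ => (totalDegree_mul _ _).trans (Nat.add_le_add (hP _) (hQ _))

lemma CD_C {σ : Type} {d : ℕ} (r : MvPolynomial σ ℤ) (hr : r.totalDegree ≤ d) : CD d (C r) := fun m => by
  classical
  rw [coeff_C]; split_ifs <;> simp [hr]

lemma CD_X {σ : Type} (i : Fin 2) : CD 0 (X i : MvPolynomial (Fin 2) (MvPolynomial σ ℤ)) := fun m => by
  classical
  rw [coeff_X]; split_ifs <;> simp

lemma CD_pow {σ : Type} {d : ℕ} {P : MvPolynomial (Fin 2) (MvPolynomial σ ℤ)} (hP : CD d P) (e : ℕ) :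
    CD (e * d) (P ^ e) := by
  induction e with
  | zero => rw [pow_zero, ← C_1]; exact CD_C 1 (by simp)
  | succ e ih => rw [pow_succ, add_mul, one_mul]; exact CD_mul ih hP

lemma CD_prod {σ : Type} {ι : Type} (s : Finset ι) (d : ι → ℕ) (P : ι → MvPolynomial (Fin 2) (MvPolynomial σ ℤ))
    (hP : ∀ i ∈ s, CD (d i) (P i)) : CD (∑ i ∈ s, d i) (∏ i ∈ s, P i) := by
  classical
  induction s using Finset.induction_on with
  | empty => rw [Finset.prod_empty, ← C_1]; exact CD_C 1 (by simp)
  | insert a s ha ih =>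
    rw [Finset.prod_insert ha, Finset.sum_insert ha]
    exact CD_mul (hP a (by simp)) (ih fun i hi => hP i (by simp [hi]))

lemma CD_EE {n : ℕ} {σ : Type} (h : MvPolynomial (Fin n) ℤ) (hh : h.IsHomogeneous 4) (a b c : Fin n → MvPolynomial σ ℤ)
    (ha : ∀ i, (a i).totalDegree ≤ 1) (hb : ∀ i, (b i).totalDegree ≤ 1) (hc : ∀ i, (c i).totalDegree ≤ 1) :
    CD 4 (EE C h a b c) := by
  intro m
  rw [EE, coe_eval₂Hom, eval₂_eq, coeff_sum]
  refine totalDegree_finsetSum_le fun p hp => ?_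
  have h1 : p.degree = 4 := by
    by_contra hne
    exact (mem_support_iff.1 hp) (IsHomogeneous.coeff_eq_zero hh hne)
  have hl : ∀ i, CD 1 (C (a i) * X 0 + C (b i) * X 1 + C (c i) : MvPolynomial (Fin 2) (MvPolynomial σ ℤ)) := fun i =>
    CD_add (CD_add (CD_mul (CD_C _ (ha i)) (CD_X 0)) (CD_mul (CD_C _ (hb i)) (CD_X 1))) (CD_C _ (hc i))
  have h2 := CD_mul (CD_C (d := 0) (C (coeff p h) : MvPolynomial σ ℤ) (by rw [totalDegree_C]))
    (CD_prod p.support _ _ (fun i _ => CD_pow (hl i) (p i))) m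
  have h3 : 0 + ∑ i ∈ p.support, p i * 1 = 4 := by
    rw [zero_add, ← h1, Finsupp.degree_apply]; simp
  rw [h3] at h2
  exact h2

lemma td_aeval {σ τ : Type} (ψ : MvPolynomial τ ℤ) (l : τ → MvPolynomial σ ℤ) (d : ℕ) (hl : ∀ i, (l i).totalDegree ≤ d) :
    (aeval l ψ).totalDegree ≤ ψ.totalDegree * d := by
  rw [aeval_def, eval₂_eq]
  refine totalDegree_finsetSum_le fun p hp => (totalDegree_mul _ _).trans ?_
  have h1 : (∏ i ∈ p.support, l i ^ p i).totalDegree ≤ ∑ i ∈ p.support, p i * d :=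
    (totalDegree_finsetProd _ _).trans (Finset.sum_le_sum fun i _ =>
      (totalDegree_pow _ _).trans (Nat.mul_le_mul_left _ (hl i)))
  have h2 : ∑ i ∈ p.support, p i * d ≤ ψ.totalDegree * d := by
    rw [← Finset.sum_mul]
    exact Nat.mul_le_mul_right _ (le_totalDegree hp)
  have h3 : (algebraMap ℤ (MvPolynomial σ ℤ) (coeff p ψ)).totalDegree = 0 := by
    rw [MvPolynomial.algebraMap_eq, totalDegree_C]
  omega

lemma EE_coeff_hom {n : ℕ} {S A B : Type} [CommRing S] [CommRing A] [CommRing B] [Algebra ℤ A] (φ : S →+* A) (h : MvPolynomial (Fin n) S)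
    (a b c : Fin n → A) (j : A →+* B) (ψ : MvPolynomial (Fin 2 →₀ ℕ) ℤ) :
    j (aeval (fun m => coeff m (EE φ h a b c)) ψ)
      = aeval (fun m => coeff m (EE (j.comp φ) h (fun i => j (a i)) (fun i => j (b i)) (fun i => j (c i)))) ψ := by
  rw [← EE_map, map_aeval, aeval_def]
  simp only [coeff_map]
  rw [coe_eval₂Hom]
  congr 1
  exact Subsingleton.elim _ _

set_option maxHeartbeats 1000000 in
lemma bert2 : ∃ N : ℕ, ∀ (n : ℕ) (ι : Fin 3 → Fin n), Function.Injective ι →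
    ∀ h : MvPolynomial (Fin n) ℤ, h.IsHomogeneous 4 → Irreducible (MvPolynomial.map (Int.castRingHom ℂ) h) →
    ∃ a : Fin 3 → Fin n → ℤ, (∀ s i, 0 ≤ a s i ∧ a s i ≤ N) ∧
      Irreducible (EE (Int.castRingHom ℂ) h (fun i => (a 0 i : ℂ)) (fun i => (a 1 i : ℂ)) (fun i => (a 2 i : ℂ))) ∧
      aeval (a 0) h ≠ 0 ∧ (Matrix.of fun s t => a s (ι t)).det ≠ 0 := by
  classical
  obtain ⟨D0, hD0⟩ : ∃ D0 : MvPolynomial (Fin 3 × Fin 3) ℤ, D0 = (Matrix.of fun s t => X (s, t)).det := ⟨_, rfl⟩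
  refine ⟨(noe.sup fun ψ => ψ.totalDegree) * 4 + 4 + D0.totalDegree, ?_⟩
  intro n ι hι h hh hi
  obtain ⟨ψ, hψ, K, iK, φ, α, β, γ, hne⟩ := bert1 _ hi (hh.map _)
  obtain ⟨Eg, hEg⟩ : ∃ Eg : MvPolynomial (Fin 2) (MvPolynomial (Fin 3 × Fin n) ℤ),
    Eg = EE C h (fun i => X (0, i)) (fun i => X (1, i)) (fun i => X (2, i)) := ⟨_, rfl⟩
  have hX : ∀ s : Fin 3 × Fin n, (X s : MvPolynomial (Fin 3 × Fin n) ℤ).totalDegree ≤ 1 := fun s => by simp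
  have hCD : CD 4 Eg := by rw [hEg]; exact CD_EE h hh _ _ _ (fun _ => hX _) (fun _ => hX _) (fun _ => hX _)
  obtain ⟨Θ, hΘ⟩ : ∃ Θ, Θ = aeval (fun m => coeff m Eg) ψ := ⟨_, rfl⟩
  have hΘd : Θ.totalDegree ≤ (noe.sup fun ψ => ψ.totalDegree) * 4 := by
    rw [hΘ]
    exact (td_aeval ψ _ 4 hCD).trans (Nat.mul_le_mul_right _ (Finset.le_sup (f := fun ψ : MvPolynomial (Fin 2 →₀ ℕ) ℤ => ψ.totalDegree) hψ))
  have hΘ0 : Θ ≠ 0 := by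
    intro h0
    apply hne
    have := EE_coeff_hom C h (fun i => X (0, i)) (fun i => X (1, i)) (fun i => X (2, i))
      (eval₂Hom (Int.castRingHom K) (fun s : Fin 3 × Fin n => (![α, β, γ] s.1) s.2)) ψ
    rw [← hEg, ← hΘ, h0, map_zero] at this
    have e : EE φ (MvPolynomial.map (Int.castRingHom ℂ) h) α β γ
      = EE ((eval₂Hom (Int.castRingHom K) (fun s : Fin 3 × Fin n => (![α, β, γ] s.1) s.2)).comp C) h
        (fun i => eval₂Hom (Int.castRingHom K) (fun s : Fin 3 × Fin n => (![α, β, γ] s.1) s.2) (X (0, i)))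
        (fun i => eval₂Hom (Int.castRingHom K) (fun s : Fin 3 × Fin n => (![α, β, γ] s.1) s.2) (X (1, i)))
        (fun i => eval₂Hom (Int.castRingHom K) (fun s : Fin 3 × Fin n => (![α, β, γ] s.1) s.2) (X (2, i))) := by
      rw [EE, EE, coe_eval₂Hom, coe_eval₂Hom, eval₂_map]
      congr 1
      · exact Subsingleton.elim _ _
      · funext i; simp
    rw [e]; exact this.symm
  obtain ⟨T, hT⟩ : ∃ T, T = coeff (Finsupp.single 0 4) Eg := ⟨_, rfl⟩
  have hTe : T = eval₂ C (fun i => X (0, i)) h := by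
    rw [hT, hEg]; exact (EE_top C h hh _ _ _).2
  have hT0 : T ≠ 0 := by
    intro h0
    apply hi.ne_zero
    apply MvPolynomial.funext
    intro x
    have := congrArg (eval₂Hom (Int.castRingHom ℂ) (fun s : Fin 3 × Fin n => x s.2)) h0
    rw [hTe, coe_eval₂Hom, ← coe_eval₂Hom, eval₂_comp_left, map_zero] at this
    rw [map_zero, eval_map, ← this]
    congr 1
    · exact Subsingleton.elim _ _
    · funext i; simp
  obtain ⟨D, hD⟩ : ∃ D : MvPolynomial (Fin 3 × Fin n) ℤ, D = rename (fun p : Fin 3 × Fin 3 => (p.1, ι p.2)) D0 := ⟨_, rfl⟩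
  have hDe : ∀ a : Fin 3 × Fin n → ℤ, eval a D = (Matrix.of fun s t => a (s, ι t)).det := by
    intro a
    rw [hD, eval_rename, hD0, RingHom.map_det]
    congr 1
    ext s t
    simp
  have hD00 : D ≠ 0 := by
    intro h0
    have := hDe (fun p => if p.2 = ι p.1 then 1 else 0)
    rw [h0, map_zero] at this
    have e : (Matrix.of fun s t : Fin 3 => if ι t = ι s then (1:ℤ) else 0) = 1 := by
      ext s t
      simp [Matrix.one_apply, hι.eq_iff, eq_comm]
    simp only [e, Matrix.det_one] at this
    exact zero_ne_one this
  have hdeg : (Θ * T * D).totalDegree ≤ (noe.sup fun ψ => ψ.totalDegree) * 4 + 4 + D0.totalDegree := by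
    refine (totalDegree_mul _ _).trans (Nat.add_le_add ((totalDegree_mul _ _).trans (Nat.add_le_add hΘd ?_)) ?_)
    · rw [hT]; exact hCD _
    · rw [hD]; exact totalDegree_rename_le _ _
  have hne0 : Θ * T * D ≠ 0 := mul_ne_zero (mul_ne_zero hΘ0 hT0) hD00
  generalize (noe.sup fun ψ => ψ.totalDegree) * 4 + 4 + D0.totalDegree = N at hdeg
  obtain ⟨a, ha, hae⟩ : ∃ a : Fin 3 × Fin n → ℤ, (∀ s, a s ∈ Finset.Icc (0:ℤ) N) ∧ eval a (Θ * T * D) ≠ 0 := by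
    by_contra hc
    push Not at hc
    apply hne0
    refine eq_zero_of_eval_zero_at_prod_finset _ (fun _ => Finset.Icc (0:ℤ) N) (fun i => ?_) hc
    rw [Int.card_Icc]
    have := (degreeOf_le_totalDegree (Θ * T * D) i).trans hdeg
    omega
  rw [map_mul, map_mul] at hae
  have hae1 := left_ne_zero_of_mul (left_ne_zero_of_mul hae)
  have hae2 := right_ne_zero_of_mul (left_ne_zero_of_mul hae)
  have hae3 := right_ne_zero_of_mul hae
  have htop : aeval (fun i => a (0, i)) h ≠ 0 := by
    rw [hTe] at hae2
    intro h0
    apply hae2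
    rw [eval₂_comp_left, ← h0, aeval_def]
    congr 1
    · exact Subsingleton.elim _ _
    · funext i; simp
  refine ⟨fun s i => a (s, i), fun s i => Finset.mem_Icc.1 (ha _), ?_, htop, ?_⟩
  · have ht := EE_top (Int.castRingHom ℂ) h hh (fun i => (a (0,i) : ℂ)) (fun i => (a (1,i) : ℂ)) (fun i => (a (2,i) : ℂ))
    apply noe_spec2 ℂ _ ht.1 _ ψ hψ
    · have := EE_coeff_hom C h (fun i => X (0, i)) (fun i => X (1, i)) (fun i => X (2, i))
        ((Int.castRingHom ℂ).comp (eval a)) ψ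
      rw [← hEg, ← hΘ, RingHom.comp_apply] at this
      intro h0
      apply hae1
      have h5 : ((eval a Θ : ℤ) : ℂ) = 0 := by
        have e : EE (((Int.castRingHom ℂ).comp (eval a)).comp C) h (fun i => ((Int.castRingHom ℂ).comp (eval a)) (X (0, i)))
            (fun i => ((Int.castRingHom ℂ).comp (eval a)) (X (1, i))) (fun i => ((Int.castRingHom ℂ).comp (eval a)) (X (2, i)))
            = EE (Int.castRingHom ℂ) h (fun i => (a (0,i) : ℂ)) (fun i => (a (1,i) : ℂ)) (fun i => (a (2,i) : ℂ)) := by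
          have e0 : ((Int.castRingHom ℂ).comp (eval a)).comp C = Int.castRingHom ℂ := Subsingleton.elim _ _
          rw [e0]
          simp only [RingHom.comp_apply, eval_X, eq_intCast]
        rw [e, h0] at this
        exact this
      exact_mod_cast h5
    · rw [ht.2]
      intro h0
      apply htop
      have : ((aeval (fun i => a (0, i)) h : ℤ) : ℂ) = 0 := by
        rw [← h0, aeval_def]
        have := eval₂_comp_left (Int.castRingHom ℂ) (algebraMap ℤ ℤ) (fun i => a (0,i)) h
        rw [← eq_intCast (Int.castRingHom ℂ), this]
        rfl
      exact_mod_cast this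
  · rw [← hDe]; exact hae3

end DG

end

section
namespace DG
open MvPolynomial

/-- the linear forms of a plane -/
noncomputable def LL {n : ℕ} (a : Fin 3 → Fin n → ℤ) (r : Fin n → ℤ) (i : Fin n) : MvPolynomial (Fin 3) ℤ :=
  C (a 0 i) * X 0 + C (a 1 i) * X 1 + C (a 2 i) * X 2 + C (r i)

lemma td_CX {R : Type*} [CommRing R] {k : ℕ} (c : R) (i : Fin k) : (C c * X i : MvPolynomial (Fin k) R).totalDegree ≤ 1 := by
  refine (totalDegree_mul _ _).trans ?_
  rw [totalDegree_C, zero_add]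
  exact (isHomogeneous_X _ _).totalDegree_le

lemma LL_deg {n : ℕ} (a : Fin 3 → Fin n → ℤ) (r : Fin n → ℤ) (i : Fin n) : (LL a r i).totalDegree ≤ 1 := by
  unfold LL
  refine (totalDegree_add _ _).trans (max_le ((totalDegree_add _ _).trans (max_le ((totalDegree_add _ _).trans (max_le ?_ ?_)) ?_)) ?_)
  · exact td_CX _ _
  · exact td_CX _ _
  · exact td_CX _ _
  · rw [totalDegree_C]; omega

lemma LL_eval {n : ℕ} (a : Fin 3 → Fin n → ℤ) (r : Fin n → ℤ) (P : MvPolynomial (Fin n) ℤ) (y : Fin 3 → ℤ) :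
    aeval y (aeval (LL a r) P) = aeval (fun i => a 0 i * y 0 + a 1 i * y 1 + a 2 i * y 2 + r i) P := by
  rw [← AlgHom.comp_apply, comp_aeval]
  congr 2
  funext i
  simp [LL]

lemma hom_subst {n : ℕ} (P : MvPolynomial (Fin n) ℤ) (d : ℕ) (hd : P.totalDegree ≤ d) (a : Fin 3 → Fin n → ℤ) (r : Fin n → ℤ) :
    homogeneousComponent d (aeval (LL a r) P) = aeval (LL a 0) (homogeneousComponent d P) := by
  apply MvPolynomial.funext
  intro w
  have hPd := (coeff_top_subst (n := 2) P d hd (LL a r) (LL_deg a r)).1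
  have h1 := (coeff_top_subst (n := 0) (aeval (LL a r) P) d hPd (fun i => C (w i) * X 0) (fun i => td_CX _ _)).2
  have h2 := (coeff_top_subst (n := 0) P d hd (fun i => C (a 0 i * w 0 + a 1 i * w 1 + a 2 i * w 2) * X 0 + C (r i)) (fun i => by
    refine (totalDegree_add _ _).trans (max_le (td_CX _ _) ?_)
    rw [totalDegree_C]; omega)).2
  have h3 : aeval (fun i => C (w i) * X 0 : Fin 3 → MvPolynomial (Fin 1) ℤ) (aeval (LL a r) P)
      = aeval (fun i => C (a 0 i * w 0 + a 1 i * w 1 + a 2 i * w 2) * X 0 + C (r i)) P := by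
    rw [← AlgHom.comp_apply, comp_aeval]
    congr 2
    funext i
    simp only [LL, map_add, map_mul, aeval_X, algHom_C, MvPolynomial.algebraMap_eq]
    ring
  have e2 : (0 : Fin 1 →₀ ℕ) ≠ Finsupp.single (0 : Fin 1) 1 := by
    intro h; simpa using congrArg (fun m => m 0) h
  rw [h3, h2] at h1
  have h4 : (fun i => coeff (Finsupp.single 0 1) (C (w i) * X 0 : MvPolynomial (Fin 1) ℤ)) = w := by
    funext i; rw [coeff_C_mul, coeff_X, if_pos rfl, mul_one]
  have h5 : (fun i => coeff (Finsupp.single 0 1) (C (a 0 i * w 0 + a 1 i * w 1 + a 2 i * w 2) * X 0 + C (r i) : MvPolynomial (Fin 1) ℤ))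
      = fun i => a 0 i * w 0 + a 1 i * w 1 + a 2 i * w 2 + (0 : Fin n → ℤ) i := by
    funext i; rw [coeff_add, coeff_C_mul, coeff_X, if_pos rfl, mul_one, coeff_C, if_neg e2]; simp
  rw [h4, h5, ← LL_eval, aeval_eq_eval] at h1
  exact h1.symm

/-- the fibre polynomial -/
noncomputable def fr {n : ℕ} (f : MvPolynomial (Fin n) ℤ) (D : ℤ) (a : Fin 3 → Fin n → ℤ) (r : Fin n → ℤ) : MvPolynomial (Fin 3) ℤ :=
  ∑ j ∈ Finset.range 5, C (D^(4-j)) * aeval (LL a r) (homogeneousComponent j f)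

lemma fr_deg {n : ℕ} (f : MvPolynomial (Fin n) ℤ) (D : ℤ) (a : Fin 3 → Fin n → ℤ) (r : Fin n → ℤ) : (fr f D a r).totalDegree ≤ 4 := by
  refine totalDegree_finsetSum_le fun j hj => (totalDegree_mul _ _).trans ?_
  rw [totalDegree_C, zero_add]
  have := (coeff_top_subst (n := 2) (homogeneousComponent j f) j (homogeneousComponent_isHomogeneous j f).totalDegree_le (LL a r) (LL_deg a r)).1
  have := Finset.mem_range.1 hj
  omega

lemma fr_hom {n : ℕ} (f : MvPolynomial (Fin n) ℤ) (D : ℤ) (a : Fin 3 → Fin n → ℤ) (r : Fin n → ℤ) :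
    homogeneousComponent 4 (fr f D a r) = aeval (LL a 0) (homogeneousComponent 4 f) := by
  rw [fr, map_sum, Finset.sum_range_succ, Finset.sum_eq_zero, zero_add]
  · rw [homogeneousComponent_C_mul, hom_subst _ 4 (homogeneousComponent_isHomogeneous 4 f).totalDegree_le,
      homogeneousComponent_of_mem (homogeneousComponent_mem 4 f), if_pos rfl]
    simp
  · intro j hj
    have hj4 := Finset.mem_range.1 hj
    rw [homogeneousComponent_C_mul, homogeneousComponent_eq_zero, mul_zero]
    exact lt_of_le_of_lt (coeff_top_subst (n := 2) (homogeneousComponent j f) j (homogeneousComponent_isHomogeneous j f).totalDegree_le (LL a r) (LL_deg a r)).1 hj4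

lemma fr_eval {n : ℕ} (f : MvPolynomial (Fin n) ℤ) (hf : f.totalDegree = 4) (D : ℤ) (a : Fin 3 → Fin n → ℤ) (r : Fin n → ℤ)
    (x : Fin n → ℤ) (y : Fin 3 → ℤ) (hx : ∀ i, D * x i = a 0 i * y 0 + a 1 i * y 1 + a 2 i * y 2 + r i) :
    aeval y (fr f D a r) = D^4 * aeval x f := by
  have h1 : ∀ j ∈ Finset.range 5, aeval y (C (D^(4-j)) * aeval (LL a r) (homogeneousComponent j f))
      = D^4 * aeval x (homogeneousComponent j f) := by
    intro j hj
    have hj4 := Finset.mem_range.1 hj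
    rw [map_mul, LL_eval, ← funext hx, hom_scale _ j (homogeneousComponent_isHomogeneous j f), algHom_C,
      ← mul_assoc]
    congr 1
    simp only [eq_intCast, Int.cast_id, Algebra.algebraMap_self_apply]
    rw [← pow_add]
    congr 1
    omega
  rw [fr, map_sum, Finset.sum_congr rfl h1, ← Finset.mul_sum, ← map_sum]
  congr 2
  have := sum_homogeneousComponent f
  rw [hf] at this
  exact this

lemma fr_slE {n : ℕ} (f : MvPolynomial (Fin n) ℤ) (D : ℤ) (a : Fin 3 → Fin n → ℤ) (r : Fin n → ℤ) :
    slE (fr f D a r) (0:ℂ) = EE (Int.castRingHom ℂ) (homogeneousComponent 4 f) (fun i => (a 0 i : ℂ)) (fun i => (a 1 i : ℂ)) (fun i => (a 2 i : ℂ)) := by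
  rw [slE_hom _ (fr_deg f D a r), hom_map, fr_hom, EE]
  rw [show (Int.castRingHom ℂ) = algebraMap ℤ ℂ from rfl, aeval_map_algebraMap]
  have h : ∀ Q : MvPolynomial (Fin 3) ℤ, aeval (dh ℂ) Q = ((aeval (R := ℤ) (dh ℂ)) : MvPolynomial (Fin 3) ℤ →+* _) Q := fun _ => rfl
  rw [h, map_aeval]
  congr 2
  · exact Subsingleton.elim _ _
  · funext i
    simp [LL, dh]

end DG

end

section
namespace DG
open MvPolynomial

lemma adj_bound (N : ℕ) (M : Matrix (Fin 3) (Fin 3) ℤ) (hM : ∀ i j, 0 ≤ M i j ∧ M i j ≤ N) :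
    |M.det| ≤ 6 * ((N:ℤ)+1)^3 ∧ ∀ i j, |M.adjugate i j| ≤ 6 * ((N:ℤ)+1)^3 := by
  have h : ∀ A : Matrix (Fin 3) (Fin 3) ℤ, (∀ i j, |A i j| ≤ (N:ℤ)+1) → |A.det| ≤ 6 * ((N:ℤ)+1)^3 := by
    intro A hA
    refine (det_abs_le A (fun _ => (N:ℤ)+1) hA).trans ?_
    simp [Nat.factorial]
  have hM' : ∀ i j, |M i j| ≤ (N:ℤ)+1 := fun i j => by
    rw [abs_of_nonneg (hM i j).1]; linarith [(hM i j).2]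
  refine ⟨h M hM', fun i j => ?_⟩
  rw [Matrix.adjugate_apply]
  apply h
  intro s t
  rw [Matrix.updateRow_apply]
  split_ifs
  · rw [Pi.single_apply]; split_ifs
    · simp
    · simp; positivity
  · exact hM' s t

/-- plane coordinates of a point -/
def yy {m : ℕ} (a : Fin 3 → Fin (3+m) → ℤ) (x : Fin (3+m) → ℤ) : Fin 3 → ℤ :=
  Matrix.vecMul (fun t => x (Fin.castAdd m t)) (Matrix.of fun s t => a s (Fin.castAdd m t)).adjugate

def rr {m : ℕ} (a : Fin 3 → Fin (3+m) → ℤ) (x : Fin (3+m) → ℤ) (i : Fin (3+m)) : ℤ :=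
  (Matrix.of fun s t => a s (Fin.castAdd m t)).det * x i - (a 0 i * yy a x 0 + a 1 i * yy a x 1 + a 2 i * yy a x 2)

lemma rr_zero {m : ℕ} (a : Fin 3 → Fin (3+m) → ℤ) (x : Fin (3+m) → ℤ) (t : Fin 3) : rr a x (Fin.castAdd m t) = 0 := by
  obtain ⟨M, hM⟩ : ∃ M : Matrix (Fin 3) (Fin 3) ℤ, M = (Matrix.of fun s t => a s (Fin.castAdd m t)) := ⟨_, rfl⟩
  have h1 : Matrix.vecMul (yy a x) M = M.det • (fun t => x (Fin.castAdd m t)) := by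
    rw [yy, ← hM, Matrix.vecMul_vecMul, Matrix.adjugate_mul, Matrix.vecMul_smul, Matrix.vecMul_one]
  have h2 := congrFun h1 t
  rw [Matrix.vecMul, dotProduct, Fin.sum_univ_three] at h2
  have h3 : ∀ s, M s t = a s (Fin.castAdd m t) := fun s => by rw [hM]; rfl
  rw [h3, h3, h3] at h2
  rw [rr, ← hM]
  simp only [Pi.smul_apply, smul_eq_mul] at h2
  linarith

lemma yy_rr_bound {m : ℕ} (N : ℕ) (a : Fin 3 → Fin (3+m) → ℤ) (ha : ∀ s i, 0 ≤ a s i ∧ a s i ≤ N) (B : ℕ) (x : Fin (3+m) → ℤ)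
    (hx : ∀ i, |x i| ≤ (B:ℤ)) :
    (∀ s, |yy a x s| ≤ ((60 * (N+1)^4 * B : ℕ) : ℤ)) ∧ ∀ i, |rr a x i| ≤ ((60 * (N+1)^4 * B : ℕ) : ℤ) := by
  obtain ⟨M, hM⟩ : ∃ M : Matrix (Fin 3) (Fin 3) ℤ, M = (Matrix.of fun s t => a s (Fin.castAdd m t)) := ⟨_, rfl⟩
  have hMb := adj_bound N M (fun i j => by rw [hM]; exact ha _ _)
  obtain ⟨Q, hQ⟩ : ∃ Q : ℤ, Q = 6 * ((N:ℤ)+1)^3 := ⟨_, rfl⟩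
  rw [← hQ] at hMb
  have hQ0 : 0 ≤ Q := by rw [hQ]; positivity
  have hB0 : (0:ℤ) ≤ B := by positivity
  have hN0 : (0:ℤ) ≤ N := by positivity
  have hy : ∀ s, |yy a x s| ≤ 3 * (B * Q) := by
    intro s
    rw [yy, ← hM, Matrix.vecMul, dotProduct]
    refine (Finset.abs_sum_le_sum_abs _ _).trans ?_
    refine (Finset.sum_le_card_nsmul _ _ (B * Q) fun t _ => ?_).trans (by simp)
    rw [abs_mul]
    exact mul_le_mul (hx _) (hMb.2 _ _) (abs_nonneg _) hB0
  have hBQ : 0 ≤ (B:ℤ) * Q := by positivity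
  have hfin : ((60 * (N+1)^4 * B : ℕ) : ℤ) = 10 * (N+1) * (B * Q) := by
    rw [hQ]; push_cast; ring
  rw [hfin]
  have hp : ∀ s i, |a s i * yy a x s| ≤ N * (3 * (B * Q)) := by
    intro s i
    rw [abs_mul, abs_of_nonneg (ha s i).1]
    exact mul_le_mul (ha s i).2 (hy s) (abs_nonneg _) hN0
  refine ⟨fun s => (hy s).trans (by nlinarith), fun i => ?_⟩
  rw [rr, ← hM]
  have h1 : |M.det * x i| ≤ Q * B := by
    rw [abs_mul]; exact mul_le_mul hMb.1 (hx i) (abs_nonneg _) hQ0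
  have h2 := hp 0 i
  have h3 := hp 1 i
  have h4 := hp 2 i
  rw [abs_le] at *
  have : 0 ≤ (N:ℤ) * (B * Q) := by positivity
  constructor <;> nlinarith

lemma rcount (m K : ℕ) (T : Finset (Fin (3+m) → ℤ)) (h0 : ∀ r ∈ T, ∀ t : Fin 3, r (Fin.castAdd m t) = 0)
    (hK : ∀ r ∈ T, ∀ i, |r i| ≤ (K:ℤ)) : T.card ≤ (2*K+1)^m := by
  classical
  have h1 : T.card ≤ (Fintype.piFinset fun _ : Fin m => Finset.Icc (-(K:ℤ)) K).card := by
    refine Finset.card_le_card_of_injOn (fun r j => r (Fin.natAdd 3 j)) ?_ ?_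
    · intro r hr
      simp only [Finset.mem_coe, Fintype.mem_piFinset, Finset.mem_Icc]
      intro j
      exact abs_le.1 (hK r hr _)
    · intro r hr r' hr' he
      funext i
      refine Fin.addCases (fun t => ?_) (fun j => ?_) i
      · rw [h0 r hr, h0 r' hr']
      · exact congrFun he j
  refine h1.trans ?_
  rw [Fintype.card_piFinset]
  simp only [Int.card_Icc, Finset.prod_const, Finset.card_univ, Fintype.card_fin]
  apply Nat.pow_le_pow_left
  omega

lemma dg_nat : ∃ (C : ℝ) (κ K : ℕ), 0 ≤ C ∧ 1 ≤ K ∧ ∀ (m : ℕ) (f : MvPolynomial (Fin (3+m)) ℤ), f.totalDegree = 4 →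
    Irreducible (MvPolynomial.map (Int.castRingHom ℂ) (homogeneousComponent 4 f)) → ∀ B : ℕ, 1 ≤ B →
    ∀ S : Finset (Fin (3+m) → ℤ), (∀ v ∈ S, aeval v f = 0 ∧ ∀ i, |v i| ≤ (B:ℤ)) →
    (S.card : ℝ) ≤ ((2*(K*B)+1 : ℕ):ℝ)^m * (C * ((Nat.log 2 (K*B) + 1 : ℕ):ℝ)^κ * (K*B : ℕ)) := by
  classical
  obtain ⟨C, κ, hC, hT3⟩ := T3
  obtain ⟨N, hN⟩ := bert2
  refine ⟨C, κ, 60 * (N+1)^4, hC, Nat.one_le_iff_ne_zero.2 (by positivity), ?_⟩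
  intro m f hf hi B hB S hS
  obtain ⟨a, ha, hirr, htop, hdet⟩ := hN (3+m) (Fin.castAdd m) (Fin.castAdd_injective 3 m) _
    (homogeneousComponent_isHomogeneous 4 f) hi
  obtain ⟨D, hD⟩ : ∃ D, D = (Matrix.of fun s t => a s (Fin.castAdd m t)).det := ⟨_, rfl⟩
  rw [← hD] at hdet
  have hx : ∀ x : Fin (3+m) → ℤ, ∀ i, D * x i = a 0 i * yy a x 0 + a 1 i * yy a x 1 + a 2 i * yy a x 2 + rr a x i := by
    intro x i
    rw [rr, ← hD]; ring
  have hbd := fun x hx => yy_rr_bound N a ha B x hx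
  obtain ⟨K, hK⟩ : ∃ K, K = 60 * (N+1)^4 := ⟨_, rfl⟩
  rw [← hK] at hbd ⊢
  have hK1 : 1 ≤ K := by rw [hK]; exact Nat.one_le_iff_ne_zero.2 (by positivity)
  have hfib : ∀ r ∈ S.image (rr a), (((S.filter fun x => rr a x = r).card : ℕ) : ℝ) ≤ C * ((Nat.log 2 (K*B) + 1 : ℕ):ℝ)^κ * (K*B : ℕ) := by
    intro r _
    have hinj : Set.InjOn (yy a) (S.filter fun x => rr a x = r : Finset _) := by
      intro x hx1 x' hx2 he
      have h1 := (Finset.mem_filter.1 hx1).2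
      have h2 := (Finset.mem_filter.1 hx2).2
      funext i
      have e1 := hx x i
      have e2 := hx x' i
      rw [he, h1] at e1
      rw [h2] at e2
      exact mul_left_cancel₀ hdet (e1.trans e2.symm)
    rw [← Finset.card_image_of_injOn hinj]
    refine hT3 (fr f D a r) (fr_deg _ _ _ _) ?_ ?_ (K*B) (Nat.mul_pos hK1 hB) _ ?_
    · intro h0
      have h1 := slE_top (fr f D a r) (fr_deg _ _ _ _) (0:ℂ)
      rw [h0, fr_slE, (EE_top _ _ (homogeneousComponent_isHomogeneous 4 f) _ _ _).2] at h1
      apply htop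
      have h2 := aeval_intCast ℂ (a 0) (homogeneousComponent 4 f)
      have h3 : ((aeval (a 0) (homogeneousComponent 4 f) : ℤ) : ℂ) = 0 := by
        rw [← h2, aeval_def]
        refine Eq.trans ?_ (h1.trans (by simp))
        congr 1
      exact_mod_cast h3
    · rw [fr_slE]; exact hirr
    · intro y hy
      obtain ⟨x, hx1, rfl⟩ := Finset.mem_image.1 hy
      obtain ⟨hxS, hxr⟩ := Finset.mem_filter.1 hx1
      refine ⟨?_, fun i => (hbd x (hS x hxS).2).1 i⟩
      rw [fr_eval f hf D a r x (yy a x) (fun i => by rw [← hxr]; exact hx x i), (hS x hxS).1, mul_zero]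
  have hr : (S.image (rr a)).card ≤ (2*(K*B)+1)^m := by
    apply rcount m (K*B)
    · intro r hr t
      obtain ⟨x, hxS, rfl⟩ := Finset.mem_image.1 hr
      exact rr_zero a x t
    · intro r hr i
      obtain ⟨x, hxS, rfl⟩ := Finset.mem_image.1 hr
      exact (hbd x (hS x hxS).2).2 i
  rw [Finset.card_eq_sum_card_image (rr a) S, Nat.cast_sum]
  refine (Finset.sum_le_card_nsmul _ _ _ hfib).trans ?_
  rw [nsmul_eq_mul]
  apply mul_le_mul_of_nonneg_right _ (by positivity)
  exact_mod_cast hr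

end DG

end

theorem DG.final_aux : ∃ κ : ℝ, ∀ n : ℕ, 2 < n → ∃ c : ℝ, ∀ (f : MvPolynomial (Fin n) ℤ),
    f.totalDegree = 4 →
    Irreducible (MvPolynomial.map (Int.castRingHom ℂ) (MvPolynomial.homogeneousComponent 4 f)) →
    ∀ H : ℝ, 2 ≤ H →
    ({x : Fin n → ℤ | MvPolynomial.eval x f = 0 ∧ ∀ i, (|x i| : ℝ) ≤ H}).Finite ∧
    (({x : Fin n → ℤ | MvPolynomial.eval x f = 0 ∧ ∀ i, (|x i| : ℝ) ≤ H}).ncard : ℝ)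
      ≤ c * H ^ ((n : ℝ) - 2) * Real.log H ^ κ := by
  obtain ⟨C, κ, K, hC, hK, hmain⟩ := DG.dg_nat
  refine ⟨(κ : ℝ), fun n hn => ?_⟩
  obtain ⟨m, rfl⟩ := Nat.exists_eq_add_of_le (show 3 ≤ n from hn)
  have hl2 : 0 < Real.log 2 := Real.log_pos (by norm_num)
  have hKr : (1 : ℝ) ≤ K := by exact_mod_cast hK
  have hlK : 0 ≤ Real.log K := Real.log_nonneg hKr
  set c' : ℝ := (Real.log K / Real.log 2 + 1) / Real.log 2 + 1 / Real.log 2 with hc'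
  have hc'0 : 0 ≤ c' := by positivity
  refine ⟨(3 * K) ^ m * (C * c' ^ κ * K), fun f hd hirr H hH => ?_⟩
  set B := ⌊H⌋₊ with hB
  have hH0 : 0 < H := by linarith
  have hB1 : 1 ≤ B := Nat.le_floor (by push_cast; linarith)
  have hBH : (B : ℝ) ≤ H := Nat.floor_le hH0.le
  have hBr : (1 : ℝ) ≤ B := by exact_mod_cast hB1
  have hbd : ∀ z : ℤ, (|z| : ℝ) ≤ H → |z| ≤ (B : ℤ) := by
    intro z hz
    have h1 : ((z.natAbs : ℕ) : ℝ) ≤ H := by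
      rw [Nat.cast_natAbs]; exact_mod_cast hz
    have h2 : z.natAbs ≤ B := Nat.le_floor h1
    rw [Int.abs_eq_natAbs]; exact_mod_cast h2
  have hfin : ({x : Fin (3+m) → ℤ | MvPolynomial.eval x f = 0 ∧ ∀ i, (|x i| : ℝ) ≤ H}).Finite := by
    refine (Set.finite_Icc (fun _ => -(B : ℤ)) (fun _ => (B : ℤ))).subset ?_
    intro x hx
    exact ⟨fun i => (abs_le.mp (hbd _ (hx.2 i))).1, fun i => (abs_le.mp (hbd _ (hx.2 i))).2⟩
  refine ⟨hfin, ?_⟩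
  rw [Set.ncard_eq_toFinset_card _ hfin]
  refine (hmain m f hd hirr B hB1 hfin.toFinset ?_).trans ?_
  · intro v hv
    rw [Set.Finite.mem_toFinset] at hv
    exact ⟨by rw [MvPolynomial.aeval_eq_eval]; exact hv.1, fun i => hbd _ (hv.2 i)⟩
  have hKB : (((K * B : ℕ)) : ℝ) ≤ K * H := by
    push_cast; gcongr
  have hKH1 : (1 : ℝ) ≤ K * H := by nlinarith
  have e1 : ((2 * (K * B) + 1 : ℕ) : ℝ) ≤ 3 * K * H := by
    push_cast at hKB ⊢; linarith
  have hlH : Real.log 2 ≤ Real.log H := Real.log_le_log (by norm_num) hH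
  have e2 : ((Nat.log 2 (K * B) + 1 : ℕ) : ℝ) ≤ c' * Real.log H := by
    have hne : K * B ≠ 0 := by positivity
    have h1 : ((2 : ℝ)) ^ (Nat.log 2 (K * B)) ≤ K * H := by
      refine le_trans ?_ hKB
      exact_mod_cast Nat.pow_log_le_self 2 hne
    have h2 := Real.log_le_log (by positivity) h1
    rw [Real.log_pow, Real.log_mul (by positivity) (by positivity)] at h2
    push_cast
    have h3 : (Nat.log 2 (K * B) : ℝ) ≤ (Real.log K + Real.log H) / Real.log 2 := by
      rw [le_div_iff₀ hl2]; exact h2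
    have h4 : c' * Real.log H = (Real.log K / Real.log 2 + 1) * (Real.log H / Real.log 2)
        + Real.log H / Real.log 2 := by rw [hc']; ring
    have h5 : 1 ≤ Real.log H / Real.log 2 := by rw [le_div_iff₀ hl2]; linarith
    have h6 : 0 ≤ Real.log K / Real.log 2 := by positivity
    rw [h4]
    rw [add_div] at h3
    nlinarith
  have e3 : H ^ ((((3 + m : ℕ)) : ℝ) - 2) = H ^ m * H := by
    rw [← pow_succ, ← Real.rpow_natCast]
    congr 1; push_cast; ring
  rw [e3, Real.rpow_natCast]
  have h0 : 0 ≤ c' * Real.log H := mul_nonneg hc'0 (hl2.le.trans hlH)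
  have h00 : 0 ≤ C * (c' * Real.log H) ^ κ := mul_nonneg hC (pow_nonneg h0 _)
  calc _ ≤ (3 * K * H) ^ m * (C * (c' * Real.log H) ^ κ * (K * H)) := by
        gcongr
    _ = _ := by rw [mul_pow (3 * (K : ℝ)) H, mul_pow c']; ring

theorem dimension_growth_affine_deg_four :
    ∃ κ : ℝ, ∀ n : ℕ, 2 < n → ∃ c : ℝ,
      ∀ (f : MvPolynomial (Fin n) ℤ) (d : ℕ),
      d = f.totalDegree → d = 4 →
      Irreducible (MvPolynomial.map (Int.castRingHom ℂ)
        (MvPolynomial.homogeneousComponent d f)) →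
      ∀ H : ℝ, 2 ≤ H →
      ∀ S : Set (Fin n → ℤ),
        S = {x | MvPolynomial.eval x f = 0 ∧ ∀ i, (|x i| : ℝ) ≤ H} →
        S.Finite ∧ (S.ncard : ℝ) ≤ c * H ^ ((n : ℝ) - 2) * Real.log H ^ κ := by
  obtain ⟨κ, hκ⟩ := DG.final_aux
  refine ⟨κ, fun n hn => ?_⟩
  obtain ⟨c, hc⟩ := hκ n hn
  refine ⟨c, fun f d hd hd4 hirr H hH S hS => ?_⟩
  subst hd4
  subst hS
  exact hc f hd.symm hirr H hH
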